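/- Let d ≥ 1 and p₁ < 0 < p₀, and let P satisfy hypothesis (H_{p₀,p₁}) with constants P₀ > 0 and P₁ > 0. Let χ_l, χ_h ∈ C_c^∞(ℝ^d) be equal to 1 near 0 and let ε₀, ε₁ satisfy the admissibility condition. Then there exist a constant C > 0 and a time t₀ ≥ 1 such that for every t with |t| > t₀ and every Schwartz function f on ℝ^d, ‖Op(1_{|x| > |t|·|P'(ξ)|} · (1−χ_l)(|t|^{ε₀} ξ) · χ_h(|t|^{−ε₁} ξ)) f‖_{L²(ℝ^d)} ≤ C ‖f‖_{L²(ℝ^d)}. -/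

import Mathlib

open MeasureTheory Filter Topology
open scoped RealInnerProductSpace ENNReal

noncomputable section

abbrev Euc (d : ℕ) := EuclideanSpace ℝ (Fin d)

/-- Fourier transform `f̂(ξ) = ∫ e^{-i x·ξ} f(x) dx`. -/
def FT {d : ℕ} (f : Euc d → ℂ) (ξ : Euc d) : ℂ :=
  ∫ x : Euc d, Complex.exp (-(Complex.I * ((⟪x, ξ⟫ : ℝ) : ℂ))) * f x

/-- The radial vector field `P'(ξ) = P'(|ξ|) · ξ/|ξ|`. -/
def Pgrad {d : ℕ} (P : ℝ → ℝ) (ξ : Euc d) : Euc d :=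
  (deriv P ‖ξ‖ / ‖ξ‖) • ξ

/-- Hypothesis (H_{p₀,p₁}) with constants P₀, P₁. -/
def HypH (p₀ p₁ P₀ P₁ : ℝ) (P : ℝ → ℝ) : Prop :=
  ContDiffOn ℝ (⊤ : ℕ∞) P (Set.Ioi 0) ∧
  (∀ ρ > (0:ℝ), 0 < deriv P ρ) ∧
  (MonotoneOn (deriv P) (Set.Ioi 0) ∨ AntitoneOn (deriv P) (Set.Ioi 0)) ∧
  (∃ c C ρ₀ : ℝ, 0 < c ∧ c < C ∧ 0 < ρ₀ ∧ ∀ ρ : ℝ, 0 < ρ → ρ < ρ₀ →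
      (c * ρ ^ p₀ ≤ |deriv P ρ - P₀| ∧ |deriv P ρ - P₀| ≤ C * ρ ^ p₀) ∧
      (c * ρ ^ (p₀ - 1) ≤ |deriv (deriv P) ρ| ∧ |deriv (deriv P) ρ| ≤ C * ρ ^ (p₀ - 1))) ∧
  (∃ c C R : ℝ, 0 < c ∧ c < C ∧ ∀ ρ : ℝ, R < ρ →
      (c * ρ ^ p₁ ≤ |deriv P ρ - P₁| ∧ |deriv P ρ - P₁| ≤ C * ρ ^ p₁) ∧
      (c * ρ ^ (p₁ - 1) ≤ |deriv (deriv P) ρ| ∧ |deriv (deriv P) ρ| ≤ C * ρ ^ (p₁ - 1))) ∧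
  (∀ j : ℕ, 3 ≤ j → ∃ C : ℝ,
      (∀ ρ : ℝ, 0 < ρ → ρ < 1 → |iteratedDeriv j P ρ| ≤ C * ρ ^ (p₀ + 1 - (j : ℝ))) ∧
      (∀ ρ : ℝ, 1 < ρ → |iteratedDeriv j P ρ| ≤ C * ρ ^ (p₁ + 1 - (j : ℝ))))

/-- The truncation symbol `a_{χ,δ}(t,x,ξ)
    `= χ((x+tP'(ξ))/|t|^{1/2+δ}) · 1_{|x| > |t|·|P'(ξ)|}`. -/
def symbA {d : ℕ} (P : ℝ → ℝ) (χ : Euc d → ℝ) (δ t : ℝ) (x ξ : Euc d) : ℂ :=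
  ((χ ((|t| ^ ((1:ℝ)/2 + δ))⁻¹ • (x + t • Pgrad P ξ)) : ℝ) : ℂ) *
    (if |t| * ‖Pgrad P ξ‖ < ‖x‖ then (1:ℂ) else 0)

/-- `Op(a) (e^{itP(D)} f)` for a Schwartz function `f`:
    `(2π)^{-d} ∫ e^{i(x·ξ + tP(ξ))} a(x,ξ) f̂(ξ) dξ`. -/
def combOp {d : ℕ} (P : ℝ → ℝ) (a : Euc d → Euc d → ℂ) (t : ℝ)
    (f : Euc d → ℂ) (x : Euc d) : ℂ :=
  (((2 * Real.pi) ^ d : ℝ) : ℂ)⁻¹ *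
    ∫ ξ : Euc d,
      Complex.exp (Complex.I * ((⟪x, ξ⟫ + t * P ‖ξ‖ : ℝ) : ℂ)) * a x ξ * FT f ξ


/-- A function equals `1` in a neighbourhood of `0`. -/
def EqOneNearZero {d : ℕ} (f : Euc d → ℝ) : Prop :=
  ∃ r : ℝ, 0 < r ∧ ∀ x : Euc d, ‖x‖ < r → f x = 1

/-- Admissibility condition on the frequency-truncation exponents `ε₀, ε₁`. -/
def Admissible (p₀ p₁ ε₀ ε₁ : ℝ) : Prop :=
  0 < ε₀ ∧ ε₀ ≤ 1 / (p₀ + 1) ∧ 0 < ε₁ ∧ (p₁ < -1 → ε₁ ≤ 1 / (-(p₁ + 1)))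

/-- The pseudo-differential operator `Op(a)` on a Schwartz function:
`Op(a)f(x) = (2π)^{-d} ∫ e^{i x·ξ} a(x,ξ) f̂(ξ) dξ`. -/
def OpS {d : ℕ} (a : Euc d → Euc d → ℂ) (f : Euc d → ℂ) (x : Euc d) : ℂ :=
  (((2 * Real.pi) ^ d : ℝ) : ℂ)⁻¹ *
    ∫ ξ : Euc d, Complex.exp (Complex.I * ((⟪x, ξ⟫ : ℝ) : ℂ)) * a x ξ * FT f ξ

open Real (abs_cos_le_one abs_sin_le_one continuous_cos continuous_fourierChar continuous_sin cos exp exp_pos le_sqrt_of_sq_le mul_rpow mul_self_sqrt norm_eq_abs norm_of_nonneg rpow_add rpow_add_one rpow_le_rpow rpow_mul rpow_natCast rpow_neg_one sin sq_sqrt sqrt_div sqrt_eq_rpow sqrt_le_left sqrt_le_sqrt sqrt_nonneg sqrt_pos sqrt_sq volume_Icc volume_Ioo zero_rpow)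
open Set (Icc Ici Iic Iio Ioc Ioi Ioo indicator_apply indicator_of_mem indicator_of_notMem mem_Iio mem_Ioi self_mem_Ici uIcc uIcc_of_le)
open MeasureTheory.Measure (integrableOn_of_bounded restrict_restrict)
open Finset (mul_sum range sum_congr)
open ENNReal (mul_ne_top ofReal ofReal_add ofReal_le_ofReal ofReal_mul ofReal_ne_top ofReal_pow)
open Complex (normSq_eq_norm_sq)
open MeasureTheory.StronglyMeasurable (integral_prod_right)

section
lemma cs_lint {α : Type*} [MeasurableSpace α] (μ : Measure α) {f g : α → ℝ≥0∞}
    (hf : AEMeasurable f μ) (hg : AEMeasurable g μ) :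
    (∫⁻ x, f x * g x ∂μ) ^ 2 ≤ (∫⁻ x, f x ^ 2 ∂μ) * (∫⁻ x, g x ^ 2 ∂μ) := by
  have h := ENNReal.lintegral_mul_le_Lp_mul_Lq μ Real.HolderConjugate.two_two hf hg
  have h2 := pow_le_pow_left' h 2
  refine h2.trans (le_of_eq ?_)
  rw [mul_pow]
  simp only [← ENNReal.rpow_natCast, ← ENNReal.rpow_mul]
  norm_num

/-- averaging kernel -/
def kap (ρ : ℝ → ℝ) (y x : ℝ) : ℝ≥0∞ := if |x - y| < ρ y then ofReal (1 / (2 * ρ y)) else 0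

lemma kap_meas {ρ : ℝ → ℝ} (hρ : Measurable ρ) : Measurable (fun p : ℝ × ℝ => kap ρ p.1 p.2) := by
  unfold kap
  refine Measurable.ite ?_ ?_ measurable_const
  · exact measurableSet_lt (by fun_prop) (by fun_prop)
  · fun_prop

def avgL (ρ : ℝ → ℝ) (f : ℝ → ℝ≥0∞) (y : ℝ) : ℝ≥0∞ := ∫⁻ x, kap ρ y x * f x

lemma avgL_meas {ρ : ℝ → ℝ} (hρ : Measurable ρ) {f : ℝ → ℝ≥0∞} (hf : Measurable f) :
    Measurable (avgL ρ f) := by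
  unfold avgL
  have := kap_meas hρ
  refine Measurable.lintegral_prod_right' (f := fun p : ℝ × ℝ => kap ρ p.1 p.2 * f p.2) ?_
  exact this.mul (hf.comp measurable_snd)

lemma kap_int {ρ : ℝ → ℝ} {y : ℝ} (hy : 0 < ρ y) : ∫⁻ x, kap ρ y x = 1 := by
  have : (fun x => kap ρ y x) = (Ioo (y - ρ y) (y + ρ y)).indicator
      (fun _ => ofReal (1 / (2 * ρ y))) := by
    ext x
    unfold kap
    by_cases h : |x - y| < ρ y
    · rw [if_pos h, indicator_of_mem]
      rw [abs_lt] at h; constructor <;> linarith [h.1, h.2]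
    · rw [if_neg h, indicator_of_notMem]
      intro h2; apply h; rw [abs_lt]; constructor <;> linarith [h2.1, h2.2]
  rw [this, lintegral_indicator measurableSet_Ioo, setLIntegral_const, volume_Ioo,
    ← ofReal_mul (by positivity)]
  rw [← ENNReal.ofReal_one]; congr 1; field_simp; ring

lemma kap_const_le (c : ℝ) (hc : 0 < c) (x : ℝ) : ∫⁻ y, kap (fun _ => c) y x = 1 := by
  have : (fun y => kap (fun _ => c) y x) = fun y => kap (fun _ => c) x y := by
    ext y; unfold kap; rw [abs_sub_comm]
  rw [this]; exact kap_int (ρ := fun _ => c) hc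

lemma avg_const_sq (c : ℝ) (hc : 0 < c) {f : ℝ → ℝ≥0∞} (hf : Measurable f) :
    ∫⁻ y, (avgL (fun _ => c) f y) ^ 2 ≤ ∫⁻ x, f x ^ 2 := by
  have hk := kap_meas (ρ := fun _ => c) measurable_const
  have h1 : ∀ y, (avgL (fun _ => c) f y) ^ 2 ≤ ∫⁻ x, kap (fun _ => c) y x * f x ^ 2 := by
    intro y
    have hky : Measurable (fun x => kap (fun _ => c) y x) := hk.comp (measurable_prodMk_left)
    have := cs_lint (volume.withDensity (fun x => kap (fun _ => c) y x)) (f := fun _ => 1) (g := f)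
      aemeasurable_const hf.aemeasurable
    rw [lintegral_withDensity_eq_lintegral_mul _ hky (by fun_prop),
      lintegral_withDensity_eq_lintegral_mul _ hky (by fun_prop),
      lintegral_withDensity_eq_lintegral_mul _ hky (by fun_prop)] at this
    simp only [Pi.mul_apply, one_mul, one_pow, mul_one] at this
    rw [kap_int (ρ := fun _ => c) hc, one_mul] at this
    exact this
  calc _ ≤ ∫⁻ y, ∫⁻ x, kap (fun _ => c) y x * f x ^ 2 := lintegral_mono h1
    _ = ∫⁻ x, ∫⁻ y, kap (fun _ => c) y x * f x ^ 2 := by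
        rw [lintegral_lintegral_swap]
        exact (hk.mul ((hf.pow_const 2).comp measurable_snd)).aemeasurable
    _ = ∫⁻ x, f x ^ 2 := by
        congr 1; ext x
        rw [lintegral_mul_const, kap_const_le c hc, one_mul]
        exact hk.comp measurable_prodMk_right

def HLP (N : ℕ) (a : ℝ) : Prop := ∀ ρ : ℝ → ℝ, Measurable ρ → (∀ y, 0 < ρ y) →
  (∃ R : Finset ℝ, R.card ≤ N ∧ ∀ y, ρ y ∈ R) → ∀ f : ℝ → ℝ≥0∞, Measurable f →
    ∫⁻ y, (avgL ρ f y) ^ 2 ≤ ofReal a * ∫⁻ x, f x ^ 2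

lemma HLP_triv (N : ℕ) : HLP N N := by
  rintro ρ hρ hpos ⟨R, hR, hmem⟩ f hf
  have h1 : ∀ y, (avgL ρ f y) ^ 2 ≤ ∑ r ∈ R.filter (0 < ·), (avgL (fun _ => r) f y) ^ 2 := by
    intro y
    have : avgL ρ f y = avgL (fun _ => ρ y) f y := rfl
    rw [this]
    exact Finset.single_le_sum (f := fun r => (avgL (fun _ => r) f y) ^ 2) (fun _ _ => zero_le)
      (by simp [hmem y, hpos y])
  calc _ ≤ ∫⁻ y, ∑ r ∈ R.filter (0 < ·), (avgL (fun _ => r) f y) ^ 2 := lintegral_mono h1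
    _ = ∑ r ∈ R.filter (0 < ·), ∫⁻ y, (avgL (fun _ => r) f y) ^ 2 := by
        rw [lintegral_finsetSum]
        intro r _; exact (avgL_meas measurable_const hf).pow_const 2
    _ ≤ ∑ r ∈ R.filter (0 < ·), ∫⁻ x, f x ^ 2 :=
        Finset.sum_le_sum fun r hr => avg_const_sq r (by simp at hr; exact hr.2) hf
    _ ≤ _ := by
        rw [Finset.sum_const, nsmul_eq_mul, ENNReal.ofReal_natCast]
        gcongr
        exact (Finset.card_filter_le _ _).trans hR

def kap2 (ρ : ℝ → ℝ) (y x : ℝ) : ℝ≥0∞ := 2 * kap (fun z => 2 * ρ z) y x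

lemma kap_comp {ρ : ℝ → ℝ} (hpos : ∀ y, 0 < ρ y) (y y' : ℝ) :
    ∫⁻ x, kap ρ y x * kap ρ y' x ≤ kap2 ρ y y' + kap2 ρ y' y := by
  wlog h : ρ y' ≤ ρ y generalizing y y'
  · have := this y' y (by linarith)
    rw [add_comm]; simpa only [mul_comm] using this
  by_cases h2 : |y' - y| < 2 * ρ y
  · have h3 : ofReal (1 / (2 * ρ y)) ≤ kap2 ρ y y' := by
      unfold kap2 kap
      rw [if_pos h2, show (2:ℝ≥0∞) = ofReal 2 by simp, ← ofReal_mul (by norm_num)]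
      apply ofReal_le_ofReal
      have := hpos y
      apply le_of_eq; field_simp
    calc _ ≤ ∫⁻ x, ofReal (1 / (2 * ρ y)) * kap ρ y' x := by
          apply lintegral_mono; intro x
          dsimp only
          gcongr
          unfold kap; split_ifs <;> simp
      _ = ofReal (1 / (2 * ρ y)) := by
          rw [lintegral_const_mul' _ _ ofReal_ne_top, kap_int (hpos y'), mul_one]
      _ ≤ _ := h3.trans le_self_add
  · have : ∀ x, kap ρ y x * kap ρ y' x = 0 := by
      intro x
      unfold kap
      by_cases h3 : |x - y| < ρ y
      · have : ¬ |x - y'| < ρ y' := by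
          intro h4; apply h2
          have := abs_sub_abs_le_abs_sub (y' - x) (y - x)
          calc |y' - y| = |(x - y) - (x - y')| := by congr 1; ring
            _ ≤ |x - y| + |x - y'| := abs_sub _ _
            _ < _ := by linarith
        rw [if_neg this, mul_zero]
      · rw [if_neg h3, zero_mul]
    simp [this]

lemma HL_arith (a : ℝ) (ha : 0 ≤ a) (F I L : ℝ≥0∞) (hFt : F ≠ ⊤) (hIt : I ≠ ⊤) (hLt : L ≠ ⊤)
    (e5 : L ^ 2 ≤ I * (ofReal a * I)) (e6 : I ^ 2 ≤ F * (2 * (2 * L))) :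
    I ≤ ofReal (a / 2 + 8) * F := by
  lift F to NNReal using hFt
  lift I to NNReal using hIt
  lift L to NNReal using hLt
  rw [show ofReal a = ((a.toNNReal : NNReal) : ℝ≥0∞) from rfl] at e5
  rw [show ofReal (a/2+8) = (((a/2+8).toNNReal : NNReal) : ℝ≥0∞) from rfl]
  norm_cast at e5 e6 ⊢
  rw [← NNReal.coe_le_coe] at e5 e6 ⊢
  push_cast at e5 e6 ⊢
  rw [Real.coe_toNNReal a ha] at e5
  rw [Real.coe_toNNReal _ (by positivity)]
  have hI0 := I.coe_nonneg
  have hF0 := F.coe_nonneg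
  have hL0 := L.coe_nonneg
  generalize (I:ℝ) = i at *
  generalize (F:ℝ) = f at *
  generalize (L:ℝ) = l at *
  by_contra hcon
  push Not at hcon
  have hi : 0 < i := lt_of_le_of_lt (by positivity) hcon
  have hi4 : (i^2)^2 ≤ (f * (2 * (2 * l)))^2 := pow_le_pow_left₀ (by positivity) e6 2
  have h16 : i^2 * i^2 ≤ (16 * a * f^2) * i^2 := by nlinarith [mul_le_mul_of_nonneg_left e5 (sq_nonneg f)]
  have h17 : i^2 ≤ 16 * a * f^2 := le_of_mul_le_mul_right h16 (by positivity)
  have h18 : ((a/2+8)*f)^2 < i^2 := by gcongr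
  nlinarith [sq_nonneg ((a/2-8)*f)]

lemma HLP_step (N : ℕ) (a : ℝ) (ha : 0 ≤ a) (h : HLP N a) : HLP N (a / 2 + 8) := by
  rintro ρ hρ hpos ⟨R, hR, hmem⟩ f hf
  have hk := kap_meas hρ
  set F := ∫⁻ x, f x ^ 2 with hF
  set g := avgL ρ f with hg
  set I := ∫⁻ y, g y ^ 2 with hI
  have hgm : Measurable g := avgL_meas hρ hf
  by_cases hFt : F = ⊤
  · rw [hFt, ENNReal.mul_top]; · exact le_top
    simp; linarith
  have hIt : I ≠ ⊤ := by
    have := HLP_triv N ρ hρ hpos ⟨R, hR, hmem⟩ f hf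
    exact ne_top_of_le_ne_top (mul_ne_top ofReal_ne_top hFt) this
  set G : ℝ → ℝ≥0∞ := fun x => ∫⁻ y, g y * kap ρ y x with hG
  have hGm : Measurable G := by
    refine Measurable.lintegral_prod_left' (f := fun p : ℝ × ℝ => g p.1 * kap ρ p.1 p.2) ?_
    exact (hgm.comp measurable_fst).mul hk
  have e1 : I = ∫⁻ x, f x * G x := by
    calc I = ∫⁻ y, ∫⁻ x, g y * kap ρ y x * f x := by
          rw [hI]; congr 1; ext y; rw [sq]; nth_rewrite 2 [hg]; unfold avgL
          rw [← lintegral_const_mul]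
          · congr 1; ext x; ring
          · exact (hk.comp measurable_prodMk_left).mul hf
      _ = ∫⁻ x, ∫⁻ y, g y * kap ρ y x * f x := by
          rw [lintegral_lintegral_swap]
          exact (((hgm.comp measurable_fst).mul hk).mul (hf.comp measurable_snd)).aemeasurable
      _ = _ := by
          congr 1; ext x; rw [lintegral_mul_const, mul_comm]
          exact hgm.mul (hk.comp measurable_prodMk_right)
  have e2 : I ^ 2 ≤ F * ∫⁻ x, G x ^ 2 := by
    rw [e1]; exact cs_lint _ hf.aemeasurable hGm.aemeasurable
  have hk2 : Measurable (fun p : ℝ × ℝ => kap2 ρ p.1 p.2) :=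
    (kap_meas (ρ := fun z => 2 * ρ z) (by fun_prop)).const_mul 2
  have e3 : ∫⁻ x, G x ^ 2 ≤ 2 * ∫⁻ y, g y * ∫⁻ y', kap2 ρ y y' * g y' := by
    calc ∫⁻ x, G x ^ 2 = ∫⁻ x, ∫⁻ y, g y * kap ρ y x * G x := by
          congr 1; ext x; rw [sq]; nth_rewrite 1 [hG]; dsimp only
          rw [← lintegral_mul_const]
          exact hgm.mul (hk.comp measurable_prodMk_right)
      _ = ∫⁻ y, ∫⁻ x, g y * kap ρ y x * G x := by
          rw [lintegral_lintegral_swap]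
          refine ((((hgm.comp measurable_snd).mul (hk.comp measurable_swap))).mul
            (hGm.comp measurable_fst)).aemeasurable
      _ = ∫⁻ y, g y * ∫⁻ x, ∫⁻ y', kap ρ y x * (g y' * kap ρ y' x) := by
          congr 1; ext y
          rw [← lintegral_const_mul]
          · congr 1; ext x; rw [lintegral_const_mul]
            · rw [mul_assoc]
            · exact hgm.mul (hk.comp measurable_prodMk_right)
          · refine Measurable.lintegral_prod_right'
              (f := fun p : ℝ × ℝ => kap ρ y p.1 * (g p.2 * kap ρ p.2 p.1)) ?_
            exact ((hk.comp measurable_prodMk_left).comp measurable_fst).mul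
              ((hgm.comp measurable_snd).mul (hk.comp measurable_swap))
      _ = ∫⁻ y, g y * ∫⁻ y', g y' * ∫⁻ x, kap ρ y x * kap ρ y' x := by
          congr 1; ext y; congr 1
          rw [lintegral_lintegral_swap]
          · congr 1; ext y'
            rw [← lintegral_const_mul]
            · congr 1; ext x; ring
            · exact (hk.comp measurable_prodMk_left).mul (hk.comp measurable_prodMk_left)
          · exact (((hk.comp measurable_prodMk_left).comp measurable_fst).mul
              ((hgm.comp measurable_snd).mul (hk.comp measurable_swap))).aemeasurable
      _ ≤ ∫⁻ y, g y * ∫⁻ y', g y' * (kap2 ρ y y' + kap2 ρ y' y) := by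
          gcongr with y y'; exact kap_comp hpos y y'
      _ = (∫⁻ y, g y * ∫⁻ y', kap2 ρ y y' * g y') + ∫⁻ y, g y * ∫⁻ y', g y' * kap2 ρ y' y := by
          rw [← lintegral_add_left]
          · congr 1; ext y; rw [← mul_add, ← lintegral_add_left]
            · congr 1; congr 1; ext y'; ring
            · exact (hk2.comp measurable_prodMk_left).mul hgm
          · refine hgm.mul (Measurable.lintegral_prod_right'
              (f := fun p : ℝ × ℝ => kap2 ρ p.1 p.2 * g p.2) (hk2.mul (hgm.comp measurable_snd)))
      _ = _ := by
          rw [two_mul]; congr 1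
          calc _ = ∫⁻ y, ∫⁻ y', g y * (g y' * kap2 ρ y' y) := by
                congr 1; ext y; rw [lintegral_const_mul]
                exact hgm.mul (hk2.comp measurable_prodMk_right)
            _ = ∫⁻ y', ∫⁻ y, g y * (g y' * kap2 ρ y' y) := by
                rw [lintegral_lintegral_swap]
                exact ((hgm.comp measurable_fst).mul ((hgm.comp measurable_snd).mul
                  (hk2.comp measurable_swap))).aemeasurable
            _ = _ := by
                congr 1; ext y'
                rw [← lintegral_const_mul]
                · congr 1; ext y; ring
                · exact (hk2.comp measurable_prodMk_left).mul hgm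
  have e4 : (∫⁻ y, g y * ∫⁻ y', kap2 ρ y y' * g y') = 2 * ∫⁻ y, g y * avgL (fun z => 2 * ρ z) g y := by
    rw [← lintegral_const_mul]
    · congr 1; ext y; unfold kap2 avgL
      rw [mul_left_comm]; congr 1
      rw [← lintegral_const_mul]
      · congr 1; ext x; ring
      · exact ((kap_meas (ρ := fun z => 2 * ρ z) (by fun_prop)).comp measurable_prodMk_left).mul hgm
    · exact hgm.mul (avgL_meas (by fun_prop) hgm)
  have e5 : (∫⁻ y, g y * avgL (fun z => 2 * ρ z) g y) ^ 2 ≤ I * (ofReal a * I) := by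
    refine (cs_lint _ hgm.aemeasurable (avgL_meas (by fun_prop) hgm).aemeasurable).trans ?_
    gcongr
    refine h (fun z => 2 * ρ z) (by fun_prop) (fun y => by have := hpos y; positivity)
      ⟨R.image (fun r => 2 * r), Finset.card_image_le.trans hR, fun y => ?_⟩ g hgm
    exact Finset.mem_image_of_mem _ (hmem y)
  set L := ∫⁻ y, g y * avgL (fun z => 2 * ρ z) g y with hL
  rw [e4] at e3
  have hLt : L ≠ ⊤ := by
    intro hh
    rw [hh] at e5
    have : I * (ofReal a * I) ≠ ⊤ :=
      mul_ne_top hIt (mul_ne_top ofReal_ne_top hIt)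
    apply this; rw [eq_top_iff]; simpa using e5
  have e6 : I ^ 2 ≤ F * (2 * (2 * L)) := e2.trans (by gcongr)
  exact HL_arith a ha F I L hFt hIt hLt e5 e6

lemma HLP_17 (N : ℕ) : HLP N 17 := by
  have h : ∀ k : ℕ, HLP N (16 + N / 2 ^ k) := by
    intro k
    induction k with
    | zero =>
      intro ρ hρ hpos hR f hf
      refine (HLP_triv N ρ hρ hpos hR f hf).trans ?_
      gcongr; simp
    | succ k ih =>
      have := HLP_step N _ (by positivity) ih
      convert this using 1
      rw [pow_succ]; field_simp; ring
  obtain ⟨k, hk⟩ := pow_unbounded_of_one_lt (N:ℝ) (one_lt_two)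
  intro ρ hρ hpos hR f hf
  refine (h k ρ hρ hpos hR f hf).trans ?_
  gcongr
  have : (N:ℝ) / 2^k ≤ 1 := by rw [div_le_one (by positivity)]; exact hk.le
  linarith

/-- maximal function with positive rational radii -/
def HLM (f : ℝ → ℝ≥0∞) (y : ℝ) : ℝ≥0∞ :=
  ⨆ q : {q : ℚ // 0 < q}, avgL (fun _ => ((q : ℚ) : ℝ)) f y

lemma HLM_meas {f : ℝ → ℝ≥0∞} (hf : Measurable f) : Measurable (HLM f) :=
  Measurable.iSup fun _ => avgL_meas measurable_const hf

open Classical in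
def selR (q : ℕ → ℝ) (f : ℝ → ℝ≥0∞) : ℕ → ℝ → ℝ
  | 0, _ => q 0
  | n+1, y => if avgL (selR q f n) f y < avgL (fun _ => q (n+1)) f y then q (n+1) else selR q f n y

lemma HL_max {f : ℝ → ℝ≥0∞} (hf : Measurable f) :
    ∫⁻ y, HLM f y ^ 2 ≤ 17 * ∫⁻ x, f x ^ 2 := by
  obtain ⟨e, he⟩ := exists_surjective_nat {q : ℚ // 0 < q}
  set q : ℕ → ℝ := fun n => ((e n : ℚ) : ℝ) with hq
  have hq0 : ∀ n, 0 < q n := fun n => by simpa [hq] using (e n).2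
  have hm : ∀ n, Measurable (selR q f n) := by
    intro n
    induction n with
    | zero => exact measurable_const
    | succ n ih =>
      exact Measurable.ite (measurableSet_lt (avgL_meas ih hf) (avgL_meas measurable_const hf))
        measurable_const ih
  have hmem : ∀ n y, selR q f n y ∈ (range (n+1)).image q := by
    intro n y
    induction n with
    | zero => simp [selR]
    | succ n ih =>
      simp only [selR]
      split_ifs
      · exact Finset.mem_image_of_mem _ (by simp)
      · rw [Finset.mem_image] at ih ⊢
        obtain ⟨i, hi, h⟩ := ih
        exact ⟨i, by simp at hi ⊢; omega, h⟩
  have hpos : ∀ n y, 0 < selR q f n y := by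
    intro n y
    obtain ⟨i, -, h⟩ := Finset.mem_image.1 (hmem n y)
    rw [← h]; exact hq0 i
  have hstep : ∀ n y, avgL (selR q f (n+1)) f y =
      max (avgL (selR q f n) f y) (avgL (fun _ => q (n+1)) f y) := by
    intro n y
    have e0 : ∀ ρ : ℝ → ℝ, avgL ρ f y = avgL (fun _ => ρ y) f y := fun _ => rfl
    rw [e0 (selR q f (n+1))]
    simp only [selR]
    split_ifs with h
    · rw [max_eq_right h.le]
    · rw [max_eq_left (not_lt.1 h)]; rfl
  have hmono : ∀ y, Monotone fun n => avgL (selR q f n) f y := fun y =>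
    monotone_nat_of_le_succ fun n => by rw [hstep]; exact le_max_left _ _
  have hge : ∀ n y, avgL (fun _ => q n) f y ≤ avgL (selR q f n) f y := by
    intro n y
    cases n with
    | zero => exact le_of_eq rfl
    | succ n => rw [hstep]; exact le_max_right _ _
  have hsup : ∀ y, HLM f y ≤ ⨆ n, avgL (selR q f n) f y := by
    intro y
    refine iSup_le fun p => ?_
    obtain ⟨n, rfl⟩ := he p
    exact (hge n y).trans (le_iSup (fun n => avgL (selR q f n) f y) n)
  calc _ ≤ ∫⁻ y, (⨆ n, avgL (selR q f n) f y ^ 2) := by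
        apply lintegral_mono; intro y
        have : (⨆ n, avgL (selR q f n) f y) ^ 2 = ⨆ n, avgL (selR q f n) f y ^ 2 := by
          have := (ENNReal.orderIsoRpow 2 (by norm_num)).map_iSup (fun n => avgL (selR q f n) f y)
          simpa only [ENNReal.orderIsoRpow_apply, ENNReal.rpow_two] using this
        dsimp only
        rw [← this]
        gcongr; exact hsup y
    _ = ⨆ n, ∫⁻ y, avgL (selR q f n) f y ^ 2 := by
        rw [lintegral_iSup (fun n => (avgL_meas (hm n) hf).pow_const 2)]
        intro n m hnm y
        exact pow_le_pow_left' (hmono y hnm) 2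
    _ ≤ _ := by
        refine iSup_le fun n => ?_
        have := HLP_17 (n+1) (selR q f n) (hm n) (hpos n)
          ⟨_, Finset.card_image_le.trans (by simp), hmem n⟩ f hf
        simpa using this

/-- the use of the maximal function -/
lemma HLM_ge (f : ℝ → ℝ≥0∞) (y u v R : ℝ) (hR : 0 < R) (hu : y - R ≤ u) (hv : v ≤ y + R) :
    ∫⁻ x in Ioo u v, f x ≤ ofReal (4 * R) * HLM f y := by
  obtain ⟨q, hq1, hq2⟩ := exists_rat_btwn (show R < 2 * R by linarith)
  have hq0 : (0:ℝ) < q := by linarith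
  have h1 : avgL (fun _ => (q:ℝ)) f y ≤ HLM f y :=
    le_iSup (fun q : {q : ℚ // 0 < q} => avgL (fun _ => ((q : ℚ) : ℝ)) f y) ⟨q, by exact_mod_cast hq0⟩
  calc _ ≤ ∫⁻ x, ofReal (4 * R) * (kap (fun _ => (q:ℝ)) y x * f x) := by
        rw [← lintegral_indicator measurableSet_Ioo]
        apply lintegral_mono; intro x
        dsimp only
        by_cases hx : x ∈ Ioo u v
        · rw [indicator_of_mem hx]
          unfold kap
          rw [if_pos (by rw [abs_lt]; constructor <;> linarith [hx.1, hx.2]), ← mul_assoc,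
            ← ofReal_mul (by linarith)]
          calc f x = 1 * f x := by rw [one_mul]
            _ ≤ _ := by
              gcongr
              rw [← ENNReal.ofReal_one]
              apply ofReal_le_ofReal
              rw [mul_one_div, le_div_iff₀ (by positivity)]; linarith
        · rw [indicator_of_notMem hx]; exact zero_le
    _ = ofReal (4 * R) * avgL (fun _ => (q:ℝ)) f y := by
        rw [lintegral_const_mul' _ _ ofReal_ne_top]; rfl
    _ ≤ _ := by gcongr
end

section
structure Ker (B γ m : ℝ) (k k' : ℝ → ℝ) : Prop where
  hk : ∀ u, 0 < u → HasDerivAt k (k' u) u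
  hk' : ∀ u, 0 < u → HasDerivAt k' (-(1 - m / u ^ 2) * k u) u
  hm : -(1 / 4) ≤ m
  hγ : 0 ≤ γ
  hB : ∀ u, 0 < u → |k u| ≤ B * u ^ γ
  hmγ : 0 < m → 0 < γ
  meas : Measurable k
  iso : ∀ (φ : ℝ → ℝ) (a b M : ℝ), Measurable φ → 0 < a → (∀ r, |φ r| ≤ M) →
    (∀ r, r ∉ Icc a b → φ r = 0) →
    ∫⁻ s in Ioi 0, ofReal ((∫ r, k (r * s) * φ r) ^ 2) = ∫⁻ r, ofReal (φ r ^ 2)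
  wr : ∀ r r', 0 < r → 0 < r' → Tendsto
    (fun s => k (r * s) * (r' * k' (r' * s)) - r * k' (r * s) * k (r' * s)) (𝓝[>] 0) (𝓝 0)

def Wk (m : ℝ) (k k' : ℝ → ℝ) (u : ℝ) : ℝ :=
  k' u ^ 2 * (u / √(u ^ 2 - m)) + k u ^ 2 * (√(u ^ 2 - m) / u)

def Zk (m : ℝ) (k k' : ℝ → ℝ) (u : ℝ) : ℝ :=
  Wk m k k' u + m / √(u ^ 2 - m) ^ 3 * (k u * k' u)

def GoodU (m u : ℝ) : Prop := 0 < u ∧ m < u ^ 2 ∧ 2 * |m| ≤ √(u ^ 2 - m) ^ 3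

lemma GoodU.mono {m u v : ℝ} (h : GoodU m u) (huv : u ≤ v) : GoodU m v := by
  obtain ⟨h1, h2, h3⟩ := h
  have : u ^ 2 ≤ v ^ 2 := by gcongr
  refine ⟨by linarith, by linarith, h3.trans ?_⟩
  gcongr

section
variable {B γ m : ℝ} {k k' : ℝ → ℝ}

lemma sqrt_hd {u : ℝ} (hm : m < u ^ 2) :
    HasDerivAt (fun u => √(u ^ 2 - m)) (u / √(u ^ 2 - m)) u := by
  have h := ((hasDerivAt_pow 2 u).sub_const m).sqrt (by linarith)
  convert h using 1
  have hp0 : 0 < √(u ^ 2 - m) := sqrt_pos.2 (by linarith)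
  push_cast; field_simp

lemma Zk_hd (K : Ker B γ m k k') {u : ℝ} (hu : 0 < u) (hm : m < u ^ 2) :
    HasDerivAt (Zk m k k') (-3 * m * u / √(u ^ 2 - m) ^ 5 * (k u * k' u)) u := by
  have hp := sqrt_hd hm
  have hp0 : 0 < √(u ^ 2 - m) := sqrt_pos.2 (by linarith)
  have hsq : √(u ^ 2 - m) ^ 2 = u ^ 2 - m := sq_sqrt (by linarith)
  have h1 := K.hk u hu
  have h2 := K.hk' u hu
  have hid := hasDerivAt_id u
  have H := (((h2.pow 2).mul (hid.div hp hp0.ne')).add ((h1.pow 2).mul (hp.div hid hu.ne'))).add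
    (((hasDerivAt_const u m).div (hp.pow 3) (pow_pos hp0 3).ne').mul (h1.mul h2))
  have H2 : HasDerivAt (Zk m k k') _ u := H
  convert H2 using 1
  simp only [Pi.pow_apply, Pi.div_apply, id, Pi.mul_apply]
  set p := √(u ^ 2 - m) with hpdef
  have hmp : m = u ^ 2 - p ^ 2 := by linarith
  clear_value p
  subst hmp
  field_simp
  ring

lemma WZ {u : ℝ} (h : GoodU m u) : 3 / 4 * Wk m k k' u ≤ Zk m k k' u ∧
    Zk m k k' u ≤ 5 / 4 * Wk m k k' u ∧ |k u * k' u| ≤ Wk m k k' u / 2 ∧ 0 ≤ Wk m k k' u := by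
  obtain ⟨h1, h2, h3⟩ := h
  have hp0 : 0 < √(u ^ 2 - m) := sqrt_pos.2 (by linarith)
  unfold Zk
  have hW : |k u * k' u| ≤ Wk m k k' u / 2 := by
    unfold Wk
    set p := √(u ^ 2 - m)
    have e : k' u ^ 2 * (u / p) + k u ^ 2 * (p / u) - 2 * |k u * k' u| =
        (|k' u| * u - |k u| * p) ^ 2 / (p * u) := by
      have e1 := sq_abs (k u); have e2 := sq_abs (k' u)
      rw [← e1, ← e2, abs_mul]
      field_simp; ring
    have : 0 ≤ (|k' u| * u - |k u| * p) ^ 2 / (p * u) := by positivity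
    linarith
  have hρ : |m / √(u ^ 2 - m) ^ 3| ≤ 1 / 2 := by
    rw [abs_div, abs_of_pos (pow_pos hp0 3), div_le_iff₀ (by positivity)]
    linarith
  have : |m / √(u ^ 2 - m) ^ 3 * (k u * k' u)| ≤ 1 / 2 * (Wk m k k' u / 2) := by
    rw [abs_mul]; gcongr
  have h4 := abs_le.1 this
  have h0 := abs_nonneg (k u * k' u)
  refine ⟨by linarith [h4.1], by linarith [h4.2], hW, by linarith⟩

lemma Zk_comp (K : Ker B γ m k k') {u v : ℝ} (h : GoodU m u) (huv : u ≤ v) :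
    Zk m k k' u ≤ 2 * Zk m k k' v ∧ Zk m k k' v ≤ 2 * Zk m k k' u := by
  have good : ∀ x ∈ Ici u, GoodU m x := fun x hx => h.mono hx
  have hρd : ∀ x ∈ Ici u, HasDerivAt (fun x => |m| / √(x ^ 2 - m) ^ 3)
      (-3 * |m| * x / √(x ^ 2 - m) ^ 5) x := by
    intro x hx
    obtain ⟨h1, h2, h3⟩ := good x hx
    have hp0 : 0 < √(x ^ 2 - m) := sqrt_pos.2 (by linarith)
    have : HasDerivAt (fun x => |m| / √(x ^ 2 - m) ^ 3) _ x :=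
      (hasDerivAt_const x |m|).div ((sqrt_hd h2).pow 3) (pow_pos hp0 3).ne'
    convert this using 1
    field_simp; ring
  have hZd : ∀ x ∈ Ici u, HasDerivAt (Zk m k k') _ x := fun x hx =>
    Zk_hd K (good x hx).1 (good x hx).2.1
  have key : ∀ x ∈ Ici u, |-3 * m * x / √(x ^ 2 - m) ^ 5 * (k x * k' x)| ≤
      3 * |m| * x / √(x ^ 2 - m) ^ 5 * Zk m k k' x := by
    intro x hx
    obtain ⟨h1, h2, h3⟩ := good x hx
    obtain ⟨w1, w2, w3, w4⟩ := WZ (k := k) (k' := k') (good x hx)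
    have hp0 : 0 < √(x ^ 2 - m) := sqrt_pos.2 (by linarith)
    rw [abs_mul, abs_div, abs_mul, abs_mul, abs_of_pos h1, abs_of_pos (pow_pos hp0 5),
      abs_of_neg (by norm_num : (-3:ℝ) < 0), neg_neg]
    gcongr
    linarith
  have hexp : exp (|m| / √(u ^ 2 - m) ^ 3) ≤ 2 := by
    have hp0 : 0 < √(u ^ 2 - m) := sqrt_pos.2 (by linarith [h.2.1])
    have : |m| / √(u ^ 2 - m) ^ 3 ≤ 1 / 2 := by
      rw [div_le_iff₀ (by positivity)]; linarith [h.2.2]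
    have h1 : exp (1/2) ≤ 2 := by
      have := Real.exp_one_lt_d9
      have h2 : exp (1/2) ^ 2 = exp 1 := by rw [← Real.exp_nat_mul]; norm_num
      nlinarith [exp_pos (1/2)]
    exact (Real.exp_le_exp.2 this).trans h1
  have conv : Convex ℝ (Ici u) := convex_Ici u
  have Zpos : ∀ x ∈ Ici u, 0 ≤ Zk m k k' x := fun x hx => by
    obtain ⟨w1, w2, w3, w4⟩ := WZ (k := k) (k' := k') (good x hx); linarith
  have hone : ∀ x, 1 ≤ exp (|m| / √(x ^ 2 - m) ^ 3) := fun x => Real.one_le_exp (by positivity)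
  constructor
  · have hd : ∀ x ∈ Ici u, HasDerivAt (fun x => Zk m k k' x * exp (-(|m| / √(x ^ 2 - m) ^ 3)))
        _ x := fun x hx => (hZd x hx).mul (hρd x hx).neg.exp
    have hmono := monotoneOn_of_deriv_nonneg conv
      (fun x hx => (hd x hx).continuousAt.continuousWithinAt)
      (fun x hx => (hd x (interior_subset hx)).differentiableAt.differentiableWithinAt)
      (fun x hx => by
        rw [(hd x (interior_subset hx)).deriv]
        have := (abs_le.1 (key x (interior_subset hx))).1
        have he := exp_pos (-(|m| / √(x ^ 2 - m) ^ 3))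
        simp only [Pi.neg_apply]
        have : 0 ≤ (-3 * m * x / √(x ^ 2 - m) ^ 5 * (k x * k' x) +
          3 * |m| * x / √(x ^ 2 - m) ^ 5 * Zk m k k' x) * exp (-(|m| / √(x ^ 2 - m) ^ 3)) := by
            apply mul_nonneg _ he.le; linarith
        refine this.trans (le_of_eq ?_)
        ring)
    have h1 := hmono self_mem_Ici (show v ∈ Ici u from huv) huv
    simp only [Real.exp_neg] at h1
    rw [mul_inv_le_iff₀ (exp_pos _)] at h1
    have h2 : (exp (|m| / √(v ^ 2 - m) ^ 3))⁻¹ ≤ 1 := inv_le_one_of_one_le₀ (hone v)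
    have zv := Zpos v huv
    calc _ ≤ _ := h1
      _ ≤ Zk m k k' v * 1 * 2 := by gcongr
      _ = _ := by ring
  · have hd : ∀ x ∈ Ici u, HasDerivAt (fun x => Zk m k k' x * exp ((|m| / √(x ^ 2 - m) ^ 3)))
        _ x := fun x hx => (hZd x hx).mul (hρd x hx).exp
    have hmono := antitoneOn_of_deriv_nonpos conv
      (fun x hx => (hd x hx).continuousAt.continuousWithinAt)
      (fun x hx => (hd x (interior_subset hx)).differentiableAt.differentiableWithinAt)
      (fun x hx => by
        rw [(hd x (interior_subset hx)).deriv]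
        have := (abs_le.1 (key x (interior_subset hx))).2
        have he := exp_pos ((|m| / √(x ^ 2 - m) ^ 3))
        have : 0 ≤ (3 * |m| * x / √(x ^ 2 - m) ^ 5 * Zk m k k' x - -3 * m * x / √(x ^ 2 - m) ^ 5 * (k x * k' x)
          ) * exp ((|m| / √(x ^ 2 - m) ^ 3)) := by
            apply mul_nonneg _ he.le; linarith
        rw [← neg_nonneg]
        refine this.trans (le_of_eq ?_)
        ring)
    have h1 := hmono self_mem_Ici (show v ∈ Ici u from huv) huv
    have zv := Zpos v huv
    have zu := Zpos u self_mem_Ici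
    calc _ = Zk m k k' v * 1 := by ring
      _ ≤ Zk m k k' v * exp (|m| / √(v ^ 2 - m) ^ 3) := mul_le_mul_of_nonneg_left (hone v) zv
      _ ≤ _ := h1
      _ ≤ Zk m k k' u * 2 := mul_le_mul_of_nonneg_left hexp zu
      _ = _ := by ring

lemma ofReal_int_le {α : Type*} [MeasurableSpace α] {μ : Measure α} {f : α → ℝ} (hf : Integrable f μ) :
    ofReal (∫ x, f x ∂μ) ≤ ∫⁻ x, ofReal (f x) ∂μ := by
  have h1 : ∫ x, f x ∂μ ≤ ∫ x, max (f x) 0 ∂μ :=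
    integral_mono hf hf.pos_part (fun x => le_max_left _ _)
  refine (ofReal_le_ofReal h1).trans (le_of_eq ?_)
  rw [ofReal_integral_eq_lintegral_ofReal hf.pos_part (Eventually.of_forall fun x => le_max_right _ _)]
  congr 1; ext x
  rcases le_total (f x) 0 with h | h
  · simp [h]
  · simp [h]

lemma Ker.cont (K : Ker B γ m k k') : ContinuousOn k (Ioi 0) :=
  fun u hu => (K.hk u hu).continuousAt.continuousWithinAt
lemma Ker.cont' (K : Ker B γ m k k') : ContinuousOn k' (Ioi 0) :=
  fun u hu => (K.hk' u hu).continuousAt.continuousWithinAt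

lemma ar1 {x p m a b : ℝ} (hx : 0 < x) (hp : 0 < p) (hsq : p ^ 2 = x ^ 2 - m) (h1 : -(0.01 * x ^ 2) ≤ m)
    (h2 : m ≤ 0.01 * x ^ 2) (ha : 0 ≤ a) (hb : 0 ≤ b) :
    0.99 * (a + b) ≤ a * (x / p) + b * (p / x) ∧ a * (x / p) + b * (p / x) ≤ 1.02 * (a + b) := by
  have b1 : p ≤ 1.01 * x := by nlinarith
  have b2 : 0.99 * x ≤ p := by nlinarith
  have a1 : 0.99 ≤ x / p := by rw [le_div_iff₀ hp]; linarith
  have a2 : 0.99 ≤ p / x := by rw [le_div_iff₀ hx]; linarith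
  have a3 : x / p ≤ 1.02 := by rw [div_le_iff₀ hp]; linarith
  have a4 : p / x ≤ 1.02 := by rw [div_le_iff₀ hx]; linarith
  have := mul_le_mul_of_nonneg_left a1 ha
  have := mul_le_mul_of_nonneg_left a2 hb
  have := mul_le_mul_of_nonneg_left a3 ha
  have := mul_le_mul_of_nonneg_left a4 hb
  constructor <;> linarith

lemma ar2 {I J a b x Z q r y : ℝ} (hx : 100 ≤ x) (hZ : 0 ≤ Z) (h1 : J - q = a - b) (h2 : q ≤ 1.01 * I)
    (h3 : 0.39 * Z * x ≤ J + I) (h4 : -(1.35 * Z) ≤ b) (h5 : a ≤ 1.35 * Z) : 0.17 * x * Z ≤ I := by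
  have : 100 * Z ≤ x * Z := by gcongr
  nlinarith

lemma ar3 {δ X I K Z : ℝ} (hδ : 0 < δ) (hZ : 0 ≤ Z) (L2 : 1 / 2 * δ ^ 2 * (0.17 * X * Z) ≤ K)
    (hδX : δ * X = 1 / 20)
    (L1 : K - (2 * X - X) * (0.027 * δ ^ 2 * Z) ≤ δ) : Z ≤ 400 := by
  have e1 : 1 / 2 * δ ^ 2 * (0.17 * X * Z) = δ * (0.085 * (δ * X) * Z) := by ring
  have e2 : (2 * X - X) * (0.027 * δ ^ 2 * Z) = δ * (0.027 * (δ * X) * Z) := by ring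
  rw [e1] at L2; rw [e2] at L1; rw [hδX] at L1 L2
  have : δ * (0.058 * (1/20) * Z) ≤ δ * 1 := by linarith
  have := le_of_mul_le_mul_left this hδ
  linarith

set_option maxHeartbeats 1000000 in
lemma Zk_bound (K : Ker B γ m k k') {u : ℝ} (h : GoodU m u) : Zk m k k' u ≤ 800 := by
  set X := u + 100 * (1 + |m|) with hX
  have hu0 := h.1
  have hm0 := abs_nonneg m
  have hX100 : 100 ≤ X := by linarith
  set Z0 := Zk m k k' X with hZ0
  have hZu : Zk m k k' u ≤ 2 * Z0 := (Zk_comp K h (by linarith)).1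
  suffices Z0 ≤ 400 by linarith
  have hgX : GoodU m X := h.mono (by linarith)
  have Z0pos : 0 ≤ Z0 := by
    obtain ⟨w1, w2, w3, w4⟩ := WZ (k := k) (k' := k') hgX; linarith
  have pt : ∀ x, X ≤ x → k' x ^ 2 + k x ^ 2 ≤ 2.7 * Z0 ∧ 0.39 * Z0 ≤ k' x ^ 2 + k x ^ 2 ∧
      |k x * k' x| ≤ 1.35 * Z0 ∧ |m / x ^ 2| ≤ 0.01 := by
    intro x hx
    have hg := hgX.mono hx
    obtain ⟨w1, w2, w3, w4⟩ := WZ (k := k) (k' := k') hg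
    obtain ⟨c1, c2⟩ := Zk_comp K hgX hx
    have hx0 : 0 < x := hg.1
    have hmx : |m / x ^ 2| ≤ 0.01 := by
      rw [abs_div, abs_of_pos (pow_pos hx0 2), div_le_iff₀ (by positivity)]
      nlinarith
    have hmx' : |m| ≤ 0.01 * x ^ 2 := by
      rw [abs_div, abs_of_pos (pow_pos hx0 2), div_le_iff₀ (by positivity)] at hmx; exact hmx
    have hmb := abs_le.1 hmx'
    have hp0 : 0 < √(x ^ 2 - m) := sqrt_pos.2 (by linarith [hg.2.1])
    have hsq : √(x ^ 2 - m) ^ 2 = x ^ 2 - m := sq_sqrt (by linarith [hg.2.1])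
    obtain ⟨W1, W2⟩ := ar1 hx0 hp0 hsq hmb.1 hmb.2 (sq_nonneg (k' x)) (sq_nonneg (k x))
    change _ ≤ Wk m k k' x at W1
    change Wk m k k' x ≤ _ at W2
    refine ⟨by linarith, by linarith, by linarith, hmx⟩
  have hX0 : 0 < X := by linarith
  have sub : Icc X (2 * X) ⊆ Ioi 0 := fun x hx => lt_of_lt_of_le hX0 hx.1
  have uI : uIcc X (2 * X) = Icc X (2 * X) := uIcc_of_le (by linarith)
  have ck : ContinuousOn k (uIcc X (2*X)) := by rw [uI]; exact K.cont.mono sub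
  have ck' : ContinuousOn k' (uIcc X (2*X)) := by rw [uI]; exact K.cont'.mono sub
  have ik : IntervalIntegrable (fun x => k x ^ 2) volume X (2 * X) := (ck.pow 2).intervalIntegrable
  have ik' : IntervalIntegrable (fun x => k' x ^ 2) volume X (2 * X) := (ck'.pow 2).intervalIntegrable
  have cQ : ContinuousOn (fun x => (1 - m / x ^ 2) * k x ^ 2) (uIcc X (2*X)) := by
    refine ContinuousOn.mul (continuousOn_const.sub (continuousOn_const.div (by fun_prop) ?_)) (ck.pow 2)
    intro x hx; rw [uI] at hx; have := sub hx; exact (pow_pos this 2).ne'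
  have iQ := cQ.intervalIntegrable (μ := volume)
  have J1 : ∫ x in X..(2*X), (k' x ^ 2 - (1 - m / x ^ 2) * k x ^ 2) = k (2*X) * k' (2*X) - k X * k' X := by
    refine intervalIntegral.integral_eq_sub_of_hasDerivAt (f := fun x => k x * k' x) ?_ ?_
    · intro x hx
      rw [uI] at hx
      have hx0 := sub hx
      have hd : HasDerivAt (fun x => k x * k' x) _ x := (K.hk x hx0).mul (K.hk' x hx0)
      have heq : k' x ^ 2 - (1 - m / x ^ 2) * k x ^ 2 = k' x * k' x + k x * (-(1 - m / x ^ 2) * k x) := by ring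
      rw [heq]; exact hd
    · exact ik'.sub iQ
  rw [intervalIntegral.integral_sub ik' iQ] at J1
  have J2 : ∫ x in X..(2*X), (1 - m / x ^ 2) * k x ^ 2 ≤ 1.01 * ∫ x in X..(2*X), k x ^ 2 := by
    rw [← intervalIntegral.integral_const_mul]
    refine intervalIntegral.integral_mono_on (by linarith) iQ (ik.const_mul _) ?_
    intro x hx
    have := (abs_le.1 (pt x hx.1).2.2.2).1
    gcongr; linarith
  have J3 : 0.39 * Z0 * X ≤ (∫ x in X..(2*X), k' x ^ 2) + ∫ x in X..(2*X), k x ^ 2 := by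
    rw [← intervalIntegral.integral_add ik' ik]
    have : ∫ x in X..(2*X), (0.39 * Z0) = 0.39 * Z0 * X := by
      rw [intervalIntegral.integral_const]; simp; ring
    rw [← this]
    refine intervalIntegral.integral_mono_on (by linarith) (by simp) (ik'.add ik) ?_
    intro x hx; exact (pt x hx.1).2.1
  have b1 := (abs_le.1 (pt X le_rfl).2.2.1).1
  have b2 := (abs_le.1 (pt (2*X) (by linarith)).2.2.1).2
  have J4 : 0.17 * X * Z0 ≤ ∫ x in X..(2*X), k x ^ 2 := ar2 (r := 0) (y := 0) hX100 Z0pos J1 J2 J3 b1 b2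
  set δ := 1 / (20 * X) with hδ
  have hδ0 : 0 < δ := by positivity
  have hδX : δ * X = 1 / 20 := by rw [hδ]; field_simp
  set φ : ℝ → ℝ := (Icc 1 (1+δ)).indicator (fun _ => 1) with hφ
  have hiso := K.iso φ 1 (1+δ) 1 (measurable_const.indicator measurableSet_Icc) one_pos
    (fun r => by rw [hφ, indicator_apply]; split_ifs <;> simp)
    (fun r hr => by rw [hφ, indicator_of_notMem hr])
  have hR : ∫⁻ r, ofReal (φ r ^ 2) = ofReal δ := by
    have : (fun r => ofReal (φ r ^ 2)) = (Icc 1 (1+δ)).indicator (fun _ => 1) := by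
      ext r; rw [hφ, indicator_apply, indicator_apply]; split_ifs <;> simp
    rw [this, lintegral_indicator measurableSet_Icc, setLIntegral_const, volume_Icc]; simp
  rw [hR] at hiso
  have hKφ : ∀ s, X ≤ s → s ≤ 2 * X →
      1 / 2 * δ ^ 2 * k s ^ 2 - 0.027 * δ ^ 2 * Z0 ≤ (∫ r, k (r * s) * φ r) ^ 2 := by
    intro s hs1 hs2
    have hs0 : 0 < s := by linarith
    have e1 : ∫ r, k (r * s) * φ r = ∫ r in (1:ℝ)..(1+δ), k (r * s) := by
      rw [intervalIntegral.integral_of_le (by linarith), ← integral_Icc_eq_integral_Ioc,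
        ← integral_indicator measurableSet_Icc]
      congr 1; ext r; rw [hφ, indicator_apply, indicator_apply]; split_ifs <;> simp
    have hc : ContinuousOn (fun r => k (r * s)) (uIcc 1 (1+δ)) := by
      rw [uIcc_of_le (by linarith)]
      refine K.cont.comp (by fun_prop) ?_
      intro r hr; have := hr.1; simp only [mem_Ioi]; positivity
    have e2 : (∫ r in (1:ℝ)..(1+δ), k (r * s)) - δ * k s = ∫ r in (1:ℝ)..(1+δ), (k (r * s) - k s) := by
      rw [intervalIntegral.integral_sub hc.intervalIntegrable (by simp)]
      simp
    have e3 : |(∫ r in (1:ℝ)..(1+δ), k (r * s)) - δ * k s| ≤ (√(2.7 * Z0) * (1/10)) * |1 + δ - 1| := by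
      rw [e2, ← norm_eq_abs]
      refine intervalIntegral.norm_integral_le_of_norm_le_const ?_
      intro r hr
      rw [Set.uIoc_of_le (by linarith)] at hr
      have hmv := (convex_Ici X).norm_image_sub_le_of_norm_hasDerivWithin_le (f := k) (f' := k')
        (C := √(2.7 * Z0)) (x := s) (y := r * s)
        (fun x hx => (K.hk x (lt_of_lt_of_le hX0 hx)).hasDerivWithinAt)
        (fun x hx => by
          have := (pt x hx).1
          refine Real.abs_le_sqrt ?_
          nlinarith [sq_nonneg (k x)]) hs1
          (by have := hr.1; show X ≤ r * s; nlinarith)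
      refine hmv.trans ?_
      gcongr
      rw [norm_eq_abs, abs_of_nonneg (by nlinarith [hr.1])]
      have : r - 1 ≤ δ := by linarith [hr.2]
      nlinarith [hr.1]
    rw [e1]
    set I := ∫ r in (1:ℝ)..(1+δ), k (r * s)
    have e4 : (I - δ * k s) ^ 2 ≤ 0.027 * δ ^ 2 * Z0 := by
      rw [← sq_abs]
      refine (pow_le_pow_left₀ (abs_nonneg _) e3 2).trans (le_of_eq ?_)
      rw [mul_pow, mul_pow, sq_sqrt (by positivity), sq_abs]; ring
    nlinarith [sq_nonneg (2 * I - δ * k s)]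
  have iF : IntervalIntegrable (fun s => 1 / 2 * δ ^ 2 * k s ^ 2 - 0.027 * δ ^ 2 * Z0) volume X (2*X) :=
    (ik.const_mul _).sub (by simp)
  have L1 : ofReal (∫ s in X..(2*X), (1 / 2 * δ ^ 2 * k s ^ 2 - 0.027 * δ ^ 2 * Z0)) ≤
      ofReal δ := by
    rw [← hiso, intervalIntegral.integral_of_le (by linarith)]
    rw [intervalIntegrable_iff_integrableOn_Ioc_of_le (by linarith)] at iF
    refine (ofReal_int_le iF).trans ?_
    calc _ ≤ ∫⁻ s in Ioc X (2*X), ofReal ((∫ r, k (r * s) * φ r) ^ 2) := by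
          refine setLIntegral_mono' measurableSet_Ioc fun s hs => ?_
          exact ofReal_le_ofReal (hKφ s hs.1.le hs.2)
      _ ≤ _ := lintegral_mono_set fun s hs => lt_trans hX0 hs.1
  rw [ENNReal.ofReal_le_ofReal_iff hδ0.le, intervalIntegral.integral_sub (ik.const_mul _) (by simp),
    intervalIntegral.integral_const_mul, intervalIntegral.integral_const] at L1
  simp only [smul_eq_mul] at L1
  have L2 : 1 / 2 * δ ^ 2 * (0.17 * X * Z0) ≤ 1 / 2 * δ ^ 2 * ∫ x in X..(2*X), k x ^ 2 := by gcongr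
  exact ar3 (I := 0) hδ0 Z0pos L2 hδX L1

/-- amplitude function -/
def qf (m u : ℝ) : ℝ := 1 - max m 0 / u ^ 2

lemma ker_B1 (K : Ker B γ m k k') {u : ℝ} (hu : 0 < u) (hq : 0 < qf m u) (h : 2 ≤ u * √(qf m u) ^ 3) :
    k u ^ 2 ≤ 1200 / √(qf m u) ∧ k' u ^ 2 ≤ 1200 * √(qf m u) := by
  have hτ0 : 0 < √(qf m u) := sqrt_pos.2 hq
  have hmain : GoodU m u ∧ √(u ^ 2 - m) / u ≤ 1.05 * √(qf m u) ∧ √(qf m u) ≤ √(u ^ 2 - m) / u := by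
    rcases le_total 0 m with h0 | h0
    · have e : u ^ 2 - m = u ^ 2 * qf m u := by
        unfold qf; rw [max_eq_left h0]; field_simp
      have e2 : √(u ^ 2 - m) = u * √(qf m u) := by
        rw [e, Real.sqrt_mul (by positivity), sqrt_sq hu.le]
      have h1 : m < u ^ 2 := by have := mul_pos (pow_pos hu 2) hq; linarith
      refine ⟨⟨hu, h1, ?_⟩, ?_, ?_⟩
      · rw [e2, abs_of_nonneg h0]
        have : (u * √(qf m u)) ^ 3 = u ^ 2 * (u * √(qf m u) ^ 3) := by ring
        rw [this]
        nlinarith [pow_pos hu 2]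
      · rw [e2, mul_div_cancel_left₀ _ hu.ne']; linarith
      · rw [e2, mul_div_cancel_left₀ _ hu.ne']
    · have e : qf m u = 1 := by unfold qf; rw [max_eq_right h0]; simp
      rw [e] at h ⊢
      simp only [Real.sqrt_one, one_pow, mul_one] at h ⊢
      have hm4 := K.hm
      have hsq : √(u ^ 2 - m) ^ 2 = u ^ 2 - m := sq_sqrt (by nlinarith)
      have hp0 : 0 ≤ √(u ^ 2 - m) := sqrt_nonneg _
      have hpu : u ≤ √(u ^ 2 - m) := le_sqrt_of_sq_le (by linarith)
      refine ⟨⟨hu, by nlinarith, ?_⟩, ?_, ?_⟩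
      · rw [abs_of_nonpos h0]
        have : (2:ℝ) ^ 3 ≤ √(u ^ 2 - m) ^ 3 := by gcongr; linarith
        linarith
      · rw [div_le_iff₀ hu]; nlinarith
      · rw [le_div_iff₀ hu]; linarith
  obtain ⟨hg, h1, h2⟩ := hmain
  obtain ⟨w1, w2, w3, w4⟩ := WZ (k := k) (k' := k') hg
  have hZ := Zk_bound K hg
  have hW : Wk m k k' u ≤ 1067 := by linarith
  have hp0 : 0 < √(u ^ 2 - m) := sqrt_pos.2 (by linarith [hg.2.1])
  unfold Wk at hW
  set τ := √(qf m u)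
  set p := √(u ^ 2 - m)
  have hA : k u ^ 2 * (p / u) ≤ 1067 := by
    have : 0 ≤ k' u ^ 2 * (u / p) := by positivity
    linarith
  have hB : k' u ^ 2 * (u / p) ≤ 1067 := by
    have : 0 ≤ k u ^ 2 * (p / u) := by positivity
    linarith
  constructor
  · rw [le_div_iff₀ hτ0]
    calc _ ≤ k u ^ 2 * (p / u) := by gcongr
      _ ≤ _ := by linarith
  · have e : k' u ^ 2 = (k' u ^ 2 * (u / p)) * (p / u) := by field_simp
    rw [e]
    have : 0 < p / u := by positivity
    nlinarith

end
end

section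
def ug (A m : ℝ) : ℝ := √(max m 0) + (A ^ 2 + 2) * (1 + √(max m 0)) ^ ((1:ℝ) / 3)

lemma cc_spec (n : ℝ) (hn : 0 ≤ n) : 1 ≤ (1 + n) ^ ((1:ℝ)/3) ∧ ((1 + n) ^ ((1:ℝ)/3)) ^ 3 = 1 + n := by
  constructor
  · exact Real.one_le_rpow (by linarith) (by norm_num)
  · rw [← rpow_natCast, ← rpow_mul (by linarith)]; norm_num

lemma ug_ar {A n c h : ℝ} (hA : 2 ≤ A) (hn : 0 ≤ n) (hc : 1 ≤ c) (hc3 : c ^ 3 = 1 + n)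
    (hh : (A ^ 2 + 2) * c ≤ h) : A ^ 2 * (n + h) ≤ h ^ 3 := by
  have h1 : A ^ 2 + 2 ≤ h := by nlinarith
  have h2 : A ^ 2 * c ^ 2 ≤ h ^ 2 - A ^ 2 := by
    have : ((A ^ 2 + 2) * c) ^ 2 ≤ h ^ 2 := by gcongr
    have e : ((A ^ 2 + 2) * c) ^ 2 = (A^4 + 4 * A^2 + 4) * c ^ 2 := by ring
    have : 1 ≤ c ^ 2 := by nlinarith
    nlinarith [mul_le_mul_of_nonneg_left this (sq_nonneg A), sq_nonneg (A^2), mul_nonneg (sq_nonneg (A^2)) (sq_nonneg c)]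
  have h3 : c * (A ^ 2 * c ^ 2) ≤ h * (h ^ 2 - A ^ 2) := by
    have : c ≤ h := by nlinarith
    have : 0 ≤ h := by linarith
    gcongr
  have h4 : c * (A ^ 2 * c ^ 2) = A ^ 2 * (1 + n) := by rw [← hc3]; ring
  nlinarith [sq_nonneg A]

lemma ug_good {A m u : ℝ} (hA : 2 ≤ A) (hu : ug A m ≤ u) :
    0 < u ∧ 0 < qf m u ∧ A ≤ u * √(qf m u) ^ 3 := by
  unfold ug at hu
  set n := √(max m 0) with hn
  have hn0 : 0 ≤ n := sqrt_nonneg _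
  have hn2 : n ^ 2 = max m 0 := sq_sqrt (le_max_right _ _)
  obtain ⟨hc1, hc3⟩ := cc_spec n hn0
  set c := (1 + n) ^ ((1:ℝ)/3)
  set h := u - n with hh
  have h1 : (A ^ 2 + 2) * c ≤ h := by linarith
  have key := ug_ar hA hn0 hc1 hc3 h1
  have hh0 : 0 < h := by nlinarith
  have hu0 : 0 < u := by linarith
  have hq : qf m u = (u ^ 2 - n ^ 2) / u ^ 2 := by unfold qf; rw [← hn2]; field_simp
  have hd : h * u ≤ u ^ 2 - n ^ 2 := by rw [hh]; nlinarith
  have hq1 : h / u ≤ qf m u := by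
    rw [hq, div_le_div_iff₀ hu0 (by positivity)]
    nlinarith
  have hq0 : 0 < qf m u := lt_of_lt_of_le (by positivity) hq1
  refine ⟨hu0, hq0, ?_⟩
  have hs : √(qf m u) ^ 2 = qf m u := sq_sqrt hq0.le
  have : A ^ 2 ≤ (u * √(qf m u) ^ 3) ^ 2 := by
    have e : (u * √(qf m u) ^ 3) ^ 2 = u ^ 2 * (√(qf m u) ^ 2) ^ 3 := by ring
    rw [e, hs]
    have : u ^ 2 * (h / u) ^ 3 ≤ u ^ 2 * qf m u ^ 3 := by gcongr
    refine le_trans ?_ this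
    have e2 : u ^ 2 * (h / u) ^ 3 = h ^ 3 / u := by field_simp
    rw [e2, le_div_iff₀ hu0]
    have : n + h = u := by rw [hh]; ring
    rw [this] at key; exact key
  exact le_of_sq_le_sq this (by positivity)
where
  le_of_sq_le_sq {a b : ℝ} (h : a ^ 2 ≤ b ^ 2) (hb : 0 ≤ b) : a ≤ b := by
    exact le_of_abs_le ((sq_le_sq.1 h).trans_eq (abs_of_nonneg hb))

/-- convex functions vanishing at zero -/
lemma cvx_zero {f f' : ℝ → ℝ} {n : ℝ} (hd : ∀ x ∈ Ioc 0 n, HasDerivAt f (f' x) x)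
    (hm : MonotoneOn f' (Ioc 0 n)) (h0 : Tendsto f (𝓝[>] 0) (𝓝 0))
    (hf : ∀ x ∈ Ioc 0 n, 0 ≤ f x) : ∀ x ∈ Ioc 0 n, 0 ≤ f' x := by
  intro x hx
  have h1 : ∀ᶠ y in 𝓝[>] (0:ℝ), f x - f y ≤ f' x * (x - y) := by
    filter_upwards [Ioo_mem_nhdsGT hx.1] with y hy
    obtain ⟨ξ, hξ, he⟩ := exists_hasDerivAt_eq_slope f f' hy.2
      (fun z hz => (hd z ⟨hy.1.trans_le hz.1, hz.2.trans hx.2⟩).continuousAt.continuousWithinAt)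
      (fun z hz => hd z ⟨hy.1.trans hz.1, hz.2.le.trans hx.2⟩)
    have h2 := hm ⟨hy.1.trans hξ.1, hξ.2.le.trans hx.2⟩ hx hξ.2.le
    rw [he, div_le_iff₀ (by linarith [hy.2])] at h2
    exact h2
  have h2 : Tendsto (fun y => f x - f y) (𝓝[>] 0) (𝓝 (f x - 0)) := h0.const_sub _
  have h3 : Tendsto (fun y => f' x * (x - y)) (𝓝[>] 0) (𝓝 (f' x * (x - 0))) := by
    apply Tendsto.mono_left _ nhdsWithin_le_nhds
    exact (Continuous.tendsto (by fun_prop) 0)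
  have h4 := le_of_tendsto_of_tendsto h2 h3 h1
  have := hf x hx
  simp only [sub_zero] at h4
  by_contra hc
  push Not at hc
  have := mul_neg_of_neg_of_pos hc hx.1
  linarith

lemma mono_of_hd {f f' : ℝ → ℝ} {a b : ℝ} {s : Set ℝ} (hs : s = Ioc a b ∨ s = Icc a b)
    (hd : ∀ x ∈ s, HasDerivAt f (f' x) x)
    (hm : ∀ x ∈ s, 0 ≤ f' x) : MonotoneOn f s := by
  refine monotoneOn_of_deriv_nonneg ?_ (fun x hx => (hd x hx).continuousAt.continuousWithinAt)
    (fun x hx => (hd x (interior_subset hx)).differentiableAt.differentiableWithinAt)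
    (fun x hx => by rw [(hd x (interior_subset hx)).deriv]; exact hm x (interior_subset hx))
  rcases hs with rfl | rfl
  · exact convex_Ioc _ _
  · exact convex_Icc _ _

lemma forb {h h' R : ℝ → ℝ} {n : ℝ} (hd : ∀ x ∈ Ioc 0 n, HasDerivAt h (h' x) x)
    (hd' : ∀ x ∈ Ioc 0 n, HasDerivAt h' (R x * h x) x) (hR : ∀ x ∈ Ioc 0 n, 0 ≤ R x)
    (h0 : Tendsto h (𝓝[>] 0) (𝓝 0)) :
    ∀ x ∈ Ioc 0 n, |h x| ≤ |h n| ∧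
     ∀ a ∈ Ioc 0 x, ContinuousOn R (Ioc 0 n) → ∫ u in a..x, R u * |h u| ≤ |h' n| := by
  intro x hx
  have hn0 : 0 < n := hx.1.trans_le hx.2
  have hnn : n ∈ Ioc 0 n := ⟨hn0, le_rfl⟩
  have d2 : ∀ x ∈ Ioc 0 n, HasDerivAt (fun x => h x * h x) (2 * (h x * h' x)) x := fun x hx =>
    ((hd x hx).mul (hd x hx)).congr_deriv (by ring)
  have d3 : ∀ x ∈ Ioc 0 n, HasDerivAt (fun x => 2 * (h x * h' x)) (2 * (h' x * h' x + R x * (h x * h x))) x := fun x hx =>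
    (((hd x hx).mul (hd' x hx)).const_mul 2).congr_deriv (by ring)
  have m3 := mono_of_hd (Or.inl rfl) d3 (fun x hx => by
    have := hR x hx
    have := mul_self_nonneg (h x); have := mul_self_nonneg (h' x); positivity)
  have m2 := mono_of_hd (Or.inl rfl) d2 (cvx_zero d2 m3 (by simpa using h0.mul h0) (fun x _ => mul_self_nonneg _))
  have habs : ∀ x ∈ Ioc 0 n, ∀ y ∈ Ioc 0 n, x ≤ y → |h x| ≤ |h y| := fun x hx y hy hxy =>
    abs_le_abs_iff_mul.2 (m2 hx hy hxy)
  refine ⟨habs x hx n hnn hx.2, ?_⟩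
  intro a ha cR
  obtain ⟨ε, hε, hεn⟩ : ∃ ε : ℝ, (ε = 1 ∨ ε = -1) ∧ 0 ≤ ε * h n := by
    rcases le_total 0 (h n) with h | h
    · exact ⟨1, Or.inl rfl, by linarith⟩
    · exact ⟨-1, Or.inr rfl, by linarith⟩
  have hε2 : |ε| = 1 := by rcases hε with rfl | rfl <;> simp
  have hpos : ∀ x ∈ Ioc 0 n, 0 ≤ ε * h x := by
    intro x hx
    by_contra hc
    push Not at hc
    have cont : ContinuousOn (fun x => ε * h x) (Icc x n) := fun z hz =>
      ((hd z ⟨hx.1.trans_le hz.1, hz.2⟩).continuousAt.continuousWithinAt).const_mul _ |>.congr (fun _ _ => rfl) rfl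
    obtain ⟨z, hz, hz0⟩ := intermediate_value_Icc hx.2 cont ⟨hc.le, hεn⟩
    have := habs x hx z ⟨hx.1.trans_le hz.1, hz.2⟩ hz.1
    have hz1 : h z = 0 := by
      rcases hε with rfl | rfl <;> simpa using hz0
    rw [hz1, abs_zero] at this
    have : h x = 0 := by simpa using this
    rw [this] at hc; simp at hc
  have he : ∀ x ∈ Ioc 0 n, |h x| = ε * h x := fun x hx => by
    rw [← abs_of_nonneg (hpos x hx), abs_mul, hε2, one_mul]
  have e1 : ∀ x ∈ Ioc 0 n, HasDerivAt (fun x => ε * h x) (ε * h' x) x := fun x hx => (hd x hx).const_mul ε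
  have e2 : ∀ x ∈ Ioc 0 n, HasDerivAt (fun x => ε * h' x) (R x * |h x|) x := fun x hx =>
    ((hd' x hx).const_mul ε).congr_deriv (by rw [he x hx]; ring)
  have m4 := mono_of_hd (Or.inl rfl) e2 (fun x hx => by have := hR x hx; positivity)
  have p4 := cvx_zero e1 m4 (by simpa using h0.const_mul ε) hpos
  have sub : Icc a x ⊆ Ioc 0 n := fun z hz => ⟨ha.1.trans_le hz.1, hz.2.trans hx.2⟩
  have hint : IntervalIntegrable (fun u => R u * |h u|) volume a x := by
    apply ContinuousOn.intervalIntegrable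
    rw [uIcc_of_le ha.2]
    exact (cR.mono sub).mul (ContinuousOn.abs fun z hz => (hd z (sub hz)).continuousAt.continuousWithinAt)
  rw [intervalIntegral.integral_eq_sub_of_hasDerivAt (f := fun x => ε * h' x) (fun z hz => e2 z (sub (by rwa [uIcc_of_le ha.2] at hz))) hint]
  have q1 := p4 a ⟨ha.1, ha.2.trans hx.2⟩
  have q2 := m4 hx hnn hx.2
  have q3 := le_abs_self (ε * h' n)
  rw [abs_mul, hε2, one_mul] at q3
  simp only at q2
  linarith
where
  abs_le_abs_iff_mul {a b : ℝ} : |a| ≤ |b| ↔ a * a ≤ b * b := by rw [abs_le_iff_mul_self_le]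
end

section
section
variable {B γ m : ℝ} {k k' : ℝ → ℝ}

lemma lint_const_Icc {F : ℝ → ℝ} {a b C : ℝ} (hab : a ≤ b) (hC : 0 ≤ C) (h : ∀ u ∈ Icc a b, F u ≤ C) :
    ∫⁻ u in Icc a b, ofReal (F u) ≤ ofReal (C * (b - a)) := by
  calc _ ≤ ∫⁻ u in Icc a b, ofReal C :=
        setLIntegral_mono' measurableSet_Icc fun u hu => ofReal_le_ofReal (h u hu)
    _ = _ := by rw [setLIntegral_const, volume_Icc, ofReal_mul hC]

lemma lint_Ioc_sup {F : ℝ → ℝ≥0∞} {v : ℝ} {C : ℝ≥0∞}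
    (h : ∀ a, 0 < a → a ≤ v → ∫⁻ u in Ioc a v, F u ≤ C) :
    ∫⁻ u in Ioc 0 v, F u ≤ C := by
  have e : Ioc 0 v = ⋃ j : ℕ, Ioc (1 / ((j:ℝ) + 1)) v := by
    ext x
    simp only [Set.mem_Ioc, Set.mem_iUnion]
    constructor
    · rintro ⟨h1, h2⟩
      obtain ⟨j, hj⟩ := exists_nat_one_div_lt h1
      exact ⟨j, hj, h2⟩
    · rintro ⟨j, h1, h2⟩
      exact ⟨lt_trans (by positivity) h1, h2⟩
  rw [e, setLIntegral_iUnion_of_directed]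
  · refine iSup_le fun j => ?_
    rcases le_total (1 / ((j:ℝ) + 1)) v with h1 | h1
    · exact h _ (by positivity) h1
    · rw [Set.Ioc_eq_empty (by linarith)]; simp
  · apply Monotone.directed_le
    intro i j hij
    apply Set.Ioc_subset_Ioc_left
    have : (i:ℝ) ≤ j := by exact_mod_cast hij
    gcongr

lemma b3_ar {n c : ℝ} (hn : 1 ≤ n) (hc : 1 ≤ c) (hc3 : c ^ 3 = 1 + n) : c ≤ 3 / 2 * n ∧ n ≤ c ^ 3 ∧ c ^ 3 ≤ 2 * n := by
  refine ⟨?_, by linarith, by linarith⟩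
  by_contra h
  push Not at h
  have : (3/2 * n) ^ 3 < c ^ 3 := by gcongr
  have : n ≤ n ^ 3 := by nlinarith [sq_nonneg n]
  nlinarith

/-- transition zone bounds -/
lemma b3_trans (K : Ker B γ m k k') {A : ℝ} (hA : 2 ≤ A) {n c : ℝ} (hn1 : 1 ≤ n) (hn2 : n ^ 2 = m)
    (hc1 : 1 ≤ c) (hc3 : c ^ 3 = 1 + n) (hu : ug A m = n + (A ^ 2 + 2) * c) :
    |k' n| ≤ 70 * (A ^ 2 + 2) / √c ∧ ∀ u ∈ Icc n (ug A m), |k u| ≤ (42 + 70 * (A ^ 2 + 2) ^ 2) * √c := by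
  obtain ⟨hg1, hg2, hg3⟩ := ug_good hA (le_refl (ug A m))
  obtain ⟨hB1, hB2⟩ := ker_B1 K hg1 hg2 (by linarith)
  set U := ug A m
  set D := A ^ 2 + 2 with hD
  have hD1 : 1 ≤ D := by nlinarith
  clear_value D U
  have hs : √(qf m U) ^ 2 = qf m U := sq_sqrt hg2.le
  have ht0 : 0 < √(qf m U) := sqrt_pos.2 hg2
  have hm0 : 0 < m := by nlinarith
  have hq : qf m U = 1 - m / U ^ 2 := by unfold qf; rw [max_eq_left hm0.le]
  have hq' : qf m U = (D * c) * (2 * n + D * c) / U ^ 2 := by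
    rw [hq, ← hn2, hu]; field_simp; ring
  obtain ⟨ha1, ha2, ha3⟩ := b3_ar hn1 hc1 hc3
  have hDc : 1 ≤ D * c := one_le_mul_of_one_le_of_one_le hD1 hc1
  have hDD : D ≤ D * D := le_mul_of_one_le_left (by linarith) hD1
  have hc13 : c ≤ c ^ 3 := le_self_pow₀ hc1 (by norm_num)
  have up : √(qf m U) ≤ 2 * D / c := by
    have : qf m U ≤ 4 * D / c ^ 2 := by
      rw [hq', div_le_div_iff₀ (by positivity) (by positivity)]
      have h1 : (2 * n + D * c) ≤ 2 * U := by rw [hu]; linarith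
      have h2 : c ^ 3 ≤ 2 * U := by rw [hu]; linarith
      calc D * c * (2 * n + D * c) * c ^ 2 = D * (2 * n + D * c) * c ^ 3 := by ring
        _ ≤ D * (2 * U) * (2 * U) := by gcongr
        _ = _ := by ring
    apply Real.sqrt_le_iff.2
    refine ⟨by positivity, this.trans ?_⟩
    rw [div_pow]; gcongr; linarith [mul_le_mul hD1 hD1 zero_le_one (by linarith), mul_self_nonneg (D-1)]
  have lo : 1 / √(qf m U) ≤ √2 * c := by
    have : 1 / (2 * c ^ 2) ≤ qf m U := by
      rw [hq', div_le_div_iff₀ (by positivity) (by positivity), one_mul, hu]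
      have : n ≤ c ^ 3 := ha2
      have h3 : n + D * c ≤ D * c * (2 * c ^ 2) := by
        have : c ^ 3 ≤ D * c ^ 3 := le_mul_of_one_le_left (by positivity) hD1
        have : D * c ≤ D * c ^ 3 := by gcongr
        have e : D * c * (2 * c ^ 2) = 2 * (D * c ^ 3) := by ring
        linarith
      calc (n + D * c) ^ 2 = (n + D * c) * (n + D * c) := by ring
        _ ≤ (2 * n + D * c) * (D * c * (2 * c ^ 2)) := by gcongr; linarith
        _ = _ := by ring
    rw [div_le_iff₀ ht0]
    have h2 : 1 ≤ (√2 * c * √(qf m U)) ^ 2 := by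
      rw [mul_pow, hs, mul_pow, sq_sqrt (by norm_num)]
      rw [div_le_iff₀ (by positivity)] at this
      linarith
    have h3 := abs_le_of_sq_le_sq (a := 1) (b := √2 * c * √(qf m U)) (by linarith) (by positivity)
    exact le_of_abs_le h3
  have hc0 : 0 < √c := sqrt_pos.2 (by linarith)
  have hcs : √c ^ 2 = c := sq_sqrt (by linarith)
  have hE : ∀ x ∈ Icc n U, HasDerivAt (fun x => k' x ^ 2 + (1 - m / x ^ 2) * k x ^ 2)
      (2 * m / x ^ 3 * k x ^ 2) x := by
    intro x hx
    have hx0 : 0 < x := by linarith [hx.1]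
    have h1 := K.hk x hx0
    have h2 := K.hk' x hx0
    have h3 : HasDerivAt (fun x : ℝ => 1 - m / x ^ 2) _ x := ((hasDerivAt_const x m).div (hasDerivAt_pow 2 x) (pow_pos hx0 2).ne').const_sub 1
    refine ((h2.pow 2).add (h3.mul (h1.pow 2))).congr_deriv ?_
    simp only [Pi.pow_apply]
    field_simp
    push_cast
    ring
  have mE := mono_of_hd (Or.inr rfl) hE (fun x hx => by
    have hx0 : 0 < x := by linarith [hx.1]
    positivity)
  have hnU : n ≤ U := by rw [hu]; linarith
  have EU : k' U ^ 2 + (1 - m / U ^ 2) * k U ^ 2 ≤ 4800 * D / c := by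
    rw [← hq]
    have : qf m U * k U ^ 2 ≤ 1200 * √(qf m U) := by
      have h1 : qf m U * k U ^ 2 ≤ qf m U * (1200 / √(qf m U)) := by gcongr
      have h2 : qf m U * (1200 / √(qf m U)) = 1200 * √(qf m U) := by
        rw [← hs]; field_simp; rw [sqrt_sq ht0.le]
      linarith
    have e : 4800 * D / c = 2400 * (2 * D / c) := by ring
    rw [e]; linarith
  have kb : ∀ x ∈ Icc n U, |k' x| ≤ 70 * D / √c := by
    intro x hx
    have h1 := mE hx ⟨hnU, le_rfl⟩ hx.2
    simp only at h1
    have hx0 : 0 < x := by linarith [hx.1]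
    have : 0 ≤ (1 - m / x ^ 2) * k x ^ 2 := by
      apply mul_nonneg _ (sq_nonneg _)
      rw [sub_nonneg, div_le_one (by positivity), ← hn2]
      have := hx.1; gcongr
    have h2 : k' x ^ 2 ≤ 4800 * D / c := by linarith
    apply abs_le_of_sq_le_sq _ (by positivity)
    rw [div_pow, hcs]
    refine h2.trans ?_
    gcongr
    have e : (70 * D) ^ 2 = 4900 * (D * D) := by ring
    linarith
  refine ⟨kb n ⟨le_rfl, hnU⟩, ?_⟩
  intro u huu
  have hmv := (convex_Icc n U).norm_image_sub_le_of_norm_hasDerivWithin_le (f := k) (f' := k')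
        (C := 70 * D / √c) (x := U) (y := u)
        (fun x hx => (K.hk x (by linarith [hx.1])).hasDerivWithinAt)
        (fun x hx => kb x hx) ⟨hnU, le_rfl⟩ huu
  have hkU : |k U| ≤ 42 * √c := by
    apply abs_le_of_sq_le_sq _ (by positivity)
    rw [mul_pow, hcs]
    have e : 1200 / √(qf m U) = 1200 * (1 / √(qf m U)) := by ring
    rw [e] at hB1
    have h2 : √2 ≤ 1.42 := by rw [sqrt_le_left (by norm_num)]; norm_num
    have h3 : √2 * c ≤ 1.42 * c := by gcongr
    linarith
  rw [norm_eq_abs, norm_eq_abs] at hmv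
  have hlen : |u - U| ≤ D * c := by rw [abs_sub_comm, abs_of_nonneg (by linarith [huu.2])]; rw [hu]; linarith [huu.1]
  have h5 : |k u - k U| ≤ 70 * D ^ 2 * √c := by
    refine hmv.trans ?_
    calc _ ≤ 70 * D / √c * (D * c) := by gcongr
      _ = 70 * D / √c * (D * √c ^ 2) := by rw [hcs]
      _ = _ := by field_simp
  have := abs_sub_abs_le_abs_sub (k u) (k U)
  linarith

lemma rpow_half {u : ℝ} (hu : 0 < u) : u ^ (-(1/2):ℝ) = 1 / √u := by
  rw [Real.rpow_neg hu.le, ← sqrt_eq_rpow, one_div]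

lemma b3_big (K : Ker B γ m k k') {A : ℝ} (hA : 2 ≤ A) {n c : ℝ} (hn1 : 1 ≤ n) (hn2 : n ^ 2 = m)
    (hc1 : 1 ≤ c) (hc3 : c ^ 3 = 1 + n) (hu : ug A m = n + (A ^ 2 + 2) * c) :
    ∫⁻ u in Ioc 0 (ug A m), ofReal (|k u| * u ^ (-(1/2):ℝ)) ≤
      ofReal (140 * (A ^ 2 + 2)) + ofReal (3 * (42 + 70 * (A ^ 2 + 2) ^ 2) * (A ^ 2 + 3)) := by
  obtain ⟨t1, t2⟩ := b3_trans K hA hn1 hn2 hc1 hc3 hu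
  obtain ⟨ha1, ha2, ha3⟩ := b3_ar hn1 hc1 hc3
  set U := ug A m
  set D := A ^ 2 + 2 with hD
  have hD1 : 1 ≤ D := by nlinarith
  have hD3 : A ^ 2 + 3 = D + 1 := by rw [hD]; ring
  rw [hD3]
  have hc0 : 0 < √c := sqrt_pos.2 (by linarith)
  have hcs : √c ^ 2 = c := sq_sqrt (by linarith)
  have hn0 : 0 < √n := sqrt_pos.2 (by linarith)
  have hns : √n ^ 2 = n := sq_sqrt (by linarith)
  have r1 : √n ≤ √c ^ 3 := by
    apply le_of_abs_le
    apply abs_le_of_sq_le_sq _ (by positivity)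
    rw [hns, ← pow_mul, mul_comm 3 2, pow_mul, hcs]; exact ha2
  have r2 : √c ^ 3 ≤ 1.5 * √n := by
    apply le_of_abs_le
    apply abs_le_of_sq_le_sq _ (by positivity)
    rw [mul_pow, hns, ← pow_mul, mul_comm 3 2, pow_mul, hcs]; linarith
  have hm0 : 0 < m := by nlinarith
  have lim0 : Tendsto k (𝓝[>] 0) (𝓝 0) := by
    have hγ := K.hmγ hm0
    have h1 : Tendsto (fun u : ℝ => B * u ^ γ) (𝓝[>] 0) (𝓝 0) := by
      apply Tendsto.mono_left _ nhdsWithin_le_nhds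
      have := (continuous_const (y := B)).mul (Real.continuous_rpow_const (q := γ) hγ.le)
      have := this.tendsto 0
      simp only [Pi.mul_apply, zero_rpow hγ.ne', mul_zero] at this
      exact this
    refine squeeze_zero_norm' ?_ h1
    filter_upwards [self_mem_nhdsWithin] with u hu
    exact K.hB u hu
  have F := forb (h := k) (h' := k') (R := fun u => -(1 - m / u ^ 2)) (n := n)
    (fun x hx => K.hk x hx.1) (fun x hx => K.hk' x hx.1) (fun x hx => by
      have := hx.1
      rw [neg_sub, sub_nonneg, one_le_div (by positivity), ← hn2]
      have := hx.2; gcongr) lim0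
  set v := n - c / 2 with hv
  have hv4 : n / 4 ≤ v := by rw [hv]; linarith
  have hv0 : 0 < v := by linarith
  have hvn : v ≤ n := by rw [hv]; linarith
  have hnU : n ≤ U := by rw [hu]; have := mul_nonneg (by linarith : 0 ≤ D) (by linarith : 0 ≤ c); linarith
  have hsplit : Ioc 0 U ⊆ Ioc 0 v ∪ Icc v U := by
    intro x hx
    rcases le_total x v with h | h
    · exact Or.inl ⟨hx.1, h⟩
    · exact Or.inr ⟨h, hx.2⟩
  refine (lintegral_mono_set hsplit).trans ((lintegral_union_le _ _ _).trans (add_le_add ?_ ?_))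
  · apply lint_Ioc_sup
    intro a ha0 hav
    have sub : Icc a v ⊆ Ioc 0 n := fun x hx => ⟨ha0.trans_le hx.1, hx.2.trans hvn⟩
    have cR : ContinuousOn (fun u : ℝ => -(1 - m / u ^ 2)) (Ioc 0 n) := by
      refine (continuousOn_const.sub (continuousOn_const.div (by fun_prop) ?_)).neg
      intro x hx; exact (pow_pos hx.1 2).ne'
    have hF := (F v ⟨hv0, hvn⟩).2 a ⟨ha0, hav⟩ cR
    have hint : IntegrableOn (fun u => -(1 - m / u ^ 2) * |k u|) (Ioc a v) := by
      apply IntegrableOn.mono_set _ Set.Ioc_subset_Icc_self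
      apply ContinuousOn.integrableOn_Icc
      exact (cR.mono sub).mul (ContinuousOn.abs fun z hz => (K.hk z (sub hz).1).continuousAt.continuousWithinAt)
    rw [intervalIntegral.integral_of_le hav] at hF
    have pw : ∀ u ∈ Ioc a v, |k u| * u ^ (-(1/2):ℝ) ≤ 2 * √n / c * (-(1 - m / u ^ 2) * |k u|) := by
      intro u hu
      have hu0 : 0 < u := ha0.trans hu.1
      rw [rpow_half hu0]
      have hun : u ≤ n := hu.2.trans hvn
      have s0 : 0 < √u := sqrt_pos.2 hu0
      have ss : √u ^ 2 = u := sq_sqrt hu0.le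
      have s1 : √u ≤ √n := sqrt_le_sqrt hun
      have : 1 / √u ≤ 2 * √n / c * (-(1 - m / u ^ 2)) := by
        have e : 2 * √n / c * (-(1 - m / u ^ 2)) = 2 * √n * (m - u ^ 2) / (c * u ^ 2) := by field_simp; ring
        rw [e, div_le_div_iff₀ s0 (by positivity), one_mul]
        have h1 : c / 2 * n ≤ m - u ^ 2 := by
          rw [← hn2]
          have : c / 2 ≤ n - u := by have := hu.2; rw [hv] at this; linarith
          have e2 : n ^ 2 - u ^ 2 = (n - u) * (n + u) := by ring
          rw [e2]; gcongr; linarith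
        calc c * u ^ 2 = c * (√u * √u * u) := by rw [← sq, ss]; ring
          _ ≤ c * (√n * √u * n) := by gcongr
          _ = 2 * √n * (c / 2 * n) * √u := by ring
          _ ≤ _ := by gcongr
      calc |k u| * (1 / √u) ≤ |k u| * (2 * √n / c * (-(1 - m / u ^ 2))) := by gcongr
        _ = _ := by ring
    calc _ ≤ ∫⁻ u in Ioc a v, ofReal (2 * √n / c * (-(1 - m / u ^ 2) * |k u|)) :=
          setLIntegral_mono' measurableSet_Ioc fun u hu => ofReal_le_ofReal (pw u hu)
      _ = ofReal (∫ u in Ioc a v, 2 * √n / c * (-(1 - m / u ^ 2) * |k u|)) := by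
          rw [ofReal_integral_eq_lintegral_ofReal (hint.const_mul _)]
          refine (ae_restrict_iff' measurableSet_Ioc).2 (Eventually.of_forall fun u hu => ?_)
          have := pw u hu
          have hu0 : 0 < u := ha0.trans hu.1
          exact le_trans (by positivity) this
      _ ≤ _ := by
          apply ofReal_le_ofReal
          rw [integral_const_mul]
          calc _ ≤ 2 * √n / c * (70 * D / √c) := by gcongr; exact hF.trans t1
            _ ≤ 2 * √c ^ 3 / c * (70 * D / √c) := by gcongr
            _ = 2 * √c ^ 3 / √c ^ 2 * (70 * D / √c) := by rw [hcs]
            _ = 140 * D := by field_simp; ring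
  · have : ∀ u ∈ Icc v U, |k u| * u ^ (-(1/2):ℝ) ≤ (42 + 70 * D ^ 2) * √c * (2 / √n) := by
      intro u hu
      have hu0 : 0 < u := hv0.trans_le hu.1
      have k1 : |k u| ≤ (42 + 70 * D ^ 2) * √c := by
        rcases le_total n u with h | h
        · exact t2 u ⟨h, hu.2⟩
        · exact (F u ⟨hu0, h⟩).1.trans (t2 n ⟨le_rfl, hnU⟩)
      rw [rpow_half hu0]
      refine mul_le_mul k1 ?_ (by positivity) (by positivity)
      have : √n / 2 ≤ √u := by
        apply le_sqrt_of_sq_le; rw [div_pow, hns]; linarith [hu.1]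
      rw [div_le_div_iff₀ (by positivity) hn0]; linarith
    refine (lint_const_Icc (by linarith) (by positivity) this).trans (ofReal_le_ofReal ?_)
    have e : U - v = D * c + c / 2 := by rw [hu, hv]; ring
    rw [e]
    calc _ ≤ (42 + 70 * D ^ 2) * √c * (2 / √n) * ((D + 1) * c) := by gcongr; linarith
      _ = (42 + 70 * D ^ 2) * √c * (2 / √n) * ((D + 1) * √c ^ 2) := by rw [hcs]
      _ = (42 + 70 * D ^ 2) * (D + 1) * (2 / √n) * √c ^ 3 := by ring
      _ ≤ (42 + 70 * D ^ 2) * (D + 1) * (2 / √n) * (1.5 * √n) := by gcongr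
      _ = _ := by field_simp; ring

/-- B3 -/
lemma ker_B3 {B γ A : ℝ} (hA : 2 ≤ A) : ∃ C : ℝ, 0 ≤ C ∧ ∀ m k k', Ker B γ m k k' →
    ∫⁻ u in Ioc 0 (ug A m), ofReal (|k u| * u ^ (-(1/2):ℝ)) ≤ ofReal C := by
  set D := A ^ 2 + 2 with hD
  have hD1 : 1 ≤ D := by nlinarith
  refine ⟨140 * D + 3 * (42 + 70 * D ^ 2) * (A ^ 2 + 3) + |B| * (1 + 2 * D) ^ γ * (2 * (1 + 2 * D)), by positivity, ?_⟩
  intro m k k' K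
  obtain ⟨hc1, hc3⟩ := cc_spec (√(max m 0)) (sqrt_nonneg _)
  have hu : ug A m = √(max m 0) + D * (1 + √(max m 0)) ^ ((1:ℝ)/3) := rfl
  have hn0 : 0 ≤ √(max m 0) := sqrt_nonneg _
  have hns : √(max m 0) ^ 2 = max m 0 := sq_sqrt (le_max_right _ _)
  set n := √(max m 0)
  set c := (1 + n) ^ ((1:ℝ)/3)
  rcases le_or_gt 1 n with h | h
  · have hm : n ^ 2 = m := by
      rw [hns]; apply max_eq_left
      by_contra hc
      rw [max_eq_right (by linarith)] at hns
      nlinarith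
    refine (b3_big K hA h hm hc1 hc3 hu).trans ?_
    rw [← ofReal_add (by positivity) (by positivity)]
    apply ofReal_le_ofReal
    have : 0 ≤ |B| * (1 + 2 * D) ^ γ * (2 * (1 + 2 * D)) := by positivity
    linarith
  · have hc2 : c ≤ 2 := by
      by_contra hc
      push Not at hc
      have : (2:ℝ) ^ 3 < c ^ 3 := by gcongr
      linarith
    have hU : ug A m ≤ 1 + 2 * D := by rw [hu]; nlinarith
    have hγ := K.hγ
    have hint : IntegrableOn (fun u : ℝ => |B| * (1 + 2 * D) ^ γ * u ^ (-(1/2):ℝ)) (Ioc 0 (1 + 2 * D)) := by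
      apply Integrable.const_mul
      have := intervalIntegral.intervalIntegrable_rpow' (a := 0) (b := 1 + 2 * D) (r := -(1/2)) (by norm_num)
      rwa [intervalIntegrable_iff_integrableOn_Ioc_of_le (by linarith)] at this
    calc _ ≤ ∫⁻ u in Ioc 0 (1 + 2 * D), ofReal (|k u| * u ^ (-(1/2):ℝ)) :=
          lintegral_mono_set (Set.Ioc_subset_Ioc_right hU)
      _ ≤ ∫⁻ u in Ioc 0 (1 + 2 * D), ofReal (|B| * (1 + 2 * D) ^ γ * u ^ (-(1/2):ℝ)) := by
          refine setLIntegral_mono' measurableSet_Ioc fun u hu => ofReal_le_ofReal ?_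
          have hu0 := hu.1
          have := K.hB u hu0
          gcongr
          refine this.trans ?_
          have : B ≤ |B| := le_abs_self _
          have := hu.2
          gcongr
      _ = ofReal (∫ u in Ioc 0 (1 + 2 * D), |B| * (1 + 2 * D) ^ γ * u ^ (-(1/2):ℝ)) := by
          rw [ofReal_integral_eq_lintegral_ofReal hint]
          refine (ae_restrict_iff' measurableSet_Ioc).2 (Eventually.of_forall fun u hu => ?_)
          have := hu.1
          simp only [Pi.zero_apply]
          positivity
      _ ≤ _ := by
          apply ofReal_le_ofReal
          rw [integral_const_mul, ← intervalIntegral.integral_of_le (by linarith), integral_rpow (by left; norm_num)]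
          have e : (1 + 2 * D) ^ (-(1/2) + 1:ℝ) = √(1 + 2 * D) := by rw [sqrt_eq_rpow]; norm_num
          have e0 : (0:ℝ) ^ (-(1/2) + 1:ℝ) = 0 := by rw [zero_rpow]; norm_num
          rw [e, e0]
          have : √(1 + 2 * D) ≤ 1 + 2 * D := by
            rw [sqrt_le_left (by linarith)]; nlinarith
          have h2 : (√(1 + 2 * D) - 0) / (-(1/2) + 1:ℝ) ≤ 2 * (1 + 2 * D) := by
            rw [div_le_iff₀ (by norm_num)]; linarith
          have : |B| * (1 + 2 * D) ^ γ * ((√(1 + 2 * D) - 0) / (-(1/2) + 1:ℝ)) ≤ |B| * (1 + 2 * D) ^ γ * (2 * (1 + 2 * D)) := by gcongr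
          have : 0 ≤ 140 * D + 3 * (42 + 70 * D ^ 2) * (A ^ 2 + 3) := by positivity
          linarith
end
end

section
lemma lint_Ioi_scale {F : ℝ → ℝ≥0∞} (hF : Measurable F) {s : ℝ} (hs : 0 < s) :
    ∫⁻ r in Ioi 0, F (r * s) = ofReal s⁻¹ * ∫⁻ u in Ioi 0, F u := by
  have h1 : (fun r => (Ioi (0:ℝ)).indicator F (r * s)) = (Ioi (0:ℝ)).indicator (fun r => F (r * s)) := by
    ext r
    simp only [indicator_apply, mem_Ioi, mul_pos_iff_of_pos_right hs]
  rw [← lintegral_indicator measurableSet_Ioi, ← h1, ← lintegral_indicator measurableSet_Ioi,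
    ← lintegral_map (f := (Ioi (0:ℝ)).indicator F) (g := fun r => r * s) (hF.indicator measurableSet_Ioi) (by fun_prop),
    Real.map_volume_mul_right hs.ne', lintegral_smul_measure, abs_of_pos (by positivity)]
  rfl

lemma rp_cancel {x p : ℝ} (hx : 0 < x) : x ^ (-p) * x ^ p = 1 := by
  rw [← rpow_add hx]; simp

lemma schur_mul {h : ℝ → ℝ} (hh : Measurable h) (h0 : ∀ u, 0 ≤ h u) {H : ℝ≥0∞}
    (hH : ∫⁻ u in Ioi 0, ofReal (h u * u ^ (-(1/2):ℝ)) ≤ H) {f : ℝ → ℝ≥0∞} (hf : Measurable f) :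
    ∫⁻ s in Ioi 0, (∫⁻ r in Ioi 0, ofReal (h (r * s)) * f r) ^ 2 ≤
      H ^ 2 * ∫⁻ r in Ioi 0, f r ^ 2 := by
  have sc : ∀ s : ℝ, 0 < s → ∫⁻ r in Ioi 0, ofReal (h (r * s) * r ^ (-(1/2):ℝ)) ≤
      ofReal (s ^ (-(1/2):ℝ)) * H := by
    intro s hs
    have e : ∀ r ∈ Ioi (0:ℝ), ofReal (h (r * s) * r ^ (-(1/2):ℝ)) =
        ofReal (s ^ (1/2:ℝ)) * ofReal (h (r * s) * (r * s) ^ (-(1/2):ℝ)) := by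
      intro r hr
      rw [← ofReal_mul (by positivity), mul_rpow (le_of_lt hr) hs.le]
      congr 1
      have := rp_cancel (p := 1/2) hs
      calc _ = h (r * s) * r ^ (-(1/2):ℝ) * (s ^ (-(1/2):ℝ) * s ^ (1/2:ℝ)) := by rw [this, mul_one]
        _ = _ := by ring
    rw [setLIntegral_congr_fun measurableSet_Ioi e, lintegral_const_mul _ (by fun_prop),
      lint_Ioi_scale (F := fun u => ofReal (h u * u ^ (-(1/2):ℝ))) (by fun_prop) hs, ← mul_assoc,
      ← ofReal_mul (by positivity)]
    have : s ^ (1/2:ℝ) * s⁻¹ = s ^ (-(1/2):ℝ) := by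
      rw [← rpow_neg_one, ← rpow_add hs]; norm_num
    rw [this]; gcongr
  have cs : ∀ s ∈ Ioi (0:ℝ), (∫⁻ r in Ioi 0, ofReal (h (r * s)) * f r) ^ 2 ≤
      (ofReal (s ^ (-(1/2):ℝ)) * H) * ∫⁻ r in Ioi 0, ofReal (h (r * s) * r ^ (1/2:ℝ)) * f r ^ 2 := by
    intro s hs
    have := cs_lint (volume.restrict (Ioi (0:ℝ))) (f := fun r => ofReal (√(h (r * s)) * r ^ (-(1/4):ℝ)))
      (g := fun r => ofReal (√(h (r * s)) * r ^ ((1/4):ℝ)) * f r) (by fun_prop) (by fun_prop)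
    have e1 : ∀ r ∈ Ioi (0:ℝ), ofReal (√(h (r * s)) * r ^ (-(1/4):ℝ)) * (ofReal (√(h (r * s)) * r ^ ((1/4):ℝ)) * f r) = ofReal (h (r * s)) * f r := by
      intro r hr
      have hr0 : (0:ℝ) < r := hr
      rw [← mul_assoc, ← ofReal_mul (by positivity)]
      congr 2
      have := rp_cancel (p := 1/4) hr0
      have h2 := mul_self_sqrt (h0 (r * s))
      calc _ = (√(h (r * s)) * √(h (r * s))) * (r ^ (-(1/4):ℝ) * r ^ ((1/4):ℝ)) := by ring
        _ = _ := by rw [this, h2, mul_one]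
    have e2 : ∀ r ∈ Ioi (0:ℝ), ofReal (√(h (r * s)) * r ^ (-(1/4):ℝ)) ^ 2 = ofReal (h (r * s) * r ^ (-(1/2):ℝ)) := by
      intro r hr
      have hr0 : (0:ℝ) < r := hr
      rw [← ofReal_pow (by positivity), mul_pow, sq_sqrt (h0 _), ← rpow_natCast, ← rpow_mul hr0.le]
      norm_num
    have e3 : ∀ r ∈ Ioi (0:ℝ), (ofReal (√(h (r * s)) * r ^ ((1/4):ℝ)) * f r) ^ 2 = ofReal (h (r * s) * r ^ (1/2:ℝ)) * f r ^ 2 := by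
      intro r hr
      have hr0 : (0:ℝ) < r := hr
      rw [mul_pow, ← ofReal_pow (by positivity), mul_pow, sq_sqrt (h0 _), ← rpow_natCast (r ^ _), ← rpow_mul hr0.le]
      norm_num
    rw [setLIntegral_congr_fun measurableSet_Ioi e1, setLIntegral_congr_fun measurableSet_Ioi e2,
      setLIntegral_congr_fun measurableSet_Ioi e3] at this
    refine this.trans ?_
    gcongr
    exact sc s hs
  calc _ ≤ ∫⁻ s in Ioi 0, (ofReal (s ^ (-(1/2):ℝ)) * H) * ∫⁻ r in Ioi 0, ofReal (h (r * s) * r ^ (1/2:ℝ)) * f r ^ 2 :=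
        setLIntegral_mono' measurableSet_Ioi cs
    _ = H * ∫⁻ s in Ioi 0, ∫⁻ r in Ioi 0, ofReal (s ^ (-(1/2):ℝ)) * (ofReal (h (r * s) * r ^ (1/2:ℝ)) * f r ^ 2) := by
        rw [← lintegral_const_mul]
        · refine lintegral_congr fun s => ?_
          rw [lintegral_const_mul _ (by fun_prop)]; ring
        · apply Measurable.lintegral_prod_right' (f := fun p : ℝ × ℝ => ofReal (p.1 ^ (-(1/2):ℝ)) * (ofReal (h (p.2 * p.1) * p.2 ^ (1/2:ℝ)) * f p.2 ^ 2))
          fun_prop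
    _ = H * ∫⁻ r in Ioi 0, ∫⁻ s in Ioi 0, ofReal (s ^ (-(1/2):ℝ)) * (ofReal (h (r * s) * r ^ (1/2:ℝ)) * f r ^ 2) := by
        rw [lintegral_lintegral_swap]
        apply Measurable.aemeasurable
        simp only [Function.uncurry_def]
        fun_prop
    _ ≤ H * ∫⁻ r in Ioi 0, H * f r ^ 2 := by
        gcongr H * ?_
        refine setLIntegral_mono' measurableSet_Ioi fun r hr => ?_
        have hr0 : (0:ℝ) < r := hr
        have e : ∀ s ∈ Ioi (0:ℝ), ofReal (s ^ (-(1/2):ℝ)) * (ofReal (h (r * s) * r ^ (1/2:ℝ)) * f r ^ 2) =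
            (ofReal (r ^ (1/2:ℝ)) * f r ^ 2) * ofReal (h (s * r) * s ^ (-(1/2):ℝ)) := by
          intro s hs
          have hs0 : (0:ℝ) < s := hs
          rw [ofReal_mul (h0 _), ofReal_mul (h0 _), mul_comm r s]; ring
        rw [setLIntegral_congr_fun measurableSet_Ioi e, lintegral_const_mul _ (by fun_prop)]
        calc _ ≤ (ofReal (r ^ (1/2:ℝ)) * f r ^ 2) * (ofReal (r ^ (-(1/2):ℝ)) * H) := by gcongr; exact sc r hr0
          _ = (ofReal (r ^ (-(1/2):ℝ)) * ofReal (r ^ (1/2:ℝ))) * (H * f r ^ 2) := by ring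
          _ = _ := by rw [← ofReal_mul (by positivity), rp_cancel hr0]; simp
    _ = _ := by rw [lintegral_const_mul _ (by fun_prop)]; ring

lemma layer {f w : ℝ → ℝ≥0∞} (hf : Measurable f) (hw : Measurable w) {E : Set ℝ} :
    ∫⁻ x in E, f x * ∫⁻ y in Ioi x, w y = ∫⁻ y, w y * ∫⁻ x in E ∩ Iio y, f x := by
  have m : Measurable (fun p : ℝ × ℝ => {p : ℝ × ℝ | p.1 < p.2}.indicator (fun p => f p.1 * w p.2) p) := by
    apply Measurable.indicator (by fun_prop)
    exact measurableSet_lt measurable_fst measurable_snd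
  calc _ = ∫⁻ x in E, ∫⁻ y, {p : ℝ × ℝ | p.1 < p.2}.indicator (fun p => f p.1 * w p.2) (x, y) := by
        refine lintegral_congr fun x => ?_
        rw [← lintegral_indicator measurableSet_Ioi, ← lintegral_const_mul _ (hw.indicator measurableSet_Ioi)]
        refine lintegral_congr fun y => ?_
        simp only [indicator_apply, mem_Ioi, Set.mem_setOf_eq]
        split_ifs <;> simp
    _ = ∫⁻ y, ∫⁻ x in E, {p : ℝ × ℝ | p.1 < p.2}.indicator (fun p => f p.1 * w p.2) (x, y) := by
        rw [lintegral_lintegral_swap]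
        exact m.aemeasurable
    _ = _ := by
        refine lintegral_congr fun y => ?_
        rw [Set.inter_comm, ← restrict_restrict measurableSet_Iio, ← lintegral_indicator measurableSet_Iio,
          ← lintegral_const_mul _ (hf.indicator measurableSet_Iio)]
        refine lintegral_congr fun x => ?_
        simp only [indicator_apply, mem_Iio, Set.mem_setOf_eq]
        split_ifs <;> simp [mul_comm]

lemma rp_shift {c a p : ℝ} (hp : p < -1) (hc : a < c) :
    ∫⁻ y in Ioi c, ofReal ((y - a) ^ p) = ofReal (-(c - a) ^ (p + 1) / (p + 1)) := by
  have h := (measurePreserving_sub_right volume a).setLIntegral_comp_preimage_emb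
    (MeasurableEquiv.subRight a).measurableEmbedding (fun y => ofReal (y ^ p)) (Ioi (c - a))
  have e : (fun x => x - a) ⁻¹' Ioi (c - a) = Ioi c := by ext; simp
  rw [e] at h
  rw [h, ← integral_Ioi_rpow_of_lt hp (by linarith), ofReal_integral_eq_lintegral_ofReal]
  · exact integrableOn_Ioi_rpow_of_lt hp (by linarith)
  · refine (ae_restrict_iff' measurableSet_Ioi).2 (Eventually.of_forall fun y hy => ?_)
    have : 0 < y := by have : c - a < y := hy; linarith
    simp only [Pi.zero_apply]; positivity

lemma amgm {x y : ℝ≥0∞} {t : ℝ} (ht : 0 < t) : x * y ≤ x ^ 2 * ofReal t + y ^ 2 * ofReal t⁻¹ := by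
  have htt : ofReal t * ofReal t⁻¹ = 1 := by
    rw [← ofReal_mul ht.le, mul_inv_cancel₀ ht.ne']; simp
  rcases le_total (x * ofReal t) y with h | h
  · calc x * y = (x * ofReal t) * ofReal t⁻¹ * y := by rw [mul_assoc x, htt, mul_one]
      _ ≤ y * ofReal t⁻¹ * y := by gcongr
      _ = y ^ 2 * ofReal t⁻¹ := by ring
      _ ≤ _ := le_add_self
  · calc x * y ≤ x * (x * ofReal t) := by gcongr
      _ = x ^ 2 * ofReal t := by ring
      _ ≤ _ := le_self_add

lemma hilb_int {c : ℝ} (hc : 0 < c) : ∫⁻ e in Ioi 0, ofReal (1 / (e + c) * √(c / e)) ≤ 4 := by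
  have hs : Ioi (0:ℝ) ⊆ Ioc 0 c ∪ Ioi c := fun x hx => by
    rcases le_or_gt x c with h | h
    · exact Or.inl ⟨hx, h⟩
    · exact Or.inr h
  have sc : 0 < √c := sqrt_pos.2 hc
  have scc : √c * √c = c := mul_self_sqrt hc.le
  have e4 : (4:ℝ≥0∞) = ofReal 2 + ofReal 2 := by
    rw [← ofReal_add (by norm_num) (by norm_num)]; norm_num
  rw [e4]
  refine (lintegral_mono_set hs).trans ((lintegral_union_le _ _ _).trans (add_le_add ?_ ?_))
  · have hint : IntegrableOn (fun u : ℝ => (√c)⁻¹ * u ^ (-(1/2):ℝ)) (Ioc 0 c) := by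
      apply Integrable.const_mul
      have := intervalIntegral.intervalIntegrable_rpow' (a := 0) (b := c) (r := -(1/2)) (by norm_num)
      rwa [intervalIntegrable_iff_integrableOn_Ioc_of_le hc.le] at this
    calc _ ≤ ∫⁻ u in Ioc 0 c, ofReal ((√c)⁻¹ * u ^ (-(1/2):ℝ)) := by
          refine setLIntegral_mono' measurableSet_Ioc fun u hu => ofReal_le_ofReal ?_
          have hu0 := hu.1
          rw [rpow_half hu0, sqrt_div hc.le]
          calc _ ≤ 1 / c * (√c / √u) := by gcongr; linarith
            _ = 1 / (√c * √c) * (√c / √u) := by rw [scc]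
            _ = _ := by field_simp
      _ = ofReal (∫ u in Ioc 0 c, (√c)⁻¹ * u ^ (-(1/2):ℝ)) := by
          rw [ofReal_integral_eq_lintegral_ofReal hint]
          refine (ae_restrict_iff' measurableSet_Ioc).2 (Eventually.of_forall fun u hu => ?_)
          have := hu.1
          simp only [Pi.zero_apply]; positivity
      _ ≤ _ := by
          apply ofReal_le_ofReal
          rw [integral_const_mul, ← intervalIntegral.integral_of_le hc.le, integral_rpow (by left; norm_num)]
          have e : c ^ (-(1/2) + 1:ℝ) = √c := by rw [sqrt_eq_rpow]; norm_num
          have e0 : (0:ℝ) ^ (-(1/2) + 1:ℝ) = 0 := by rw [zero_rpow]; norm_num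
          rw [e, e0]; apply le_of_eq; field_simp; norm_num
  · calc _ ≤ ∫⁻ u in Ioi c, ofReal (√c) * ofReal ((u - 0) ^ (-(3/2):ℝ)) := by
          refine setLIntegral_mono' measurableSet_Ioi fun u hu => ?_
          have hu0 : 0 < u := hc.trans hu
          rw [← ofReal_mul (by positivity)]
          apply ofReal_le_ofReal
          have : (u - 0) ^ (-(3/2):ℝ) = u⁻¹ * u ^ (-(1/2):ℝ) := by
            rw [sub_zero, ← rpow_neg_one, ← rpow_add hu0]; norm_num
          rw [this, rpow_half hu0, sqrt_div hc.le]
          calc _ ≤ 1 / u * (√c / √u) := by gcongr; linarith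
            _ = _ := by field_simp
      _ = ofReal (√c) * ofReal (-(c - 0) ^ (-(3/2) + 1:ℝ) / (-(3/2) + 1)) := by
          rw [lintegral_const_mul _ (by fun_prop), rp_shift (by norm_num) hc]
      _ ≤ _ := by
          rw [← ofReal_mul (by positivity)]
          apply ofReal_le_ofReal
          have : (c - 0) ^ (-(3/2) + 1:ℝ) = 1 / √c := by rw [sub_zero, ← rpow_half hc]; norm_num
          rw [this]; apply le_of_eq; field_simp; norm_num
end

section
/-- far part -/
lemma far_bd {f : ℝ → ℝ≥0∞} (hf : Measurable f) {r₁ ℓ z : ℝ} (hℓ : 0 < ℓ) (hz : z ∈ Ioo (r₁ - ℓ) r₁) :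
    ∫⁻ r' in Ioi (r₁ + ℓ), f r' * ofReal (ℓ ^ (1/4:ℝ) * (r' - r₁) ^ (-(5/4):ℝ)) ≤ 40 * HLM f z := by
  have e : ∀ r' ∈ Ioi (r₁ + ℓ), f r' * ofReal (ℓ ^ (1/4:ℝ) * (r' - r₁) ^ (-(5/4):ℝ)) =
      ofReal (5/4 * ℓ ^ (1/4:ℝ)) * (f r' * ∫⁻ y in Ioi r', ofReal ((y - r₁) ^ (-(9/4):ℝ))) := by
    intro r' hr'
    have h0 : r₁ < r' := by have : r₁ + ℓ < r' := hr'; linarith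
    rw [rp_shift (by norm_num) h0, mul_left_comm, ← ofReal_mul (by positivity)]
    congr 2
    have : (-(9/4) + 1 : ℝ) = -(5/4) := by norm_num
    rw [this]; ring
  rw [setLIntegral_congr_fun measurableSet_Ioi e, lintegral_const_mul', layer hf (by fun_prop)]
  swap
  · exact ofReal_ne_top
  have pw : ∀ y, ofReal ((y - r₁) ^ (-(9/4):ℝ)) * ∫⁻ x in Ioi (r₁ + ℓ) ∩ Iio y, f x ≤
      (Ioi (r₁ + ℓ)).indicator (fun y => 8 * HLM f z * ofReal ((y - r₁) ^ (-(5/4):ℝ))) y := by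
    intro y
    rcases le_or_gt y (r₁ + ℓ) with h | h
    · have : Ioi (r₁ + ℓ) ∩ Iio y = ∅ := by
        ext x; simp only [Set.mem_inter_iff, mem_Ioi, mem_Iio, Set.mem_empty_iff_false, iff_false]
        rintro ⟨h1, h2⟩; linarith
      rw [this]; simp
    · rw [indicator_of_mem (show y ∈ Ioi (r₁ + ℓ) from h), Set.Ioi_inter_Iio]
      have h1 := HLM_ge f z (r₁ + ℓ) y (2 * (y - r₁)) (by linarith) (by linarith [hz.2]) (by linarith [hz.1])
      have e2 : (y - r₁) ^ (-(9/4):ℝ) * (4 * (2 * (y - r₁))) = 8 * (y - r₁) ^ (-(5/4):ℝ) := by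
        have h0 : 0 < y - r₁ := by linarith
        have : (y - r₁) ^ (-(5/4):ℝ) = (y - r₁) ^ (-(9/4):ℝ) * (y - r₁) := by
          rw [← rpow_add_one h0.ne']; norm_num
        rw [this]; ring
      have h0 : 0 < y - r₁ := by linarith
      calc _ ≤ ofReal ((y - r₁) ^ (-(9/4):ℝ)) * (ofReal (4 * (2 * (y - r₁))) * HLM f z) := by gcongr
        _ = _ := by
          rw [← mul_assoc, ← ofReal_mul (by positivity), e2, ofReal_mul (by norm_num)]
          simp; ring
  refine (mul_le_mul_right (lintegral_mono pw) _).trans ?_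
  rw [lintegral_indicator measurableSet_Ioi, lintegral_const_mul _ (by fun_prop), rp_shift (by norm_num) (by linarith)]
  have e3 : ofReal (5/4 * ℓ ^ (1/4:ℝ)) * ofReal (-(r₁ + ℓ - r₁) ^ (-(5/4) + 1:ℝ) / (-(5/4) + 1)) = 5 := by
    rw [← ofReal_mul (by positivity)]
    have : (-(5/4) + 1 : ℝ) = -(1/4) := by norm_num
    rw [this, add_sub_cancel_left]
    have := rp_cancel (p := 1/4) hℓ
    have e : 5/4 * ℓ ^ (1/4:ℝ) * (-ℓ ^ (-(1/4):ℝ) / -(1/4)) = 5 * (ℓ ^ (-(1/4):ℝ) * ℓ ^ (1/4:ℝ)) := by ring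
    rw [e, this]; simp
  calc _ = (ofReal (5/4 * ℓ ^ (1/4:ℝ)) * ofReal (-(r₁ + ℓ - r₁) ^ (-(5/4) + 1:ℝ) / (-(5/4) + 1))) * (8 * HLM f z) := by ring
    _ = 40 * HLM f z := by rw [e3, ← mul_assoc]; norm_num
    _ ≤ _ := le_rfl

lemma near_bd {f : ℝ → ℝ≥0∞} (hf : Measurable f) {r₁ ℓ r z : ℝ} (hℓ : 0 < ℓ) (hz : z ∈ Ioo (r₁ - ℓ) r₁)
    (hr : r < r₁) :
    ∫⁻ r' in Ioc r₁ (r₁ + ℓ), f r' * ofReal (1 / (r' - r)) ≤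
      8 * (∫⁻ y in Ioo (r₁ - ℓ) r₁, HLM f y * ofReal (1 / ((r₁ - y) + (r₁ - r)))) + 8 * HLM f z := by
  have e : ∀ r' ∈ Ioc r₁ (r₁ + ℓ), f r' * ofReal (1 / (r' - r)) =
      f r' * ∫⁻ y in Ioi r', ofReal ((y - r) ^ (-2:ℝ)) := by
    intro r' hr'
    rw [rp_shift (by norm_num) (hr.trans hr'.1)]
    congr 2
    have : (-2 + 1 : ℝ) = -1 := by norm_num
    rw [this, rpow_neg_one]; ring
  rw [setLIntegral_congr_fun measurableSet_Ioc e, layer hf (by fun_prop)]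
  have r2 : ∀ y, (y - r) ^ (-2:ℝ) = 1 / (y - r) ^ 2 := fun y => by
    have := Real.rpow_intCast (y - r) (-2)
    push_cast at this
    rw [this, zpow_neg, one_div]; norm_cast
  set H := HLM f z
  have pw : ∀ y, ofReal ((y - r) ^ (-2:ℝ)) * ∫⁻ x in Ioc r₁ (r₁ + ℓ) ∩ Iio y, f x ≤
      (Ioo r₁ (r₁ + ℓ)).indicator (fun y => 8 * (HLM f (2 * r₁ - y) * ofReal (1 / (y - r)))) y +
      (Ici (r₁ + ℓ)).indicator (fun y => ofReal (8 * ℓ) * H * ofReal ((y - r) ^ (-2:ℝ))) y := by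
    intro y
    rcases le_or_gt y r₁ with h | h
    · have : Ioc r₁ (r₁ + ℓ) ∩ Iio y = ∅ := by
        ext x; simp only [Set.mem_inter_iff, Set.mem_Ioc, mem_Iio, Set.mem_empty_iff_false, iff_false]
        rintro ⟨⟨h1, h2⟩, h3⟩; linarith
      rw [this]; simp
    rcases lt_or_ge y (r₁ + ℓ) with h' | h'
    · rw [indicator_of_mem (show y ∈ Ioo r₁ (r₁ + ℓ) from ⟨h, h'⟩)]
      refine le_trans ?_ le_self_add
      have hs : Ioc r₁ (r₁ + ℓ) ∩ Iio y ⊆ Ioo r₁ y := fun x hx => ⟨hx.1.1, hx.2⟩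
      have h1 := HLM_ge f (2 * r₁ - y) r₁ y (2 * (y - r₁)) (by linarith) (by linarith) (by linarith)
      calc _ ≤ ofReal ((y - r) ^ (-2:ℝ)) * (ofReal (4 * (2 * (y - r₁))) * HLM f (2 * r₁ - y)) := by
            gcongr; exact (lintegral_mono_set hs).trans h1
        _ = ofReal (8 * ((y - r₁) / (y - r) ^ 2)) * HLM f (2 * r₁ - y) := by
            rw [← mul_assoc, ← ofReal_mul (by rw [r2]; positivity), r2]; congr 2; ring
        _ ≤ ofReal (8 * (1 / (y - r))) * HLM f (2 * r₁ - y) := by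
            have h0 : 0 < y - r := by linarith
            refine mul_le_mul' (ofReal_le_ofReal ?_) le_rfl
            have : (y - r₁) / (y - r) ^ 2 ≤ 1 / (y - r) := by
              rw [div_le_div_iff₀ (by positivity) h0, one_mul, pow_two]
              exact mul_le_mul_of_nonneg_right (by linarith) h0.le
            linarith
        _ = _ := by rw [ofReal_mul (by norm_num)]; simp; ring
    · rw [indicator_of_mem (show y ∈ Ici (r₁ + ℓ) from h')]
      refine le_trans ?_ le_add_self
      have hs : Ioc r₁ (r₁ + ℓ) ∩ Iio y ⊆ Ioc r₁ (r₁ + ℓ) := Set.inter_subset_left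
      have h1 := HLM_ge f z r₁ (r₁ + ℓ) (2 * ℓ) (by linarith) (by linarith [hz.2]) (by linarith [hz.1])
      calc _ ≤ ofReal ((y - r) ^ (-2:ℝ)) * (ofReal (4 * (2 * ℓ)) * H) := by
            gcongr; refine (lintegral_mono_set hs).trans ?_
            rwa [← Measure.restrict_congr_set (Ioo_ae_eq_Ioc (μ := volume) (a := r₁) (b := r₁ + ℓ))]
        _ = _ := by
            have : 4 * (2 * ℓ) = 8 * ℓ := by ring
            rw [this]; ring
  have hHm := HLM_meas hf
  refine (lintegral_mono pw).trans ?_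
  rw [lintegral_add_left (Measurable.indicator (by fun_prop) measurableSet_Ioo), lintegral_indicator measurableSet_Ioo,
    lintegral_indicator measurableSet_Ici, lintegral_const_mul _ (by fun_prop), lintegral_const_mul _ (by fun_prop)]
  gcongr 8 * ?_ + ?_
  · have h := (Measure.measurePreserving_sub_left volume (2 * r₁)).setLIntegral_comp_preimage_emb
      (MeasurableEquiv.subLeft (2 * r₁)).measurableEmbedding
      (fun y => HLM f y * ofReal (1 / ((r₁ - y) + (r₁ - r)))) (Ioo (r₁ - ℓ) r₁)
    have e : (fun x => 2 * r₁ - x) ⁻¹' Ioo (r₁ - ℓ) r₁ = Ioo r₁ (r₁ + ℓ) := by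
      ext x; simp only [Set.mem_preimage, Set.mem_Ioo]; constructor <;> rintro ⟨h1, h2⟩ <;> constructor <;> linarith
    rw [e] at h
    rw [← h]
    apply le_of_eq
    refine lintegral_congr fun y => ?_
    congr 3; ring
  · rw [← Measure.restrict_congr_set (Ioi_ae_eq_Ici (μ := volume) (a := r₁ + ℓ)), rp_shift (by norm_num) (by linarith)]
    have : (-2 + 1 : ℝ) = -1 := by norm_num
    rw [this, rpow_neg_one]
    calc _ = (ofReal (8 * ℓ) * ofReal (-(r₁ + ℓ - r)⁻¹ / -1)) * H := by ring
      _ ≤ 8 * H := by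
        gcongr
        rw [← ofReal_mul (by positivity)]
        have : 8 * ℓ * (-(r₁ + ℓ - r)⁻¹ / -1) ≤ 8 := by
          rw [neg_div_neg_eq, div_one, ← div_eq_mul_inv, div_le_iff₀ (by linarith)]; linarith
        calc _ ≤ ofReal 8 := ofReal_le_ofReal this
          _ = 8 := by simp
end

section
def crossT (r₁ r z : ℝ) : ℝ≥0∞ := ofReal (1 / ((r₁ - z) + (r₁ - r)) * √((r₁ - r) / (r₁ - z)))

lemma crossT_int {r₀ r₁ r : ℝ} (hr : r < r₁) : ∫⁻ z in Ioo r₀ r₁, crossT r₁ r z ≤ 4 := by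
  have h := (Measure.measurePreserving_sub_left volume r₁).setLIntegral_comp_preimage_emb
      (MeasurableEquiv.subLeft r₁).measurableEmbedding
      (fun e => ofReal (1 / (e + (r₁ - r)) * √((r₁ - r) / e))) (Ioi 0)
  refine le_trans ?_ (h.le.trans (hilb_int (sub_pos.2 hr)))
  refine lintegral_mono_set fun z hz => ?_
  simp only [Set.mem_preimage, mem_Ioi]; linarith [hz.2]

lemma crossT_meas (r₁ : ℝ) : Measurable (fun p : ℝ × ℝ => crossT r₁ p.1 p.2) := by
  unfold crossT; fun_prop

def crossI (f : ℝ → ℝ≥0∞) (r₁ ℓ r : ℝ) : ℝ≥0∞ :=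
  (∫⁻ r' in Ioc r₁ (r₁ + ℓ), f r' * ofReal (1 / (r' - r))) +
  ∫⁻ r' in Ioi (r₁ + ℓ), f r' * ofReal (ℓ ^ (1/4:ℝ) * (r' - r₁) ^ (-(5/4):ℝ))

lemma crossI_le {f : ℝ → ℝ≥0∞} (hf : Measurable f) {r₀ r₁ r : ℝ} (h : r₀ < r₁) (hr : r < r₁) :
    crossI f r₁ (r₁ - r₀) r ≤ ∫⁻ z in Ioo r₀ r₁, HLM f z *
      (8 * ofReal (1 / ((r₁ - z) + (r₁ - r))) + 48 * ofReal (1 / (r₁ - r₀))) := by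
  set ℓ := r₁ - r₀ with hℓ
  have hℓ0 : 0 < ℓ := by simp only [hℓ]; linarith
  have hJ : Ioo (r₁ - ℓ) r₁ = Ioo r₀ r₁ := by congr 1; simp [hℓ]
  have hHm := HLM_meas hf
  set X := ∫⁻ y in Ioo r₀ r₁, HLM f y * ofReal (1 / ((r₁ - y) + (r₁ - r))) with hX
  have pw : ∀ z ∈ Ioo r₀ r₁, crossI f r₁ ℓ r ≤ 8 * X + 48 * HLM f z := by
    intro z hz
    rw [← hJ] at hz
    have h1 := near_bd hf hℓ0 hz hr
    have h2 := far_bd hf hℓ0 hz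
    rw [hJ] at h1
    calc _ ≤ (8 * X + 8 * HLM f z) + 40 * HLM f z := add_le_add h1 h2
      _ = _ := by ring
  have vol : ofReal (1 / ℓ) * volume (Ioo r₀ r₁) = 1 := by
    rw [volume_Ioo, ← ofReal_mul (by positivity), one_div, inv_mul_cancel₀ hℓ0.ne']; simp
  calc crossI f r₁ ℓ r = ofReal (1 / ℓ) * ∫⁻ z in Ioo r₀ r₁, crossI f r₁ ℓ r := by
        rw [setLIntegral_const, mul_comm (crossI _ _ _ _), ← mul_assoc, vol, one_mul]
    _ ≤ ofReal (1 / ℓ) * ∫⁻ z in Ioo r₀ r₁, (8 * X + 48 * HLM f z) := by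
        gcongr 1
        exact setLIntegral_mono (by fun_prop) pw
    _ = 8 * X + 48 * (ofReal (1 / ℓ) * ∫⁻ z in Ioo r₀ r₁, HLM f z) := by
        rw [lintegral_add_left measurable_const, setLIntegral_const, lintegral_const_mul _ hHm, mul_add,
          mul_comm (8 * X), ← mul_assoc, vol, one_mul]; ring
    _ = _ := by
        rw [hX, ← lintegral_const_mul _ hHm, ← lintegral_const_mul _ (by fun_prop), ← lintegral_const_mul _ (by fun_prop),
          ← lintegral_add_left (by fun_prop)]
        refine lintegral_congr fun z => by ring

lemma cross_bd {f ρ : ℝ → ℝ≥0∞} (hf : Measurable f) (hρ : Measurable ρ) {r₀ r₁ : ℝ} (h : r₀ < r₁)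
    (hρ1 : ∫⁻ r in Ioo r₀ r₁, ρ r ^ 2 ≤ 2 * ofReal (r₁ - r₀))
    (hρ2 : ∀ r ∈ Ioo r₀ r₁, r₁ - r ≤ (r₁ - r₀) / 2 → ρ r ≤ 2) :
    ∫⁻ r in Ioo r₀ r₁, f r * ρ r * crossI f r₁ (r₁ - r₀) r ≤
      192 * ∫⁻ r in Ioo r₀ r₁, (f r ^ 2 + HLM f r ^ 2) := by
  have crI0 := fun r (hr : r ∈ Ioo r₀ r₁) => crossI_le hf h hr.2
  obtain ⟨ℓ, hℓ⟩ : ∃ ℓ, ℓ = r₁ - r₀ := ⟨_, rfl⟩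
  rw [← hℓ] at hρ1 hρ2 crI0 ⊢
  have hℓ0 : 0 < ℓ := by rw [hℓ]; linarith
  have hHm := HLM_meas hf
  obtain ⟨M, hM⟩ : ∃ M, M = HLM f := ⟨_, rfl⟩
  obtain ⟨a, ha⟩ : ∃ a, a = ofReal (1 / ℓ) := ⟨_, rfl⟩
  rw [← hM] at hHm crI0 ⊢
  rw [← ha] at crI0
  have vol : a * volume (Ioo r₀ r₁) = 1 := by
    rw [ha, volume_Ioo, ← hℓ, ← ofReal_mul (by positivity), one_div, inv_mul_cancel₀ hℓ0.ne']; simp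
  set ν := volume.restrict (Ioo r₀ r₁) with hν
  have mono : ∀ F G : ℝ → ℝ≥0∞, (∀ r ∈ Ioo r₀ r₁, F r ≤ G r) → ∫⁻ r, F r ∂ν ≤ ∫⁻ r, G r ∂ν :=
    fun F G hFG => setLIntegral_mono' measurableSet_Ioo hFG
  have cI : ∀ c : ℝ≥0∞, ∫⁻ z, c ∂ν = c * volume (Ioo r₀ r₁) := fun c => by rw [hν, setLIntegral_const]
  have crI : ∀ r ∈ Ioo r₀ r₁, crossI f r₁ ℓ r ≤ ∫⁻ z, M z * (8 * ofReal (1 / ((r₁ - z) + (r₁ - r))) + 48 * a) ∂ν :=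
    crI0
  have crT : ∀ r ∈ Ioo r₀ r₁, ∫⁻ z, crossT r₁ r z ∂ν ≤ 4 := fun r hr => crossT_int hr.2
  have hSF : SFinite ν := by rw [hν]; infer_instance
  clear_value ν
  have hT := crossT_meas r₁
  have hT1 : ∀ r, Measurable (fun z => crossT r₁ r z) := fun r => by unfold crossT; fun_prop
  have hT2 : ∀ r, Measurable (fun z => crossT r₁ z r) := fun r => by unfold crossT; fun_prop
  have pw : ∀ r ∈ Ioo r₀ r₁, ∀ z ∈ Ioo r₀ r₁, f r * ρ r * (M z *
      (8 * ofReal (1 / ((r₁ - z) + (r₁ - r))) + 48 * a)) ≤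
      16 * (f r ^ 2 * crossT r₁ r z) + 16 * (M z ^ 2 * crossT r₁ z r) + (64 * a * f r ^ 2 + 64 * a * ρ r ^ 2 * M z ^ 2) := by
    intro r hr z hz
    have her : 0 < r₁ - r := by linarith [hr.2]
    have hez : 0 < r₁ - z := by linarith [hz.2]
    set g := ofReal (1 / ((r₁ - z) + (r₁ - r))) with hg
    have k1 : ρ r * g ≤ 2 * g + 2 * a * ρ r := by
      rcases le_or_gt (r₁ - r) (ℓ / 2) with h' | h'
      · refine le_trans ?_ le_self_add
        gcongr; exact hρ2 r hr h'
      · refine le_trans ?_ le_add_self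
        have : g ≤ 2 * a := by
          have e : (2:ℝ≥0∞) = ofReal 2 := by simp
          rw [hg, ha, e, ← ofReal_mul (by norm_num)]
          apply ofReal_le_ofReal
          rw [mul_one_div, div_le_div_iff₀ (by positivity) hℓ0]; linarith
        rw [mul_comm]; gcongr
    have k2 : f r * M z * g ≤ f r ^ 2 * crossT r₁ r z + M z ^ 2 * crossT r₁ z r := by
      have ht : 0 < √((r₁ - r) / (r₁ - z)) := sqrt_pos.2 (by positivity)
      have := amgm (x := f r) (y := M z) ht
      calc _ ≤ _ := mul_le_mul_left this g
        _ = _ := by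
          rw [add_mul, mul_assoc, mul_assoc, hg, ← ofReal_mul ht.le, ← ofReal_mul (by positivity)]
          unfold crossT
          rw [← Real.sqrt_inv, inv_div, mul_comm (1 / _) √_, mul_comm (1 / _) √_, add_comm (r₁ - r) (r₁ - z)]
    have k3 : f r * (ρ r * M z) ≤ f r ^ 2 + ρ r ^ 2 * M z ^ 2 := by
      have := amgm (x := f r) (y := ρ r * M z) one_pos
      simpa [mul_pow] using this
    calc _ = f r * M z * (8 * (ρ r * g) + 48 * a * ρ r) := by ring
      _ ≤ f r * M z * (8 * (2 * g + 2 * a * ρ r) + 48 * a * ρ r) := by gcongr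
      _ = 16 * (f r * M z * g) + 64 * a * (f r * (ρ r * M z)) := by ring
      _ ≤ 16 * (f r ^ 2 * crossT r₁ r z + M z ^ 2 * crossT r₁ z r) + 64 * a * (f r ^ 2 + ρ r ^ 2 * M z ^ 2) := by gcongr
      _ = _ := by ring
  set F := ∫⁻ r, f r ^ 2 ∂ν with hF
  set N := ∫⁻ r, M r ^ 2 ∂ν with hN
  calc _ ≤ ∫⁻ r, ∫⁻ z, (16 * (f r ^ 2 * crossT r₁ r z) + 16 * (M z ^ 2 * crossT r₁ z r) +
        (64 * a * f r ^ 2 + 64 * a * ρ r ^ 2 * M z ^ 2)) ∂ν ∂ν := by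
        refine mono _ _ fun r hr => ?_
        have hc := crI r hr
        calc _ ≤ f r * ρ r * _ := mul_le_mul' le_rfl hc
          _ = _ := (lintegral_const_mul _ (by fun_prop)).symm
          _ ≤ _ := mono _ _ fun z hz => pw r hr z hz
    _ = (∫⁻ r, 16 * (f r ^ 2 * ∫⁻ z, crossT r₁ r z ∂ν) ∂ν) + (∫⁻ r, ∫⁻ z, 16 * (M z ^ 2 * crossT r₁ z r) ∂ν ∂ν) +
        (64 * F + (∫⁻ r, 64 * a * ρ r ^ 2 * N ∂ν)) := by
        have m1 : Measurable fun r => ∫⁻ z, crossT r₁ r z ∂ν := hT.lintegral_prod_right'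
        have m2 : Measurable (fun p : ℝ × ℝ => crossT r₁ p.2 p.1) := by unfold crossT; fun_prop
        have m3 : Measurable fun r => ∫⁻ z, 16 * (M z ^ 2 * crossT r₁ z r) ∂ν :=
          Measurable.lintegral_prod_right' (f := fun p : ℝ × ℝ => 16 * (M p.2 ^ 2 * crossT r₁ p.2 p.1)) (by fun_prop)
        have e64 : 64 * F = ∫⁻ r, 64 * f r ^ 2 ∂ν := by rw [hF, lintegral_const_mul _ (by fun_prop)]
        rw [e64, ← lintegral_add_left (by fun_prop), ← lintegral_add_left (by fun_prop), ← lintegral_add_left (by fun_prop)]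
        refine lintegral_congr fun r => ?_
        rw [lintegral_add_left (by fun_prop), lintegral_add_left (by fun_prop), lintegral_add_left (by fun_prop), cI,
          lintegral_const_mul _ (by fun_prop), lintegral_const_mul _ (by fun_prop), lintegral_const_mul _ (by fun_prop)]
        have : 64 * a * f r ^ 2 * volume (Ioo r₀ r₁) = 64 * f r ^ 2 * (a * volume (Ioo r₀ r₁)) := by ring
        rw [this, vol, mul_one, lintegral_const_mul (64 * a * ρ r ^ 2) (by fun_prop)]
    _ ≤ (64 * F) + (64 * N) + (64 * F + 128 * N) := by
        gcongr
        · calc _ ≤ ∫⁻ r, 64 * f r ^ 2 ∂ν := by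
                refine mono _ _ fun r hr => ?_
                calc _ ≤ 16 * (f r ^ 2 * 4) := by gcongr; exact crT r hr
                  _ = _ := by ring
            _ = _ := by rw [lintegral_const_mul _ (by fun_prop)]
        · rw [lintegral_lintegral_swap]
          swap
          · have m2 : Measurable (fun p : ℝ × ℝ => crossT r₁ p.2 p.1) := by unfold crossT; fun_prop
            exact Measurable.aemeasurable (f := fun p : ℝ × ℝ => 16 * (M p.2 ^ 2 * crossT r₁ p.2 p.1)) (by fun_prop)
          calc _ ≤ ∫⁻ z, 64 * M z ^ 2 ∂ν := by
                refine mono _ _ fun z hz => ?_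
                rw [lintegral_const_mul _ (by fun_prop), lintegral_const_mul _ (by fun_prop)]
                calc _ ≤ 16 * (M z ^ 2 * 4) := by gcongr; exact crT z hz
                  _ = _ := by ring
            _ = _ := by rw [lintegral_const_mul _ (by fun_prop)]
        · rw [lintegral_mul_const _ (by fun_prop), lintegral_const_mul _ (by fun_prop)]
          calc _ ≤ 64 * a * (2 * ofReal ℓ) * N := by gcongr
            _ = 128 * (a * ofReal ℓ) * N := by ring
            _ = 128 * N := by
              rw [ha, ← ofReal_mul (by positivity), one_div, inv_mul_cancel₀ hℓ0.ne']; simp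
    _ ≤ 192 * F + 192 * N := by
        have : 64 * F + 64 * N + (64 * F + 128 * N) = 128 * F + 192 * N := by ring
        rw [this]
        have h128 : (128:ℝ≥0∞) ≤ 192 := by norm_num
        exact add_le_add (mul_le_mul' h128 le_rfl) le_rfl
    _ = _ := by rw [lintegral_add_left (by fun_prop), mul_add]
end

section
def bet (lo w s : ℝ) : ℝ := 1 - 3 * ((s - lo) / w) ^ 2 + 2 * ((s - lo) / w) ^ 3
def bet1 (lo w s : ℝ) : ℝ := (-6 * ((s - lo) / w) + 6 * ((s - lo) / w) ^ 2) / w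
def bet2 (lo w s : ℝ) : ℝ := (-6 + 12 * ((s - lo) / w)) / w ^ 2

lemma bet_hd {lo w : ℝ} (s : ℝ) : HasDerivAt (bet lo w) (bet1 lo w s) s := by
  have h := (((hasDerivAt_id s).sub_const lo).div_const w)
  have H := ((h.pow 2).const_mul 3).const_sub 1 |>.add ((h.pow 3).const_mul 2)
  refine HasDerivAt.congr_deriv H ?_
  simp [bet1]; ring

lemma bet1_hd {lo w : ℝ} (s : ℝ) : HasDerivAt (bet1 lo w) (bet2 lo w s) s := by
  have h := (((hasDerivAt_id s).sub_const lo).div_const w)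
  have H := ((h.const_mul (-6)).add ((h.pow 2).const_mul 6)).div_const w
  refine HasDerivAt.congr_deriv H ?_
  simp [bet2]; ring

lemma bet_bds {lo w s : ℝ} (hw : 0 < w) (hs : s ∈ Icc lo (lo + w)) :
    |bet1 lo w s| ≤ 1.5 / w ∧ |bet2 lo w s| ≤ 6 / w ^ 2 ∧ 0 ≤ bet lo w s ∧ bet lo w s ≤ 1 := by
  obtain ⟨x, hx⟩ : ∃ x, x = (s - lo) / w := ⟨_, rfl⟩
  have h0 : 0 ≤ x := by rw [hx]; exact div_nonneg (by linarith [hs.1]) hw.le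
  have h1 : x ≤ 1 := by rw [hx, div_le_one hw]; linarith [hs.2]
  unfold bet bet1 bet2
  rw [← hx]
  refine ⟨?_, ?_, ?_, ?_⟩
  · rw [abs_div, abs_of_pos hw]; gcongr
    rw [abs_le]; constructor <;> nlinarith [sq_nonneg (x - 1/2)]
  · rw [abs_div, abs_of_pos (pow_pos hw 2)]; gcongr
    rw [abs_le]; constructor <;> linarith
  · have : 1 - 3 * x ^ 2 + 2 * x ^ 3 = (1 - x) ^ 2 * (1 + 2 * x) := by ring
    rw [this]; positivity
  · have : 1 - 3 * x ^ 2 + 2 * x ^ 3 = 1 - x ^ 2 * (3 - 2 * x) := by ring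
    rw [this]
    have : 0 ≤ x ^ 2 * (3 - 2 * x) := mul_nonneg (sq_nonneg x) (by linarith)
    linarith

def Gam (k : ℝ → ℝ) (r r' lo w : ℝ) : ℝ :=
  (∫ s in (0:ℝ)..lo, k (r * s) * k (r' * s)) + ∫ s in lo..(lo + w), bet lo w s * (k (r * s) * k (r' * s))

section
variable {B γ m : ℝ} {k k' : ℝ → ℝ}

lemma Ker.hA (K : Ker B γ m k k') {r s : ℝ} (hr : 0 < r) (hs : 0 < s) :
    HasDerivAt (fun s => k (r * s)) (r * k' (r * s)) s ∧
    HasDerivAt (fun s => r * k' (r * s)) (-(r ^ 2 - m / s ^ 2) * k (r * s)) s := by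
  have hl : HasDerivAt (fun s => r * s) r s := by simpa using (hasDerivAt_id s).const_mul r
  constructor
  · refine ((K.hk (r * s) (by positivity)).comp s hl).congr_deriv (by ring)
  · refine (((K.hk' (r * s) (by positivity)).comp s hl).const_mul r).congr_deriv ?_
    field_simp

lemma Ker.intAB (K : Ker B γ m k k') {r r' lo : ℝ} (hr : 0 < r) (hr' : 0 < r') (hlo : 0 < lo) :
    IntervalIntegrable (fun s => k (r * s) * k (r' * s)) volume 0 lo := by
  rw [intervalIntegrable_iff_integrableOn_Ioc_of_le hlo.le]
  have km := K.meas
  refine integrableOn_of_bounded (M := (|B| * (r * lo) ^ γ) * (|B| * (r' * lo) ^ γ)) (by simp) (by fun_prop) ?_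
  rw [ae_restrict_iff' measurableSet_Ioc]
  refine Eventually.of_forall fun s hs => ?_
  have h : ∀ r, 0 < r → |k (r * s)| ≤ |B| * (r * lo) ^ γ := fun r hr => by
    have hs0 : 0 < r * s := mul_pos hr hs.1
    refine (K.hB _ hs0).trans ?_
    have := K.hγ
    have h2 : (r * s) ^ γ ≤ (r * lo) ^ γ := by
      apply rpow_le_rpow hs0.le _ K.hγ
      exact mul_le_mul_of_nonneg_left hs.2 hr.le
    have h3 : 0 ≤ (r * s) ^ γ := by positivity
    calc _ ≤ |B| * (r * s) ^ γ := mul_le_mul_of_nonneg_right (le_abs_self B) h3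
      _ ≤ _ := mul_le_mul_of_nonneg_left h2 (abs_nonneg B)
  rw [norm_eq_abs, abs_mul]
  exact mul_le_mul (h r hr) (h r' hr') (abs_nonneg _) ((abs_nonneg _).trans (h r hr))

lemma Gam_abs {a a' b b' : ℝ → ℝ} {r r' m lo w : ℝ} (hlo : 0 < lo) (hw : 0 < w)
    (ha : ∀ s, 0 < s → HasDerivAt a (a' s) s) (ha' : ∀ s, 0 < s → HasDerivAt a' (-(r ^ 2 - m / s ^ 2) * a s) s)
    (hb : ∀ s, 0 < s → HasDerivAt b (b' s) s) (hb' : ∀ s, 0 < s → HasDerivAt b' (-(r' ^ 2 - m / s ^ 2) * b s) s)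
    (hint : IntervalIntegrable (fun s => a s * b s) volume 0 lo)
    (hwr : Tendsto (fun s => a s * b' s - a' s * b s) (𝓝[>] 0) (𝓝 0)) :
    (r' ^ 2 - r ^ 2) * ((∫ s in (0:ℝ)..lo, a s * b s) + ∫ s in lo..(lo + w), bet lo w s * (a s * b s)) =
      - ∫ s in lo..(lo + w), bet1 lo w s * (a' s * b s - a s * b' s) ∧
    (r' ^ 2 - r ^ 2) ^ 2 * ((∫ s in (0:ℝ)..lo, a s * b s) + ∫ s in lo..(lo + w), bet lo w s * (a s * b s)) =
     - ∫ s in lo..(lo + w), (bet2 lo w s *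
      (2 * (a' s * b' s) + (r ^ 2 + r' ^ 2 - 2 * m / s ^ 2) * (a s * b s)) +
      bet1 lo w s * (4 * m / s ^ 3) * (a s * b s)) := by
  have c1 : ContinuousOn a (Icc lo (lo + w)) := fun s hs => (ha s (hlo.trans_le hs.1)).continuousAt.continuousWithinAt
  have c2 : ContinuousOn b (Icc lo (lo + w)) := fun s hs => (hb s (hlo.trans_le hs.1)).continuousAt.continuousWithinAt
  have c3 : ContinuousOn a' (Icc lo (lo + w)) := fun s hs => (ha' s (hlo.trans_le hs.1)).continuousAt.continuousWithinAt
  have c4 : ContinuousOn b' (Icc lo (lo + w)) := fun s hs => (hb' s (hlo.trans_le hs.1)).continuousAt.continuousWithinAt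
  have cb1 : ContinuousOn (fun s => bet1 lo w s) (Icc lo (lo + w)) := by unfold bet1; fun_prop
  have cb : ContinuousOn (fun s => bet lo w s) (Icc lo (lo + w)) := by unfold bet; fun_prop
  have cb2 : ContinuousOn (fun s => bet2 lo w s) (Icc lo (lo + w)) := by unfold bet2; fun_prop
  have cs2 : ∀ s ∈ Icc lo (lo + w), s ^ 2 ≠ 0 := fun s hs => (pow_pos (hlo.trans_le hs.1) 2).ne'
  have cs3 : ∀ s ∈ Icc lo (lo + w), s ^ 3 ≠ 0 := fun s hs => (pow_pos (hlo.trans_le hs.1) 3).ne'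
  have ii : ∀ F : ℝ → ℝ, ContinuousOn F (Icc lo (lo + w)) → IntervalIntegrable F volume lo (lo + w) := fun F hF =>
    ContinuousOn.intervalIntegrable (by rwa [uIcc_of_le (by linarith)])
  set W : ℝ → ℝ := fun s => a' s * b s - a s * b' s with hW
  have cW : ContinuousOn (fun s => W s) (Icc lo (lo + w)) := by simp only [hW]; fun_prop
  have hWd : ∀ s, 0 < s → HasDerivAt W ((r' ^ 2 - r ^ 2) * (a s * b s)) s := fun s hs => by
    have a1 := ha s hs
    have a2 := ha' s hs
    have b1 := hb s hs
    have b2 := hb' s hs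
    refine ((a2.mul b1).sub (a1.mul b2)).congr_deriv ?_
    ring
  have P1 : (r' ^ 2 - r ^ 2) * (∫ s in (0:ℝ)..lo, a s * b s) = W lo := by
    rw [← intervalIntegral.integral_const_mul]
    rw [intervalIntegral.integral_eq_sub_of_hasDerivAt_of_tendsto (f := W) (fa := 0) (fb := W lo) hlo
      (fun x hx => hWd x hx.1) (hint.const_mul _) ?_ ?_, sub_zero]
    · have := (hwr).neg
      rw [neg_zero] at this
      refine this.congr fun s => ?_
      simp only [hW]; ring
    · exact (hWd lo hlo).continuousAt.tendsto.mono_left nhdsWithin_le_nhds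
  have b0 : bet lo w lo = 1 := by simp [bet]
  have b1 : bet lo w (lo + w) = 0 := by simp [bet, div_self hw.ne']; norm_num
  have b10 : bet1 lo w lo = 0 := by simp [bet1]
  have b11 : bet1 lo w (lo + w) = 0 := by simp [bet1, div_self hw.ne']
  have hu : ∀ s ∈ uIcc lo (lo + w), 0 < s := fun s hs => by
    rw [uIcc_of_le (by linarith)] at hs; linarith [hs.1]
  have iAB : IntervalIntegrable (fun s => bet lo w s * (a s * b s)) volume lo (lo + w) := ii _ (by fun_prop)
  constructor
  · have i1 : IntervalIntegrable (fun s => bet1 lo w s * W s) volume lo (lo + w) := ii _ (by fun_prop)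
    have P2 := intervalIntegral.integral_eq_sub_of_hasDerivAt (f := fun s => bet lo w s * W s)
      (fun s hs => (bet_hd s).mul (hWd s (hu s hs)))
      (ii _ (by fun_prop))
    rw [b0, b1, intervalIntegral.integral_add i1 (ii _ (by fun_prop))] at P2
    have e : ∀ s, bet lo w s * ((r' ^ 2 - r ^ 2) * (a s * b s)) =
      (r' ^ 2 - r ^ 2) * (bet lo w s * (a s * b s)) := fun s => by ring
    simp only [e] at P2
    rw [intervalIntegral.integral_const_mul] at P2
    rw [mul_add, P1]
    linarith
  · have hQd : ∀ s, 0 < s → HasDerivAt (fun s => r ^ 2 + r' ^ 2 - 2 * m * (s ^ 2)⁻¹) (4 * m * (s ^ 3)⁻¹) s := fun s hs => by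
      have h := (((hasDerivAt_pow 2 s).inv (pow_pos hs 2).ne').const_mul (2 * m)).const_sub (r ^ 2 + r' ^ 2)
      refine h.congr_deriv ?_
      push_cast; field_simp; ring
    set V : ℝ → ℝ := fun s => 2 * (a' s * b' s) +
      (r ^ 2 + r' ^ 2 - 2 * m * (s ^ 2)⁻¹) * (a s * b s) with hV
    have cV : ContinuousOn (fun s => V s) (Icc lo (lo + w)) := by simp only [hV]; fun_prop (disch := assumption)
    have hVd : ∀ s, 0 < s → HasDerivAt V (-(r' ^ 2 - r ^ 2) * W s + 4 * m * (s ^ 3)⁻¹ * (a s * b s)) s := fun s hs => by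
      have a1 := ha s hs
      have a2 := ha' s hs
      have b1 := hb s hs
      have b2 := hb' s hs
      refine (((a2.mul b2).const_mul 2).add ((hQd s hs).mul (a1.mul b1))).congr_deriv ?_
      simp only [hW, Pi.mul_apply]
      ring
    have P2 := intervalIntegral.integral_eq_sub_of_hasDerivAt (f := fun s => (r' ^ 2 - r ^ 2) * (bet lo w s * W s) + bet1 lo w s * V s)
      (f' := fun s => (r' ^ 2 - r ^ 2) * (bet1 lo w s * W s + bet lo w s * ((r' ^ 2 - r ^ 2) * (a s * b s))) +
        (bet2 lo w s * V s + bet1 lo w s * (-(r' ^ 2 - r ^ 2) * W s + 4 * m * (s ^ 3)⁻¹ * (a s * b s))))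
      (fun s hs => (((bet_hd s).mul (hWd s (hu s hs))).const_mul _).add ((bet1_hd s).mul (hVd s (hu s hs))))
      (ii _ ((continuousOn_const.mul ((cb1.mul cW).add (cb.mul (continuousOn_const.mul (c1.mul c2))))).add ((cb2.mul cV).add
        (cb1.mul ((continuousOn_const.mul cW).add ((continuousOn_const.mul (ContinuousOn.inv₀ (by fun_prop) cs3)).mul (c1.mul c2)))))))
    rw [b0, b1, b10, b11] at P2
    have e : ∀ s, (r' ^ 2 - r ^ 2) * (bet1 lo w s * W s + bet lo w s * ((r' ^ 2 - r ^ 2) * (a s * b s))) +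
        (bet2 lo w s * V s + bet1 lo w s * (-(r' ^ 2 - r ^ 2) * W s + 4 * m * (s ^ 3)⁻¹ * (a s * b s))) =
      (r' ^ 2 - r ^ 2) ^ 2 * (bet lo w s * (a s * b s)) +
        (bet2 lo w s * (2 * (a' s * b' s) + (r ^ 2 + r' ^ 2 - 2 * m / s ^ 2) * (a s * b s)) +
      bet1 lo w s * (4 * m / s ^ 3) * (a s * b s)) := fun s => by
        simp only [hV, div_eq_mul_inv]; ring
    simp only [e] at P2
    have i2 : IntervalIntegrable (fun s => bet2 lo w s * (2 * (a' s * b' s) + (r ^ 2 + r' ^ 2 - 2 * m / s ^ 2) * (a s * b s)) +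
      bet1 lo w s * (4 * m / s ^ 3) * (a s * b s)) volume lo (lo + w) :=
      ii _ ((cb2.mul ((continuousOn_const.mul (c3.mul c4)).add
      ((continuousOn_const.sub (continuousOn_const.div (by fun_prop) cs2)).mul (c1.mul c2)))).add
      ((cb1.mul (continuousOn_const.div (by fun_prop) cs3)).mul (c1.mul c2)))
    rw [intervalIntegral.integral_add (iAB.const_mul _) i2,
      intervalIntegral.integral_const_mul] at P2
    rw [mul_add, pow_two, mul_assoc, P1]
    rw [pow_two] at P2
    linarith

lemma Gam_ids (K : Ker B γ m k k') {r r' lo w : ℝ} (hr : 0 < r) (hr' : 0 < r') (hlo : 0 < lo) (hw : 0 < w) :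
    (r' ^ 2 - r ^ 2) * Gam k r r' lo w = - ∫ s in lo..(lo + w), bet1 lo w s *
      (r * k' (r * s) * k (r' * s) - k (r * s) * (r' * k' (r' * s))) ∧
    (r' ^ 2 - r ^ 2) ^ 2 * Gam k r r' lo w = - ∫ s in lo..(lo + w), (bet2 lo w s *
      (2 * (r * k' (r * s) * (r' * k' (r' * s))) + (r ^ 2 + r' ^ 2 - 2 * m / s ^ 2) * (k (r * s) * k (r' * s))) +
      bet1 lo w s * (4 * m / s ^ 3) * (k (r * s) * k (r' * s))) :=
  Gam_abs hlo hw (fun _ hs => (K.hA hr hs).1) (fun _ hs => (K.hA hr hs).2) (fun _ hs => (K.hA hr' hs).1)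
    (fun _ hs => (K.hA hr' hs).2) (K.intAB hr hr' hlo) (K.wr r r' hr hr')

lemma Gam_bds (K : Ker B γ m k k') {r r' lo w p p' : ℝ} (hr : 0 < r) (hrr : r < r') (hlo : 0 < lo) (hw : 0 < w)
    (hp : 0 < p) (hpp : p ≤ p')
    (hA : ∀ s ∈ Icc lo (lo + w), |k (r * s)| ≤ 49 / p ∧ |k' (r * s)| ≤ 49 * p)
    (hB : ∀ s ∈ Icc lo (lo + w), |k (r' * s)| ≤ 49 / p' ∧ |k' (r' * s)| ≤ 49 * p')
    (hQ : ∀ s ∈ Icc lo (lo + w), |r ^ 2 + r' ^ 2 - 2 * m / s ^ 2| ≤ 4 * r' ^ 2 * p' ^ 4)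
    (hm3 : ∀ s ∈ Icc lo (lo + w), 1.5 * w * |4 * m / s ^ 3| ≤ 2 * r' ^ 2 * p' ^ 4) :
    |Gam k r r' lo w| ≤ 3602 * (p' / p) / (r' - r) ∧
    |Gam k r r' lo w| ≤ 92000 * (p' ^ 3 / p) / (w * (r' - r) ^ 2) := by
  have hp' : 0 < p' := hp.trans_le hpp
  have hr' : 0 < r' := hr.trans hrr
  have hd : 0 < r' - r := by linarith
  obtain ⟨I1, I2⟩ := Gam_ids K hr hr' hlo hw
  have hIoc : ∀ s ∈ Set.uIoc lo (lo + w), s ∈ Icc lo (lo + w) := fun s hs => by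
    rw [Set.uIoc_of_le (by linarith)] at hs; exact ⟨hs.1.le, hs.2⟩
  have hX : p / p' ≤ p' / p := by rw [div_le_div_iff₀ hp' hp]; nlinarith
  constructor
  · have h1 : |∫ s in lo..(lo + w), bet1 lo w s *
      (r * k' (r * s) * k (r' * s) - k (r * s) * (r' * k' (r' * s)))| ≤ (1.5 / w * (2401 * (r + r') * (p' / p))) * |lo + w - lo| := by
      rw [← norm_eq_abs]
      refine intervalIntegral.norm_integral_le_of_norm_le_const fun s hs => ?_
      have hs' := hIoc s hs
      obtain ⟨a1, a2⟩ := hA s hs'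
      obtain ⟨b1, b2⟩ := hB s hs'
      rw [norm_eq_abs, abs_mul]
      refine mul_le_mul (bet_bds hw hs').1 ?_ (abs_nonneg _) (by positivity)
      refine (abs_sub _ _).trans ?_
      rw [abs_mul, abs_mul, abs_mul, abs_mul, abs_of_pos hr, abs_of_pos hr']
      have t1 : |k' (r * s)| * |k (r' * s)| ≤ (49 * p) * (49 / p') := mul_le_mul a2 b1 (abs_nonneg _) (by positivity)
      have t2 : |k (r * s)| * |k' (r' * s)| ≤ (49 / p) * (49 * p') := mul_le_mul a1 b2 (abs_nonneg _) (by positivity)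
      have e1 : (49 * p) * (49 / p') = 2401 * (p / p') := by ring
      have e2 : (49 / p) * (49 * p') = 2401 * (p' / p) := by ring
      rw [e1] at t1; rw [e2] at t2
      have t3 := mul_le_mul_of_nonneg_left (t1.trans (mul_le_mul_of_nonneg_left hX (by norm_num))) hr.le
      have t4 := mul_le_mul_of_nonneg_left t2 hr'.le
      linarith
    rw [add_sub_cancel_left, abs_of_pos hw] at h1
    have h2 : |(r' ^ 2 - r ^ 2) * Gam k r r' lo w| ≤ (1.5 / w * (2401 * (r + r') * (p' / p))) * w := by
      rw [I1, abs_neg]; exact h1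
    have e : r' ^ 2 - r ^ 2 = (r' - r) * (r' + r) := by ring
    rw [abs_mul, e, abs_of_pos (by positivity)] at h2
    have e2 : (1.5 / w * (2401 * (r + r') * (p' / p))) * w = 3601.5 * (p' / p) * (r + r') := by
      field_simp; ring
    rw [e2] at h2
    rw [le_div_iff₀ hd]
    have h3 : |Gam k r r' lo w| * (r' - r) * (r' + r) ≤ 3602 * (p' / p) * (r' + r) := by
      have : 0 ≤ (p' / p) * (r' + r) := by positivity
      nlinarith
    exact le_of_mul_le_mul_right h3 (by positivity)
  · have h1 : |∫ s in lo..(lo + w), (bet2 lo w s *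
      (2 * (r * k' (r * s) * (r' * k' (r' * s))) + (r ^ 2 + r' ^ 2 - 2 * m / s ^ 2) * (k (r * s) * k (r' * s))) +
      bet1 lo w s * (4 * m / s ^ 3) * (k (r * s) * k (r' * s)))| ≤ (38 * 2401 * r' ^ 2 * (p' ^ 3 / p) / w ^ 2) * |lo + w - lo| := by
      rw [← norm_eq_abs]
      refine intervalIntegral.norm_integral_le_of_norm_le_const fun s hs => ?_
      have hs' := hIoc s hs
      obtain ⟨a1, a2⟩ := hA s hs'
      obtain ⟨b1, b2⟩ := hB s hs'
      obtain ⟨c1, c2, -, -⟩ := bet_bds hw hs'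
      have q := hQ s hs'
      have q3 := hm3 s hs'
      have t1 : |k' (r * s)| * |k' (r' * s)| ≤ 2401 * (p' ^ 3 / p) := by
        refine (mul_le_mul a2 b2 (abs_nonneg _) (by positivity)).trans ?_
        have : p * p' ≤ p' ^ 3 / p := by
          rw [le_div_iff₀ hp]
          calc p * p' * p ≤ p' * p' * p' := by gcongr
            _ = _ := by ring
        linarith
      have t2 : |k (r * s)| * |k (r' * s)| ≤ 2401 / (p * p') := by
        refine (mul_le_mul a1 b1 (abs_nonneg _) (by positivity)).trans (le_of_eq ?_)
        field_simp; norm_num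
      have t3 : 2 * (r * r' * (|k' (r * s)| * |k' (r' * s)|)) ≤ 2 * (r' ^ 2 * (2401 * (p' ^ 3 / p))) := by
        have : r * r' ≤ r' ^ 2 := by nlinarith
        gcongr
      have t4 : |r ^ 2 + r' ^ 2 - 2 * m / s ^ 2| * (|k (r * s)| * |k (r' * s)|) ≤ 4 * r' ^ 2 * p' ^ 4 * (2401 / (p * p')) :=
        mul_le_mul q t2 (by positivity) (by positivity)
      have t5 : |bet1 lo w s| * |4 * m / s ^ 3| * (|k (r * s)| * |k (r' * s)|) ≤ (2 * r' ^ 2 * p' ^ 4 / w ^ 2) * (2401 / (p * p')) := by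
        refine mul_le_mul ?_ t2 (by positivity) (by positivity)
        refine (mul_le_mul_of_nonneg_right c1 (abs_nonneg _)).trans ?_
        rw [le_div_iff₀ (by positivity)]
        calc 1.5 / w * |4 * m / s ^ 3| * w ^ 2 = 1.5 * w * |4 * m / s ^ 3| := by field_simp
          _ ≤ _ := q3
      have e4 : 4 * r' ^ 2 * p' ^ 4 * (2401 / (p * p')) = 4 * 2401 * r' ^ 2 * (p' ^ 3 / p) := by field_simp
      have e5 : (2 * r' ^ 2 * p' ^ 4 / w ^ 2) * (2401 / (p * p')) = 2 * 2401 * r' ^ 2 * (p' ^ 3 / p) / w ^ 2 := by field_simp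
      rw [e4] at t4
      rw [e5] at t5
      calc _ ≤ |bet2 lo w s| * (2 * (r * r' * (|k' (r * s)| * |k' (r' * s)|)) +
            |r ^ 2 + r' ^ 2 - 2 * m / s ^ 2| * (|k (r * s)| * |k (r' * s)|)) +
            |bet1 lo w s| * |4 * m / s ^ 3| * (|k (r * s)| * |k (r' * s)|) := by
            rw [norm_eq_abs]
            refine (abs_add_le _ _).trans ?_
            rw [abs_mul (bet2 _ _ _), abs_mul (_ * _) (_ * _), abs_mul (bet1 _ _ _), abs_mul (k _)]
            gcongr
            refine (abs_add_le _ _).trans (le_of_eq ?_)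
            simp only [abs_mul, abs_of_pos hr, abs_of_pos hr', abs_two]
            ring
        _ ≤ 6 / w ^ 2 * (2 * (r' ^ 2 * (2401 * (p' ^ 3 / p))) + 4 * 2401 * r' ^ 2 * (p' ^ 3 / p)) +
            2 * 2401 * r' ^ 2 * (p' ^ 3 / p) / w ^ 2 :=
            add_le_add (mul_le_mul c2 (add_le_add t3 t4) (by positivity) (by positivity)) t5
        _ = _ := by ring
    rw [add_sub_cancel_left, abs_of_pos hw] at h1
    rw [← abs_neg, ← I2, abs_mul, abs_of_nonneg (sq_nonneg _)] at h1
    rw [le_div_iff₀ (by positivity)]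
    have e : (r' ^ 2 - r ^ 2) ^ 2 = (r' - r) ^ 2 * (r' + r) ^ 2 := by ring
    rw [e] at h1
    have e2 : 38 * 2401 * r' ^ 2 * (p' ^ 3 / p) / w ^ 2 * w = 38 * 2401 * r' ^ 2 * (p' ^ 3 / p) / w := by
      field_simp
    rw [e2, le_div_iff₀ hw] at h1
    have h4 : r' ^ 2 ≤ (r' + r) ^ 2 := by gcongr; linarith
    have h5 : (r' - r) ^ 2 * r' ^ 2 * |Gam k r r' lo w| * w ≤ 38 * 2401 * r' ^ 2 * (p' ^ 3 / p) := by
      refine le_trans ?_ h1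
      gcongr
    have h6 : |Gam k r r' lo w| * (w * (r' - r) ^ 2) * r' ^ 2 ≤ 92000 * (p' ^ 3 / p) * r' ^ 2 := by
      have : 0 ≤ (p' ^ 3 / p) * r' ^ 2 := by positivity
      linarith
    exact le_of_mul_le_mul_right h6 (by positivity)
end
end

section
def pk (m S₀ r : ℝ) : ℝ := √√(qf m (r * S₀))

/-- box data -/
structure Box (C₀ m r₀ S₀ l w : ℝ) : Prop where
  hC : 1 ≤ C₀
  hr : 0 < r₀
  hS : 0 < S₀
  hu : ug (200 * C₀) m ≤ r₀ * S₀
  hl : 0 < l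
  hw : 0 ≤ w
  hlw : l * w ≤ √(qf m ((r₀ + l) * S₀))
  hwS : w ≤ C₀ * S₀ * l / r₀

section
variable {B γ m C₀ r₀ S₀ l w : ℝ} {k k' : ℝ → ℝ}

lemma qf_form {S₀ r : ℝ} : qf m (r * S₀) = 1 - (max m 0 / S₀ ^ 2) / r ^ 2 := by
  unfold qf
  rw [div_div, mul_pow, mul_comm]

lemma qf_le_one {u : ℝ} : qf m u ≤ 1 := by
  unfold qf
  have : 0 ≤ max m 0 / u ^ 2 := by positivity
  linarith

lemma qf_mono {u v : ℝ} (hu : 0 < u) (h : u ≤ v) : qf m u ≤ qf m v := by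
  unfold qf
  have : max m 0 / v ^ 2 ≤ max m 0 / u ^ 2 := by gcongr
  linarith

lemma Box.q0 (b : Box C₀ m r₀ S₀ l w) : 0 < qf m (r₀ * S₀) ∧ 200 * C₀ ≤ r₀ * S₀ * √(qf m (r₀ * S₀)) ^ 3 := by
  have := ug_good (by linarith [b.hC]) b.hu
  exact this.2

lemma Box.qm (b : Box C₀ m r₀ S₀ l w) {r r' : ℝ} (h : r₀ ≤ r) (h' : r ≤ r') : qf m (r * S₀) ≤ qf m (r' * S₀) :=
  qf_mono (mul_pos (b.hr.trans_le h) b.hS) (mul_le_mul_of_nonneg_right h' b.hS.le)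

lemma Box.qp (b : Box C₀ m r₀ S₀ l w) {r : ℝ} (h : r₀ ≤ r) : 0 < qf m (r * S₀) :=
  b.q0.1.trans_le (b.qm le_rfl h)

lemma Box.pp (b : Box C₀ m r₀ S₀ l w) {r : ℝ} (h : r₀ ≤ r) : 0 < pk m S₀ r := by
  unfold pk; exact sqrt_pos.2 (sqrt_pos.2 (b.qp h))

lemma Box.pm (b : Box C₀ m r₀ S₀ l w) {r r' : ℝ} (h : r₀ ≤ r) (h' : r ≤ r') : pk m S₀ r ≤ pk m S₀ r' := by
  unfold pk; exact sqrt_le_sqrt (sqrt_le_sqrt (b.qm h h'))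

lemma pk_sq {r : ℝ} : pk m S₀ r ^ 2 = √(qf m (r * S₀)) := by
  unfold pk; exact sq_sqrt (sqrt_nonneg _)

lemma Box.p4 (b : Box C₀ m r₀ S₀ l w) {r : ℝ} (h : r₀ ≤ r) : pk m S₀ r ^ 4 = qf m (r * S₀) := by
  rw [show (4:ℕ) = 2 * 2 from rfl, pow_mul, pk_sq, sq_sqrt (b.qp h).le]

lemma conc_aux {c r₀ r r' : ℝ} (h0 : 0 < r₀) (hc : c ≤ r₀ ^ 2) (h : r₀ ≤ r) (h' : r ≤ r') :
    (r - r₀) * (1 - c / r' ^ 2) ≤ (r' - r₀) * (1 - c / r ^ 2) := by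
  have hr : 0 < r := by linarith
  have hr' : 0 < r' := by linarith
  have e : (r' - r₀) * (1 - c / r ^ 2) - (r - r₀) * (1 - c / r' ^ 2) =
    (r' - r) * (r ^ 2 * r' ^ 2 - c * (r' ^ 2 + r * r' + r ^ 2 - r₀ * (r' + r))) / (r ^ 2 * r' ^ 2) := by
    field_simp; ring
  have h1 : 0 ≤ r' ^ 2 + r * r' + r ^ 2 - r₀ * (r' + r) := by nlinarith
  have h2 : c * (r' ^ 2 + r * r' + r ^ 2 - r₀ * (r' + r)) ≤ r₀ ^ 2 * (r' ^ 2 + r * r' + r ^ 2 - r₀ * (r' + r)) := by gcongr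
  have h3 : 0 ≤ (r - r₀) * (r' - r₀) * ((r + r₀) * (r' + r₀) - r₀ ^ 2) := by
    have : 0 ≤ (r + r₀) * (r' + r₀) - r₀ ^ 2 := by nlinarith
    have h5 : 0 ≤ r - r₀ := by linarith
    have h6 : 0 ≤ r' - r₀ := by linarith
    positivity
  have h4 : 0 ≤ (r' - r) * (r ^ 2 * r' ^ 2 - c * (r' ^ 2 + r * r' + r ^ 2 - r₀ * (r' + r))) / (r ^ 2 * r' ^ 2) := by
    apply div_nonneg _ (by positivity)
    apply mul_nonneg (by linarith)
    nlinarith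
  linarith

lemma Box.c_le (b : Box C₀ m r₀ S₀ l w) : max m 0 / S₀ ^ 2 ≤ r₀ ^ 2 := by
  have := b.q0.1
  rw [qf_form] at this
  have h2 : max m 0 / S₀ ^ 2 / r₀ ^ 2 ≤ 1 := by linarith
  rwa [div_le_one (pow_pos b.hr 2)] at h2

lemma Box.conc (b : Box C₀ m r₀ S₀ l w) {r r' : ℝ} (h : r₀ ≤ r) (h' : r ≤ r') :
    (r - r₀) * qf m (r' * S₀) ≤ (r' - r₀) * qf m (r * S₀) := by
  rw [qf_form, qf_form]
  exact conc_aux b.hr b.c_le h h'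

lemma F2_aux {C₀ r S l w q₀ q₁ τ τ₁ : ℝ} (hC : 1 ≤ C₀) (hr : 0 < r) (hS : 0 < S) (hl : 0 < l) (hw : 0 ≤ w)
    (hτ : 0 < τ) (hτ1 : 0 < τ₁) (e : q₀ = τ ^ 2) (e1 : q₁ = τ₁ ^ 2) (hq1 : q₀ ≤ 1)
    (hA : 200 * C₀ ≤ r * S * τ ^ 3) (hlw : l * w ≤ τ₁) (hwS : w * r ≤ C₀ * S * l)
    (hq : q₁ * r ≤ q₀ * r + 2 * l) : w ≤ S * q₀ / 8 := by
  have hq0 : 0 < q₀ := by rw [e]; positivity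
  by_cases hc : l ≤ r * q₀
  · have h1 : τ₁ ≤ 2 * τ := by
      apply le_of_sq_le_sq _ (by positivity)
      have : q₁ * r ≤ (4 * q₀) * r := by nlinarith
      have := le_of_mul_le_mul_right this hr
      nlinarith
    have h2 : w ^ 2 * r ≤ C₀ * S * (2 * τ) := by
      calc w ^ 2 * r = w * (w * r) := by ring
        _ ≤ w * (C₀ * S * l) := by gcongr
        _ = C₀ * S * (l * w) := by ring
        _ ≤ C₀ * S * (2 * τ) := mul_le_mul_of_nonneg_left (hlw.trans h1) (by positivity)
    have h3 : w ^ 2 ≤ (S * q₀ / 8) ^ 2 := by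
      have h4 : C₀ * (2 * S * τ) ≤ (r * S * τ ^ 3 / 200) * (2 * S * τ) := by gcongr; linarith
      have h5 : w ^ 2 * r ≤ (S * q₀ / 8) ^ 2 * r := by
        calc w ^ 2 * r ≤ C₀ * (2 * S * τ) := by linarith
          _ ≤ _ := h4
          _ = (S ^ 2 * q₀ ^ 2 * r) / 100 := by rw [e]; ring
          _ ≤ (S * q₀ / 8) ^ 2 * r := by
            have : 0 ≤ S ^ 2 * q₀ ^ 2 * r := by positivity
            linarith [show (S * q₀ / 8) ^ 2 * r = S ^ 2 * q₀ ^ 2 * r / 64 by ring]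
      exact le_of_mul_le_mul_right h5 hr
    exact le_of_sq_le_sq h3 (by positivity)
  · push Not at hc
    have h1 : q₁ * r ≤ 3 * l := by linarith
    have h2 : w ^ 2 * l ^ 2 ≤ q₁ := by
      rw [e1, show w ^ 2 * l ^ 2 = (l * w) ^ 2 by ring]; gcongr
    have h3 : w ^ 2 * l * r ≤ 3 := by
      have : (w ^ 2 * l * r) * l ≤ 3 * l := by
        calc (w ^ 2 * l * r) * l = (w ^ 2 * l ^ 2) * r := by ring
          _ ≤ q₁ * r := by gcongr
          _ ≤ _ := h1
      exact le_of_mul_le_mul_right this hl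
    have h4 : w ^ 2 * (r ^ 2 * q₀) ≤ 3 := by
      calc w ^ 2 * (r ^ 2 * q₀) = w ^ 2 * (r * q₀) * r := by ring
        _ ≤ w ^ 2 * l * r := by gcongr
        _ ≤ 3 := h3
    have h5 : (200:ℝ) ^ 2 ≤ (r * S * τ ^ 3) ^ 2 := by gcongr; linarith
    have h6 : w ^ 2 * (r ^ 2 * q₀) ≤ (S * q₀ / 8) ^ 2 * (r ^ 2 * q₀) := by
      have : (S * q₀ / 8) ^ 2 * (r ^ 2 * q₀) = (r * S * τ ^ 3) ^ 2 / 64 := by rw [e]; ring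
      rw [this]; linarith
    have h7 := le_of_mul_le_mul_right h6 (by positivity)
    exact le_of_sq_le_sq h7 (by positivity)

lemma Box.F2 (b : Box C₀ m r₀ S₀ l w) : w ≤ S₀ * qf m (r₀ * S₀) / 8 := by
  have hr := b.hr; have hl := b.hl; have hS := b.hS
  have h0 := b.q0
  have h1 := b.qp (r := r₀ + l) (by linarith)
  refine F2_aux b.hC hr hS hl b.hw (sqrt_pos.2 h0.1) (sqrt_pos.2 h1) (sq_sqrt h0.1.le).symm
    (sq_sqrt h1.le).symm qf_le_one h0.2 b.hlw ?_ ?_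
  · have := b.hwS; rwa [le_div_iff₀ hr] at this
  · rw [qf_form, qf_form]
    have hc := b.c_le
    obtain ⟨c, hcd⟩ : ∃ c, c = max m 0 / S₀ ^ 2 := ⟨_, rfl⟩
    have hc0 : 0 ≤ c := by rw [hcd]; positivity
    rw [← hcd] at hc ⊢
    have e : (1 - c / r₀ ^ 2) * r₀ + 2 * l - (1 - c / (r₀ + l) ^ 2) * r₀ =
      2 * l - c / r₀ ^ 2 * (r₀ * l * (2 * r₀ + l) / (r₀ + l) ^ 2) := by field_simp; ring
    have h2 : c / r₀ ^ 2 ≤ 1 := by rw [div_le_one (by positivity)]; exact hc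
    have h3 : r₀ * l * (2 * r₀ + l) / (r₀ + l) ^ 2 ≤ 2 * l := by
      rw [div_le_iff₀ (by positivity)]
      have : 0 ≤ 2 * l * (r₀ + l) ^ 2 - r₀ * l * (2 * r₀ + l) := by
        have : 2 * l * (r₀ + l) ^ 2 - r₀ * l * (2 * r₀ + l) = 3 * r₀ * l ^ 2 + 2 * l ^ 3 := by ring
        rw [this]; positivity
      linarith
    have h4 : c / r₀ ^ 2 * (r₀ * l * (2 * r₀ + l) / (r₀ + l) ^ 2) ≤ 1 * (2 * l) := by gcongr
    linarith

lemma Box.s_bds (b : Box C₀ m r₀ S₀ l w) {s : ℝ} (hs : |s - S₀| ≤ w) : 7 / 8 * S₀ ≤ s ∧ s ≤ 9 / 8 * S₀ := by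
  have h := b.F2
  have h1 : S₀ * qf m (r₀ * S₀) ≤ S₀ * 1 := mul_le_mul_of_nonneg_left qf_le_one b.hS.le
  have := abs_le.1 hs
  constructor <;> linarith [this.1, this.2]

lemma q_cmp_aux {S s q q₀ : ℝ} (hS : 0 < S) (hq : q ≤ 1) (hq0 : 0 < q₀) (hqq : q₀ ≤ q) (hs : |s - S| ≤ S * q₀ / 8)
    : |1 - (1 - q) * S ^ 2 / s ^ 2 - q| ≤ 0.35 * q := by
  have h := abs_le.1 hs
  have h1 : 7 / 8 * S ≤ s := by nlinarith
  have h1' : s ≤ 9 / 8 * S := by nlinarith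
  have hs0 : 0 < s := by nlinarith
  have e : 1 - (1 - q) * S ^ 2 / s ^ 2 - q = (1 - q) * ((s - S) * (s + S) / s ^ 2) := by field_simp; ring
  rw [e, abs_mul, abs_of_nonneg (by linarith), abs_div, abs_mul, abs_of_pos (pow_pos hs0 2), abs_of_pos (by linarith : 0 < s + S)]
  have h2 : |s - S| * (s + S) / s ^ 2 ≤ 0.35 * q₀ := by
    rw [div_le_iff₀ (by positivity)]
    calc |s - S| * (s + S) ≤ (S * q₀ / 8) * (s + S) := by gcongr
      _ ≤ 0.35 * q₀ * s ^ 2 := by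
        have : S * (s + S) / 8 ≤ 0.35 * s ^ 2 := by nlinarith
        nlinarith
  calc (1 - q) * (|s - S| * (s + S) / s ^ 2) ≤ 1 * (0.35 * q₀) := by
        gcongr; linarith
    _ ≤ _ := by linarith

lemma Box.q_cmp (b : Box C₀ m r₀ S₀ l w) {r s : ℝ} (h : r₀ ≤ r) (hs : |s - S₀| ≤ w) :
    |qf m (r * s) - qf m (r * S₀)| ≤ 0.35 * qf m (r * S₀) := by
  have hr := b.hr.trans_le h
  have hS := b.hS
  have hs0 : 0 < s := by linarith [(b.s_bds hs).1]
  have := q_cmp_aux hS (qf_le_one (m := m) (u := r * S₀)) b.q0.1 (b.qm le_rfl h) (hs.trans b.F2)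
  convert this using 3
  unfold qf
  field_simp
  ring

lemma kb_aux {x y p q qs : ℝ} (hq : 0 < q) (e : p ^ 2 = √q) (hp : 0 < p) (h : |qs - q| ≤ 0.35 * q)
    (h1 : x ^ 2 ≤ 1200 / √qs) (h2 : y ^ 2 ≤ 1200 * √qs) : |x| ≤ 49 / p ∧ |y| ≤ 49 * p := by
  have ha := abs_le.1 h
  have hqs : 0 < qs := by linarith [ha.1]
  have b1 : √q / 2 ≤ √qs := by
    rw [show √q / 2 = √(q / 4) by rw [sqrt_div hq.le, show (4:ℝ) = 2 ^ 2 by norm_num, sqrt_sq (by norm_num)]]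
    exact sqrt_le_sqrt (by linarith [ha.1])
  have b2 : √qs ≤ √q * 2 := by
    rw [show √q * 2 = √(q * 4) by rw [Real.sqrt_mul hq.le, show (4:ℝ) = 2 ^ 2 by norm_num, sqrt_sq (by norm_num)]]
    exact sqrt_le_sqrt (by linarith [ha.2])
  have hsq : 0 < √q := sqrt_pos.2 hq
  constructor
  · apply abs_le_of_sq_le_sq _ (by positivity)
    rw [div_pow, e]
    refine h1.trans ?_
    rw [div_le_div_iff₀ (by positivity) hsq]
    nlinarith
  · apply abs_le_of_sq_le_sq _ (by positivity)
    rw [mul_pow, e]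
    linarith

lemma Box.kb (b : Box C₀ m r₀ S₀ l w) (K : Ker B γ m k k') {r s : ℝ} (h : r₀ ≤ r) (hs : |s - S₀| ≤ w) :
    |k (r * s)| ≤ 49 / pk m S₀ r ∧ |k' (r * s)| ≤ 49 * pk m S₀ r := by
  have hr := b.hr.trans_le h
  have hS := b.hS
  have hsb := b.s_bds hs
  have hs0 : 0 < s := by linarith [hsb.1]
  have hq := b.qp h
  have hc := b.q_cmp h hs
  have hqs : 0 < qf m (r * s) := by have := (abs_le.1 hc).1; linarith
  have hg : 2 ≤ r * s * √(qf m (r * s)) ^ 3 := by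
    have h1 : √(qf m (r₀ * S₀)) / 2 ≤ √(qf m (r * s)) := by
      rw [show √(qf m (r₀ * S₀)) / 2 = √(qf m (r₀ * S₀) / 4) by
        rw [sqrt_div b.q0.1.le, show (4:ℝ) = 2 ^ 2 by norm_num, sqrt_sq (by norm_num)]]
      apply sqrt_le_sqrt
      have := (abs_le.1 hc).1
      have := b.qm le_rfl h
      linarith
    have hh := b.q0.2
    have hC := b.hC
    have hr0 := b.hr
    calc (2:ℝ) ≤ (r₀ * (7 / 8 * S₀)) * (√(qf m (r₀ * S₀)) / 2) ^ 3 := by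
          have : (r₀ * (7 / 8 * S₀)) * (√(qf m (r₀ * S₀)) / 2) ^ 3 = 7 / 64 * (r₀ * S₀ * √(qf m (r₀ * S₀)) ^ 3) := by ring
          rw [this]; linarith
      _ ≤ _ := by gcongr; exact hsb.1
  have := ker_B1 K (mul_pos hr hs0) hqs hg
  exact kb_aux hq pk_sq (b.pp h) hc this.1 this.2

lemma Box.m_le (b : Box C₀ m r₀ S₀ l w) (K : Ker B γ m k k') : |m| ≤ r₀ ^ 2 * S₀ ^ 2 ∧ 2 ≤ r₀ * S₀ := by
  have hr := b.hr; have hS := b.hS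
  have h2 : 2 ≤ r₀ * S₀ := by
    have h1 := b.q0.2
    have h3 : √(qf m (r₀ * S₀)) ≤ 1 := Real.sqrt_le_one.2 qf_le_one
    have h4 : √(qf m (r₀ * S₀)) ^ 3 ≤ 1 := pow_le_one₀ (sqrt_nonneg _) h3
    have : r₀ * S₀ * √(qf m (r₀ * S₀)) ^ 3 ≤ r₀ * S₀ * 1 := by gcongr
    linarith [b.hC]
  refine ⟨?_, h2⟩
  have hc := b.c_le
  rw [div_le_iff₀ (by positivity)] at hc
  rw [abs_le]
  constructor
  · have := K.hm; nlinarith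
  · exact (le_max_left m 0).trans hc

lemma Box.hQ (b : Box C₀ m r₀ S₀ l w) (K : Ker B γ m k k') {r r' s : ℝ} (h : r₀ ≤ r) (h' : r ≤ r') (hs : |s - S₀| ≤ w) :
    |r ^ 2 + r' ^ 2 - 2 * m / s ^ 2| ≤ 4 * r' ^ 2 * pk m S₀ r' ^ 4 := by
  have hr := b.hr.trans_le h
  have hr' := hr.trans_le h'
  have hS := b.hS
  have hsb := b.s_bds hs
  have hs0 : 0 < s := by linarith [hsb.1]
  have hml := b.m_le K
  rw [b.p4 (h.trans h')]
  rcases le_or_gt 0 m with hm | hm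
  · have c1 := abs_le.1 (b.q_cmp h hs)
    have c2 := abs_le.1 (b.q_cmp (h.trans h') hs)
    have q1 := b.qp h
    have q2 := b.qp (h.trans h')
    have q3 := b.qm h h'
    have e : r ^ 2 + r' ^ 2 - 2 * m / s ^ 2 = r ^ 2 * qf m (r * s) + r' ^ 2 * qf m (r' * s) := by
      unfold qf; rw [max_eq_left hm]; field_simp; ring
    have q4 : 0 < qf m (r * s) := by linarith
    have q5 : 0 < qf m (r' * s) := by linarith
    rw [e, abs_of_pos (by positivity)]
    have : r ^ 2 * qf m (r * s) ≤ r' ^ 2 * (2 * qf m (r' * S₀)) := by gcongr; linarith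
    have : r' ^ 2 * qf m (r' * s) ≤ r' ^ 2 * (2 * qf m (r' * S₀)) := by gcongr; linarith
    linarith
  · have e : qf m (r' * S₀) = 1 := by unfold qf; rw [max_eq_right hm.le]; simp
    have hK := K.hm
    have h3 : |2 * m / s ^ 2| ≤ r' ^ 2 := by
      rw [abs_div, abs_of_pos (pow_pos hs0 2), div_le_iff₀ (by positivity), abs_mul, abs_of_neg hm]
      have : 1 ≤ r' * s := by
        calc (1:ℝ) ≤ 7 / 8 * (r₀ * S₀) := by linarith
          _ = r₀ * (7 / 8 * S₀) := by ring
          _ ≤ r' * s := by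
            have := b.hr
            exact mul_le_mul (h.trans h') hsb.1 (by positivity) hr'.le
      have : 1 ≤ (r' * s) ^ 2 := one_le_pow₀ this
      rw [mul_pow] at this
      norm_num; linarith
    have h4 := abs_le.1 h3
    rw [e, abs_le]
    have : r ^ 2 ≤ r' ^ 2 := by gcongr
    constructor <;> nlinarith [sq_nonneg r]

lemma Box.hm3 (b : Box C₀ m r₀ S₀ l w) (K : Ker B γ m k k') {r' s : ℝ} (h : r₀ ≤ r') (hs : |s - S₀| ≤ w) :
    1.5 * w * |4 * m / s ^ 3| ≤ 2 * r' ^ 2 * pk m S₀ r' ^ 4 := by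
  have hr' := b.hr.trans_le h
  have hr := b.hr
  have hS := b.hS
  have hsb := b.s_bds hs
  have hs0 : 0 < s := by linarith [hsb.1]
  have hml := (b.m_le K).1
  rw [b.p4 h, abs_div, abs_mul, abs_of_pos (pow_pos hs0 3), ← mul_div_assoc, div_le_iff₀ (by positivity)]
  have h1 := b.F2
  have q0 := b.q0.1
  calc 1.5 * w * (|4| * |m|) ≤ 1.5 * (S₀ * qf m (r₀ * S₀) / 8) * (4 * (r₀ ^ 2 * S₀ ^ 2)) := by
        norm_num; gcongr
    _ = 0.75 * (r₀ ^ 2 * qf m (r₀ * S₀) * S₀ ^ 3) := by ring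
    _ ≤ 2 * r₀ ^ 2 * qf m (r₀ * S₀) * (7 / 8 * S₀) ^ 3 := by
        have : 0 ≤ r₀ ^ 2 * qf m (r₀ * S₀) * S₀ ^ 3 := by positivity
        nlinarith
    _ ≤ _ := by
        have := b.qp h
        gcongr
        · exact b.qm le_rfl h
        · exact hsb.1

end
end

section
section
variable {B γ m C₀ r₀ S₀ l w : ℝ} {k k' : ℝ → ℝ}

lemma Box.Gam0 (b : Box C₀ m r₀ S₀ l w) (K : Ker B γ m k k') (hw : 0 < w) {r r' lo : ℝ} (h : r₀ ≤ r) (h' : r < r')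
    (hlo : S₀ - w ≤ lo) (hlo' : lo ≤ S₀) :
    |Gam k r r' lo w| ≤ 3602 * (pk m S₀ r' / pk m S₀ r) / (r' - r) ∧
    |Gam k r r' lo w| ≤ 92000 * (pk m S₀ r' ^ 3 / pk m S₀ r) / (w * (r' - r) ^ 2) := by
  have hs : ∀ s ∈ Icc lo (lo + w), |s - S₀| ≤ w := fun s hs => by
    rw [abs_le]; constructor <;> linarith [hs.1, hs.2]
  have hl0 : 0 < lo := by
    have := (b.s_bds (s := lo) (hs lo ⟨le_rfl, by linarith⟩)).1
    linarith [b.hS]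
  exact Gam_bds K (b.hr.trans_le h) h' hl0 hw (b.pp h) (b.pm h h'.le) (fun s hh => b.kb K h (hs s hh))
    (fun s hh => b.kb K (h.trans h'.le) (hs s hh)) (fun s hh => b.hQ K h h'.le (hs s hh))
    (fun s hh => b.hm3 K (h.trans h'.le) (hs s hh))

def rhk (m r₀ S₀ l r : ℝ) : ℝ := pk m S₀ (r₀ + l) / pk m S₀ r

lemma Box.rho_sq (b : Box C₀ m r₀ S₀ l w) {r : ℝ} (h : r₀ < r) (h' : r ≤ r₀ + l) :
    rhk m r₀ S₀ l r ^ 2 ≤ √(l / (r - r₀)) := by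
  have hc := b.conc h.le h'
  have hp := b.pp h.le
  have hd : 0 < r - r₀ := by linarith
  apply le_sqrt_of_sq_le
  rw [← pow_mul, rhk, div_pow]
  norm_num
  rw [b.p4 h.le, b.p4 (by linarith [b.hl]), div_le_div_iff₀ (b.qp h.le) hd]
  linarith

lemma Box.rho_two (b : Box C₀ m r₀ S₀ l w) {r : ℝ} (h : r₀ < r) (h' : r ≤ r₀ + l) (h2 : r₀ + l - r ≤ l / 2) :
    rhk m r₀ S₀ l r ≤ 2 := by
  have h1 := b.rho_sq h h'
  have h3 : √(l / (r - r₀)) ≤ 2 ^ 2 := by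
    rw [sqrt_le_left (by norm_num), div_le_iff₀ (by linarith)]
    have := b.hl
    norm_num
    linarith
  exact le_of_sq_le_sq (h1.trans h3) (by norm_num)

lemma rhk_meas : Measurable (rhk m r₀ S₀ l) := by
  unfold rhk pk qf; fun_prop

lemma int_sqrt {r₀ l : ℝ} (hl : 0 < l) :
    ∫⁻ r in Ioo r₀ (r₀ + l), ofReal √(l / (r - r₀)) ≤ 2 * ofReal l := by
  have i0 : IntervalIntegrable (fun x : ℝ => x ^ (-(1/2) : ℝ)) volume 0 l :=
    intervalIntegral.intervalIntegrable_rpow' (by norm_num)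
  have i1 := (i0.comp_sub_right r₀).const_mul √l
  simp only [zero_add] at i1
  rw [add_comm l r₀, intervalIntegrable_iff_integrableOn_Ioo_of_le (by linarith)] at i1
  have e : ∀ r ∈ Ioo r₀ (r₀ + l), √(l / (r - r₀)) = √l * (r - r₀) ^ (-(1/2) : ℝ) := fun r hr => by
    have : 0 < r - r₀ := by linarith [hr.1]
    rw [rpow_half this, sqrt_div hl.le]; ring
  rw [setLIntegral_congr_fun (g := fun r => ofReal (√l * (r - r₀) ^ (-(1/2) : ℝ))) measurableSet_Ioo
    (fun r hr => by simp only [e r hr])]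
  rw [← ofReal_integral_eq_lintegral_ofReal i1 (by
    refine (ae_restrict_iff' measurableSet_Ioo).2 (Eventually.of_forall fun r hr => ?_)
    have : 0 < r - r₀ := by linarith [hr.1]
    positivity)]
  rw [← integral_Ioc_eq_integral_Ioo, ← intervalIntegral.integral_of_le (by linarith), intervalIntegral.integral_const_mul,
    intervalIntegral.integral_comp_sub_right (fun x : ℝ => x ^ (-(1/2) : ℝ)), integral_rpow (by left; norm_num)]
  rw [show (2:ℝ≥0∞) = ofReal 2 by simp, ← ofReal_mul (by norm_num)]
  apply ofReal_le_ofReal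
  norm_num
  rw [← sqrt_eq_rpow]
  nlinarith [mul_self_sqrt hl.le]

lemma Box.rho_int (b : Box C₀ m r₀ S₀ l w) :
    ∫⁻ r in Ioo r₀ (r₀ + l), ofReal (rhk m r₀ S₀ l r) ^ 2 ≤ 2 * ofReal l := by
  refine le_trans (setLIntegral_mono' measurableSet_Ioo fun r hr => ?_) (int_sqrt b.hl)
  rw [← ofReal_pow]
  · exact ofReal_le_ofReal (b.rho_sq hr.1 hr.2.le)
  · exact div_nonneg (b.pp (by linarith [b.hl])).le (b.pp hr.1.le).le

lemma Box.Gam1 (b : Box C₀ m r₀ S₀ l w) (K : Ker B γ m k k') (hw : 0 < w) {r r' lo : ℝ} (h : r₀ ≤ r) (h' : r ≤ r₀ + l)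
    (hr' : r₀ + l < r') (hr2 : r' ≤ r₀ + l + l)
    (hlo : S₀ - w ≤ lo) (hlo' : lo ≤ S₀) :
    |Gam k r r' lo w| ≤ 184000 * (rhk m r₀ S₀ l r * (1 / (r' - r))) := by
  have h1 := (b.Gam0 K hw h (h'.trans_lt hr') hlo hlo').1
  have hl := b.hl
  have p0 := b.pp h
  have p1 := b.pp (r := r₀ + l) (by linarith)
  have p2 := b.pp (r := r') (by linarith)
  have h2 : pk m S₀ r' ≤ 2 * pk m S₀ (r₀ + l) := by
    have hc := b.conc (r := r₀ + l) (r' := r') (by linarith) hr'.le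
    rw [← b.p4 (by linarith), ← b.p4 (by linarith)] at hc
    have h3 : l * pk m S₀ r' ^ 4 ≤ l * (2 * pk m S₀ (r₀ + l) ^ 4) := by
      have : (r' - r₀) * pk m S₀ (r₀ + l) ^ 4 ≤ (2 * l) * pk m S₀ (r₀ + l) ^ 4 := by gcongr; linarith
      linarith
    have h4 := le_of_mul_le_mul_left h3 hl
    apply le_of_pow_le_pow_left₀ (n := 4) (by norm_num) (by positivity)
    rw [mul_pow]
    have : 0 < pk m S₀ (r₀ + l) ^ 4 := by positivity
    linarith
  refine h1.trans ?_
  have hd : 0 < r' - r := by linarith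
  unfold rhk
  rw [mul_one_div, mul_div_assoc]
  have h5 : pk m S₀ r' / pk m S₀ r / (r' - r) ≤ 2 * pk m S₀ (r₀ + l) / pk m S₀ r / (r' - r) := by gcongr
  have e : 2 * pk m S₀ (r₀ + l) / pk m S₀ r / (r' - r) = 2 * (pk m S₀ (r₀ + l) / pk m S₀ r / (r' - r)) := by ring
  have : 0 ≤ pk m S₀ (r₀ + l) / pk m S₀ r / (r' - r) := by positivity
  linarith

lemma Box.Gam2 (b : Box C₀ m r₀ S₀ l w) (K : Ker B γ m k k') (hw : 0 < w)
    (he : l * w = √(qf m ((r₀ + l) * S₀))) {r r' lo : ℝ} (h : r₀ ≤ r) (h' : r ≤ r₀ + l)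
    (hr' : r₀ + l + l < r')
    (hlo : S₀ - w ≤ lo) (hlo' : lo ≤ S₀) :
    |Gam k r r' lo w| ≤ 184000 * (rhk m r₀ S₀ l r * (l ^ (1/4 : ℝ) * (r' - (r₀ + l)) ^ (-(5/4) : ℝ))) := by
  have hl := b.hl
  have h1 := (b.Gam0 K hw h (r' := r') (by linarith) hlo hlo').2
  have p0 := b.pp h
  have p1 := b.pp (r := r₀ + l) (by linarith)
  have p2 := b.pp (r := r') (by linarith)
  have hx : 0 < r' - (r₀ + l) := by linarith
  rw [← pk_sq] at he
  unfold rhk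
  have hc := b.conc (r := r₀ + l) (r' := r') (by linarith) (by linarith)
  rw [← b.p4 (by linarith), ← b.p4 (by linarith)] at hc
  obtain ⟨p, hp⟩ : ∃ p, p = pk m S₀ r := ⟨_, rfl⟩
  obtain ⟨P, hP⟩ : ∃ p, p = pk m S₀ (r₀ + l) := ⟨_, rfl⟩
  obtain ⟨Q, hQ⟩ : ∃ p, p = pk m S₀ r' := ⟨_, rfl⟩
  rw [← hp] at p0 h1 ⊢
  rw [← hP] at p1 he hc ⊢
  rw [← hQ] at p2 h1 hc
  clear hp hP hQ
  obtain ⟨x, hxd⟩ : ∃ x, x = r' - (r₀ + l) := ⟨_, rfl⟩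
  rw [← hxd] at hx ⊢
  have hxl : l < x := by linarith
  obtain ⟨a, ha⟩ : ∃ a, a = l ^ (1/4 : ℝ) := ⟨_, rfl⟩
  obtain ⟨y, hy⟩ : ∃ a, a = x ^ (1/4 : ℝ) := ⟨_, rfl⟩
  have ha0 : 0 < a := by rw [ha]; positivity
  have hy0 : 0 < y := by rw [hy]; positivity
  have ha4 : a ^ 4 = l := by
    rw [ha, ← rpow_natCast, ← rpow_mul hl.le]; norm_num
  have hy4 : y ^ 4 = x := by
    rw [hy, ← rpow_natCast, ← rpow_mul hx.le]; norm_num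
  have e5 : x ^ (-(5/4) : ℝ) = (y ^ 5)⁻¹ := by
    rw [hy, ← rpow_natCast, ← rpow_mul hx.le, ← Real.rpow_neg hx.le]; norm_num
  rw [e5, ← ha]
  have h4 : (a * Q) ^ 4 ≤ 2 * (y * P) ^ 4 := by
    rw [mul_pow, mul_pow, ha4, hy4]
    have : (r' - r₀) * P ^ 4 ≤ (2 * x) * P ^ 4 := by gcongr; linarith
    linarith
  have h3 : (a * Q) ^ 3 ≤ 2 * (y * P) ^ 3 := by
    have : ((a * Q) ^ 3) ^ 4 ≤ (2 * (y * P) ^ 3) ^ 4 := by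
      calc ((a * Q) ^ 3) ^ 4 = ((a * Q) ^ 4) ^ 3 := by ring
        _ ≤ (2 * (y * P) ^ 4) ^ 3 := by gcongr
        _ = 8 * (y * P) ^ 12 := by ring
        _ ≤ 16 * (y * P) ^ 12 := by gcongr; norm_num
        _ = _ := by ring
    exact le_of_pow_le_pow_left₀ (by norm_num) (by positivity) this
  have hd : x ≤ r' - r := by linarith
  refine h1.trans ?_
  have hw' : w = P ^ 2 / a ^ 4 := by rw [ha4]; field_simp; linarith
  calc 92000 * (Q ^ 3 / p) / (w * (r' - r) ^ 2) ≤ 92000 * (Q ^ 3 / p) / (w * x ^ 2) := by gcongr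
    _ = 92000 * ((a * Q) ^ 3 * a / (p * P ^ 2 * y ^ 8)) := by
        rw [hw', ← hy4]; field_simp
    _ ≤ 92000 * ((2 * (y * P) ^ 3) * a / (p * P ^ 2 * y ^ 8)) := by gcongr
    _ = _ := by field_simp; norm_num

lemma Box.HS (b : Box C₀ m r₀ S₀ l w) (K : Ker B γ m k k') {lo : ℝ}
    (hlo : S₀ - w ≤ lo) (hlo' : lo ≤ S₀) :
    ∫⁻ s in Ioo lo (lo + w), ∫⁻ r in Ioo r₀ (r₀ + l), ofReal (k (r * s) ^ 2) ≤ 4802 := by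
  have hl := b.hl
  have hw := b.hw
  have p1 := b.pp (r := r₀ + l) (by linarith)
  have e : ∀ s ∈ Ioo lo (lo + w), ∫⁻ r in Ioo r₀ (r₀ + l), ofReal (k (r * s) ^ 2) ≤
      ofReal (2401 / pk m S₀ (r₀ + l) ^ 2) * (2 * ofReal l) := fun s hs => by
    refine le_trans ?_ (mul_le_mul_right b.rho_int _)
    rw [← lintegral_const_mul _ ((rhk_meas (m := m) (r₀ := r₀) (S₀ := S₀) (l := l)).ennreal_ofReal.pow_const 2)]
    refine setLIntegral_mono' measurableSet_Ioo fun r hr => ?_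
    have hp := b.pp hr.1.le
    have hk := (b.kb K hr.1.le (s := s) (by rw [abs_le]; constructor <;> linarith [hs.1, hs.2])).1
    have h0 : 0 ≤ rhk m r₀ S₀ l r := div_nonneg p1.le hp.le
    rw [← ofReal_pow h0, ← ofReal_mul (by positivity)]
    apply ofReal_le_ofReal
    rw [← sq_abs]
    calc |k (r * s)| ^ 2 ≤ (49 / pk m S₀ r) ^ 2 := by gcongr
      _ = _ := by unfold rhk; field_simp; norm_num
  refine (setLIntegral_mono' measurableSet_Ioo e).trans ?_
  rw [setLIntegral_const, volume_Ioo, add_sub_cancel_left,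
    show (2:ℝ≥0∞) = ofReal 2 by simp, ← ofReal_mul (by norm_num), ← ofReal_mul (by positivity),
    ← ofReal_mul (by positivity), show (4802:ℝ≥0∞) = ofReal 4802 by simp]
  apply ofReal_le_ofReal
  have h := b.hlw
  rw [← pk_sq] at h
  have : 2401 / pk m S₀ (r₀ + l) ^ 2 * (2 * l) * w = 4802 * (l * w / pk m S₀ (r₀ + l) ^ 2) := by ring
  rw [this]
  have : l * w / pk m S₀ (r₀ + l) ^ 2 ≤ 1 := by rw [div_le_one (by positivity)]; exact h
  linarith
end
end

section
def Kop (k φ : ℝ → ℝ) (s : ℝ) : ℝ := ∫ r, k (r * s) * φ r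

def Adm (φ : ℝ → ℝ) : Prop := Measurable φ ∧ ∃ a b M, 0 < a ∧ (∀ r, |φ r| ≤ M) ∧ ∀ r, r ∉ Icc a b → φ r = 0

def NN (F : ℝ → ℝ) : ℝ≥0∞ := ∫⁻ s in Ioi 0, ofReal (F s ^ 2)

section
variable {B γ m : ℝ} {k k' : ℝ → ℝ} {φ ψ : ℝ → ℝ}

lemma Adm.mono (h : Adm φ) (hψ : Measurable ψ) (hle : ∀ r, |ψ r| ≤ |φ r|) : Adm ψ := by
  obtain ⟨h1, a, b, M, ha, hM, h0⟩ := h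
  refine ⟨hψ, a, b, M, ha, fun r => (hle r).trans (hM r), fun r hr => ?_⟩
  have := hle r
  rw [h0 r hr, abs_zero] at this
  exact abs_eq_zero.1 (le_antisymm this (abs_nonneg _))

lemma Adm.ind (h : Adm φ) {s : Set ℝ} (hs : MeasurableSet s) : Adm (s.indicator φ) :=
  h.mono (h.1.indicator hs) fun r => by
    by_cases hr : r ∈ s <;> simp [hr]

lemma Adm.lin (h : Adm φ) (h' : Adm ψ) (c : ℝ) : Adm (fun r => φ r + c * ψ r) := by
  obtain ⟨h1, a, b, M, ha, hM, h0⟩ := h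
  obtain ⟨h1', a', b', M', ha', hM', h0'⟩ := h'
  refine ⟨by fun_prop, min a a', max b b', M + |c| * M', by positivity, fun r => ?_, fun r hr => ?_⟩
  · refine (abs_add_le _ _).trans ?_
    rw [abs_mul]
    gcongr
    · exact hM r
    · exact hM' r
  · show φ r + c * ψ r = 0
    rw [h0 r, h0' r]; · simp
    · intro h; exact hr ⟨(min_le_right _ _).trans h.1, h.2.trans (le_max_right _ _)⟩
    · intro h; exact hr ⟨(min_le_left _ _).trans h.1, h.2.trans (le_max_left _ _)⟩

lemma Adm.iso (h : Adm φ) (K : Ker B γ m k k') : NN (Kop k φ) = ∫⁻ r, ofReal (φ r ^ 2) := by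
  obtain ⟨h1, a, b, M, ha, hM, h0⟩ := h
  exact K.iso φ a b M h1 ha hM h0

lemma Adm.fin (h : Adm φ) : ∫⁻ r, ofReal (φ r ^ 2) < ⊤ := by
  obtain ⟨h1, a, b, M, ha, hM, h0⟩ := h
  have : ∀ r, ofReal (φ r ^ 2) ≤ (Icc a b).indicator (fun _ => ofReal (M ^ 2)) r := fun r => by
    by_cases hr : r ∈ Icc a b
    · rw [indicator_of_mem hr]
      apply ofReal_le_ofReal
      rw [← sq_abs]; have := hM r; gcongr
    · rw [h0 r hr]; simp
  refine (lintegral_mono this).trans_lt ?_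
  rw [lintegral_indicator measurableSet_Icc, setLIntegral_const, volume_Icc]
  exact ENNReal.mul_lt_top ENNReal.ofReal_lt_top ENNReal.ofReal_lt_top

/-- pointwise domination -/
lemma Adm.dom (h : Adm φ) (K : Ker B γ m k k') {hi : ℝ} : ∃ c, ∃ D : ℝ → ℝ, Integrable D ∧ Measurable D ∧ (∀ r, 0 ≤ D r) ∧
    (∀ r s, 0 < s → s ≤ hi → |k (r * s) * φ r| ≤ D r) ∧ ∫ r, D r ≤ c := by
  obtain ⟨h1, a, b, M, ha, hM, h0⟩ := h
  have hM0 : 0 ≤ M := (abs_nonneg _).trans (hM 0)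
  refine ⟨_, (Icc a b).indicator fun _ => |B| * (max b 0 * max hi 0) ^ γ * M, ?_, ?_, ?_, ?_, le_rfl⟩
  · rw [integrable_indicator_iff measurableSet_Icc]
    exact integrableOn_const (by simp)
  · exact measurable_const.indicator measurableSet_Icc
  · intro r; apply Set.indicator_nonneg; intro r _; positivity
  · intro r s hs hs'
    by_cases hr : r ∈ Icc a b
    · rw [indicator_of_mem hr, abs_mul]
      have hr0 : 0 < r := ha.trans_le hr.1
      have := K.hB (r * s) (by positivity)
      have hγ := K.hγ
      have e : B * (r * s) ^ γ ≤ |B| * (max b 0 * max hi 0) ^ γ := by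
        refine mul_le_mul (le_abs_self _) ?_ (by positivity) (abs_nonneg _)
        apply rpow_le_rpow (by positivity) _ hγ
        exact mul_le_mul (hr.2.trans (le_max_left _ _)) (hs'.trans (le_max_left _ _)) hs.le (le_max_right _ _)
      exact mul_le_mul (this.trans e) (hM r) (abs_nonneg _) (by positivity)
    · rw [h0 r hr, indicator_of_notMem hr]; simp

lemma Adm.integ (h : Adm φ) (K : Ker B γ m k k') {s : ℝ} (hs : 0 < s) : Integrable (fun r => k (r * s) * φ r) := by
  obtain ⟨c, D, hD, hDm, h0, h1, -⟩ := h.dom K (hi := s)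
  have := K.meas
  have := h.1
  refine hD.mono' (by fun_prop) (Eventually.of_forall fun r => ?_)
  exact h1 r s hs le_rfl

lemma Kop_meas (hk : Measurable k) (hφ : Measurable φ) : Measurable (Kop k φ) := by
  unfold Kop
  have : Measurable (fun p : ℝ × ℝ => k (p.2 * p.1) * φ p.2) := by fun_prop
  exact this.stronglyMeasurable.integral_prod_right.measurable

lemma Kop_lin (K : Ker B γ m k k') (h : Adm φ) (h' : Adm ψ) (c : ℝ) {s : ℝ} (hs : 0 < s) :
    Kop k (fun r => φ r + c * ψ r) s = Kop k φ s + c * Kop k ψ s := by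
  unfold Kop
  rw [← integral_const_mul, ← integral_add (h.integ K hs) ((h'.integ K hs).const_mul c)]
  congr 1; ext r; ring

lemma memL2 {F : ℝ → ℝ} (hF : Measurable F) (h : NN F < ⊤) : MemLp F 2 (volume.restrict (Ioi 0)) := by
  rw [memLp_two_iff_integrable_sq hF.aestronglyMeasurable]
  refine ⟨(hF.pow_const 2).aestronglyMeasurable, ?_⟩
  rw [hasFiniteIntegral_iff_ofReal (Eventually.of_forall fun s => sq_nonneg _)]
  exact h

lemma NN_real {F : ℝ → ℝ} (hF : Measurable F) (h : NN F < ⊤) :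
    NN F = ofReal (∫ s in Ioi 0, F s ^ 2) := by
  rw [ofReal_integral_eq_lintegral_ofReal (memL2 hF h).integrable_sq (Eventually.of_forall fun s => sq_nonneg _)]
  rfl

lemma NN_add_le {F G : ℝ → ℝ} (hF : Measurable F) (hG : Measurable G) : NN (fun s => F s + G s) ≤ 2 * NN F + 2 * NN G := by
  unfold NN
  rw [← lintegral_const_mul _ (by fun_prop), ← lintegral_const_mul _ (by fun_prop), ← lintegral_add_left (by fun_prop)]
  refine lintegral_mono fun s => ?_
  rw [show (2:ℝ≥0∞) = ofReal 2 by simp, ← ofReal_mul (by norm_num), ← ofReal_mul (by norm_num),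
    ← ofReal_add (by positivity) (by positivity)]
  exact ofReal_le_ofReal (by nlinarith [sq_nonneg (F s - G s)])

lemma NN_mono {F G : ℝ → ℝ} (h : ∀ s, 0 < s → |F s| ≤ |G s|) : NN F ≤ NN G := by
  refine setLIntegral_mono' measurableSet_Ioi fun s hs => ofReal_le_ofReal ?_
  rw [sq_le_sq]; exact h s hs

lemma NN_congr {F G : ℝ → ℝ} (h : ∀ s, 0 < s → F s = G s) : NN F = NN G := by
  refine setLIntegral_congr_fun measurableSet_Ioi fun s hs => ?_
  simp only [h s hs]

lemma sq_expand {F G : ℝ → ℝ} (hF : Measurable F) (hG : Measurable G) (h : NN F < ⊤) (h' : NN G < ⊤) (c : ℝ) :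
    ∫ s in Ioi 0, (F s + c * G s) ^ 2 = (∫ s in Ioi 0, F s ^ 2) + c ^ 2 * (∫ s in Ioi 0, G s ^ 2) +
      2 * c * ∫ s in Ioi 0, F s * G s := by
  have i1 := (memL2 hF h).integrable_sq
  have i2 := ((memL2 hG h').integrable_sq).const_mul (c ^ 2)
  have i3 : Integrable (fun s => F s * G s) (volume.restrict (Ioi 0)) := (memL2 hF h).integrable_mul (memL2 hG h')
  have i4 := i3.const_mul (2 * c)
  have i5 : Integrable (fun s => F s ^ 2 + c ^ 2 * G s ^ 2) (volume.restrict (Ioi 0)) := i1.add i2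
  have e : ∀ s, (F s + c * G s) ^ 2 = F s ^ 2 + c ^ 2 * G s ^ 2 + 2 * c * (F s * G s) := fun s => by ring
  simp only [e]
  rw [integral_add i5 i4, integral_add i1 i2, integral_const_mul, integral_const_mul]

lemma NN_add_cross {F G : ℝ → ℝ} (hF : Measurable F) (hG : Measurable G) (h : NN F < ⊤) (h' : NN G < ⊤) :
    NN (fun s => F s + G s) ≤ NN F + NN G + 2 * ofReal |∫ s in Ioi 0, F s * G s| := by
  have h2 : NN (fun s => F s + G s) < ⊤ :=
    (NN_add_le hF hG).trans_lt (by finiteness)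
  rw [NN_real (F := fun s => F s + G s) (hF.add hG) h2, NN_real hF h, NN_real hG h', show (2:ℝ≥0∞) = ofReal 2 by simp, ← ofReal_mul (by norm_num),
    ← ofReal_add (integral_nonneg fun s => sq_nonneg _) (integral_nonneg fun s => sq_nonneg _),
    ← ofReal_add (add_nonneg (integral_nonneg fun s => sq_nonneg _) (integral_nonneg fun s => sq_nonneg _)) (by positivity)]
  apply ofReal_le_ofReal
  have := sq_expand hF hG h h' 1
  simp only [one_mul] at this
  rw [this]
  have := le_abs_self (∫ s in Ioi 0, F s * G s)
  linarith

lemma Kop_NN_fin (K : Ker B γ m k k') (h : Adm φ) : NN (Kop k φ) < ⊤ := by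
  rw [h.iso K]; exact h.fin

lemma Kop_orth (K : Ker B γ m k k') (h : Adm φ) (h' : Adm ψ) (hd : ∀ r, φ r * ψ r = 0) :
    ∫ s in Ioi 0, Kop k φ s * Kop k ψ s = 0 := by
  have m1 := Kop_meas K.meas h.1
  have m2 := Kop_meas K.meas h'.1
  have f1 := Kop_NN_fin K h
  have f2 := Kop_NN_fin K h'
  have e : ∀ c : ℝ, c ^ 2 = 1 → ofReal (∫ s in Ioi 0, (Kop k φ s + c * Kop k ψ s) ^ 2) =
      ∫⁻ r, ofReal (φ r ^ 2 + ψ r ^ 2) := fun c hc => by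
    have m3 : Measurable (fun s => Kop k φ s + c * Kop k ψ s) := m1.add (m2.const_mul c)
    have e1 : NN (fun s => Kop k φ s + c * Kop k ψ s) = NN (Kop k (fun r => φ r + c * ψ r)) :=
      NN_congr fun s hs => (Kop_lin K h h' c hs).symm
    rw [← NN_real m3 (e1 ▸ Kop_NN_fin K (h.lin h' c)), e1, (h.lin h' c).iso K]
    congr 1; ext r; congr 1
    have := hd r
    linear_combination (ψ r ^ 2) * hc + 2 * c * this
  have e3 := (e 1 (by norm_num)).trans (e (-1) (by norm_num)).symm
  rw [ENNReal.ofReal_eq_ofReal_iff (integral_nonneg fun s => sq_nonneg _) (integral_nonneg fun s => sq_nonneg _),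
    sq_expand m1 m2 f1 f2, sq_expand m1 m2 f1 f2] at e3
  linarith

end
end

section
def wgt (lo w s : ℝ) : ℝ := if s ≤ lo then 1 else if s ≤ lo + w then bet lo w s else 0

section
variable {B γ m C₀ r₀ S₀ l w lo : ℝ} {k k' : ℝ → ℝ} {φ ψ : ℝ → ℝ}

lemma wgt_meas : Measurable (wgt lo w) := by
  unfold wgt bet
  refine Measurable.ite (measurableSet_Iic) measurable_const (Measurable.ite measurableSet_Iic (by fun_prop) measurable_const)

lemma wgt_bds (hw : 0 < w) (s : ℝ) : 0 ≤ wgt lo w s ∧ wgt lo w s ≤ 1 := by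
  unfold wgt
  split_ifs with h1 h2
  · simp
  · exact ⟨(bet_bds hw ⟨by linarith, h2⟩).2.2.1, (bet_bds hw ⟨by linarith, h2⟩).2.2.2⟩
  · simp

lemma wgt_Gam (K : Ker B γ m k k') {r r' : ℝ} (hr : 0 < r) (hr' : 0 < r') (hlo : 0 < lo) (hw : 0 < w) :
    ∫ s in Ioc 0 (lo + w), wgt lo w s * (k (r * s) * k (r' * s)) = Gam k r r' lo w := by
  have h1 := K.intAB hr hr' hlo
  have h2 := K.intAB hr hr' (show 0 < lo + w by linarith)
  have h3 : IntegrableOn (fun s => wgt lo w s * (k (r * s) * k (r' * s))) (Ioc 0 (lo + w)) := by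
    rw [intervalIntegrable_iff_integrableOn_Ioc_of_le (by linarith)] at h2
    refine Integrable.bdd_mul (c := 1) h2 wgt_meas.aestronglyMeasurable (Eventually.of_forall fun s => ?_)
    rw [norm_eq_abs, abs_of_nonneg (wgt_bds hw s).1]
    exact (wgt_bds hw s).2
  rw [← Set.Ioc_union_Ioc_eq_Ioc hlo.le (by linarith : lo ≤ lo + w)] at h3 ⊢
  rw [setIntegral_union (by
    rw [Set.disjoint_left]; intro s hs hs'; linarith [hs.2, hs'.1]) measurableSet_Ioc h3.left_of_union h3.right_of_union]
  unfold Gam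
  rw [intervalIntegral.integral_of_le hlo.le, intervalIntegral.integral_of_le (by linarith)]
  congr 1
  · refine setIntegral_congr_fun measurableSet_Ioc fun s hs => ?_
    simp [wgt, hs.2]
  · refine setIntegral_congr_fun measurableSet_Ioc fun s hs => ?_
    simp [wgt, hs.2, not_le.2 hs.1]

lemma fub (K : Ker B γ m k k') (h : Adm φ) (h' : Adm ψ) (hlo : 0 < lo) (hw : 0 < w) :
    ∫ s in Ioi 0, wgt lo w s * Kop k φ s * Kop k ψ s = ∫ p : ℝ × ℝ, φ p.1 * ψ p.2 * Gam k p.1 p.2 lo w := by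
  have km := K.meas
  have e1 : ∫ s in Ioi 0, wgt lo w s * Kop k φ s * Kop k ψ s =
      ∫ s in Ioc 0 (lo + w), ∫ p : ℝ × ℝ, wgt lo w s * ((k (p.1 * s) * φ p.1) * (k (p.2 * s) * ψ p.2)) := by
    have : ∀ s ∈ Ioc 0 (lo + w), ∫ p : ℝ × ℝ, wgt lo w s * ((k (p.1 * s) * φ p.1) * (k (p.2 * s) * ψ p.2)) =
      wgt lo w s * Kop k φ s * Kop k ψ s := fun s hs => by
      rw [integral_const_mul, Measure.volume_eq_prod, integral_prod_mul (fun r => k (r * s) * φ r) (fun r => k (r * s) * ψ r), mul_assoc]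
      rfl
    rw [setIntegral_congr_fun measurableSet_Ioc this]
    apply setIntegral_eq_of_subset_of_forall_sdiff_eq_zero measurableSet_Ioi
    · intro s hs; exact hs.1
    · intro s hs
      have h1 : 0 < s := hs.1
      have h2 : ¬ s ≤ lo + w := fun hh => hs.2 ⟨h1, hh⟩
      have : wgt lo w s = 0 := by unfold wgt; rw [if_neg (by linarith), if_neg h2]
      simp [this]
  rw [e1]
  obtain ⟨-, D, hD, hDm, hD0, hD1, -⟩ := h.dom K (hi := lo + w)
  obtain ⟨-, D', hD', hDm', hD0', hD1', -⟩ := h'.dom K (hi := lo + w)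
  have m1 := h.1
  have m2 := h'.1
  have mw := wgt_meas (lo := lo) (w := w)
  rw [integral_integral_swap]
  · congr 1; ext p
    have : ∀ s, wgt lo w s * ((k (p.1 * s) * φ p.1) * (k (p.2 * s) * ψ p.2)) =
      (φ p.1 * ψ p.2) * (wgt lo w s * (k (p.1 * s) * k (p.2 * s))) := fun s => by ring
    simp only [this]
    rw [integral_const_mul]
    by_cases hp : 0 < p.1 ∧ 0 < p.2
    · rw [wgt_Gam K hp.1 hp.2 hlo hw]
    · have : φ p.1 * ψ p.2 = 0 := by
        obtain ⟨h1, a, b, M, ha, hM, h0⟩ := h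
        obtain ⟨h1', a', b', M', ha', hM', h0'⟩ := h'
        rw [not_and_or] at hp
        rcases hp with hp | hp
        · rw [h0 p.1 (fun h => hp (ha.trans_le h.1))]; simp
        · rw [h0' p.2 (fun h => hp (ha'.trans_le h.1))]; simp
      rw [this]; simp
  · have i1 : Integrable (fun q : ℝ × (ℝ × ℝ) => (1:ℝ) * (D q.2.1 * D' q.2.2)) ((volume.restrict (Ioc 0 (lo + w))).prod volume) :=
      Integrable.mul_prod (f := fun _ => (1:ℝ)) (g := fun p : ℝ × ℝ => D p.1 * D' p.2) (integrable_const _) (Integrable.mul_prod hD hD')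
    refine i1.mono' ?_ ?_
    · apply Measurable.aestronglyMeasurable
      unfold Function.uncurry
      fun_prop
    · have : ∀ᵐ q : ℝ × (ℝ × ℝ) ∂((volume.restrict (Ioc 0 (lo + w))).prod volume), q.1 ∈ Ioc 0 (lo + w) :=
        Measure.quasiMeasurePreserving_fst.ae (ae_restrict_mem measurableSet_Ioc)
      filter_upwards [this] with q hq
      simp only [Function.uncurry]
      rw [norm_mul, norm_mul, norm_eq_abs, abs_of_nonneg (wgt_bds hw _).1]
      exact mul_le_mul (wgt_bds hw _).2 (mul_le_mul (hD1 _ _ hq.1 hq.2) (hD1' _ _ hq.1 hq.2) (norm_nonneg _) (hD0 _)) (by positivity) (by norm_num)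

lemma box_cross (b : Box C₀ m r₀ S₀ l w) (K : Ker B γ m k k') (hw : 0 < w)
    (he : l * w = √(qf m ((r₀ + l) * S₀))) {g : ℝ → ℝ} (hg : Adm g) {c : ℝ}
    (hlo : S₀ - w ≤ lo) (hlo' : lo ≤ S₀) :
    ofReal |∫ s in Ioi 0, wgt lo w s * Kop k ((Ioc r₀ (r₀ + l)).indicator g) s *
        Kop k ((Ioc (r₀ + l) c).indicator g) s| ≤
      184000 * 192 * ∫⁻ r in Ioc r₀ (r₀ + l), (ofReal |g r| ^ 2 + HLM (fun r => ofReal |g r|) r ^ 2) := by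
  have hl := b.hl
  have hl0 : 0 < lo := by
    have := (b.s_bds (s := lo) (by rw [abs_le]; constructor <;> linarith)).1
    linarith [b.hS]
  have gm := hg.1
  rw [fub K (hg.ind measurableSet_Ioc) (hg.ind measurableSet_Ioc) hl0 hw, ← norm_eq_abs, ofReal_norm]
  refine (enorm_integral_le_lintegral_enorm _).trans ?_
  obtain ⟨f, hf⟩ : ∃ f : ℝ → ℝ≥0∞, f = fun r => ofReal |g r| := ⟨_, rfl⟩
  have fm : Measurable f := by rw [hf]; fun_prop
  obtain ⟨ρ, hρ⟩ : ∃ f : ℝ → ℝ≥0∞, f = fun r => ofReal (rhk m r₀ S₀ l r) := ⟨_, rfl⟩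
  have ρm : Measurable ρ := by rw [hρ]; exact rhk_meas.ennreal_ofReal
  obtain ⟨E, hE⟩ : ∃ E : ℝ × ℝ → ℝ≥0∞, E = fun p => (Ioc r₀ (r₀ + l)).indicator (fun r => f r * ρ r) p.1 *
    ((Ioc (r₀ + l) (r₀ + l + l)).indicator f p.2 * ofReal (1 / (p.2 - p.1)) +
     (Ioi (r₀ + l + l)).indicator f p.2 * ofReal (l ^ (1/4:ℝ) * (p.2 - (r₀ + l)) ^ (-(5/4):ℝ))) := ⟨_, rfl⟩
  have Em : Measurable E := by
    have h1 : Measurable ((Ioc r₀ (r₀ + l)).indicator (fun r => f r * ρ r)) := (fm.mul ρm).indicator measurableSet_Ioc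
    have h2 : Measurable ((Ioc (r₀ + l) (r₀ + l + l)).indicator f) := fm.indicator measurableSet_Ioc
    have h3 : Measurable ((Ioi (r₀ + l + l)).indicator f) := fm.indicator measurableSet_Ioi
    rw [hE]
    fun_prop
  have hpt : ∀ p : ℝ × ℝ, ‖(Ioc r₀ (r₀ + l)).indicator g p.1 * (Ioc (r₀ + l) c).indicator g p.2 * Gam k p.1 p.2 lo w‖ₑ ≤
      184000 * E p := by
    intro p
    by_cases h1 : p.1 ∈ Ioc r₀ (r₀ + l)
    swap
    · simp [h1]
    by_cases h2 : p.2 ∈ Ioc (r₀ + l) c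
    swap
    · simp [h2]
    have hρ0 : 0 ≤ rhk m r₀ S₀ l p.1 := div_nonneg (b.pp (by linarith)).le (b.pp h1.1.le).le
    rw [indicator_of_mem h1, indicator_of_mem h2, hE]
    simp only [indicator_of_mem h1]
    rw [← ofReal_norm, norm_mul, norm_mul, norm_eq_abs, norm_eq_abs, norm_eq_abs]
    have c184 : (184000:ℝ≥0∞) = ofReal 184000 := by simp
    by_cases h3 : p.2 ≤ r₀ + l + l
    · have h4 : p.2 ∈ Ioc (r₀ + l) (r₀ + l + l) := ⟨h2.1, h3⟩
      have h5 : p.2 ∉ Ioi (r₀ + l + l) := not_lt.2 h3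
      rw [indicator_of_mem h4, indicator_of_notMem h5, zero_mul, add_zero, hf, hρ]
      simp only
      have hd : 0 < p.2 - p.1 := by linarith [h1.2, h2.1]
      rw [c184, ← ofReal_mul (by positivity), ← ofReal_mul (by positivity), ← ofReal_mul (by positivity),
        ← ofReal_mul (by positivity)]
      apply ofReal_le_ofReal
      have := b.Gam1 K hw h1.1.le h1.2 h2.1 h3 hlo hlo'
      refine (mul_le_mul_of_nonneg_left this (by positivity)).trans (le_of_eq ?_)
      ring
    · push Not at h3
      have h4 : p.2 ∉ Ioc (r₀ + l) (r₀ + l + l) := fun h => by linarith [h.2]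
      have h5 : p.2 ∈ Ioi (r₀ + l + l) := h3
      rw [indicator_of_mem h5, indicator_of_notMem h4, zero_mul, zero_add, hf, hρ]
      simp only
      have hd : 0 < p.2 - (r₀ + l) := by linarith [h1.2, h2.1]
      rw [c184, ← ofReal_mul (by positivity), ← ofReal_mul (by positivity), ← ofReal_mul (by positivity),
        ← ofReal_mul (by positivity)]
      apply ofReal_le_ofReal
      have := b.Gam2 K hw he h1.1.le h1.2 h3 hlo hlo'
      refine (mul_le_mul_of_nonneg_left this (by positivity)).trans (le_of_eq ?_)
      ring
  refine (lintegral_mono hpt).trans ?_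
  rw [lintegral_const_mul _ Em, mul_assoc]
  refine mul_le_mul_right ?_ _
  rw [Measure.volume_eq_prod, lintegral_prod _ Em.aemeasurable]
  have e2 : ∀ r, ∫⁻ r', E (r, r') = (Ioc r₀ (r₀ + l)).indicator (fun r => f r * ρ r * crossI f (r₀ + l) l r) r := by
    intro r
    rw [hE]
    simp only
    have h2 : Measurable ((Ioc (r₀ + l) (r₀ + l + l)).indicator f) := fm.indicator measurableSet_Ioc
    have h3 : Measurable ((Ioi (r₀ + l + l)).indicator f) := fm.indicator measurableSet_Ioi
    rw [lintegral_const_mul _ (by fun_prop), lintegral_add_left (by fun_prop)]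
    by_cases h1 : r ∈ Ioc r₀ (r₀ + l)
    · rw [indicator_of_mem h1, indicator_of_mem h1]
      unfold crossI
      rw [← lintegral_indicator measurableSet_Ioc, ← lintegral_indicator measurableSet_Ioi]
      congr 2
      · congr 1; ext r'; by_cases h : r' ∈ Ioc (r₀ + l) (r₀ + l + l) <;> simp [h]
      · congr 1; ext r'; by_cases h : r' ∈ Ioi (r₀ + l + l) <;> simp [h]
    · rw [indicator_of_notMem h1, indicator_of_notMem h1, zero_mul]
  simp only [e2]
  rw [lintegral_indicator measurableSet_Ioc, ← setLIntegral_congr (Ioo_ae_eq_Ioc (a := r₀) (b := r₀ + l)),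
    ← setLIntegral_congr (Ioo_ae_eq_Ioc (a := r₀) (b := r₀ + l))]
  have := cross_bd (f := f) (ρ := ρ) (r₀ := r₀) (r₁ := r₀ + l) fm ρm (by linarith) (by
    rw [add_sub_cancel_left, hρ]; exact b.rho_int) (by
    intro r hr h2
    rw [add_sub_cancel_left] at h2
    rw [hρ, show (2:ℝ≥0∞) = ofReal 2 by simp]
    exact ofReal_le_ofReal (b.rho_two hr.1 hr.2.le h2))
  rw [add_sub_cancel_left] at this
  rw [hf] at this ⊢
  exact this
end
end

section
structure Cfg (C₀ : ℝ) (S : ℝ → ℝ) : Prop where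
  hC : 1 ≤ C₀
  meas : Measurable S
  cont : ContinuousOn S (Ioi 0)
  pos : ∀ r, 0 < r → 0 < S r
  lip : ∀ r r', 0 < r → r ≤ r' → |S r' - S r| ≤ C₀ * S r * (r' - r) / r

def Dir (S : ℝ → ℝ) (L : ℝ → Set ℝ) : Prop :=
  (MonotoneOn S (Ioi 0) ∧ L = fun r => Iic (S r)) ∨ (AntitoneOn S (Ioi 0) ∧ L = fun r => Ioi (S r))

section
variable {B γ m C₀ a c : ℝ} {k k' S : ℝ → ℝ} {L : ℝ → Set ℝ}

lemma Dir.sub (h : Dir S L) {r r' : ℝ} (hr : 0 < r) (hrr : r ≤ r') : L r ⊆ L r' := by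
  rcases h with ⟨h, rfl⟩ | ⟨h, rfl⟩
  · exact Set.Iic_subset_Iic.2 (h hr (hr.trans_le hrr) hrr)
  · exact Set.Ioi_subset_Ioi (h hr (hr.trans_le hrr) hrr)

lemma Dir.meas (h : Dir S L) (r : ℝ) : MeasurableSet (L r) := by
  rcases h with ⟨h, rfl⟩ | ⟨h, rfl⟩
  · exact measurableSet_Iic
  · exact measurableSet_Ioi

lemma Dir.diff (h : Dir S L) {r r' : ℝ} (hr : 0 < r) (hrr : r ≤ r') :
    ∃ lo, L r' \ L r = Ioc lo (lo + |S r' - S r|) ∧ S r - |S r' - S r| ≤ lo ∧ lo ≤ S r ∧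
      ((lo = S r ∧ lo + |S r' - S r| = S r' ∧ L = fun r => Iic (S r)) ∨
       (lo = S r' ∧ lo + |S r' - S r| = S r ∧ L = fun r => Ioi (S r))) := by
  rcases h with ⟨h, rfl⟩ | ⟨h, rfl⟩
  · have := h hr (hr.trans_le hrr) hrr
    rw [abs_of_nonneg (by linarith)]
    refine ⟨S r, ?_, by linarith, le_rfl, Or.inl ⟨rfl, by ring, rfl⟩⟩
    ext s; simp [and_comm]
  · have := h hr (hr.trans_le hrr) hrr
    rw [abs_of_nonpos (by linarith)]
    refine ⟨S r', ?_, by linarith, this, Or.inr ⟨rfl, by ring, rfl⟩⟩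
    ext s; simp

lemma box_lemma (K : Ker B γ m k k') (cf : Cfg C₀ S) (dir : Dir S L) (ha : 0 < a) (hac : a < c)
    (good : ug (200 * C₀) m ≤ a * S a) :
    ∃ r₁, a < r₁ ∧ r₁ ≤ c ∧ (r₁ = c ∨ √(qf m (a * S a)) ≤ (r₁ - a) * |S r₁ - S a|) ∧
    ∃ α : ℝ → ℝ, Measurable α ∧ (∀ s, 0 ≤ α s ∧ α s ≤ 1) ∧ (∀ s, s ∈ L a → α s = 1) ∧
      (∀ s, s ∉ L r₁ → α s = 0) ∧
      (∫⁻ s in L r₁ \ L a, ∫⁻ r in Ioc a r₁, ofReal (k (r * s) ^ 2) ≤ 4802) ∧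
      ∀ g, Adm g → ofReal |∫ s in Ioi 0, α s * Kop k ((Ioc a r₁).indicator g) s *
        Kop k ((Ioc r₁ c).indicator g) s| ≤
      184000 * 192 * ∫⁻ r in Ioc a r₁, (ofReal |g r| ^ 2 + HLM (fun r => ofReal |g r|) r ^ 2) := by
  have mkbox : ∀ r₁, a < r₁ → (r₁ - a) * |S r₁ - S a| ≤ √(qf m (r₁ * S a)) →
      Box C₀ m a (S a) (r₁ - a) |S r₁ - S a| := fun r₁ h1 h2 => by
    refine ⟨cf.hC, ha, cf.pos a ha, good, by linarith, abs_nonneg _, ?_, ?_⟩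
    · rwa [add_sub_cancel]
    · exact cf.lip a r₁ ha h1.le
  have HS : ∀ r₁, a < r₁ → (r₁ - a) * |S r₁ - S a| ≤ √(qf m (r₁ * S a)) →
      ∫⁻ s in L r₁ \ L a, ∫⁻ r in Ioc a r₁, ofReal (k (r * s) ^ 2) ≤ 4802 := fun r₁ h1 h2 => by
    have b := mkbox r₁ h1 h2
    obtain ⟨lo, e1, e2, e3, -⟩ := dir.diff ha h1.le
    have := b.HS K e2 e3
    rw [add_sub_cancel] at this
    rw [e1, ← setLIntegral_congr Ioo_ae_eq_Ioc]
    refine le_trans (le_of_eq ?_) this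
    refine setLIntegral_congr_fun measurableSet_Ioo fun s hs => ?_
    exact (setLIntegral_congr (Ioo_ae_eq_Ioc (a := a) (b := r₁))).symm
  by_cases hc : (c - a) * |S c - S a| ≤ √(qf m (c * S a))
  · refine ⟨c, hac, le_rfl, Or.inl rfl, (L a).indicator (fun _ => 1), measurable_const.indicator (dir.meas a), ?_, ?_, ?_,
      HS c hac hc, ?_⟩
    · intro s; by_cases h : s ∈ L a <;> simp [h]
    · intro s h; simp [h]
    · intro s h
      have : s ∉ L a := fun h' => h (dir.sub ha hac.le h')
      simp [this]
    · intro g hg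
      simp [Kop]
  · push Not at hc
    have hcont : ContinuousOn (fun r => (r - a) * |S r - S a| - √(qf m (r * S a))) (Icc a c) := by
      have cS : ContinuousOn S (Icc a c) := cf.cont.mono fun r hr => ha.trans_le hr.1
      have cq : ContinuousOn (fun r => √(qf m (r * S a))) (Icc a c) := by
        unfold qf
        refine ContinuousOn.sqrt (continuousOn_const.sub (continuousOn_const.div (by fun_prop) fun r hr => ?_))
        exact (pow_pos (mul_pos (ha.trans_le hr.1) (cf.pos a ha)) 2).ne'
      fun_prop
    have hiv := intermediate_value_Icc hac.le hcont
    obtain ⟨r₁, hr₁, he⟩ := hiv (show (0:ℝ) ∈ _ from ⟨by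
      simp only [sub_self, zero_mul, zero_sub]; exact neg_nonpos.2 (sqrt_nonneg _), by linarith⟩)
    simp only at he
    have he' : (r₁ - a) * |S r₁ - S a| = √(qf m (r₁ * S a)) := by linarith
    have q0 : 0 < qf m (a * S a) := (ug_good (by linarith [cf.hC]) good).2.1
    have q1 : qf m (a * S a) ≤ qf m (r₁ * S a) :=
      qf_mono (mul_pos ha (cf.pos a ha)) (mul_le_mul_of_nonneg_right hr₁.1 (cf.pos a ha).le)
    have hpos : 0 < (r₁ - a) * |S r₁ - S a| := by rw [he']; exact sqrt_pos.2 (q0.trans_le q1)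
    have har : a < r₁ := by
      rcases hr₁.1.eq_or_lt with h | h
      · rw [← h] at hpos; simp at hpos
      · exact h
    have hw : 0 < |S r₁ - S a| := pos_of_mul_pos_right hpos (by linarith)
    have b := mkbox r₁ har he'.le
    obtain ⟨lo, e1, e2, e3, e4⟩ := dir.diff ha har.le
    have cr : ∀ g, Adm g → _ := fun g hg => box_cross b K hw (by rw [add_sub_cancel]; exact he') hg (c := c) e2 e3
    simp only [add_sub_cancel] at cr
    refine ⟨r₁, har, hr₁.2, Or.inr (by rw [he']; exact sqrt_le_sqrt q1), ?_⟩
    rcases e4 with ⟨d1, d2, rfl⟩ | ⟨d1, d2, rfl⟩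
    · refine ⟨wgt lo |S r₁ - S a|, wgt_meas, wgt_bds hw, ?_, ?_, HS r₁ har he'.le, cr⟩
      · intro s hs
        have : s ≤ lo := by rw [d1]; exact hs
        simp [wgt, this]
      · intro s hs
        have : ¬ s ≤ lo + |S r₁ - S a| := by rw [d2]; exact hs
        unfold wgt; rw [if_neg (by linarith), if_neg this]
    · refine ⟨fun s => 1 - wgt lo |S r₁ - S a| s, measurable_const.sub wgt_meas, ?_, ?_, ?_, HS r₁ har he'.le, ?_⟩
      · intro s; have := wgt_bds (lo := lo) hw s; constructor <;> linarith [this.1, this.2]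
      · intro s hs
        have : ¬ s ≤ lo + |S r₁ - S a| := by rw [d2]; exact not_le.2 hs
        have h2 : wgt lo |S r₁ - S a| s = 0 := by unfold wgt; rw [if_neg (by linarith), if_neg this]
        simp [h2]
      · intro s hs
        have : s ≤ lo := by rw [d1]; exact not_lt.1 hs
        simp [wgt, this]
      · intro g hg
        have A1 := hg.ind (measurableSet_Ioc (a := a) (b := r₁))
        have A2 := hg.ind (measurableSet_Ioc (a := r₁) (b := c))
        have o := Kop_orth K A1 A2 (fun r => by
          by_cases h : r ∈ Ioc a r₁
          · have : r ∉ Ioc r₁ c := fun h' => by linarith [h.2, h'.1]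
            simp [this]
          · simp [h])
        have i1 : Integrable (fun s => Kop k ((Ioc a r₁).indicator g) s *
          Kop k ((Ioc r₁ c).indicator g) s) (volume.restrict (Ioi 0)) :=
          (memL2 (Kop_meas K.meas A1.1) (Kop_NN_fin K A1)).integrable_mul (memL2 (Kop_meas K.meas A2.1) (Kop_NN_fin K A2))
        have i2 : Integrable (fun s => wgt lo |S r₁ - S a| s * (Kop k ((Ioc a r₁).indicator g) s *
          Kop k ((Ioc r₁ c).indicator g) s)) (volume.restrict (Ioi 0)) := by
          refine Integrable.bdd_mul (c := 1) i1 wgt_meas.aestronglyMeasurable (Eventually.of_forall fun s => ?_)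
          rw [norm_eq_abs, abs_of_nonneg (wgt_bds hw s).1]
          exact (wgt_bds hw s).2
        have := cr g hg
        simp only [sub_mul, one_mul]
        simp only [mul_assoc] at this ⊢
        rw [integral_sub i1 i2, o, zero_sub, abs_neg]
        exact this
end
end

section
def TL (k : ℝ → ℝ) (L : ℝ → Set ℝ) (g : ℝ → ℝ) (s : ℝ) : ℝ := ∫ r, {r | s ∈ L r}.indicator (fun r => k (r * s) * g r) r

section
variable {B γ m C₀ a c a₀ : ℝ} {k k' S g : ℝ → ℝ} {L : ℝ → Set ℝ}

lemma Dir.meas2 (h : Dir S L) (hS : Measurable S) : MeasurableSet {p : ℝ × ℝ | p.1 ∈ L p.2} := by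
  rcases h with ⟨h, rfl⟩ | ⟨h, rfl⟩
  · exact measurableSet_le measurable_fst (hS.comp measurable_snd)
  · exact measurableSet_lt (hS.comp measurable_snd) measurable_fst

lemma Dir.meas1 (h : Dir S L) (hS : Measurable S) (s : ℝ) : MeasurableSet {r : ℝ | s ∈ L r} := by
  rcases h with ⟨h, rfl⟩ | ⟨h, rfl⟩
  · exact measurableSet_le measurable_const hS
  · exact measurableSet_lt hS measurable_const

lemma TL_meas (hk : Measurable k) (hg : Measurable g) (h : Dir S L) (hS : Measurable S) : Measurable (TL k L g) := by
  unfold TL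
  have h1 : Measurable ({p : ℝ × ℝ | p.1 ∈ L p.2}.indicator (fun p => k (p.2 * p.1) * g p.2)) :=
    Measurable.indicator (by fun_prop) (h.meas2 hS)
  exact h1.stronglyMeasurable.integral_prod_right'.measurable

lemma TL_int (K : Ker B γ m k k') (hg : Adm g) (h : Dir S L) (hS : Measurable S) {s : ℝ} (hs : 0 < s) :
    Integrable ({r | s ∈ L r}.indicator (fun r => k (r * s) * g r)) :=
  (hg.integ K hs).indicator (h.meas1 hS s)

lemma sq_ofR (x : ℝ) : ofReal (x ^ 2) = ofReal |x| ^ 2 := by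
  rw [← ofReal_pow (abs_nonneg _), sq_abs]

lemma ind_sq_lint {s : Set ℝ} (hs : MeasurableSet s) : ∫⁻ r, ofReal (s.indicator g r ^ 2) = ∫⁻ r in s, ofReal |g r| ^ 2 := by
  rw [← lintegral_indicator hs]
  congr 1; ext r
  by_cases h : r ∈ s <;> simp [h, sq_ofR]

lemma CS_pt {J : Set ℝ} {E k g : ℝ → ℝ} {x : ℝ} (hk : Measurable k) (hg : Measurable g) (hx : x = ∫ r, E r) (hJ : MeasurableSet J)
    (hE : ∀ r ∈ J, |E r| ≤ |k r * g r|) (hE' : ∀ r, r ∉ J → E r = 0) :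
    ofReal (x ^ 2) ≤ (∫⁻ r in J, ofReal (k r ^ 2)) * ∫⁻ r in J, ofReal |g r| ^ 2 := by
  have h1 : ofReal |x| ≤ ∫⁻ r in J, ofReal |k r| * ofReal |g r| := by
    rw [hx, ← norm_eq_abs, ofReal_norm]
    refine (enorm_integral_le_lintegral_enorm _).trans ?_
    rw [← lintegral_indicator hJ]
    refine lintegral_mono fun r => ?_
    by_cases h : r ∈ J
    · rw [indicator_of_mem h, ← ofReal_mul (abs_nonneg _), ← abs_mul, ← ofReal_norm]
      exact ofReal_le_ofReal (hE r h)
    · simp [h, hE' r h]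
  rw [sq_ofR]
  simp only [sq_ofR (k _)]
  exact (pow_le_pow_left' h1 2).trans (cs_lint _ (by fun_prop) (by fun_prop))

def CGC : ℝ≥0∞ := 1 + 2 * (184000 * 192)

lemma GC_step (K : Ker B γ m k k') (cf : Cfg C₀ S) (dir : Dir S L) (hg : Adm g) {r₁ : ℝ} (ha : 0 < a) (har : a < r₁) (hrc : r₁ ≤ c)
    {α : ℝ → ℝ} (αm : Measurable α) (α1 : ∀ s, 0 ≤ α s ∧ α s ≤ 1) (α2 : ∀ s, s ∈ L a → α s = 1)
    (α3 : ∀ s, s ∉ L r₁ → α s = 0)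
    (HS : ∫⁻ s in L r₁ \ L a, ∫⁻ r in Ioc a r₁, ofReal (k (r * s) ^ 2) ≤ 4802)
    (cross : ofReal |∫ s in Ioi 0, α s * Kop k ((Ioc a r₁).indicator g) s *
        Kop k ((Ioc r₁ c).indicator g) s| ≤
      184000 * 192 * ∫⁻ r in Ioc a r₁, (ofReal |g r| ^ 2 + HLM (fun r => ofReal |g r|) r ^ 2))
    {F' D' : ℝ → ℝ} (Fm : Measurable F') (Dm : Measurable D')
    (hFD : ∀ s, 0 < s → TL k L ((Ioc r₁ c).indicator g) s = F' s + D' s)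
    (nF : NN F' ≤ CGC * ∫⁻ r in Ioc r₁ c, (ofReal |g r| ^ 2 + HLM (fun r => ofReal |g r|) r ^ 2))
    (nFf : NN F' < ⊤)
    (nD : NN D' ≤ 4802 * ∫⁻ r in Ioc r₁ c, ofReal |g r| ^ 2)
    (D0 : ∀ s, 0 < s → s ∈ L r₁ → D' s = 0) (F0 : ∀ s, 0 < s → s ∈ L r₁ → F' s = Kop k ((Ioc r₁ c).indicator g) s) :
    ∃ F D : ℝ → ℝ, Measurable F ∧ Measurable D ∧
      (∀ s, 0 < s → TL k L ((Ioc a c).indicator g) s = F s + D s) ∧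
      (NN F ≤ CGC * ∫⁻ r in Ioc a c, (ofReal |g r| ^ 2 + HLM (fun r => ofReal |g r|) r ^ 2)) ∧
      NN F < ⊤ ∧ (NN D ≤ 4802 * ∫⁻ r in Ioc a c, ofReal |g r| ^ 2) ∧
      (∀ s, 0 < s → s ∈ L a → D s = 0) ∧ (∀ s, 0 < s → s ∈ L a → F s = Kop k ((Ioc a c).indicator g) s) := by
  obtain ⟨φ, hφ⟩ : ∃ φ, φ = (Ioc a r₁).indicator g := ⟨_, rfl⟩
  obtain ⟨ψ, hψ⟩ : ∃ φ, φ = (Ioc r₁ c).indicator g := ⟨_, rfl⟩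
  have A1 : Adm φ := hφ ▸ hg.ind measurableSet_Ioc
  have A2 : Adm ψ := hψ ▸ hg.ind measurableSet_Ioc
  have gm := hg.1
  have hdj : Disjoint (Ioc a r₁) (Ioc r₁ c) := by
    rw [Set.disjoint_left]; intro s hs hs'; linarith [hs.2, hs'.1]
  have hun : Ioc a r₁ ∪ Ioc r₁ c = Ioc a c := Set.Ioc_union_Ioc_eq_Ioc har.le hrc
  have split : ∀ f : ℝ → ℝ≥0∞, ∫⁻ r in Ioc a c, f r = (∫⁻ r in Ioc a r₁, f r) + ∫⁻ r in Ioc r₁ c, f r := fun f => by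
    rw [← hun, lintegral_union measurableSet_Ioc hdj]
  have eg : (Ioc a c).indicator g = fun r => φ r + 1 * ψ r := by
    rw [← hun, Set.indicator_union_of_disjoint hdj, hφ, hψ]; ext r; simp
  have hsub := dir.sub ha har.le
  rw [← hφ, ← hψ] at cross
  rw [← hψ] at hFD
  simp only [← hψ] at F0
  have km := Kop_meas K.meas A1.1
  obtain ⟨X, hX⟩ : ∃ X : ℝ → ℝ, X = fun s => α s * Kop k φ s := ⟨_, rfl⟩
  have Xm : Measurable X := by rw [hX]; exact αm.mul km
  have nX : NN X ≤ ∫⁻ r in Ioc a r₁, ofReal |g r| ^ 2 := by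
    rw [← ind_sq_lint measurableSet_Ioc, ← hφ, ← A1.iso K, hX]
    apply NN_mono; intro s _
    rw [abs_mul, abs_of_nonneg (α1 s).1]
    exact mul_le_of_le_one_left (abs_nonneg _) (α1 s).2
  have nXf : NN X < ⊤ := nX.trans_lt (by
    rw [← ind_sq_lint measurableSet_Ioc, ← hφ]; exact A1.fin)
  obtain ⟨E, hE⟩ : ∃ E : ℝ → ℝ, E = fun s => TL k L φ s - X s := ⟨_, rfl⟩
  have Em : Measurable E := by rw [hE]; exact (TL_meas K.meas A1.1 dir cf.meas).sub Xm
  have Ei : ∀ s, 0 < s → E s = ∫ r, ({r | s ∈ L r}.indicator (fun r => k (r * s) * φ r) r - α s * (k (r * s) * φ r)) := fun s hs => by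
    rw [integral_sub (TL_int K A1 dir cf.meas hs) ((A1.integ K hs).const_mul _), integral_const_mul, hE, hX]
    rfl
  have hφ0 : ∀ r, r ∉ Ioc a r₁ → φ r = 0 := fun r hr => by rw [hφ]; simp [hr]
  have E1 : ∀ s, 0 < s → s ∈ L a → E s = 0 := fun s hs hL => by
    rw [Ei s hs, α2 s hL]
    apply integral_eq_zero_of_ae
    refine Eventually.of_forall fun r => ?_
    by_cases hr : r ∈ Ioc a r₁
    · have : r ∈ {r | s ∈ L r} := dir.sub ha hr.1.le hL
      simp [indicator_of_mem this]
    · by_cases h : r ∈ {r | s ∈ L r} <;> simp [hφ0 r hr]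
  have E2 : ∀ s, 0 < s → s ∉ L r₁ → E s = 0 := fun s hs hL => by
    rw [Ei s hs, α3 s hL]
    apply integral_eq_zero_of_ae
    refine Eventually.of_forall fun r => ?_
    by_cases hr : r ∈ Ioc a r₁
    · have : r ∉ {r | s ∈ L r} := fun h => hL (dir.sub (ha.trans hr.1) hr.2 h)
      simp [indicator_of_notMem this]
    · by_cases h : r ∈ {r | s ∈ L r} <;> simp [hφ0 r hr]
  have E3 : ∀ s, 0 < s → ofReal (E s ^ 2) ≤ (∫⁻ r in Ioc a r₁, ofReal (k (r * s) ^ 2)) *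
      ∫⁻ r in Ioc a r₁, ofReal |g r| ^ 2 := fun s hs => by
    have hk := K.meas
    refine CS_pt (by fun_prop) gm (Ei s hs) measurableSet_Ioc ?_ ?_
    · intro r hr
      have e : φ r = g r := by rw [hφ]; simp [hr]
      by_cases h : r ∈ {r | s ∈ L r}
      · rw [indicator_of_mem h, e, ← one_sub_mul, abs_mul, abs_of_nonneg (by linarith [(α1 s).2])]
        exact mul_le_of_le_one_left (abs_nonneg _) (by linarith [(α1 s).1])
      · rw [indicator_of_notMem h, e, zero_sub, abs_neg, abs_mul, abs_of_nonneg (α1 s).1]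
        exact mul_le_of_le_one_left (abs_nonneg _) (α1 s).2
    · intro r hr
      by_cases h : r ∈ {r | s ∈ L r} <;> simp [hφ0 r hr]
  have nE : NN E ≤ 4802 * ∫⁻ r in Ioc a r₁, ofReal |g r| ^ 2 := by
    have hk := K.meas
    have mm : Measurable fun s => ∫⁻ r in Ioc a r₁, ofReal (k (r * s) ^ 2) :=
      Measurable.lintegral_prod_left' (f := fun p : ℝ × ℝ => ofReal (k (p.1 * p.2) ^ 2)) (by fun_prop)
    refine le_trans ?_ (mul_le_mul_left HS _)
    rw [← lintegral_mul_const _ mm]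
    have mL : MeasurableSet (L r₁ \ L a) := (dir.meas r₁).diff (dir.meas a)
    unfold NN
    rw [← lintegral_indicator measurableSet_Ioi, ← lintegral_indicator mL]
    refine lintegral_mono fun s => ?_
    by_cases hs : s ∈ Ioi 0
    · rw [indicator_of_mem hs]
      by_cases h : s ∈ L r₁ \ L a
      · rw [indicator_of_mem h]; exact E3 s hs
      · have : E s = 0 := by
          by_cases h1 : s ∈ L r₁
          · exact E1 s hs (by by_contra h2; exact h ⟨h1, h2⟩)
          · exact E2 s hs h1
        rw [this]; simp
    · rw [indicator_of_notMem hs]; exact zero_le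
  refine ⟨fun s => X s + F' s, fun s => E s + D' s, Xm.add Fm, Em.add Dm, ?_, ?_, ?_, ?_, ?_, ?_⟩
  · intro s hs
    have : TL k L ((Ioc a c).indicator g) s = TL k L φ s + TL k L ψ s := by
      rw [eg]
      unfold TL
      rw [← integral_add (TL_int K A1 dir cf.meas hs) (TL_int K A2 dir cf.meas hs)]
      congr 1; ext r
      by_cases h : r ∈ {r | s ∈ L r} <;> simp only [indicator_of_mem, indicator_of_notMem, h, not_false_eq_true] <;> ring
    rw [this, hFD s hs, hE]; ring
  · have ecr : ∫ s in Ioi 0, X s * F' s = ∫ s in Ioi 0, α s * Kop k φ s * Kop k ψ s := by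
      refine setIntegral_congr_fun measurableSet_Ioi fun s hs => ?_
      simp only [hX]
      by_cases h : s ∈ L r₁
      · rw [F0 s hs h]
      · rw [α3 s h]; ring
    refine (NN_add_cross Xm Fm nXf nFf).trans ?_
    rw [ecr, split, mul_add]
    have h1 : NN X ≤ ∫⁻ r in Ioc a r₁, (ofReal |g r| ^ 2 + HLM (fun r => ofReal |g r|) r ^ 2) :=
      nX.trans (lintegral_mono fun r => le_self_add)
    calc _ ≤ (∫⁻ r in Ioc a r₁, (ofReal |g r| ^ 2 + HLM (fun r => ofReal |g r|) r ^ 2)) +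
          CGC * (∫⁻ r in Ioc r₁ c, (ofReal |g r| ^ 2 + HLM (fun r => ofReal |g r|) r ^ 2)) +
          2 * (184000 * 192 * ∫⁻ r in Ioc a r₁, (ofReal |g r| ^ 2 + HLM (fun r => ofReal |g r|) r ^ 2)) := by
            gcongr
      _ = _ := by unfold CGC; ring
  · exact (NN_add_le Xm Fm).trans_lt (by finiteness)
  · have e : NN (fun s => E s + D' s) = NN E + NN D' := by
      unfold NN
      rw [← lintegral_add_left (by fun_prop)]
      refine setLIntegral_congr_fun measurableSet_Ioi fun s hs => ?_
      simp only
      by_cases h : s ∈ L r₁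
      · rw [D0 s hs h]; simp
      · rw [E2 s hs h]; simp
    rw [e, split, mul_add]
    exact add_le_add nE nD
  · intro s hs h
    show E s + D' s = 0
    rw [E1 s hs h, D0 s hs (hsub h), add_zero]
  · intro s hs h
    rw [eg, Kop_lin K A1 A2 1 hs]
    show X s + F' s = _
    rw [F0 s hs (hsub h), hX]
    simp only
    rw [α2 s h]
    ring

end
end

section
section
variable {B γ m C₀ a c a₀ : ℝ} {k k' S g : ℝ → ℝ} {L : ℝ → Set ℝ}

def GCP (k : ℝ → ℝ) (L : ℝ → Set ℝ) (g : ℝ → ℝ) (a c : ℝ) : Prop :=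
    ∃ F D : ℝ → ℝ, Measurable F ∧ Measurable D ∧
      (∀ s, 0 < s → TL k L ((Ioc a c).indicator g) s = F s + D s) ∧
      (NN F ≤ CGC * ∫⁻ r in Ioc a c, (ofReal |g r| ^ 2 + HLM (fun r => ofReal |g r|) r ^ 2)) ∧
      NN F < ⊤ ∧ (NN D ≤ 4802 * ∫⁻ r in Ioc a c, ofReal |g r| ^ 2) ∧
      (∀ s, 0 < s → s ∈ L a → D s = 0) ∧ (∀ s, 0 < s → s ∈ L a → F s = Kop k ((Ioc a c).indicator g) s)

lemma GCP_triv : GCP k L g a a := by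
  refine ⟨fun _ => 0, fun _ => 0, measurable_const, measurable_const, ?_, ?_, ?_, ?_, ?_, ?_⟩ <;> simp [TL, NN, Kop]

lemma GC_ind (K : Ker B γ m k k') (cf : Cfg C₀ S) (dir : Dir S L) (hg : Adm g) (ha₀ : 0 < a₀)
    (good : ∀ r ∈ Icc a₀ c, ug (200 * C₀) m ≤ r * S r) (hac : a₀ ≤ c) : GCP k L g a₀ c := by
  have hA : 2 ≤ 200 * C₀ := by linarith [cf.hC]
  obtain ⟨hu0, hq0, -⟩ := ug_good hA (le_refl (ug (200 * C₀) m))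
  obtain ⟨q, hq⟩ : ∃ q, q = √(qf m (ug (200 * C₀) m)) := ⟨_, rfl⟩
  have hqp : 0 < q := by rw [hq]; positivity
  obtain ⟨M, hM⟩ : ∃ M, M = C₀ * S a₀ * (c - a₀) / a₀ := ⟨_, rfl⟩
  have hM0 : 0 ≤ M := by
    rw [hM]; have := cf.pos _ ha₀; have := cf.hC
    have : 0 ≤ c - a₀ := by linarith
    positivity
  have hSM : ∀ r ∈ Icc a₀ c, |S r - S a₀| ≤ M := fun r hr => by
    refine (cf.lip _ _ ha₀ hr.1).trans ?_
    rw [hM]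
    have := cf.pos _ ha₀; have := cf.hC
    have := hr.2
    gcongr
  obtain ⟨η, hη⟩ : ∃ η, η = q / (2 * M + 1) := ⟨_, rfl⟩
  have hηp : 0 < η := by rw [hη]; positivity
  have main : ∀ n : ℕ, ∀ a ∈ Icc a₀ c, c - a ≤ n * η → GCP k L g a c := by
    intro n
    induction n with
    | zero =>
      intro a ha h
      have : a = c := by
        have := ha.2; simp at h; linarith
      rw [this]; exact GCP_triv
    | succ n ih =>
      intro a ha h
      rcases ha.2.eq_or_lt with e | hlt
      · rw [e]; exact GCP_triv
      have hap := ha₀.trans_le ha.1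
      obtain ⟨r₁, h1, h2, h3, α, α0, α1, α2, α3, h4, h5⟩ := box_lemma K cf dir hap hlt (good a ha)
      have hr1 : r₁ ∈ Icc a₀ c := ⟨ha.1.trans h1.le, h2⟩
      have : GCP k L g r₁ c := by
        rcases h3 with e | h3
        · rw [e]; exact GCP_triv
        · apply ih r₁ hr1
          have b1 : q ≤ (r₁ - a) * (2 * M + 1) := by
            calc q ≤ √(qf m (a * S a)) := by
                    rw [hq]; exact sqrt_le_sqrt (qf_mono hu0 (good a ha))
              _ ≤ _ := h3
              _ ≤ _ := by
                apply mul_le_mul_of_nonneg_left _ (by linarith)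
                have := abs_sub_le (S r₁) (S a₀) (S a)
                rw [abs_sub_comm (S a₀)] at this
                linarith [hSM _ hr1, hSM _ ha]
          have : η ≤ r₁ - a := by rw [hη, div_le_iff₀ (by positivity)]; exact b1
          push_cast at h; linarith
      obtain ⟨F, D, i1, i2, i3, i4, i5, i6, i7, i8⟩ := this
      exact GC_step K cf dir hg hap h1 h2 α0 α1 α2 α3 h4 (h5 g hg) i1 i2 i3 i4 i5 i6 i7 i8
  obtain ⟨n, hn⟩ := exists_nat_ge ((c - a₀) / η)
  exact main n a₀ ⟨le_rfl, hac⟩ ((div_le_iff₀ hηp).1 hn)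

def CG : ℝ≥0∞ := 2 * (CGC * 18) + 2 * 4802

lemma GC_good (K : Ker B γ m k k') (cf : Cfg C₀ S) (dir : Dir S L) (hg : Adm g) (ha₀ : 0 < a₀)
    (good : ∀ r ∈ Icc a₀ c, ug (200 * C₀) m ≤ r * S r) (hac : a₀ ≤ c) (hg0 : ∀ r, r ∉ Ioc a₀ c → g r = 0) :
    NN (TL k L g) ≤ CG * ∫⁻ r, ofReal (g r ^ 2) := by
  obtain ⟨F, D, i1, i2, i3, i4, i5, i6, i7, i8⟩ := GC_ind K cf dir hg ha₀ good hac
  have e : (Ioc a₀ c).indicator g = g := by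
    ext r; by_cases h : r ∈ Ioc a₀ c <;> simp [h, hg0]
  rw [e] at i3
  rw [NN_congr i3]
  simp only [sq_ofR]
  have gm := hg.1
  refine (NN_add_le i1 i2).trans ?_
  have h1 : ∫⁻ r in Ioc a₀ c, (ofReal |g r| ^ 2 + HLM (fun r => ofReal |g r|) r ^ 2) ≤ 18 * ∫⁻ r, ofReal |g r| ^ 2 := by
    refine (setLIntegral_le_lintegral _ _).trans ?_
    rw [lintegral_add_left (by fun_prop)]
    refine (add_le_add le_rfl (HL_max (by fun_prop))).trans (le_of_eq ?_)
    ring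
  have h2 : ∫⁻ r in Ioc a₀ c, ofReal |g r| ^ 2 ≤ ∫⁻ r, ofReal |g r| ^ 2 := setLIntegral_le_lintegral _ _
  calc _ ≤ 2 * (CGC * (18 * ∫⁻ r, ofReal |g r| ^ 2)) + 2 * (4802 * ∫⁻ r, ofReal |g r| ^ 2) :=
        add_le_add (mul_le_mul' le_rfl (i4.trans (mul_le_mul' le_rfl h1))) (mul_le_mul' le_rfl (i6.trans (mul_le_mul' le_rfl h2)))
    _ = _ := by unfold CG; ring

lemma TZ (hk : Measurable k) (hg : Measurable g) {U : ℝ} {C : ℝ≥0∞}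
    (hC : ∫⁻ u in Ioc 0 U, ofReal (|k u| * u ^ (-(1/2):ℝ)) ≤ C) {G : ℝ → ℝ} {E : ℝ → ℝ → ℝ}
    (hG : ∀ s, 0 < s → G s = ∫ r, E s r)
    (hE : ∀ s r, 0 < s → 0 < r → r * s ≤ U → |E s r| ≤ |k (r * s)| * |g r|)
    (hE0 : ∀ s r, 0 < s → ¬ (0 < r ∧ r * s ≤ U) → E s r = 0) :
    NN G ≤ C ^ 2 * ∫⁻ r, ofReal (g r ^ 2) := by
  have hh : Measurable ((Ioc 0 U).indicator fun u => |k u|) := Measurable.indicator (by fun_prop) measurableSet_Ioc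
  have h0 : ∀ u, 0 ≤ (Ioc 0 U).indicator (fun u => |k u|) u := fun u => Set.indicator_nonneg (fun _ _ => abs_nonneg _) _
  have hH : ∫⁻ u in Ioi 0, ofReal ((Ioc 0 U).indicator (fun u => |k u|) u * u ^ (-(1/2):ℝ)) ≤ C := by
    refine le_trans ?_ hC
    rw [← lintegral_indicator measurableSet_Ioi, ← lintegral_indicator measurableSet_Ioc]
    refine lintegral_mono fun u => ?_
    by_cases hu : u ∈ Ioc 0 U
    · have : u ∈ Ioi 0 := hu.1
      simp only [indicator_of_mem, hu, this, le_refl]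
    · rw [indicator_of_notMem hu]
      by_cases h' : u ∈ Ioi (0:ℝ)
      · rw [indicator_of_mem h', indicator_of_notMem hu]; simp
      · rw [indicator_of_notMem h']
  have key := schur_mul hh h0 hH (f := fun r => ofReal |g r|) (by fun_prop)
  simp only [sq_ofR (g _)]
  refine le_trans ?_ (key.trans (mul_le_mul' le_rfl (setLIntegral_le_lintegral _ _)))
  refine setLIntegral_mono' measurableSet_Ioi fun s hs => ?_
  rw [sq_ofR]
  refine pow_le_pow_left' ?_ 2
  rw [hG s hs, ← norm_eq_abs, ofReal_norm]
  refine (enorm_integral_le_lintegral_enorm _).trans ?_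
  rw [← lintegral_indicator measurableSet_Ioi]
  refine lintegral_mono fun r => ?_
  by_cases h : 0 < r ∧ r * s ≤ U
  · have h1 : r ∈ Ioi 0 := h.1
    have h2 : r * s ∈ Ioc 0 U := ⟨mul_pos h.1 hs, h.2⟩
    rw [indicator_of_mem h1, indicator_of_mem h2, ← ofReal_mul (abs_nonneg _), ← ofReal_norm]
    exact ofReal_le_ofReal (hE s r hs h.1 h.2)
  · rw [hE0 s r hs h]; simp

lemma Cfg.max (cf : Cfg C₀ S) {U : ℝ} (hU : 0 ≤ U) : Cfg C₀ (fun r => max (S r) (U / r)) := by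
  have hS := cf.meas
  refine ⟨cf.hC, hS.max (measurable_const.div measurable_id), ?_, fun r hr => lt_max_of_lt_left (cf.pos r hr), ?_⟩
  · exact ContinuousOn.sup cf.cont (continuousOn_const.div continuousOn_id fun x hx => ne_of_gt hx)
  · intro r r' hr hrr
    have hr' := hr.trans_le hrr
    have hC := cf.hC
    have hd : 0 ≤ r' - r := by linarith
    refine (abs_max_sub_max_le_max _ _ _ _).trans (max_le ?_ ?_)
    · refine (cf.lip r r' hr hrr).trans ?_
      have : S r ≤ Max.max (S r) (U / r) := le_max_left _ _
      gcongr
    · have e : U / r' - U / r = - (U / r' * ((r' - r) / r)) := by field_simp; ring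
      have h1 : U / r' ≤ C₀ * Max.max (S r) (U / r) := by
        have : U / r' ≤ U / r := by gcongr
        have h3 : U / r ≤ Max.max (S r) (U / r) := le_max_right _ _
        have h4 : 0 ≤ U / r := by positivity
        nlinarith
      rw [e, abs_neg, abs_of_nonneg (by positivity), mul_div_assoc]
      gcongr

lemma CG_fin : CG < ⊤ := by unfold CG CGC; finiteness

theorem thm1D {B γ C₀ : ℝ} (hC₀ : 1 ≤ C₀) : ∃ C : ℝ, 0 ≤ C ∧ ∀ (m : ℝ) (k k' S g : ℝ → ℝ), Ker B γ m k k' → Cfg C₀ S →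
    (MonotoneOn S (Ioi 0) ∨ AntitoneOn S (Ioi 0)) → Adm g →
    NN (TL k (fun r => Ioi (S r)) g) ≤ ofReal C * ∫⁻ r, ofReal (g r ^ 2) := by
  have hA : 2 ≤ 200 * C₀ := by linarith
  obtain ⟨C, hC, tz⟩ := ker_B3 (B := B) (γ := γ) hA
  obtain ⟨C', hC'⟩ : ∃ C' : ℝ≥0∞, C' = 2 + 2 * (2 * CG + 2 * ofReal C ^ 2) := ⟨_, rfl⟩
  have hC't : C' < ⊤ := by rw [hC']; have := CG_fin; finiteness
  refine ⟨C'.toReal, ENNReal.toReal_nonneg, fun m k k' S g K cf hS hg => ?_⟩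
  rw [ENNReal.ofReal_toReal hC't.ne]
  have tz := tz m k k' K
  obtain ⟨U, hU⟩ : ∃ U, U = ug (200 * C₀) m := ⟨_, rfl⟩
  have hU0 : 0 < U := by rw [hU]; exact (ug_good hA le_rfl).1
  rw [← hU] at tz
  obtain ⟨gm, a, b, M, ha, hM, h0⟩ := id hg
  have Sm := cf.meas
  have h0' : ∀ r, r ≤ 0 → g r = 0 := fun r hr => h0 r (fun h => by linarith [h.1])
  obtain ⟨I, hI⟩ : ∃ I : ℝ≥0∞, I = ∫⁻ r, ofReal (g r ^ 2) := ⟨_, rfl⟩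
  rw [← hI]
  rcases hS with hS | hS
  · -- monotone
    have dir : Dir S (fun r => Iic (S r)) := Or.inl ⟨hS, rfl⟩
    obtain ⟨V, hV⟩ : ∃ V : Set ℝ, V = {r | U < r * S r} := ⟨_, rfl⟩
    have Vm : MeasurableSet V := by rw [hV]; exact measurableSet_lt measurable_const (by fun_prop)
    have A1 : Adm (V.indicator g) := hg.ind Vm
    have A2 : Adm (Vᶜ.indicator g) := hg.ind Vm.compl
    have hmono : ∀ W : Set ℝ, MeasurableSet W → ∫⁻ r, ofReal (W.indicator g r ^ 2) ≤ I := fun W hW => by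
      rw [ind_sq_lint hW, hI]; simp only [sq_ofR]; exact setLIntegral_le_lintegral _ _
    have b2 : NN (TL k (fun r => Iic (S r)) (Vᶜ.indicator g)) ≤ ofReal C ^ 2 * I := by
      rw [hI]
      refine TZ K.meas gm tz (fun s _ => rfl) ?_ ?_
      · intro s r hs hr hrs
        by_cases h1 : s ≤ S r <;> by_cases h2 : r ∈ V <;> simp [h1, h2, abs_mul] <;> positivity
      · intro s r hs h
        by_cases h1 : s ≤ S r
        · by_cases h2 : r ∈ V
          · simp [h2]
          · have : g r = 0 := by
              apply h0'
              by_contra h3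
              push Not at h3
              refine h ⟨h3, ?_⟩
              rw [hV] at h2
              simp only [Set.mem_ofPred_eq, not_lt] at h2
              exact (mul_le_mul_of_nonneg_left h1 h3.le).trans h2
            simp [this]
        · simp [h1]
    have b1 : NN (TL k (fun r => Iic (S r)) (V.indicator g)) ≤ CG * I := by
      refine le_trans ?_ (mul_le_mul' le_rfl (hmono V Vm))
      have mono2 : ∀ r r', 0 < r → r ≤ r' → r * S r ≤ r' * S r' := fun r r' hr hrr =>
        mul_le_mul hrr (hS hr (hr.trans_le hrr) hrr) (cf.pos r hr).le (hr.trans_le hrr).le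
      by_cases c1 : U < a / 2 * S (a / 2)
      · rcases le_or_gt a b with hab | hab
        · refine GC_good K cf dir A1 (a₀ := a / 2) (c := b) (by linarith) ?_ (by linarith) ?_
          · intro r hr; rw [← hU]; exact c1.le.trans (mono2 _ _ (by linarith) hr.1)
          · intro r hr
            have : g r = 0 := h0 r fun h => hr ⟨by linarith [h.1], h.2⟩
            by_cases h2 : r ∈ V <;> simp [this]
        · have : V.indicator g = fun _ => 0 := by
            ext r
            have : g r = 0 := h0 r fun h => by linarith [h.1, h.2]
            by_cases h2 : r ∈ V <;> simp [this]
          rw [this]; simp [NN, TL]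
      · push Not at c1
        by_cases c2 : ∃ r, r ∈ Icc a b ∧ U < r * S r
        · obtain ⟨r₀, hr₀, hr₀'⟩ := c2
          have hb : U ≤ b * S b := hr₀'.le.trans (mono2 _ _ (by linarith [hr₀.1]) hr₀.2)
          have hab : a / 2 ≤ b := by linarith [hr₀.1, hr₀.2]
          have hct : ContinuousOn (fun r => r * S r) (Icc (a / 2) b) :=
            continuousOn_id.mul (cf.cont.mono fun x hx => lt_of_lt_of_le (by linarith) hx.1)
          obtain ⟨a₁, ha₁, e⟩ := intermediate_value_Icc hab hct ⟨c1, hb⟩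
          simp only at e
          have ha₁p : 0 < a₁ := lt_of_lt_of_le (by linarith) ha₁.1
          refine GC_good K cf dir A1 (a₀ := a₁) (c := b) ha₁p ?_ ha₁.2 ?_
          · intro r hr; rw [← hU, ← e]; exact mono2 _ _ ha₁p hr.1
          · intro r hr
            by_cases h2 : r ∈ V
            · have h2' := h2
              rw [hV] at h2'
              have h2'' : U < r * S r := h2'
              rw [indicator_of_mem h2]
              refine h0 r fun h => hr ⟨?_, h.2⟩
              by_contra h3
              push Not at h3
              have := mono2 r a₁ (by linarith [h.1]) h3
              linarith
            · simp [h2]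
        · push Not at c2
          have : V.indicator g = fun _ => 0 := by
            ext r
            by_cases h2 : r ∈ V
            · have h2' := h2
              rw [hV] at h2'
              have h2'' : U < r * S r := h2'
              rw [indicator_of_mem h2]
              exact h0 r fun h => by linarith [c2 r h]
            · simp [h2]
          rw [this]; simp [NN, TL]
    have m1 := TL_meas K.meas A1.1 dir Sm
    have m2 := TL_meas K.meas A2.1 dir Sm
    have e : ∀ s, 0 < s → TL k (fun r => Ioi (S r)) g s = Kop k g s +
        (fun s => -(TL k (fun r => Iic (S r)) (V.indicator g) s + TL k (fun r => Iic (S r)) (Vᶜ.indicator g) s)) s := by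
      intro s hs
      simp only
      rw [← sub_eq_add_neg, eq_sub_iff_add_eq]
      have i1 := TL_int K A1 dir Sm hs
      have i2 := TL_int K A2 dir Sm hs
      have i3 : Integrable ({r | s ∈ Ioi (S r)}.indicator (fun r => k (r * s) * g r)) :=
        (hg.integ K hs).indicator (measurableSet_lt Sm measurable_const)
      unfold TL Kop
      rw [← integral_add i1 i2]
      refine (integral_add i3 (i1.add i2)).symm.trans ?_
      congr 1; ext r
      by_cases h1 : s ≤ S r
      · have h3 : ¬ S r < s := not_lt.2 h1
        by_cases h2 : r ∈ V <;> simp [h1, h2, h3]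
      · have h3 : S r < s := not_le.1 h1
        by_cases h2 : r ∈ V <;> simp [h1, h2, h3]
    rw [NN_congr e]
    refine (NN_add_le (Kop_meas K.meas gm) (m1.add m2).neg).trans ?_
    have : NN (fun s => -(TL k (fun r => Iic (S r)) (V.indicator g) s + TL k (fun r => Iic (S r)) (Vᶜ.indicator g) s)) ≤
        2 * (CG * I) + 2 * (ofReal C ^ 2 * I) := by
      refine le_trans (le_of_eq ?_) ((NN_add_le m1 m2).trans (add_le_add (mul_le_mul' le_rfl b1) (mul_le_mul' le_rfl b2)))
      unfold NN; simp only [neg_sq]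
    rw [hg.iso K, ← hI]
    refine (add_le_add le_rfl (mul_le_mul' le_rfl this)).trans (le_of_eq ?_)
    rw [hC']; ring
  · -- antitone
    have cf1 := cf.max hU0.le
    obtain ⟨S₁, hS₁⟩ : ∃ S₁ : ℝ → ℝ, S₁ = fun r => max (S r) (U / r) := ⟨_, rfl⟩
    rw [← hS₁] at cf1
    have dir : Dir S (fun r => Ioi (S r)) := Or.inr ⟨hS, rfl⟩
    have dir1 : Dir S₁ (fun r => Ioi (S₁ r)) := by
      refine Or.inr ⟨?_, rfl⟩
      rw [hS₁]
      intro r hr r' hr' h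
      have : U / r' ≤ U / r := by have : 0 < r := hr; gcongr
      exact max_le_max (hS hr hr' h) this
    have b1 : NN (TL k (fun r => Ioi (S₁ r)) g) ≤ CG * I := by
      rw [hI]
      refine GC_good K cf1 dir1 hg (a₀ := a / 2) (c := max b a) (by linarith) ?_ (by linarith [le_max_right b a]) ?_
      · intro r hr
        have hr0 : 0 < r := by linarith [hr.1]
        rw [← hU, hS₁]
        calc U = r * (U / r) := by field_simp
          _ ≤ _ := mul_le_mul_of_nonneg_left (le_max_right _ _) hr0.le
      · intro r hr
        exact h0 r fun h => hr ⟨by linarith [h.1], h.2.trans (le_max_left _ _)⟩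
    have m1 := TL_meas K.meas gm dir1 cf1.meas
    have m2 := TL_meas K.meas gm dir Sm
    have b2 : NN (fun s => TL k (fun r => Ioi (S r)) g s - TL k (fun r => Ioi (S₁ r)) g s) ≤ ofReal C ^ 2 * I := by
      rw [hI]
      refine TZ K.meas gm tz (E := fun s r => {r | s ∈ Ioi (S r)}.indicator (fun r => k (r * s) * g r) r -
        {r | s ∈ Ioi (S₁ r)}.indicator (fun r => k (r * s) * g r) r) ?_ ?_ ?_
      · intro s hs
        rw [integral_sub (TL_int K hg dir Sm hs) (TL_int K hg dir1 cf1.meas hs)]; rfl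
      · intro s r hs hr hrs
        by_cases h1 : S r < s <;> by_cases h2 : S₁ r < s <;> simp [h1, h2, abs_mul] <;> positivity
      · intro s r hs h
        by_cases hr : 0 < r
        · have hrs : U < r * s := by by_contra h'; exact h ⟨hr, not_lt.1 h'⟩
          have h3 : U / r < s := by rw [div_lt_iff₀ hr]; linarith
          by_cases h1 : S r < s
          · have h2 : S₁ r < s := by rw [hS₁]; exact max_lt h1 h3
            simp [h1, h2]
          · have h2 : ¬ S₁ r < s := fun h' => h1 (lt_of_le_of_lt (by rw [hS₁]; exact le_max_left _ _) h')
            simp [h1, h2]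
        · have := h0' r (not_lt.1 hr)
          by_cases h1 : S r < s <;> by_cases h2 : S₁ r < s <;> simp [h1, h2, this]
    have e : ∀ s, 0 < s → TL k (fun r => Ioi (S r)) g s = TL k (fun r => Ioi (S₁ r)) g s +
      (fun s => TL k (fun r => Ioi (S r)) g s - TL k (fun r => Ioi (S₁ r)) g s) s := fun s _ => by simp only; ring
    rw [NN_congr e]
    refine (NN_add_le m1 (m2.sub m1)).trans ?_
    refine (add_le_add (mul_le_mul' le_rfl b1) (mul_le_mul' le_rfl b2)).trans ?_
    rw [← mul_assoc, ← mul_assoc, ← add_mul]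
    refine mul_le_mul' ?_ le_rfl
    rw [hC']
    refine le_trans ?_ le_add_self
    rw [two_mul (2 * CG + _)]
    exact le_self_add
end
end

section
def nuS (d : ℕ) : Measure (Euc d) := ((volume : Measure (Euc d)).toSphere).map Subtype.val

def rhoS (d : ℕ) : Measure ℝ := (volume.restrict (Ioi (0:ℝ))).withDensity fun r => ofReal (r ^ (d - 1))

instance (d : ℕ) : IsFiniteMeasure (nuS d) := by unfold nuS; infer_instance

instance (d : ℕ) : SFinite (rhoS d) := by unfold rhoS; infer_instance

lemma rho_eq (d : ℕ) : (Measure.volumeIoiPow (d - 1)).map Subtype.val = rhoS d := by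
  ext s hs
  rw [Measure.map_apply measurable_subtype_coe hs, Measure.volumeIoiPow, rhoS, withDensity_apply _ (measurable_subtype_coe hs),
    withDensity_apply _ hs, setLIntegral_subtype measurableSet_Ioi _ fun a : ℝ ↦ .ofReal (a ^ (d - 1)),
    restrict_restrict hs, Subtype.image_preimage_coe, Set.inter_comm]

lemma nuS_norm (d : ℕ) : ∀ᵐ ω ∂(nuS d), ‖ω‖ = 1 := by
  unfold nuS
  rw [ae_map_iff (by fun_prop) (measurableSet_eq_fun (by fun_prop) (by fun_prop))]
  exact Eventually.of_forall fun ω => by simp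

variable {d : ℕ}

lemma polar_mp (hd : 1 ≤ d) : MeasurePreserving (fun p : Euc d × ℝ => p.2 • p.1) ((nuS d).prod (rhoS d)) volume := by
  refine ⟨by fun_prop, ?_⟩
  have : Nonempty (Fin d) := ⟨⟨0, hd⟩⟩
  have h := (volume : Measure (Euc d)).measurePreserving_homeomorphUnitSphereProd
  rw [finrank_euclideanSpace_fin] at h
  have h1 : (nuS d).prod (rhoS d) = (((volume : Measure (Euc d)).comap ((↑) : ({0}ᶜ : Set (Euc d)) → Euc d)).map (homeomorphUnitSphereProd (Euc d))).map
      (Prod.map Subtype.val Subtype.val) := by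
    rw [h.map_eq, ← rho_eq, nuS, Measure.map_prod_map _ _ measurable_subtype_coe measurable_subtype_coe]
  rw [h1, Measure.map_map (by fun_prop) (by fun_prop), Measure.map_map (by fun_prop) (by fun_prop)]
  have h2 : ((fun p : Euc d × ℝ => p.2 • p.1) ∘ Prod.map Subtype.val Subtype.val) ∘ (homeomorphUnitSphereProd (Euc d)) = Subtype.val := by
    ext1 x
    have hx : ‖x.1‖ ≠ 0 := norm_ne_zero_iff.2 x.2
    simp [smul_smul, hx]
  rw [h2, (MeasurableEmbedding.subtype_coe (measurableSet_singleton _).compl).map_comap, Subtype.range_coe]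
  exact Measure.restrict_eq_self_of_ae_mem (s := {0}ᶜ) (compl_mem_ae_iff.2 (measure_singleton _))

lemma polar_l (hd : 1 ≤ d) {f : Euc d → ℝ≥0∞} (hf : Measurable f) :
    ∫⁻ x, f x = ∫⁻ r in Ioi (0:ℝ), ofReal (r ^ (d - 1)) * ∫⁻ ω, f (r • ω) ∂(nuS d) := by
  rw [← (polar_mp hd).lintegral_comp hf, lintegral_prod_symm' _ (by fun_prop), rhoS, lintegral_withDensity_eq_lintegral_mul]
  · rfl
  · fun_prop
  · exact Measurable.lintegral_prod_left' (f := fun p : Euc d × ℝ => f (p.2 • p.1)) (by fun_prop)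

lemma polar_int (hd : 1 ≤ d) {F : Type*} [NormedAddCommGroup F] [NormedSpace ℝ F] {f : Euc d → F} (hf : Integrable f) :
    ∫ x, f x = ∫ r in Ioi (0:ℝ), (r ^ (d - 1)) • ∫ ω, f (r • ω) ∂(nuS d) := by
  have h1 := (polar_mp hd).map_eq
  have h2 : ∫ x, f x = ∫ p, f (p.2 • p.1) ∂((nuS d).prod (rhoS d)) := by
    rw [← h1]
    exact integral_map (by fun_prop) (h1 ▸ hf.aestronglyMeasurable)
  have h3 : Integrable (fun p : Euc d × ℝ => f (p.2 • p.1)) ((nuS d).prod (rhoS d)) :=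
    ((polar_mp hd).integrable_comp_of_integrable hf)
  rw [h2, integral_prod_symm _ h3, rhoS, integral_withDensity_eq_integral_toReal_smul (by fun_prop) (by simp)]
  refine setIntegral_congr_fun measurableSet_Ioi fun r hr => ?_
  have : 0 < r := hr
  simp only
  rw [ENNReal.toReal_ofReal (by positivity)]

lemma nuS_rot (hd : 1 ≤ d) (e : Euc d ≃ₗᵢ[ℝ] Euc d) : MeasurePreserving e (nuS d) (nuS d) := by
  refine ⟨e.continuous.measurable, ?_⟩
  obtain ⟨c, hc⟩ : ∃ c : ℝ≥0∞, c = ∫⁻ r in Ioc (1:ℝ) 2, ofReal (r ^ (d - 1)) := ⟨_, rfl⟩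
  have hct : c ≠ ⊤ := by
    rw [hc]
    refine ((setLIntegral_mono' (g := fun _ => ofReal (2 ^ (d - 1))) measurableSet_Ioc fun r hr => ?_).trans_lt ?_).ne
    · apply ofReal_le_ofReal
      have := hr.2; have : 0 ≤ r := by linarith [hr.1]
      gcongr
    · simp only [lintegral_const]; finiteness
  have hc0 : c ≠ 0 := by
    have : 1 ≤ c := by
      rw [hc]
      refine le_trans (le_of_eq ?_) (setLIntegral_mono' (f := fun _ => 1) measurableSet_Ioc fun r hr => ?_)
      · simp; norm_num
      · rw [ENNReal.one_le_ofReal]; exact one_le_pow₀ hr.1.le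
    exact (lt_of_lt_of_le one_pos this).ne'
  have key : ∀ F : Euc d → ℝ≥0∞, Measurable F → ∫⁻ x : Euc d, (Ioc (1:ℝ) 2).indicator 1 ‖x‖ * F (‖x‖⁻¹ • x) = c * ∫⁻ ω, F ω ∂(nuS d) := by
    intro F hF
    have mi : Measurable ((Ioc (1:ℝ) 2).indicator (1 : ℝ → ℝ≥0∞)) := measurable_one.indicator measurableSet_Ioc
    rw [polar_l hd (by fun_prop)]
    have h1 : ∀ r ∈ Ioi (0:ℝ), ofReal (r ^ (d - 1)) * ∫⁻ ω, (Ioc (1:ℝ) 2).indicator 1 ‖r • ω‖ * F (‖r • ω‖⁻¹ • r • ω) ∂(nuS d) =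
        (Ioc (1:ℝ) 2).indicator (fun r => ofReal (r ^ (d - 1))) r * ∫⁻ ω, F ω ∂(nuS d) := by
      intro r hr
      have hr : 0 < r := hr
      have : ∫⁻ ω, (Ioc (1:ℝ) 2).indicator 1 ‖r • ω‖ * F (‖r • ω‖⁻¹ • r • ω) ∂(nuS d) =
          (Ioc (1:ℝ) 2).indicator 1 r * ∫⁻ ω, F ω ∂(nuS d) := by
        rw [← lintegral_const_mul _ hF]
        refine lintegral_congr_ae ?_
        filter_upwards [nuS_norm d] with ω hω
        rw [norm_smul, hω, mul_one, norm_of_nonneg hr.le, smul_smul, inv_mul_cancel₀ hr.ne', one_smul]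
      rw [this, ← mul_assoc]
      congr 1
      by_cases h : r ∈ Ioc (1:ℝ) 2 <;> simp [h]
    rw [setLIntegral_congr_fun measurableSet_Ioi h1, lintegral_mul_const _ (Measurable.indicator (by fun_prop) measurableSet_Ioc),
      setLIntegral_indicator measurableSet_Ioc, hc, Set.inter_eq_left.2]
    intro r hr; exact lt_trans one_pos hr.1
  ext s hs
  have hs' := e.continuous.measurable hs
  rw [Measure.map_apply e.continuous.measurable hs]
  have k1 := key (s.indicator 1) (measurable_one.indicator hs)
  have k2 := key ((e ⁻¹' s).indicator 1) (measurable_one.indicator hs')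
  rw [lintegral_indicator_one hs] at k1
  rw [lintegral_indicator_one hs'] at k2
  have : c * nuS d (e ⁻¹' s) = c * nuS d s := by
    rw [← k1, ← k2]
    refine Eq.trans (lintegral_congr fun x => ?_) ((e.measurePreserving).lintegral_comp (((measurable_one.indicator measurableSet_Ioc).comp measurable_norm).mul
        ((measurable_one.indicator hs).comp (by fun_prop))))
    have h : ‖x‖⁻¹ • e x = e (‖x‖⁻¹ • x) := by rw [map_smul]
    simp only [e.norm_map]; rw [h]; rfl
  exact (ENNReal.mul_right_inj hc0 hct).1 this

/-- swapping two unit vectors -/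
lemma nuS_swap (hd : 1 ≤ d) {θ η : Euc d} (h1 : ‖θ‖ = 1) (h2 : ‖η‖ = 1) (a b : ℝ → ℝ) :
    ∫ ω, a ⟪θ, ω⟫ * b ⟪η, ω⟫ ∂(nuS d) = ∫ ω, a ⟪η, ω⟫ * b ⟪θ, ω⟫ ∂(nuS d) := by
  obtain ⟨e, he⟩ : ∃ e : Euc d ≃ₗᵢ[ℝ] Euc d, e = (ℝ ∙ (θ - η))ᗮ.reflection := ⟨_, rfl⟩
  have e1 : e θ = η := by rw [he]; exact Submodule.reflection_sub (by rw [h1, h2])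
  have e2 : e η = θ := by rw [← e1, he, Submodule.reflection_reflection]
  rw [← (nuS_rot hd e).integral_comp e.toMeasurableEquiv.measurableEmbedding]
  congr 1; ext ω
  have h1 : ⟪θ, e ω⟫ = ⟪η, ω⟫ := by rw [← e2, e.inner_map_map]
  have h2 : ⟪η, e ω⟫ = ⟪θ, ω⟫ := by rw [← e1, e.inner_map_map]
  simp only [h1, h2]
end

section
variable {d : ℕ}

lemma abs_inner_div_le {θ : Euc d} (h : ‖θ‖ = 1) (x : Euc d) : |⟪θ, x⟫ / ‖x‖| ≤ 1 := by
  rw [abs_div, abs_norm]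
  refine div_le_one_of_le₀ ((abs_real_inner_le_norm _ _).trans (by rw [h, one_mul])) (norm_nonneg _)

lemma homog (hd : 1 ≤ d) {θ η : Euc d} (h1 : ‖θ‖ = 1) (h2 : ‖η‖ = 1) {K : ℝ → ℝ} (hK : Measurable K) {M : ℝ} (hM : ∀ r, |K r| ≤ M)
    (h0 : ∀ r ∉ Icc (1:ℝ) 3, K r = 0) {W : ℝ × ℝ → ℝ} (hW : Continuous W) :
    Integrable (fun x : Euc d => K ‖x‖ * W (⟪θ, x⟫ / ‖x‖, ⟪η, x⟫ / ‖x‖)) ∧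
    ∫ x : Euc d, K ‖x‖ * W (⟪θ, x⟫ / ‖x‖, ⟪η, x⟫ / ‖x‖) = (∫ r in Ioi (0:ℝ), r ^ (d - 1) * K r) * ∫ ω, W (⟪θ, ω⟫, ⟪η, ω⟫) ∂(nuS d) := by
  obtain ⟨N, hN⟩ := (isCompact_Icc (a := (-1:ℝ)) (b := 1)).prod (isCompact_Icc (a := (-1:ℝ)) (b := 1)) |>.exists_bound_of_continuousOn hW.continuousOn
  have hM0 : 0 ≤ M := (abs_nonneg _).trans (hM 0)
  have hi : Integrable (fun x : Euc d => K ‖x‖ * W (⟪θ, x⟫ / ‖x‖, ⟪η, x⟫ / ‖x‖)) := by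
    have : IntegrableOn (fun x : Euc d => K ‖x‖ * W (⟪θ, x⟫ / ‖x‖, ⟪η, x⟫ / ‖x‖)) (Metric.closedBall 0 3) := by
      refine integrableOn_of_bounded (M := M * N) (isCompact_closedBall _ _).measure_ne_top (Measurable.aestronglyMeasurable (by fun_prop)) (Eventually.of_forall fun x => ?_)
      rw [norm_mul]
      exact mul_le_mul (hM _) (hN _ ⟨abs_le.1 (abs_inner_div_le h1 x), abs_le.1 (abs_inner_div_le h2 x)⟩) (norm_nonneg _) hM0
    refine (integrableOn_iff_integrable_of_support_subset fun x hx => ?_).1 this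
    by_contra h
    simp only [Metric.mem_closedBall, dist_zero_right, not_le] at h
    exact hx (by simp only; rw [h0 _ fun h' => by linarith [h'.2], zero_mul])
  refine ⟨hi, ?_⟩
  rw [polar_int hd hi, ← integral_mul_const]
  refine setIntegral_congr_fun measurableSet_Ioi fun r (hr : 0 < r) => ?_
  simp only [smul_eq_mul, mul_assoc]
  rw [← integral_const_mul (K r)]
  congr 1
  refine integral_congr_ae ?_
  filter_upwards [nuS_norm d] with ω hω
  simp only [inner_smul_right, norm_smul, hω, mul_one, norm_of_nonneg hr.le, mul_div_cancel_left₀ _ hr.ne']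

lemma exists_beta : ∃ β β' : ℝ → ℝ, (∀ r, HasDerivAt β (β' r) r) ∧ Continuous β ∧ Continuous β' ∧ (∀ r, 0 ≤ β r) ∧ β 2 = 1 ∧
    (∀ r ∉ Icc (1:ℝ) 3, β r = 0) ∧ (∀ r ∉ Icc (1:ℝ) 3, β' r = 0) := by
  let f : ContDiffBump (2:ℝ) := ⟨1/2, 1, by norm_num, by norm_num⟩
  have hs : tsupport f = Icc 1 3 := by rw [f.tsupport_eq, Real.closedBall_eq_Icc]; norm_num [f]
  refine ⟨f, deriv f, fun r => (f.contDiff.differentiable (n := 1) (by simp)).differentiableAt.hasDerivAt, f.continuous,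
    f.contDiff.continuous_deriv (n := 1) le_rfl, fun r => f.nonneg, f.one_of_mem_closedBall (by simp [f]), fun r hr => ?_, fun r hr => ?_⟩
  · exact image_eq_zero_of_notMem_tsupport (by rwa [hs])
  · by_contra h
    exact hr (hs ▸ support_deriv_subset h)

lemma line_norm {x v : Euc d} (hx : x ≠ 0) : HasDerivAt (fun t : ℝ => ‖x + t • v‖) (⟪x, v⟫ / ‖x‖) 0 := by
  have h1 : HasDerivAt (fun t : ℝ => x + t • v) v 0 := by simpa using ((hasDerivAt_id (0:ℝ)).smul_const v).const_add x
  have hx' : ‖x‖ ≠ 0 := norm_ne_zero_iff.2 hx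
  have h2 := h1.norm_sq.sqrt (by simpa using hx)
  simp only [zero_smul, add_zero, norm_nonneg, sqrt_sq] at h2
  refine h2.congr_deriv (by field_simp)

lemma line_inner {x v η : Euc d} (hx : x ≠ 0) : HasDerivAt (fun t : ℝ => ⟪η, x + t • v⟫ / ‖x + t • v‖)
    ((⟪η, v⟫ - (⟪η, x⟫ / ‖x‖) * (⟪x, v⟫ / ‖x‖)) / ‖x‖) 0 := by
  have hx' : ‖x‖ ≠ 0 := norm_ne_zero_iff.2 hx
  have h3 : HasDerivAt (fun t : ℝ => ⟪η, x + t • v⟫) ⟪η, v⟫ 0 := by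
    simp only [inner_add_right, inner_smul_right]
    simpa using ((hasDerivAt_id (0:ℝ)).mul_const ⟪η, v⟫).const_add ⟪η, x⟫
  have h4 := h3.div (line_norm (v := v) hx) (by simpa using hx)
  simp only [zero_smul, add_zero] at h4
  exact h4.congr_deriv (by field_simp)

/-- divergence theorem on the sphere -/
lemma sph_div (hd : 1 ≤ d) {θ η : Euc d} (h1 : ‖θ‖ = 1) (h2 : ‖η‖ = 1) {a a' b b' : ℝ → ℝ} (ha : ∀ t, HasDerivAt a (a' t) t)
    (hb : ∀ t, HasDerivAt b (b' t) t) (ca : Continuous a') (cb : Continuous b') :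
    ∫ ω, (a' ⟪θ, ω⟫ * b ⟪η, ω⟫ * (1 - ⟪θ, ω⟫ ^ 2) + a ⟪θ, ω⟫ * b' ⟪η, ω⟫ * (⟪η, θ⟫ - ⟪θ, ω⟫ * ⟪η, ω⟫)) ∂(nuS d) =
    ((d:ℝ) - 1) * ∫ ω, ⟪θ, ω⟫ * a ⟪θ, ω⟫ * b ⟪η, ω⟫ ∂(nuS d) := by
  obtain ⟨β, β', hβ, cβ, cβ', β0, β2, βs, βs'⟩ := exists_beta
  have ca0 : Continuous a := continuous_iff_continuousAt.2 fun t => (ha t).continuousAt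
  have cb0 : Continuous b := continuous_iff_continuousAt.2 fun t => (hb t).continuousAt
  have n0 : ∀ r : ℝ, r ∈ Icc (1:ℝ) 3 → r ≠ 0 := fun r hr => by have := hr.1; positivity
  have bd : ∀ (f : ℝ → ℝ) (n : ℕ), Continuous f → (∀ r ∉ Icc (1:ℝ) 3, f r = 0) → Measurable (fun r => f r / r ^ n) ∧
      (∃ M, ∀ r, |f r / r ^ n| ≤ M) ∧ ∀ r ∉ Icc (1:ℝ) 3, f r / r ^ n = 0 := by
    intro f n hf h0
    refine ⟨hf.measurable.div (by fun_prop), ?_, fun r hr => by rw [h0 r hr, zero_div]⟩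
    obtain ⟨M, hM⟩ := (isCompact_Icc (a := (1:ℝ)) (b := 3)).exists_bound_of_continuousOn hf.continuousOn
    refine ⟨M, fun r => ?_⟩
    by_cases hr : r ∈ Icc (1:ℝ) 3
    · rw [abs_div]
      refine (div_le_self (abs_nonneg _) ?_).trans (hM r hr)
      rw [abs_pow]; exact one_le_pow₀ (hr.1.trans (le_abs_self r))
    · rw [h0 r hr, zero_div, abs_zero]
      exact (norm_nonneg _).trans (hM 1 (by simp))
  obtain ⟨m1, ⟨M1, b1⟩, z1⟩ := bd β (d - 1) cβ βs
  obtain ⟨m2, ⟨M2, b2⟩, z2⟩ := bd β d cβ βs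
  obtain ⟨m3, ⟨M3, b3⟩, z3⟩ := bd β' (d - 1) cβ' βs'
  have e1 : ∀ r : ℝ, r ≠ 0 → r ^ d = r * r ^ (d - 1) := fun r hr => by rw [← pow_succ', Nat.sub_add_cancel hd]
  let K1 : ℝ → ℝ := fun r => β' r / r ^ (d - 1) - (d - 1) * (β r / r ^ d)
  let W1 : ℝ × ℝ → ℝ := fun z => z.1 * a z.1 * b z.2
  let W2 : ℝ × ℝ → ℝ := fun z => a' z.1 * b z.2 * (1 - z.1 ^ 2) + a z.1 * b' z.2 * (⟪η, θ⟫ - z.1 * z.2)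
  obtain ⟨i1, I1⟩ := homog hd h1 h2 (K := K1) (m3.sub (measurable_const.mul m2)) (M := M3 + |(d:ℝ) - 1| * M2) (fun r => by
      refine (abs_sub _ _).trans (add_le_add (b3 r) ?_)
      rw [abs_mul]; exact mul_le_mul_of_nonneg_left (b2 r) (abs_nonneg _)) (fun r hr => by simp only [K1, z3 r hr, z2 r hr]; ring) (W := W1) (by fun_prop)
  obtain ⟨i2, I2⟩ := homog hd h1 h2 m2 b2 z2 (W := W2) (by fun_prop)
  obtain ⟨i0, -⟩ := homog hd h1 h2 m1 b1 z1 (W := fun z => a z.1 * b z.2) (by fun_prop)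
  have hR : ∀ r : ℝ, r ≠ 0 → HasDerivAt (fun r => β r / r ^ (d - 1)) (K1 r) r := by
    intro r hr
    refine ((hβ r).div (hasDerivAt_pow (d - 1) r) (pow_ne_zero _ hr)).congr_deriv ?_
    simp only [K1]
    obtain ⟨n, rfl⟩ : ∃ n, d = n + 1 := ⟨d - 1, by omega⟩
    rcases n with _ | n
    · simp
    · simp only [Nat.add_sub_cancel]; push_cast; field_simp; ring
  have hline : ∀ x : Euc d, HasLineDerivAt ℝ (fun x : Euc d => β ‖x‖ / ‖x‖ ^ (d - 1) * (a (⟪θ, x⟫ / ‖x‖) * b (⟪η, x⟫ / ‖x‖)))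
      (K1 ‖x‖ * W1 (⟪θ, x⟫ / ‖x‖, ⟪η, x⟫ / ‖x‖) + β ‖x‖ / ‖x‖ ^ d * W2 (⟪θ, x⟫ / ‖x‖, ⟪η, x⟫ / ‖x‖)) x θ := by
    intro x
    unfold HasLineDerivAt
    by_cases hx : x = 0
    · subst hx
      have h01 : ∀ r : ℝ, |r| < 1 → β |r| = 0 ∧ β' |r| = 0 := fun r hr => ⟨βs _ fun h => by linarith [h.1], βs' _ fun h => by linarith [h.1]⟩
      have := h01 0 (by simp)
      rw [abs_zero] at this
      simp only [norm_zero, K1, this.1, this.2]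
      norm_num
      refine (hasDerivAt_const (0:ℝ) (0:ℝ)).congr_of_eventuallyEq ?_
      filter_upwards [Metric.ball_mem_nhds (0:ℝ) one_pos] with t ht
      simp only [Metric.mem_ball, dist_zero_right, norm_eq_abs] at ht
      rw [norm_smul, h1, mul_one, norm_eq_abs, (h01 t ht).1]; ring
    · have hx' : ‖x‖ ≠ 0 := norm_ne_zero_iff.2 hx
      have e0 : x + (0:ℝ) • θ = x := by simp
      have A := (hR ‖x‖ hx').comp_of_eq (0:ℝ) (line_norm (v := θ) hx) (by rw [e0])
      have B1 := (ha (⟪θ, x⟫ / ‖x‖)).comp_of_eq (0:ℝ) (line_inner (v := θ) (η := θ) hx) (by rw [e0])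
      have B2 := (hb (⟪η, x⟫ / ‖x‖)).comp_of_eq (0:ℝ) (line_inner (v := θ) (η := η) hx) (by rw [e0])
      refine (A.mul (B1.mul B2)).congr_deriv ?_
      simp only [Pi.mul_apply, Function.comp_apply, e0, W1, W2, real_inner_self_eq_norm_sq, h1, real_inner_comm θ x]
      rw [e1 _ hx']
      field_simp
  have hint := integral_bilinear_hasLineDerivAt_right_eq_neg_left_of_integrable (μ := (volume : Measure (Euc d))) (B := ContinuousLinearMap.mul ℝ ℝ)
    (f := fun _ => 1) (f' := fun _ => 0) (v := θ)
    (by simp) (by simp only [ContinuousLinearMap.mul_apply', one_mul]; exact i1.add i2) (by simpa using i0) (fun x => by simp [HasLineDerivAt, hasDerivAt_const]) fun x _ => hline x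
  simp only [ContinuousLinearMap.mul_apply', one_mul, zero_mul, integral_zero, neg_zero] at hint
  replace hint := (integral_add i1 i2).symm.trans hint
  rw [I1, I2] at hint
  have iβ : ∀ (f : ℝ → ℝ), Continuous f → (∀ r ∉ Icc (1:ℝ) 3, f r = 0) → Integrable f := fun f hf h0 =>
    hf.integrable_of_hasCompactSupport (HasCompactSupport.intro isCompact_Icc h0)
  have cJ : Continuous (fun r => β r / r) := by
    have : (fun r => β r / r) = fun r => β r / max r 1 := by
      ext r
      by_cases hr : r ∈ Icc (1:ℝ) 3
      · rw [max_eq_left hr.1]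
      · rw [βs r hr, zero_div, zero_div]
    rw [this]
    exact cβ.div (by fun_prop) fun r => (lt_of_lt_of_le one_pos (le_max_right _ _)).ne'
  have zJ : ∀ r ∉ Icc (1:ℝ) 3, β r / r = 0 := fun r hr => by rw [βs r hr, zero_div]
  have full : ∀ (f : ℝ → ℝ), (∀ r ∉ Icc (1:ℝ) 3, f r = 0) → ∫ r in Ioi (0:ℝ), f r = ∫ r, f r := fun f h0 => by
    refine setIntegral_eq_integral_of_forall_compl_eq_zero fun r hr => h0 r fun h => hr ?_
    exact lt_of_lt_of_le one_pos h.1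
  have J2 : ∫ r in Ioi (0:ℝ), r ^ (d - 1) * (β r / r ^ d) = ∫ r, β r / r := by
    rw [← full _ zJ]
    refine setIntegral_congr_fun measurableSet_Ioi fun r (hr : 0 < r) => ?_
    simp only [e1 r hr.ne']; field_simp
  have J1 : ∫ r in Ioi (0:ℝ), r ^ (d - 1) * K1 r = - ((d - 1) * ∫ r, β r / r) := by
    have : ∫ r in Ioi (0:ℝ), r ^ (d - 1) * K1 r = ∫ r in Ioi (0:ℝ), (β' r - (d - 1) * (β r / r)) := by
      refine setIntegral_congr_fun measurableSet_Ioi fun r (hr : 0 < r) => ?_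
      simp only [K1, e1 r hr.ne']; field_simp
    rw [this, full _ (fun r hr => by rw [βs' r hr, zJ r hr]; ring), integral_sub (iβ _ cβ' βs') ((iβ _ cJ zJ).const_mul _),
      integral_eq_zero_of_hasDerivAt_of_integrable hβ (iβ _ cβ' βs') (iβ _ cβ βs), integral_const_mul]
    ring
  have J0 : 0 < ∫ r, β r / r := by
    refine cJ.integral_pos_of_hasCompactSupport_nonneg_nonzero (HasCompactSupport.intro isCompact_Icc zJ) (fun r => ?_) (x := 2) (by rw [β2]; norm_num)
    by_cases hr : r ∈ Icc (1:ℝ) 3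
    · exact div_nonneg (β0 r) (by linarith [hr.1])
    · simp [zJ r hr]
  rw [J1, J2] at hint
  have : (∫ r, β r / r) * ((∫ ω, W2 (⟪θ, ω⟫, ⟪η, ω⟫) ∂(nuS d)) - (d - 1) * ∫ ω, W1 (⟪θ, ω⟫, ⟪η, ω⟫) ∂(nuS d)) = 0 := by
    linear_combination hint
  exact sub_eq_zero.1 ((mul_eq_zero.1 this).resolve_left J0.ne')
end

section
lemma joint_onb {H ι : Type*} [NormedAddCommGroup H] [InnerProductSpace ℝ H] (T : ι → H →ₗ[ℝ] H) (hs : ∀ i, (T i).IsSymmetric)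
    (hc : ∀ i j x, T i (T j x) = T j (T i x)) (V : Submodule ℝ H) [FiniteDimensional ℝ V] (hV : ∀ i, ∀ x ∈ V, T i x ∈ V) :
    ∃ (n : ℕ) (y : Fin n → H), Orthonormal ℝ y ∧ (∀ a, ∃ l : ι → ℝ, ∀ i, T i (y a) = l i • y a) ∧
      ∀ x ∈ V, ∀ G : H, ‖G‖ ^ 2 ≤ ∑ a, ⟪y a, G⟫ ^ 2 + ‖G - x‖ ^ 2 := by
  classical
  let T' : ι → Module.End ℝ V := fun i => (T i).restrict (hV i)
  have hs' : ∀ i, (T' i).IsSymmetric := fun i => (hs i).restrict_invariant (hV i)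
  have hI := LinearMap.IsSymmetric.directSum_isInternal_of_pairwise_commute hs' (fun i j _ => by
    ext x; exact hc i j x)
  have hO := LinearMap.IsSymmetric.orthogonalFamily_iInf_eigenspaces hs'
  have hfin := WellFoundedGT.finite_ne_bot_of_iSupIndep hI.submodule_iSupIndep
  have : Fintype {γ : ι → ℝ // (⨅ j, Module.End.eigenspace (T' j) (γ j)) ≠ ⊥} := hfin.fintype
  have hI' := DirectSum.isInternal_ne_bot_iff.2 hI
  have hO' := hO.comp (γ := {γ : ι → ℝ // (⨅ j, Module.End.eigenspace (T' j) (γ j)) ≠ ⊥}) Subtype.val_injective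
  let b := hI'.subordinateOrthonormalBasis rfl hO'
  refine ⟨_, fun a => (b a : H), ?_, fun a => ?_, fun x hx G => ?_⟩
  · exact b.orthonormal.comp_linearIsometry V.subtypeₗᵢ
  · have := hI'.subordinateOrthonormalBasis_subordinate rfl a hO'
    refine ⟨(hI'.subordinateOrthonormalBasisIndex rfl a hO').1, fun i => ?_⟩
    have h2 := Module.End.mem_eigenspace_iff.1 ((Submodule.mem_iInf _).1 this i)
    exact congrArg Subtype.val h2
  · have hx1 : ∑ a, ⟪(b a : H), x⟫ • (b a : H) = x := by
      have := congrArg Subtype.val (b.sum_repr' ⟨x, hx⟩)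
      simpa using this
    have hon : Orthonormal ℝ fun a => (b a : H) := b.orthonormal.comp_linearIsometry V.subtypeₗᵢ
    obtain ⟨z, rfl⟩ : ∃ z, G = x + z := ⟨G - x, by simp⟩
    have hb := hon.sum_inner_products_le z (s := Finset.univ)
    have e1 : ‖x‖ ^ 2 = ∑ a, ⟪(b a : H), x⟫ ^ 2 := by
      rw [← real_inner_self_eq_norm_sq]; nth_rw 1 [← hx1]
      rw [sum_inner]; simp only [real_inner_smul_left, sq]
    have e2 : ⟪x, z⟫ = ∑ a, ⟪(b a : H), x⟫ * ⟪(b a : H), z⟫ := by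
      nth_rw 1 [← hx1]; rw [sum_inner]; simp only [real_inner_smul_left]
    have e3 : ∑ a, ⟪(b a : H), x + z⟫ ^ 2 = ‖x‖ ^ 2 + 2 * ⟪x, z⟫ + ∑ a, ⟪(b a : H), z⟫ ^ 2 := by
      rw [e1, e2, mul_sum, ← Finset.sum_add_distrib, ← Finset.sum_add_distrib]
      refine sum_congr rfl fun a _ => ?_
      rw [inner_add_right]; ring
    have : 0 ≤ ∑ a, ⟪(b a : H), z⟫ ^ 2 := Finset.sum_nonneg fun _ _ => sq_nonneg _
    simp only [add_sub_cancel_left]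
    rw [norm_add_sq_real]
    linarith

abbrev Hs (d : ℕ) := Lp ℝ 2 (nuS d)

def Ak {d : ℕ} (h : ℝ → ℝ) (f : Euc d → ℝ) (θ : Euc d) : ℝ := ∫ ω, h ⟪θ, ω⟫ * f ω ∂(nuS d)

section
variable {d : ℕ} {h k : ℝ → ℝ} {f g : Euc d → ℝ}

lemma cbd (hh : Continuous h) : ∃ M, 0 ≤ M ∧ ∀ θ ω : Euc d, ‖θ‖ = 1 → ‖ω‖ = 1 → ‖h ⟪θ, ω⟫‖ ≤ M := by
  obtain ⟨M, hM⟩ := (isCompact_Icc (a := (-1:ℝ)) (b := 1)).exists_bound_of_continuousOn hh.continuousOn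
  refine ⟨M, (norm_nonneg _).trans (hM 0 (by simp)), fun θ ω h1 h2 => hM _ (abs_le.1 ?_)⟩
  simpa [h1, h2] using abs_real_inner_le_norm θ ω

lemma nu2_norm : ∀ᵐ p ∂((nuS d).prod (nuS d)), ‖p.1‖ = 1 ∧ ‖p.2‖ = 1 := by
  have h1 := (Measure.quasiMeasurePreserving_fst (μ := nuS d) (ν := nuS d)).ae (nuS_norm d)
  have h2 := (Measure.quasiMeasurePreserving_snd (μ := nuS d) (ν := nuS d)).ae (nuS_norm d)
  filter_upwards [h1, h2] with p a b using ⟨a, b⟩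

lemma Ak_i1 (hh : Continuous h) (hf : Integrable f (nuS d)) {θ : Euc d} (hθ : ‖θ‖ = 1) : Integrable (fun ω => h ⟪θ, ω⟫ * f ω) (nuS d) := by
  obtain ⟨M, -, hM⟩ := cbd (d := d) hh
  refine hf.bdd_mul (c := M) (by fun_prop) ?_
  filter_upwards [nuS_norm d] with ω hω using hM _ _ hθ hω

lemma Ak_i2 (hh : Continuous h) (hf : Integrable f (nuS d)) (hg : Integrable g (nuS d)) :
    Integrable (fun p : Euc d × Euc d => h ⟪p.1, p.2⟫ * (g p.1 * f p.2)) ((nuS d).prod (nuS d)) := by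
  obtain ⟨M, -, hM⟩ := cbd (d := d) hh
  refine (hg.mul_prod hf).bdd_mul (c := M) (by fun_prop) ?_
  filter_upwards [nu2_norm] with p hp using hM _ _ hp.1 hp.2

lemma Ak_sm (hh : Continuous h) (hf : Integrable f (nuS d)) : AEStronglyMeasurable (Ak h f) (nuS d) := by
  refine AEStronglyMeasurable.integral_prod_right' (f := fun p : Euc d × Euc d => h ⟪p.1, p.2⟫ * f p.2) ?_
  exact (Continuous.aestronglyMeasurable (by fun_prop)).mul hf.aestronglyMeasurable.comp_snd

lemma Ak_bd (hh : Continuous h) (hf : Integrable f (nuS d)) : ∃ M, ∀ θ, ‖θ‖ = 1 → ‖Ak h f θ‖ ≤ M := by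
  obtain ⟨M, hM0, hM⟩ := cbd (d := d) hh
  refine ⟨∫ ω, M * ‖f ω‖ ∂(nuS d), fun θ hθ => norm_integral_le_of_norm_le (hf.norm.const_mul M) ?_⟩
  filter_upwards [nuS_norm d] with ω hω
  rw [norm_mul]; gcongr; exact hM _ _ hθ hω

lemma Ak_mem (hh : Continuous h) (hf : Integrable f (nuS d)) : MemLp (Ak h f) 2 (nuS d) := by
  obtain ⟨M, hM⟩ := Ak_bd hh hf
  exact MemLp.of_bound (Ak_sm hh hf) M (by filter_upwards [nuS_norm d] with ω hω using hM ω hω)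

lemma Ak_congr (hfg : f =ᵐ[nuS d] g) : Ak h f = Ak h g := by
  ext θ; exact integral_congr_ae (by filter_upwards [hfg] with ω hω; rw [hω])

lemma Hs_int (f : Hs d) : Integrable f (nuS d) := (Lp.memLp f).integrable one_le_two

lemma Ak_pair (hh : Continuous h) (hf : Integrable f (nuS d)) (hg : Integrable g (nuS d)) :
    ∫ θ, g θ * Ak h f θ ∂(nuS d) = ∫ p, h ⟪p.1, p.2⟫ * (g p.1 * f p.2) ∂((nuS d).prod (nuS d)) := by
  rw [integral_prod _ (Ak_i2 hh hf hg)]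
  congr 1; ext θ
  rw [Ak, ← integral_const_mul]; congr 1; ext ω; ring

lemma Ak_sym (hh : Continuous h) (hf : Integrable f (nuS d)) (hg : Integrable g (nuS d)) :
    ∫ θ, g θ * Ak h f θ ∂(nuS d) = ∫ θ, f θ * Ak h g θ ∂(nuS d) := by
  rw [Ak_pair hh hf hg, Ak_pair hh hg hf, ← integral_prod_swap]
  congr 1; ext p
  simp only [Prod.fst_swap, Prod.snd_swap, real_inner_comm p.1 p.2]; ring

lemma Ak_Ak (hh : Continuous h) (hk : Continuous k) (hf : Integrable f (nuS d)) {θ : Euc d} (hθ : ‖θ‖ = 1) :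
    Ak h (Ak k f) θ = ∫ η, f η * ∫ ω, h ⟪θ, ω⟫ * k ⟪η, ω⟫ ∂(nuS d) ∂(nuS d) := by
  have i1 : Integrable (fun ω => h ⟪θ, ω⟫) (nuS d) := by simpa using Ak_i1 hh (integrable_const (1:ℝ)) hθ
  have : ∫ ω, h ⟪θ, ω⟫ * Ak k f ω ∂(nuS d) = _ := Ak_sym hk hf i1
  unfold Ak at this ⊢
  rw [this]
  congr 1; ext η; congr 2; ext ω; ring

lemma Ak_comm (hd : 1 ≤ d) (hh : Continuous h) (hk : Continuous k) (hf : Integrable f (nuS d)) {θ : Euc d} (hθ : ‖θ‖ = 1) :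
    Ak h (Ak k f) θ = Ak k (Ak h f) θ := by
  rw [Ak_Ak hh hk hf hθ, Ak_Ak hk hh hf hθ]
  refine integral_congr_ae ?_
  filter_upwards [nuS_norm d] with η hη
  rw [nuS_swap hd hθ hη]
  congr 2; ext ω; ring

def AL (h : C(ℝ, ℝ)) : Hs d →ₗ[ℝ] Hs d where
  toFun f := (Ak_mem h.continuous (Hs_int f)).toLp
  map_add' f g := by
    rw [← MemLp.toLp_add]
    refine MemLp.toLp_congr _ _ ?_
    filter_upwards [nuS_norm d] with θ hθ
    simp only [Pi.add_apply, Ak_congr (Lp.coeFn_add f g)]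
    rw [Ak, Ak, Ak, ← integral_add (Ak_i1 h.continuous (Hs_int f) hθ) (Ak_i1 h.continuous (Hs_int g) hθ)]
    simp only [Pi.add_apply, mul_add]
  map_smul' c f := by
    rw [RingHom.id_apply, ← MemLp.toLp_const_smul]
    refine MemLp.toLp_congr _ _ ?_
    filter_upwards with θ
    simp only [Pi.smul_apply, Ak_congr (Lp.coeFn_smul c f), smul_eq_mul]
    rw [Ak, Ak, ← integral_const_mul]
    congr 1; ext ω; simp only [Pi.smul_apply, smul_eq_mul]; ring

lemma AL_coe (h : C(ℝ, ℝ)) (f : Hs d) : AL h f =ᵐ[nuS d] Ak h f := MemLp.coeFn_toLp (Ak_mem h.continuous (Hs_int f))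

lemma Hs_inner (f g : Hs d) : ⟪f, g⟫ = ∫ θ, f θ * g θ ∂(nuS d) := by
  rw [L2.inner_def]; congr 1; ext θ; simp [mul_comm]

lemma Hs_sum {ι : Type*} (s : Finset ι) (f : ι → Hs d) : (∑ i ∈ s, f i : Hs d) =ᵐ[nuS d] fun x => ∑ i ∈ s, f i x := by
  classical
  induction s using Finset.induction_on with
  | empty => simp only [Finset.sum_empty]; exact Lp.coeFn_zero ℝ 2 (nuS d)
  | insert i s hi ih =>
    rw [Finset.sum_insert hi]
    filter_upwards [Lp.coeFn_add (f i) (∑ i ∈ s, f i), ih] with x h1 h2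
    rw [h1, Pi.add_apply, h2, Finset.sum_insert hi]

lemma AL_fin (n : ℕ) : FiniteDimensional ℝ (LinearMap.range (AL (d := d) ⟨fun t => t ^ n, by fun_prop⟩)) := by
  have mem : ∀ I : Fin n → Fin d, MemLp (fun θ : Euc d => ∏ j, θ (I j)) 2 (nuS d) := fun I => by
    refine MemLp.of_bound (Continuous.aestronglyMeasurable (by fun_prop)) 1 ?_
    filter_upwards [nuS_norm d] with θ hθ
    rw [norm_prod]
    refine Finset.prod_le_one (fun _ _ => norm_nonneg _) fun j _ => ?_
    exact (PiLp.norm_apply_le θ (I j)).trans hθ.le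
  obtain ⟨b, hb⟩ : ∃ b : (Fin n → Fin d) → Hs d, ∀ I, b I =ᵐ[nuS d] fun θ : Euc d => ∏ j, θ (I j) := ⟨fun I => (mem I).toLp, fun I => (mem I).coeFn_toLp⟩
  have : FiniteDimensional ℝ (Submodule.span ℝ (Set.range b)) := FiniteDimensional.span_of_finite ℝ (Set.finite_range _)
  refine Submodule.finiteDimensional_of_le (S₂ := Submodule.span ℝ (Set.range b)) ?_
  rintro _ ⟨f, rfl⟩
  have hfi := Hs_int f
  obtain ⟨c, hc⟩ : ∃ c : (Fin n → Fin d) → ℝ, c = fun I => ∫ ω, (∏ j, ω (I j)) * f ω ∂(nuS d) := ⟨_, rfl⟩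
  have e : AL (⟨fun t => t ^ n, by fun_prop⟩ : C(ℝ, ℝ)) f = ∑ I, c I • b I := by
    refine Lp.ext ?_
    filter_upwards [AL_coe (⟨fun t => t ^ n, by fun_prop⟩ : C(ℝ, ℝ)) f, ae_all_iff.2 hb,
      Hs_sum Finset.univ fun I => c I • b I, ae_all_iff.2 fun I => Lp.coeFn_smul (c I) (b I)] with θ h1 h2 h3 h4
    rw [h1, h3]
    simp only [h4, Pi.smul_apply, smul_eq_mul, h2, Ak, ContinuousMap.coe_mk]
    have : ∀ ω : Euc d, ⟪θ, ω⟫ ^ n * f ω = ∑ I : Fin n → Fin d, (∏ j, θ (I j)) * ((∏ j, ω (I j)) * f ω) := fun ω => by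
      rw [PiLp.inner_apply, Fintype.sum_pow, Finset.sum_mul]
      refine sum_congr rfl fun I _ => ?_
      simp only [RCLike.inner_apply, conj_trivial]
      rw [Finset.prod_mul_distrib]; ring
    simp only [this]
    rw [integral_finsetSum]
    · refine sum_congr rfl fun I _ => ?_
      rw [integral_const_mul, hc]; ring
    · intro I _
      refine Integrable.const_mul ?_ _
      exact (mem I).integrable_mul (Lp.memLp f)
  rw [e]
  exact Submodule.sum_mem _ fun I _ => Submodule.smul_mem _ _ (Submodule.subset_span ⟨I, rfl⟩)

lemma sph_basis (hd : 1 ≤ d) (N : ℕ) : ∃ (n : ℕ) (y : Fin n → Hs d), Orthonormal ℝ y ∧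
    (∀ a, ∃ l : (ℝ → ℝ) → ℝ, ∀ h, Continuous h → ∀ᵐ θ ∂(nuS d), Ak h (y a) θ = l h * y a θ) ∧
    ∀ (F : ℕ → Hs d) (G : Hs d), ‖G‖ ^ 2 ≤ ∑ a, ⟪y a, G⟫ ^ 2 + ‖G - ∑ i ∈ range N, AL ⟨fun t => t ^ i, by fun_prop⟩ (F i)‖ ^ 2 := by
  have cm : ∀ (i j : C(ℝ, ℝ)) (x : Hs d), AL i (AL j x) = AL j (AL i x) := fun i j x => by
    refine Lp.ext ?_
    filter_upwards [AL_coe i (AL j x), AL_coe j (AL i x), nuS_norm d] with θ h1 h2 h3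
    rw [h1, h2, Ak_congr (AL_coe j x), Ak_congr (AL_coe i x), Ak_comm hd i.continuous j.continuous (Hs_int x) h3]
  have fd := fun i : Fin N => AL_fin (d := d) i
  obtain ⟨V, hV⟩ : ∃ V : Submodule ℝ (Hs d), V = ⨆ i : Fin N, LinearMap.range (AL (d := d) ⟨fun t => t ^ (i : ℕ), by fun_prop⟩) := ⟨_, rfl⟩
  have : FiniteDimensional ℝ V := hV ▸ inferInstance
  have inv : ∀ h, V ≤ Submodule.comap (AL (d := d) h) V := fun h => by
    rw [hV]
    refine iSup_le fun i => ?_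
    rintro _ ⟨f, rfl⟩
    exact Submodule.mem_iSup_of_mem i ⟨AL (d := d) h f, cm _ _ _⟩
  obtain ⟨n, y, h1, h2, h3⟩ := joint_onb (fun h : C(ℝ, ℝ) => AL (d := d) h) (fun h f g => by
      rw [Hs_inner, Hs_inner]
      refine (integral_congr_ae ?_).trans ((Ak_sym h.continuous (Hs_int f) (Hs_int g)).trans (integral_congr_ae ?_))
      · filter_upwards [AL_coe h f] with θ hθ; rw [hθ, mul_comm]
      · filter_upwards [AL_coe h g] with θ hθ; rw [hθ]) cm
    V (fun h x hx => inv h hx)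
  refine ⟨n, y, h1, fun a => ?_, fun F G => h3 _ ?_ G⟩
  · obtain ⟨l, hl⟩ := h2 a
    classical
    refine ⟨fun h => if hc : Continuous h then l ⟨h, hc⟩ else 0, fun h hc => ?_⟩
    have e := hl ⟨h, hc⟩
    have e1 := AL_coe ⟨h, hc⟩ (y a)
    rw [e] at e1
    filter_upwards [e1, Lp.coeFn_smul (l ⟨h, hc⟩) (y a)] with θ h1 h2
    rw [dif_pos hc]
    rw [h2] at h1
    exact h1.symm
  · rw [hV]
    exact Submodule.sum_mem _ fun i hi => Submodule.mem_iSup_of_mem ⟨i, Finset.mem_range.1 hi⟩ ⟨F i, rfl⟩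
end
end

section
structure Eig (d : ℕ) (Y : Euc d → ℝ) (l : (ℝ → ℝ) → ℝ) : Prop where
  mem : MemLp Y 2 (nuS d)
  nrm : ∫ θ, Y θ * Y θ ∂(nuS d) = 1
  eig : ∀ h, Continuous h → ∀ᵐ θ ∂(nuS d), Ak h Y θ = l h * Y θ

section
variable {d : ℕ} {Y : Euc d → ℝ} {l : (ℝ → ℝ) → ℝ} {h k : ℝ → ℝ}

lemma Eig.int (E : Eig d Y l) : Integrable Y (nuS d) := E.mem.integrable one_le_two

lemma Eig.l_eq (E : Eig d Y l) (hh : Continuous h) : l h = ∫ p, h ⟪p.1, p.2⟫ * (Y p.1 * Y p.2) ∂((nuS d).prod (nuS d)) := by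
  rw [← Ak_pair hh E.int E.int]
  refine Eq.trans ?_ (integral_congr_ae (g := fun θ => Y θ * Ak h Y θ) (f := fun θ => l h * (Y θ * Y θ)) ?_)
  · rw [integral_const_mul, E.nrm, mul_one]
  · filter_upwards [E.eig h hh] with θ hθ; rw [hθ]; ring

lemma Eig.ll (E : Eig d Y l) (hh : Continuous h) (hk : Continuous k) :
    l h * l k = ∫ θ, Y θ * ∫ η, Y η * ∫ ω, h ⟪θ, ω⟫ * k ⟪η, ω⟫ ∂(nuS d) ∂(nuS d) ∂(nuS d) := by
  refine Eq.trans ?_ (integral_congr_ae (f := fun θ => l h * l k * (Y θ * Y θ)) ?_)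
  · rw [integral_const_mul, E.nrm, mul_one]
  · filter_upwards [E.eig h hh, nuS_norm d] with θ h2 h3
    rw [← Ak_Ak hh hk E.int h3, Ak_congr (E.eig k hk)]
    have : Ak h (fun θ => l k * Y θ) θ = l k * Ak h Y θ := by
      unfold Ak; rw [← integral_const_mul]; congr 1; ext ω; ring
    rw [this, h2]; ring

def DD (d : ℕ) (a a' : ℝ → ℝ) (t : ℝ) : ℝ := (1 - t ^ 2) * a' t - (d - 1) * (t * a t)

lemma hd_cont {a a' : ℝ → ℝ} (ha : ∀ t, HasDerivAt a (a' t) t) : Continuous a := continuous_iff_continuousAt.2 fun t => (ha t).continuousAt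

lemma Eig.swap (hd : 1 ≤ d) (E : Eig d Y l) {a a' a'' b b' b'' : ℝ → ℝ} (ha : ∀ t, HasDerivAt a (a' t) t) (ha' : ∀ t, HasDerivAt a' (a'' t) t)
    (hb : ∀ t, HasDerivAt b (b' t) t) (hb' : ∀ t, HasDerivAt b' (b'' t) t) (ca : Continuous a'') (cb : Continuous b'') :
    l (DD d a' a'') * l b = l (DD d b' b'') * l a := by
  have cont : ∀ {a a' a'' : ℝ → ℝ}, (∀ t, HasDerivAt a (a' t) t) → (∀ t, HasDerivAt a' (a'' t) t) → Continuous a'' →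
      Continuous (DD d a' a'') := fun h1 h2 h3 => by
    have := hd_cont h2; unfold DD; fun_prop
  have key : ∀ {a a' a'' b b' b'' : ℝ → ℝ}, (∀ t, HasDerivAt a (a' t) t) → (∀ t, HasDerivAt a' (a'' t) t) →
      (∀ t, HasDerivAt b (b' t) t) → (∀ t, HasDerivAt b' (b'' t) t) → Continuous a'' → Continuous b'' → ∀ {θ η : Euc d}, ‖θ‖ = 1 → ‖η‖ = 1 →
      ∫ ω, DD d a' a'' ⟪θ, ω⟫ * b ⟪η, ω⟫ ∂(nuS d) = - ∫ ω, a' ⟪θ, ω⟫ * b' ⟪η, ω⟫ * (⟪η, θ⟫ - ⟪θ, ω⟫ * ⟪η, ω⟫) ∂(nuS d) := by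
    intro a a' a'' b b' b'' ha ha' hb hb' ca cb θ η h1 h2
    have c1 := hd_cont ha'
    have c2 := hd_cont hb
    have c3 := hd_cont hb'
    have ii : ∀ W : ℝ × ℝ → ℝ, Continuous W → Integrable (fun ω => W (⟪θ, ω⟫, ⟪η, ω⟫)) (nuS d) := fun W hW => by
      obtain ⟨N, hN⟩ := (isCompact_Icc (a := (-1:ℝ)) (b := 1)).prod (isCompact_Icc (a := (-1:ℝ)) (b := 1)) |>.exists_bound_of_continuousOn hW.continuousOn
      refine Integrable.of_bound (C := N) (Continuous.aestronglyMeasurable (by fun_prop)) ?_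
      filter_upwards [nuS_norm d] with ω hω
      refine hN _ ⟨abs_le.1 ?_, abs_le.1 ?_⟩
      · simpa [h1, hω] using abs_real_inner_le_norm θ ω
      · simpa [h2, hω] using abs_real_inner_le_norm η ω
    have := sph_div hd h1 h2 ha' hb ca c3
    rw [integral_add (ii (fun z => a'' z.1 * b z.2 * (1 - z.1 ^ 2)) (by fun_prop))
      (ii (fun z => a' z.1 * b' z.2 * (⟪η, θ⟫ - z.1 * z.2)) (by fun_prop)), ← integral_const_mul] at this
    rw [eq_neg_iff_add_eq_zero, ← sub_eq_zero.2 this]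
    have e : ∀ ω, DD d a' a'' ⟪θ, ω⟫ * b ⟪η, ω⟫ = a'' ⟪θ, ω⟫ * b ⟪η, ω⟫ * (1 - ⟪θ, ω⟫ ^ 2) - (d - 1) * (⟪θ, ω⟫ * a' ⟪θ, ω⟫ * b ⟪η, ω⟫) := fun ω => by
      unfold DD; ring
    simp only [e]
    rw [integral_sub (ii (fun z => a'' z.1 * b z.2 * (1 - z.1 ^ 2)) (by fun_prop)) (ii (fun z => (d - 1) * (z.1 * a' z.1 * b z.2)) (by fun_prop))]
    ring
  rw [E.ll (cont ha ha' ca) (hd_cont hb), E.ll (cont hb hb' cb) (hd_cont ha)]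
  refine integral_congr_ae ?_
  filter_upwards [nuS_norm d] with θ h1
  congr 1
  refine integral_congr_ae ?_
  filter_upwards [nuS_norm d] with η h2
  congr 1
  rw [key ha ha' hb hb' ca cb h1 h2, nuS_swap hd h1 h2 (DD d b' b'') a, key hb hb' ha ha' cb ca h2 h1]
  congr 2; ext ω; rw [real_inner_comm η θ]; ring

lemma Eig.add (E : Eig d Y l) (hh : Continuous h) (hk : Continuous k) (x y : ℝ) : l (fun t => x * h t + y * k t) = x * l h + y * l k := by
  rw [E.l_eq hh, E.l_eq hk, E.l_eq (by fun_prop), ← integral_const_mul, ← integral_const_mul,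
    ← integral_add ((Ak_i2 hh E.int E.int).const_mul x) ((Ak_i2 hk E.int E.int).const_mul y)]
  congr 1; ext p; ring

lemma Eig.bound (E : Eig d Y l) (hh : Continuous h) {M : ℝ} (hM : ∀ t ∈ Icc (-1:ℝ) 1, |h t| ≤ M) : |l h| ≤ M * (nuS d).real Set.univ := by
  have i2 : Integrable (fun θ => Y θ * Y θ) (nuS d) := E.mem.integrable_mul E.mem
  have ia := (i2.comp_fst (nuS d)).const_mul (M / 2)
  have ib := (i2.comp_snd (nuS d)).const_mul (M / 2)
  rw [E.l_eq hh, ← norm_eq_abs]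
  refine (norm_integral_le_of_norm_le (ia.add ib) ?_).trans (le_of_eq ?_)
  · filter_upwards [nu2_norm] with p hp
    have : |h ⟪p.1, p.2⟫| ≤ M := hM _ (abs_le.1 (by simpa [hp.1, hp.2] using abs_real_inner_le_norm p.1 p.2))
    rw [norm_mul, norm_eq_abs]
    refine (mul_le_mul_of_nonneg_right this (norm_nonneg _)).trans ?_
    have h2 : ‖Y p.1 * Y p.2‖ ≤ 1 / 2 * (Y p.1 * Y p.1 + Y p.2 * Y p.2) := abs_le.2 ⟨by nlinarith [sq_nonneg (Y p.1 + Y p.2)], by nlinarith [sq_nonneg (Y p.1 - Y p.2)]⟩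
    have hM0 := (abs_nonneg _).trans this
    refine (mul_le_mul_of_nonneg_left h2 hM0).trans (le_of_eq ?_)
    simp only [Pi.add_apply]; ring
  · have e1 : ∫ p, Y p.1 * Y p.1 ∂((nuS d).prod (nuS d)) = (nuS d).real Set.univ := by
      rw [integral_prod _ (i2.comp_fst (nuS d))]; simp [integral_const_mul, E.nrm]
    have e2 : ∫ p, Y p.2 * Y p.2 ∂((nuS d).prod (nuS d)) = (nuS d).real Set.univ := by
      rw [integral_prod _ (i2.comp_snd (nuS d))]; simp [E.nrm]
    refine (integral_add ia ib).trans ?_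
    rw [integral_const_mul, integral_const_mul, e1, e2]; ring
end
end

section
section
variable {d : ℕ} {Y : Euc d → ℝ} {l : (ℝ → ℝ) → ℝ} {h h' k : ℝ → ℝ}

lemma Eig.zero (E : Eig d Y l) (hl : ∀ n : ℕ, l (fun t => t ^ n) = 0) (hh : Continuous h) : l h = 0 := by
  have hp : ∀ p : Polynomial ℝ, l (fun t => p.eval t) = 0 := by
    intro p
    induction p using Polynomial.induction_on' with
    | add p q hp hq =>
      have := E.add p.continuous q.continuous 1 1
      rw [hp, hq] at this; simpa using this
    | monomial n a =>
      have := E.add (continuous_pow n) (continuous_pow n) a 0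
      rw [hl] at this; simpa using this
  rw [← abs_eq_zero]
  refine le_antisymm (le_of_forall_pos_le_add fun ε hε => ?_) (abs_nonneg _)
  obtain ⟨A, hA⟩ : ∃ A, A = (nuS d).real Set.univ := ⟨_, rfl⟩
  have hA0 : 0 ≤ A := hA ▸ measureReal_nonneg
  obtain ⟨p, hp1⟩ := exists_polynomial_near_of_continuousOn (-1) 1 h hh.continuousOn (ε / (A + 1)) (by positivity)
  have := E.add hh p.continuous 1 (-1)
  rw [hp] at this
  have h2 := E.bound (h := fun t => 1 * h t + -1 * p.eval t) (by fun_prop) (M := ε / (A + 1)) fun t ht => by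
    rw [one_mul, neg_one_mul, ← sub_eq_add_neg, abs_sub_comm]; exact (hp1 t ht).le
  rw [this, ← hA] at h2
  simp only [one_mul, mul_zero, add_zero] at h2
  rw [zero_add]; refine h2.trans ?_
  rw [div_mul_eq_mul_div, div_le_iff₀ (by positivity)]; nlinarith

lemma Eig.mu (hd : 1 ≤ d) (E : Eig d Y l) : ∃ μ : ℝ, 0 ≤ μ ∧ (d = 1 → μ = 0) ∧ ∀ a a' a'' : ℝ → ℝ, (∀ t, HasDerivAt a (a' t) t) →
    (∀ t, HasDerivAt a' (a'' t) t) → Continuous a'' → l (DD d a' a'') = -μ * l a := by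
  have cont : ∀ {a a' a'' : ℝ → ℝ}, (∀ t, HasDerivAt a (a' t) t) → (∀ t, HasDerivAt a' (a'' t) t) → Continuous a'' →
      Continuous (DD d a' a'') := fun h1 h2 h3 => by
    have := hd_cont h2; unfold DD; fun_prop
  by_cases hl : ∀ n : ℕ, l (fun t => t ^ n) = 0
  · exact ⟨0, le_rfl, fun _ => rfl, fun a a' a'' h1 h2 h3 => by rw [E.zero hl (cont h1 h2 h3)]; simp⟩
  push Not at hl
  classical
  obtain ⟨n, hn, hmin⟩ : ∃ n : ℕ, l (fun t => t ^ n) ≠ 0 ∧ ∀ j < n, l (fun t => t ^ j) = 0 :=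
    ⟨Nat.find hl, Nat.find_spec hl, fun j hj => not_not.1 (Nat.find_min hl hj)⟩
  have d1 : ∀ t : ℝ, HasDerivAt (fun t : ℝ => t ^ n) (n * t ^ (n - 1)) t := fun t => hasDerivAt_pow n t
  have d2 : ∀ t : ℝ, HasDerivAt (fun t : ℝ => n * t ^ (n - 1)) (n * ((n - 1 : ℕ) * t ^ (n - 1 - 1))) t := fun t => (hasDerivAt_pow (n - 1) t).const_mul _
  have e1 : DD d (fun t : ℝ => n * t ^ (n - 1)) (fun t : ℝ => n * ((n - 1 : ℕ) * t ^ (n - 1 - 1))) =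
      fun t : ℝ => ((n : ℝ) * (n - 1 : ℕ)) * t ^ (n - 2) + (-((n : ℝ) * ((n : ℝ) + d - 2))) * t ^ n := by
    ext t; unfold DD
    rcases n with _ | _ | n
    · simp
    · simp; ring
    · simp; ring
  have e2 : l (DD d (fun t : ℝ => n * t ^ (n - 1)) (fun t : ℝ => n * ((n - 1 : ℕ) * t ^ (n - 1 - 1)))) = -((n : ℝ) * ((n : ℝ) + d - 2)) * l (fun t => t ^ n) := by
    rw [e1, E.add (continuous_pow _) (continuous_pow _)]
    rcases n with _ | _ | n
    · simp
    · simp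
    · rw [hmin (n + 1 + 1 - 2) (by omega)]; simp
  have hdr : (1:ℝ) ≤ d := by exact_mod_cast hd
  refine ⟨n * (n + d - 2), ?_, ?_, fun a a' a'' h1 h2 h3 => ?_⟩
  · rcases n with _ | n
    · simp
    · push_cast; have : (0:ℝ) ≤ n := by positivity
      refine mul_nonneg (by positivity) (by linarith)
  · intro h1
    have : l (DD d (fun t : ℝ => n * t ^ (n - 1)) (fun t : ℝ => n * ((n - 1 : ℕ) * t ^ (n - 1 - 1)))) = 0 := by
      rw [E.l_eq (cont d1 d2 (by fun_prop))]
      refine integral_eq_zero_of_ae ?_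
      filter_upwards [nu2_norm] with p hp
      have h3 : ⟪p.1, p.2⟫ ^ 2 = 1 := by
        subst h1
        have a1 := EuclideanSpace.real_norm_sq_eq p.1
        have a2 := EuclideanSpace.real_norm_sq_eq p.2
        simp [hp.1, hp.2] at a1 a2
        simp [PiLp.inner_apply, mul_pow, ← a1, ← a2]
      simp only [DD, h3, h1]; simp
    rw [e2] at this
    rcases mul_eq_zero.1 this with h | h
    · linarith
    · exact absurd h hn
  · have := E.swap hd h1 h2 d1 d2 h3 (by fun_prop)
    rw [e2] at this
    refine mul_right_cancel₀ hn ?_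
    rw [this]; ring

lemma Eig.der (E : Eig d Y l) (hh : ∀ t, HasDerivAt h (h' t) t) (ch : Continuous h') (hb : ∀ t, |h' t| ≤ 1) (j : ℕ) (u : ℝ) :
    HasDerivAt (fun u => l (fun t => t ^ j * h (u * t))) (l (fun t => t ^ (j + 1) * h' (u * t))) u := by
  have c1 := hd_cont hh
  have : (fun u => l (fun t => t ^ j * h (u * t))) = fun u => ∫ p : Euc d × Euc d, (⟪p.1, p.2⟫ ^ j * h (u * ⟪p.1, p.2⟫)) * (Y p.1 * Y p.2) ∂((nuS d).prod (nuS d)) :=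
    funext fun u => E.l_eq (h := fun t => t ^ j * h (u * t)) (by fun_prop)
  rw [this, E.l_eq (h := fun t => t ^ (j + 1) * h' (u * t)) (by fun_prop)]
  have i0 : Integrable (fun p : Euc d × Euc d => Y p.1 * Y p.2) ((nuS d).prod (nuS d)) := E.int.mul_prod E.int
  refine (hasDerivAt_integral_of_dominated_loc_of_deriv_le (F' := fun u p => (⟪p.1, p.2⟫ ^ (j + 1) * h' (u * ⟪p.1, p.2⟫)) * (Y p.1 * Y p.2)) (bound := fun p : Euc d × Euc d => ‖Y p.1 * Y p.2‖) (Metric.ball_mem_nhds u one_pos) ?_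
    (Ak_i2 (h := fun t => t ^ j * h (u * t)) (by fun_prop) E.int E.int) (Ak_i2 (h := fun t => t ^ (j + 1) * h' (u * t)) (by fun_prop) E.int E.int).1 ?_ i0.norm ?_).2
  · exact .of_forall fun v => (Ak_i2 (h := fun t => t ^ j * h (v * t)) (by fun_prop) E.int E.int).1
  · filter_upwards [nu2_norm] with p hp v _
    have : |⟪p.1, p.2⟫| ≤ 1 := by simpa [hp.1, hp.2] using abs_real_inner_le_norm p.1 p.2
    rw [norm_mul]
    refine mul_le_of_le_one_left (norm_nonneg _) ?_
    rw [norm_mul, norm_pow]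
    exact mul_le_one₀ (pow_le_one₀ (norm_nonneg _) this) (norm_nonneg _) (hb _)
  · refine .of_forall fun p v _ => ?_
    have := (((hh (v * ⟪p.1, p.2⟫)).comp v ((hasDerivAt_id v).mul_const ⟪p.1, p.2⟫)).const_mul (⟪p.1, p.2⟫ ^ j)).mul_const (Y p.1 * Y p.2)
    exact this.congr_deriv (by ring)

structure Trig (h h' : ℝ → ℝ) : Prop where
  d1 : ∀ t, HasDerivAt h (h' t) t
  d2 : ∀ t, HasDerivAt h' (-h t) t
  b1 : ∀ t, |h t| ≤ 1
  b2 : ∀ t, |h' t| ≤ 1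
  z : h 0 * h' 0 = 0

lemma trig_cos : Trig cos (fun t => -sin t) :=
  ⟨Real.hasDerivAt_cos, fun t => (Real.hasDerivAt_sin t).neg, abs_cos_le_one, fun t => by rw [abs_neg]; exact abs_sin_le_one t, by simp⟩

lemma trig_sin : Trig sin cos :=
  ⟨Real.hasDerivAt_sin, Real.hasDerivAt_cos, abs_sin_le_one, abs_cos_le_one, by simp⟩

lemma Eig.cont (E : Eig d Y l) (T : Trig h h') : Continuous (fun u => l (fun t => h (u * t))) := by
  refine hd_cont (a' := fun u => l (fun t => t ^ 1 * h' (u * t))) fun u => ?_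
  simpa using E.der T.d1 (hd_cont T.d2) T.b2 0 u

lemma Eig.ker (hd : 1 ≤ d) (E : Eig d Y l) (T : Trig h h') {κ : ℝ} (hκ : 0 ≤ κ)
    (iso : ∀ (φ : ℝ → ℝ) (a b M : ℝ), Measurable φ → 0 < a → (∀ r, |φ r| ≤ M) → (∀ r, r ∉ Icc a b → φ r = 0) →
      ∫⁻ s in Ioi 0, ofReal ((∫ r, κ * ((r * s) ^ (((d:ℝ) - 1) / 2) * l (fun t => h (r * s * t))) * φ r) ^ 2) = ∫⁻ r, ofReal (φ r ^ 2)) :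
    ∃ m k', Ker (κ * (nuS d).real Set.univ) (((d:ℝ) - 1) / 2) m (fun u => κ * (u ^ (((d:ℝ) - 1) / 2) * l (fun t => h (u * t)))) k' := by
  obtain ⟨μ, hμ0, hμ1, hμ⟩ := E.mu hd
  have hdr : (1:ℝ) ≤ d := by exact_mod_cast hd
  obtain ⟨γ, hγ⟩ : ∃ γ : ℝ, γ = ((d:ℝ) - 1) / 2 := ⟨_, rfl⟩
  have hγ0 : 0 ≤ γ := by rw [hγ]; linarith
  have ch := hd_cont T.d1
  have ch' := hd_cont T.d2
  obtain ⟨c, hc⟩ : ∃ c : ℝ → ℝ, c = fun u => l (fun t => h (u * t)) := ⟨_, rfl⟩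
  obtain ⟨c', hc'⟩ : ∃ c : ℝ → ℝ, c = fun u => l (fun t => t * h' (u * t)) := ⟨_, rfl⟩
  have D1 : ∀ u, HasDerivAt c (c' u) u := fun u => by simpa [hc, hc'] using E.der T.d1 ch' T.b2 0 u
  have D2 : ∀ u, HasDerivAt c' (l (fun t => t ^ 2 * -h (u * t))) u := fun u => by
    simpa [hc, hc'] using E.der T.d2 (by fun_prop) (fun t => by rw [abs_neg]; exact T.b1 t) 1 u
  have ode : ∀ u, u ^ 2 * l (fun t => t ^ 2 * -h (u * t)) + (d - 1) * (u * c' u) + u ^ 2 * c u = μ * c u := fun u => by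
    have d1 : ∀ t, HasDerivAt (fun t => h (u * t)) (u * h' (u * t)) t := fun t =>
      ((T.d1 (u * t)).comp t ((hasDerivAt_id t).const_mul u)).congr_deriv (by simp; ring)
    have d2 : ∀ t, HasDerivAt (fun t => u * h' (u * t)) (u * (u * -h (u * t))) t := fun t =>
      (((T.d2 (u * t)).comp t ((hasDerivAt_id t).const_mul u)).const_mul u).congr_deriv (by simp [mul_comm])
    have h1 := hμ _ _ _ d1 d2 (by fun_prop)
    have e1 : DD d (fun t => u * h' (u * t)) (fun t => u * (u * -h (u * t))) = fun t => (-u ^ 2) * (1 * h (u * t) + 1 * (t ^ 2 * -h (u * t))) + (-(d - 1) * u) * (t * h' (u * t)) := by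
      ext t; unfold DD; ring
    rw [e1, E.add (by fun_prop) (by fun_prop), E.add (by fun_prop) (by fun_prop)] at h1
    simp only [hc, hc']; linarith
  have cc := hd_cont D1
  have cc' := hd_cont D2
  have z0 : c 0 * c' 0 = 0 := by
    have e1 : c 0 = h 0 * l (fun _ => 1) := by
      have := E.add (h := fun _ => 1) (k := fun _ => 1) (by fun_prop) (by fun_prop) (h 0) 0
      simp only [hc, zero_mul]; simpa using this
    have e2 : c' 0 = h' 0 * l (fun t => t) := by
      have := E.add (h := fun t => t) (k := fun _ => 1) (by fun_prop) (by fun_prop) (h' 0) 0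
      simp only [hc', zero_mul]; simpa [mul_comm] using this
    rw [e1, e2, mul_mul_mul_comm, T.z, zero_mul]
  have pw : ∀ u : ℝ, 0 < u → u ^ (γ - 1) = u ^ γ / u := fun u hu => by rw [Real.rpow_sub hu, Real.rpow_one]
  have pw2 : ∀ u : ℝ, 0 < u → u ^ (γ - 1 - 1) = u ^ γ / u / u := fun u hu => by rw [Real.rpow_sub hu, pw u hu, Real.rpow_one]
  have R : ∀ u : ℝ, 0 < u → ∀ g : ℝ, HasDerivAt (fun u : ℝ => u ^ g) (g * u ^ (g - 1)) u := fun u hu g => Real.hasDerivAt_rpow_const (Or.inl hu.ne')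
  refine ⟨μ + γ * (γ - 1), fun u => κ * (γ * u ^ (γ - 1) * c u + u ^ γ * c' u), ?_⟩
  rw [← hγ]
  have ek : (fun u => κ * (u ^ γ * l (fun t => h (u * t)))) = fun u => κ * (u ^ γ * c u) := by rw [hc]
  rw [ek]
  refine ⟨fun u hu => (((R u hu γ).mul (D1 u)).const_mul κ), fun u hu => ?_, by nlinarith [sq_nonneg (γ - 1 / 2)], hγ0, fun u hu => ?_, fun hm => ?_, ?_, ?_, ?_⟩
  · refine (((((R u hu (γ - 1)).const_mul γ).mul (D1 u)).add ((R u hu γ).mul (D2 u))).const_mul κ).congr_deriv ?_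
    have h1 := ode u
    have h2 : (d:ℝ) - 1 = 2 * γ := by rw [hγ]; ring
    rw [h2] at h1
    have h3 : l (fun t => t ^ 2 * -h (u * t)) = (μ * c u - u ^ 2 * c u - 2 * γ * (u * c' u)) / u ^ 2 := by
      rw [eq_div_iff (by positivity)]; linarith
    rw [h3, pw u hu, pw2 u hu]; field_simp; ring
  · have h1 : |c u| ≤ (nuS d).real Set.univ := by
      have := E.bound (h := fun t => h (u * t)) (by fun_prop) (M := 1) fun t _ => T.b1 _
      rw [hc]; simpa using this
    have h2 : 0 < u ^ γ := by positivity
    rw [abs_mul, abs_mul, abs_of_nonneg hκ, abs_of_pos h2, mul_assoc κ, mul_comm (u ^ γ)]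
    gcongr
  · rcases eq_or_lt_of_le hγ0 with h0 | h0
    · have : (d:ℝ) = 1 := by linarith
      rw [hμ1 (by exact_mod_cast this), ← h0] at hm; simp at hm
    · exact h0
  · have : Measurable fun u : ℝ => u ^ γ := by fun_prop
    exact (this.mul cc.measurable).const_mul κ
  · rw [← hγ] at iso
    intro φ a b M h1 h2 h3 h4; rw [← iso φ a b M h1 h2 h3 h4, hc]
  · intro r r' hr hr'
    have F : Continuous fun s => κ ^ 2 * ((r * s) ^ γ * (r' * s) ^ γ) * (r' * (c (r * s) * c' (r' * s)) - r * (c' (r * s) * c (r' * s))) := by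
      have : ∀ x : ℝ, Continuous fun s : ℝ => (x * s) ^ γ := fun x => Continuous.rpow_const (by fun_prop) fun s => Or.inr hγ0
      have t1 := this r
      have t2 := this r'
      fun_prop
    have := (F.tendsto 0).mono_left (nhdsWithin_le_nhds (s := Ioi 0))
    simp only [mul_zero, z0, mul_comm (c' 0), sub_zero] at this
    refine this.congr' ?_
    filter_upwards [self_mem_nhdsWithin] with s hs
    have hs : 0 < s := hs
    rw [pw _ (mul_pos hr hs), pw _ (mul_pos hr' hs)]; field_simp; ring
end
end

section
section
variable {d : ℕ}
open scoped FourierTransform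
lemma planch {f : Euc d → ℂ} (h1 : Integrable f) (h2 : MemLp f 2) : eLpNorm (𝓕 f) 2 = eLpNorm f 2 := by
  have c1 : Continuous (𝓕 f) := VectorFourier.fourierIntegral_continuous continuous_fourierChar (by exact continuous_inner) h1
  have key : ∀ᵐ x, 𝓕 f x = (𝓕 (h2.toLp f) : Lp ℂ 2 (volume : Measure (Euc d))) x := by
    refine ae_eq_of_integral_contDiff_smul_eq c1.locallyIntegrable ((Lp.memLp _).locallyIntegrable one_le_two) fun g hg hc => ?_
    obtain ⟨φ, hφ⟩ : ∃ φ : SchwartzMap (Euc d) ℂ, ∀ x, φ x = (g x : ℂ) :=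
      ⟨(hc.comp_left (g := fun x : ℝ => (x : ℂ)) (by simp)).toSchwartzMap (Complex.ofRealCLM.contDiff.comp hg), fun x => rfl⟩
    have e1 := congrArg (fun T => T φ) (Lp.fourier_toTemperedDistribution_eq (h2.toLp f))
    simp only [TemperedDistribution.fourier_apply, Lp.toTemperedDistribution_apply] at e1
    have e2 : ∀ F : Euc d → ℂ, ∫ x, g x • F x = ∫ x, φ x • F x := fun F => by
      congr 1; ext x; rw [hφ]; simp
    rw [e2, e2, ← e1]
    have e3 := VectorFourier.integral_fourierIntegral_smul_eq_flip (μ := volume) (ν := volume) (L := innerₗ (Euc d)) (f := φ) (g := f) continuous_fourierChar (by exact continuous_inner) φ.integrable h1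
    rw [flip_innerₗ] at e3
    have e4 : ∫ x, (𝓕 φ) x • (h2.toLp f : Euc d → ℂ) x = ∫ x, (𝓕 φ) x • f x := by
      refine integral_congr_ae ?_
      filter_upwards [h2.coeFn_toLp] with x hx; rw [hx]
    rw [e4]; exact e3.symm
  rw [eLpNorm_congr_ae key, ← eLpNorm_congr_ae h2.coeFn_toLp]
  have := Lp.norm_fourier_eq (h2.toLp f)
  rw [Lp.norm_def, Lp.norm_def] at this
  exact (ENNReal.toReal_eq_toReal_iff' (Lp.eLpNorm_ne_top _) (Lp.eLpNorm_ne_top _)).1 this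

lemma enorm2 (f : Euc d → ℂ) : eLpNorm f 2 ^ 2 = ∫⁻ x, ofReal (‖f x‖ ^ 2) := by
  rw [eLpNorm_eq_lintegral_rpow_enorm_toReal (by simp) (by simp), ← ENNReal.rpow_natCast, ← ENNReal.rpow_mul]
  simp [ofReal_pow]

lemma planchFT {f : Euc d → ℂ} (h1 : Integrable f) (h2 : MemLp f 2) :
    ∫⁻ x, ofReal (‖FT f x‖ ^ 2) = ofReal ((2 * Real.pi) ^ d) * ∫⁻ x, ofReal (‖f x‖ ^ 2) := by
  have e : ∀ x, FT f x = 𝓕 f ((2 * Real.pi)⁻¹ • x) := fun x => by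
    rw [Real.fourier_eq', FT]
    congr 1; ext v
    rw [smul_eq_mul, inner_smul_right]
    congr 2; push_cast; field_simp
  have c1 : Continuous (𝓕 f) := VectorFourier.fourierIntegral_continuous continuous_fourierChar (by exact continuous_inner) h1
  rw [← enorm2 f, ← planch h1 h2, enorm2]
  simp only [e]
  have := lintegral_map (μ := (volume : Measure (Euc d))) (f := fun y => ofReal (‖𝓕 f y‖ ^ 2)) (g := fun x => (2 * Real.pi)⁻¹ • x) (by fun_prop) (by fun_prop)
  rw [← this, Measure.map_addHaar_smul _ (by positivity), lintegral_smul_measure]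
  congr 2
  simp
  rw [abs_of_nonneg (by positivity), ← inv_pow, mul_inv, inv_inv, inv_inv, mul_comm]

lemma planch_re {Φ : Euc d → ℝ} (h1 : Integrable Φ) (h2 : MemLp Φ 2) :
    ∫⁻ x, ofReal ((∫ ξ, cos ⟪x, ξ⟫ * Φ ξ) ^ 2 + (∫ ξ, sin ⟪x, ξ⟫ * Φ ξ) ^ 2) =
      ofReal ((2 * Real.pi) ^ d) * ∫⁻ x, ofReal (Φ x ^ 2) := by
  have := planchFT (f := fun x => (Φ x : ℂ)) h1.ofReal h2.ofReal
  simp only [Complex.norm_real, norm_eq_abs, sq_abs] at this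
  rw [← this]
  congr 1; ext x; congr 1
  have i1 : Integrable fun ξ => cos ⟪x, ξ⟫ * Φ ξ := h1.bdd_mul (c := 1) (Continuous.aestronglyMeasurable (by fun_prop)) (.of_forall fun _ => abs_cos_le_one _)
  have i2 : Integrable fun ξ => sin ⟪x, ξ⟫ * Φ ξ := h1.bdd_mul (c := 1) (Continuous.aestronglyMeasurable (by fun_prop)) (.of_forall fun _ => abs_sin_le_one _)
  have : FT (fun x => (Φ x : ℂ)) x = ((∫ ξ, cos ⟪x, ξ⟫ * Φ ξ : ℝ) : ℂ) - ((∫ ξ, sin ⟪x, ξ⟫ * Φ ξ : ℝ) : ℂ) * Complex.I := by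
    rw [FT, ← integral_complex_ofReal, ← integral_complex_ofReal, ← integral_mul_const, ← integral_sub i1.ofReal (i2.ofReal.mul_const _)]
    congr 1; ext ξ
    rw [real_inner_comm, mul_comm Complex.I, ← neg_mul, Complex.exp_mul_I]
    simp; ring
  rw [this, ← normSq_eq_norm_sq, Complex.normSq_apply]
  simp; ring
end
end

section
section
variable {d : ℕ} {Y : Euc d → ℝ} {l : (ℝ → ℝ) → ℝ} {h h' k : ℝ → ℝ}

def gam (d : ℕ) : ℝ := ((d:ℝ) - 1) / 2
def kk (d : ℕ) (κ : ℝ) (l : (ℝ → ℝ) → ℝ) (h : ℝ → ℝ) (u : ℝ) : ℝ := κ * (u ^ gam d * l (fun t => h (u * t)))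

lemma rp (hd : 1 ≤ d) {r : ℝ} (hr : 0 < r) : r ^ (d - 1) = r ^ gam d * r ^ gam d := by
  rw [← rpow_add hr, ← rpow_natCast]; congr 1
  unfold gam; push_cast [hd]; ring

lemma Eig.par (hd : 1 ≤ d) (E : Eig d Y l) (u v : ℝ) : l (fun t => cos (u * t)) * l (fun t => sin (v * t)) = 0 := by
  rw [E.ll (by fun_prop) (by fun_prop)]
  have : ∀ θ η : Euc d, ∫ ω, cos (u * ⟪θ, ω⟫) * sin (v * ⟪η, ω⟫) ∂(nuS d) = 0 := fun θ η => by
    have := (nuS_rot hd (LinearIsometryEquiv.neg ℝ)).integral_comp (LinearIsometryEquiv.neg ℝ).toMeasurableEquiv.measurableEmbedding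
      (fun ω => cos (u * ⟪θ, ω⟫) * sin (v * ⟪η, ω⟫))
    simp only [LinearIsometryEquiv.coe_neg, inner_neg_right, mul_neg, Real.cos_neg, Real.sin_neg, integral_neg] at this
    linarith
  simp [this]

lemma Eig.all (E : Eig d Y l) (T : Trig h h') : ∀ᵐ θ ∂(nuS d), ∀ u : ℝ, Ak (fun t => h (u * t)) Y θ = l (fun t => h (u * t)) * Y θ := by
  have ch := hd_cont T.d1
  have h1 : ∀ᵐ θ ∂(nuS d), ∀ u : ℚ, Ak (fun t => h ((u : ℝ) * t)) Y θ = l (fun t => h (u * t)) * Y θ :=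
    ae_all_iff.2 fun u => E.eig _ (by fun_prop)
  filter_upwards [h1] with θ hθ u
  refine congrFun ((Rat.denseRange_cast (𝕜 := ℝ)).equalizer (g := fun u : ℝ => Ak (fun t => h (u * t)) Y θ) (h := fun u => l (fun t => h (u * t)) * Y θ) ?_ ((E.cont T).mul_const _) (funext hθ)) u
  refine continuous_of_dominated (bound := fun ω => ‖Y ω‖) (fun u => ?_) (fun u => .of_forall fun ω => ?_) E.int.norm (.of_forall fun ω => by fun_prop)
  · exact (Continuous.aestronglyMeasurable (by fun_prop)).mul E.int.1
  · rw [norm_mul]; exact mul_le_of_le_one_left (norm_nonneg _) (T.b1 _)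

lemma Eig.sq (E : Eig d Y l) (x : ℝ) : ∫⁻ ω, ofReal ((Y ω * x) ^ 2) ∂(nuS d) = ofReal (x ^ 2) := by
  have i2 : Integrable (fun θ => Y θ * Y θ) (nuS d) := E.mem.integrable_mul E.mem
  rw [← ofReal_integral_eq_lintegral_ofReal _ (.of_forall fun _ => sq_nonneg _)]
  · congr 1; simp only [mul_pow, integral_mul_const]; simp only [pow_two, E.nrm, one_mul]
  · simp only [mul_pow]; simpa only [pow_two] using i2.mul_const _

def Ph (d : ℕ) (Y : Euc d → ℝ) (φ : ℝ → ℝ) (ξ : Euc d) : ℝ := Y (‖ξ‖⁻¹ • ξ) * (φ ‖ξ‖ * (‖ξ‖ ^ gam d)⁻¹)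

lemma Ph_pol {φ : ℝ → ℝ} {r : ℝ} (hr : 0 < r) {ω : Euc d} (hω : ‖ω‖ = 1) : Ph d Y φ (r • ω) = Y ω * (φ r * (r ^ gam d)⁻¹) := by
  unfold Ph
  rw [norm_smul, hω, mul_one, norm_of_nonneg hr.le, smul_smul, inv_mul_cancel₀ hr.ne', one_smul]

lemma Ph_meas {φ : ℝ → ℝ} (hY : Measurable Y) (hφ : Measurable φ) : Measurable (Ph d Y φ) := by
  unfold Ph; fun_prop

variable {φ : ℝ → ℝ} {a b M : ℝ}

lemma Ph_sq (hd : 1 ≤ d) (E : Eig d Y l) (hY : Measurable Y) (hφ : Measurable φ) (ha : 0 < a) (hz : ∀ r, r ∉ Icc a b → φ r = 0) :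
    ∫⁻ ξ, ofReal (Ph d Y φ ξ ^ 2) = ∫⁻ r, ofReal (φ r ^ 2) := by
  have := Ph_meas hY hφ
  rw [polar_l hd (by fun_prop), ← setLIntegral_eq_of_support_subset (s := Ioi (0:ℝ)) (f := fun r => ofReal (φ r ^ 2))]
  · refine setLIntegral_congr_fun measurableSet_Ioi fun r (hr : 0 < r) => ?_
    have h1 : ∫⁻ ω, ofReal (Ph d Y φ (r • ω) ^ 2) ∂(nuS d) = ofReal ((φ r * (r ^ gam d)⁻¹) ^ 2) := by
      rw [← E.sq]; refine lintegral_congr_ae ?_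
      filter_upwards [nuS_norm d] with ω hω; rw [Ph_pol hr hω]
    have h2 : 0 < r ^ gam d := by positivity
    simp only [h1]
    rw [← ofReal_mul (by positivity), rp hd hr]; congr 1; field_simp
  · intro r hr
    by_contra h0
    exact hr (by simp [hz r fun h1 => h0 (ha.trans_le h1.1)])

lemma Ph_int (hd : 1 ≤ d) (E : Eig d Y l) (hY : Measurable Y) (hφ : Measurable φ) (ha : 0 < a) (hM : ∀ r, |φ r| ≤ M) (hz : ∀ r, r ∉ Icc a b → φ r = 0) :
    MemLp (Ph d Y φ) 2 ∧ Integrable (Ph d Y φ) := by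
  have m := Ph_meas hY hφ
  have h1 : ∫⁻ r, ofReal (φ r ^ 2) ≠ ⊤ := by
    rw [← setLIntegral_eq_of_support_subset (s := Icc a b) (f := fun r => ofReal (φ r ^ 2))]
    · refine ((setLIntegral_mono' (g := fun _ => ofReal (M ^ 2)) measurableSet_Icc fun r _ => ?_).trans_lt ?_).ne
      · exact ofReal_le_ofReal (sq_le_sq' (abs_le.1 (hM r)).1 (abs_le.1 (hM r)).2)
      · simp; finiteness
    · intro r hr; by_contra h0; exact hr (by simp [hz r h0])
  have h2 : MemLp (Ph d Y φ) 2 := by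
    rw [memLp_two_iff_integrable_sq m.aestronglyMeasurable]
    refine ⟨(by fun_prop), ?_⟩
    rw [hasFiniteIntegral_iff_ofReal (.of_forall fun _ => sq_nonneg _), Ph_sq hd E hY hφ ha hz]
    exact h1.lt_top
  refine ⟨h2, ?_⟩
  have h3 : IntegrableOn (Ph d Y φ) (Metric.closedBall 0 b) := by
    have : IsFiniteMeasure ((volume : Measure (Euc d)).restrict (Metric.closedBall 0 b)) := ⟨by
      rw [Measure.restrict_apply_univ]; exact measure_closedBall_lt_top⟩
    exact (h2.restrict _).integrable one_le_two
  refine (integrableOn_iff_integrable_of_support_subset fun ξ hξ => ?_).1 h3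
  by_contra h0
  refine hξ ?_
  unfold Ph; rw [hz]; · simp
  intro h4; exact h0 (by simpa using h4.2)

lemma Eig.fld (hd : 1 ≤ d) (E : Eig d Y l) (T : Trig h h') {κ : ℝ} (hκ : 0 < κ) (hY : Measurable Y) (hφ : Measurable φ) (ha : 0 < a) (hM : ∀ r, |φ r| ≤ M) (hz : ∀ r, r ∉ Icc a b → φ r = 0) :
    ∀ᵐ θ ∂(nuS d), ∀ s > 0, ∫ ξ, h ⟪s • θ, ξ⟫ * Ph d Y φ ξ = Y θ * ((κ * s ^ gam d)⁻¹ * ∫ r, kk d κ l h (r * s) * φ r) := by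
  filter_upwards [E.all T] with θ hθ s hs
  have ch := hd_cont T.d1
  have i1 : Integrable fun ξ => h ⟪s • θ, ξ⟫ * Ph d Y φ ξ :=
    (Ph_int hd E hY hφ ha hM hz).2.bdd_mul (c := 1) (Continuous.aestronglyMeasurable (by fun_prop)) (.of_forall fun _ => T.b1 _)
  rw [polar_int hd i1, ← setIntegral_eq_integral_of_forall_compl_eq_zero (s := Ioi (0:ℝ)) (f := fun r => kk d κ l h (r * s) * φ r), ← integral_const_mul, ← integral_const_mul]
  · refine setIntegral_congr_fun measurableSet_Ioi fun r (hr : 0 < r) => ?_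
    have h1 : ∫ ω, h ⟪s • θ, r • ω⟫ * Ph d Y φ (r • ω) ∂(nuS d) = (φ r * (r ^ gam d)⁻¹) * Ak (fun t => h (r * s * t)) Y θ := by
      unfold Ak; rw [← integral_const_mul]; refine integral_congr_ae ?_
      filter_upwards [nuS_norm d] with ω hω
      rw [Ph_pol hr hω, real_inner_smul_left, real_inner_smul_right, ← mul_assoc s r, mul_comm s r]; ring
    have h2 : 0 < r ^ gam d := by positivity
    have h3 : 0 < s ^ gam d := by positivity
    simp only [h1, hθ, smul_eq_mul, kk]
    rw [rp hd hr, mul_rpow hr.le hs.le]; field_simp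
  · intro r hr; rw [hz r fun h1 => hr (ha.trans_le h1.1)]; simp

lemma Eig.iso (hd : 1 ≤ d) (E : Eig d Y l) {κ : ℝ} (hκ : 0 < κ) (hκ2 : κ ^ 2 * (2 * Real.pi) ^ d = 1) (hY : Measurable Y) (hφ : Measurable φ) (ha : 0 < a) (hM : ∀ r, |φ r| ≤ M) (hz : ∀ r, r ∉ Icc a b → φ r = 0) :
    ∫⁻ s in Ioi 0, ofReal ((∫ r, kk d κ l cos (r * s) * φ r) ^ 2 + (∫ r, kk d κ l sin (r * s) * φ r) ^ 2) = ∫⁻ r, ofReal (φ r ^ 2) := by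
  obtain ⟨h1, h2⟩ := Ph_int hd E hY hφ ha hM hz
  have m := Ph_meas hY hφ
  have p := planch_re h2 h1
  rw [Ph_sq hd E hY hφ ha hz] at p
  have m1 : ∀ h : ℝ → ℝ, Continuous h → Measurable fun x : Euc d => ∫ ξ, h ⟪x, ξ⟫ * Ph d Y φ ξ := fun h hh =>
    (integral_prod_right (f := fun (x : Euc d) ξ => h ⟪x, ξ⟫ * Ph d Y φ ξ) (Measurable.stronglyMeasurable (by fun_prop))).measurable
  have m2 := m1 _ continuous_cos
  have m3 := m1 _ continuous_sin
  rw [polar_l hd (by fun_prop)] at p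
  have q : ∫⁻ s in Ioi 0, ofReal ((κ ^ 2)⁻¹) * ofReal ((∫ r, kk d κ l cos (r * s) * φ r) ^ 2 + (∫ r, kk d κ l sin (r * s) * φ r) ^ 2) = ofReal ((2 * Real.pi) ^ d) * ∫⁻ r, ofReal (φ r ^ 2) := by
    rw [← p]
    refine setLIntegral_congr_fun measurableSet_Ioi fun s (hs : 0 < s) => ?_
    obtain ⟨A, hA⟩ : ∃ A, A = ∫ r, kk d κ l cos (r * s) * φ r := ⟨_, rfl⟩
    obtain ⟨B, hB⟩ : ∃ A, A = ∫ r, kk d κ l sin (r * s) * φ r := ⟨_, rfl⟩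
    have h3 : 0 < s ^ gam d := by positivity
    have e : ∫⁻ ω, ofReal ((∫ ξ, cos ⟪s • ω, ξ⟫ * Ph d Y φ ξ) ^ 2 + (∫ ξ, sin ⟪s • ω, ξ⟫ * Ph d Y φ ξ) ^ 2) ∂(nuS d) =
        ofReal (((κ * s ^ gam d)⁻¹ * √(A ^ 2 + B ^ 2)) ^ 2) := by
      rw [← E.sq]; refine lintegral_congr_ae ?_
      filter_upwards [E.fld hd trig_cos hκ hY hφ ha hM hz, E.fld hd trig_sin hκ hY hφ ha hM hz] with ω h4 h5
      rw [h4 s hs, h5 s hs, ← hA, ← hB]; simp only [mul_pow]; rw [sq_sqrt (by positivity)]; ring_nf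
    simp only [e, ← hA, ← hB]
    rw [← ofReal_mul (by positivity), ← ofReal_mul (by positivity), rp hd hs, mul_pow, sq_sqrt (by positivity)]
    congr 1; field_simp
  rw [lintegral_const_mul' _ _ (by finiteness)] at q
  have : (2 * Real.pi) ^ d = (κ ^ 2)⁻¹ := by exact eq_inv_of_mul_eq_one_right hκ2
  rw [this] at q
  exact (ENNReal.mul_right_inj (by simp; positivity) (by finiteness)).1 q

lemma Eig.kerH (hd : 1 ≤ d) (E : Eig d Y l) {κ : ℝ} (hκ : 0 < κ) (hκ2 : κ ^ 2 * (2 * Real.pi) ^ d = 1) (hY : Measurable Y)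
    (hh : h = cos ∨ h = sin) : (∀ u, l (fun t => h (u * t)) = 0) ∨ ∃ m k', Ker (κ * (nuS d).real Set.univ) (gam d) m (kk d κ l h) k' := by
  rw [or_iff_not_imp_left]; intro h0
  push Not at h0
  obtain ⟨u, hu⟩ := h0
  rcases hh with rfl | rfl
  · have z : ∀ v, l (fun t => sin (v * t)) = 0 := fun v => (mul_eq_zero.1 (E.par hd u v)).resolve_left hu
    refine E.ker hd trig_cos hκ.le fun φ a b M hφ ha hM hz => ?_
    rw [← E.iso hd hκ hκ2 hY hφ ha hM hz]
    simp [kk, z, gam]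
  · have z : ∀ v, l (fun t => cos (v * t)) = 0 := fun v => (mul_eq_zero.1 (E.par hd v u)).resolve_right hu
    refine E.ker hd trig_sin hκ.le fun φ a b M hφ ha hM hz => ?_
    rw [← E.iso hd hκ hκ2 hY hφ ha hM hz]
    simp [kk, z, gam]
end
end

section
structure Dat (d : ℕ) (a b M : ℝ) (g : Euc d → ℝ) : Prop where
  meas : Measurable g
  bd : ∀ ξ, |g ξ| ≤ M
  ha : 0 < a
  z : ∀ ξ, ‖ξ‖ ∉ Icc a b → g ξ = 0

def Tw {d : ℕ} (h : ℝ → ℝ) (w : Euc d → ℝ) (x : Euc d) : ℝ := ∫ ξ, h ⟪x, ξ⟫ * w ξ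

section
variable {d : ℕ} {Y w : Euc d → ℝ} {l : (ℝ → ℝ) → ℝ} {h h' k : ℝ → ℝ} {a b M : ℝ}

lemma Dat.supp (D : Dat d a b M w) : Function.support w ⊆ Metric.closedBall 0 b := fun ξ hξ => by
  by_contra h0
  exact hξ (D.z ξ fun h4 => h0 (by simpa using h4.2))

lemma Dat.int (D : Dat d a b M w) (hh : Continuous h) (x : Euc d) : Integrable (fun ξ => h ⟪x, ξ⟫ * w ξ) := by
  have h3 : IntegrableOn w (Metric.closedBall 0 b) :=
    integrableOn_of_bounded measure_closedBall_lt_top.ne D.meas.aestronglyMeasurable (.of_forall D.bd)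
  have h4 := h3.continuousOn_mul (g := fun ξ => h ⟪x, ξ⟫) (by fun_prop) (isCompact_closedBall 0 b)
  exact (integrableOn_iff_integrable_of_support_subset ((Function.support_mul_subset_right _ _).trans D.supp)).1 h4

lemma Dat.int1 (D : Dat d a b M w) : Integrable w := by simpa using D.int (h := fun _ => 1) continuous_const 0

lemma Dat.zr (D : Dat d a b M w) {r : ℝ} (hr : 0 < r) {ω : Euc d} (hω : ‖ω‖ = 1) (hn : r ∉ Icc a b) : w (r • ω) = 0 :=
  D.z _ (by rwa [norm_smul, hω, mul_one, norm_of_nonneg hr.le])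

lemma rho_fin (d : ℕ) (a b : ℝ) : rhoS d (Icc a b) < ⊤ := by
  rw [rhoS, withDensity_apply _ measurableSet_Icc, restrict_restrict measurableSet_Icc]
  refine (setLIntegral_mono' (g := fun _ => ofReal (b ^ (d - 1))) (measurableSet_Icc.inter measurableSet_Ioi) fun r hr => ?_).trans_lt ?_
  · exact ofReal_le_ofReal (pow_le_pow_left₀ (le_of_lt hr.2) hr.1.2 _)
  · rw [setLIntegral_const]
    exact ENNReal.mul_lt_top (by finiteness) ((measure_mono Set.inter_subset_left).trans_lt (by simp))

lemma rho_pos (d : ℕ) : ∀ᵐ r ∂(rhoS d), 0 < r :=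
  (withDensity_absolutelyContinuous _ _).ae_le (ae_restrict_mem measurableSet_Ioi)

lemma mom (hd : 1 ≤ d) (D : Dat d a b M w) (i : ℕ) : ∃ F : Hs d, ∀ᵐ θ ∂(nuS d), AL ⟨fun t => t ^ i, by fun_prop⟩ F θ = Tw (fun t => t ^ i) w θ := by
  have wm := D.meas
  have fm : AEStronglyMeasurable (fun ω : Euc d => ∫ r, r ^ i * w (r • ω) ∂(rhoS d)) (nuS d) :=
    (integral_prod_right (f := fun (ω : Euc d) (r : ℝ) => r ^ i * w (r • ω)) (Measurable.stronglyMeasurable (by fun_prop))).aestronglyMeasurable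
  have mem : MemLp (fun ω : Euc d => ∫ r, r ^ i * w (r • ω) ∂(rhoS d)) 2 (nuS d) := by
    refine MemLp.of_bound fm (b ^ i * M * (rhoS d).real (Icc a b)) ?_
    filter_upwards [nuS_norm d] with ω hω
    have e : ∫ r, r ^ i * w (r • ω) ∂(rhoS d) = ∫ r in Icc a b, r ^ i * w (r • ω) ∂(rhoS d) := by
      symm; refine setIntegral_eq_integral_of_ae_compl_eq_zero ?_
      filter_upwards [rho_pos d] with r hr hn
      rw [D.zr hr hω hn, mul_zero]
    rw [e]
    refine norm_setIntegral_le_of_norm_le_const (rho_fin d a b) fun r hr => ?_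
    have := D.ha.trans_le hr.1
    rw [norm_mul, norm_pow, norm_of_nonneg this.le]
    exact mul_le_mul (pow_le_pow_left₀ this.le hr.2 _) (D.bd _) (norm_nonneg _) (pow_nonneg (this.le.trans hr.2) _)
  refine ⟨mem.toLp, ?_⟩
  filter_upwards [AL_coe ⟨fun t => t ^ i, by fun_prop⟩ mem.toLp] with θ hθ
  rw [hθ, Ak_congr mem.coeFn_toLp]
  have ii := D.int (h := fun t => t ^ i) (by fun_prop) θ
  have h1 := (polar_mp hd).map_eq
  have i2 : Integrable (fun p : Euc d × ℝ => ⟪θ, p.2 • p.1⟫ ^ i * w (p.2 • p.1)) ((nuS d).prod (rhoS d)) := (polar_mp hd).integrable_comp_of_integrable ii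
  have h2 : Tw (fun t => t ^ i) w θ = ∫ p, ⟪θ, p.2 • p.1⟫ ^ i * w (p.2 • p.1) ∂((nuS d).prod (rhoS d)) := by
    unfold Tw
    rw [← h1]
    exact integral_map (f := fun ξ => ⟪θ, ξ⟫ ^ i * w ξ) (by fun_prop) (h1 ▸ ii.aestronglyMeasurable)
  rw [h2, integral_prod _ i2]
  unfold Ak
  congr 1; ext ω
  simp only [ContinuousMap.coe_mk]
  rw [← integral_const_mul]
  congr 1; ext r
  rw [real_inner_smul_right, mul_pow]; ring

lemma approx (hd : 1 ≤ d) (D : Dat d a b M w) (hh : Continuous h) {s : ℝ} (hs : 0 < s) {G : Hs d} (hG : ∀ᵐ θ ∂(nuS d), G θ = Tw h w (s • θ)) {ε : ℝ} (hε : 0 < ε) :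
    ∃ N₀, ∀ N ≥ N₀, ∃ F : ℕ → Hs d, ‖G - ∑ i ∈ range N, AL ⟨fun t => t ^ i, by fun_prop⟩ (F i)‖ ^ 2 ≤ ε := by
  obtain ⟨I, hI⟩ : ∃ I, I = ∫ ξ, ‖w ξ‖ := ⟨_, rfl⟩
  have hI0 : 0 ≤ I := hI ▸ integral_nonneg fun _ => norm_nonneg _
  obtain ⟨A, hA⟩ : ∃ A, A = (nuS d).real Set.univ := ⟨_, rfl⟩
  have hA0 : 0 ≤ A := hA ▸ measureReal_nonneg
  obtain ⟨η, hη, hη2⟩ : ∃ η, 0 < η ∧ (η * I) ^ 2 * A ≤ ε := by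
    refine ⟨√(ε / (I ^ 2 * A + 1)), by positivity, ?_⟩
    rw [mul_pow, sq_sqrt (by positivity), mul_assoc, div_mul_eq_mul_div, div_le_iff₀ (by positivity)]
    nlinarith
  obtain ⟨p, hp⟩ := exists_polynomial_near_of_continuousOn (-(s * b)) (s * b) h hh.continuousOn η hη
  choose F hF using fun i => mom hd D i
  refine ⟨p.natDegree + 1, fun N hN => ⟨fun i => (p.coeff i * s ^ i) • F i, ?_⟩⟩
  obtain ⟨H, hH⟩ : ∃ H : Hs d, H = ∑ i ∈ range N, AL ⟨fun t => t ^ i, by fun_prop⟩ ((p.coeff i * s ^ i) • F i) := ⟨_, rfl⟩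
  have e1 : ∀ᵐ θ ∂(nuS d), H θ = Tw (fun t => p.eval t) w (s • θ) := by
    rw [hH]
    have h2 : ∀ᵐ θ ∂(nuS d), ∀ i, (AL ⟨fun t => t ^ i, by fun_prop⟩ ((p.coeff i * s ^ i) • F i) : Hs d) θ = p.coeff i * s ^ i * (AL ⟨fun t => t ^ i, by fun_prop⟩ (F i) : Hs d) θ := by
      refine ae_all_iff.2 fun i => ?_
      rw [map_smul]; exact Lp.coeFn_smul _ _
    filter_upwards [Hs_sum (range N) fun i => AL ⟨fun t => t ^ i, by fun_prop⟩ ((p.coeff i * s ^ i) • F i), h2, ae_all_iff.2 hF] with θ h1 h2 h3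
    rw [h1]; simp only [h2, h3]
    unfold Tw
    simp only [← integral_const_mul]
    rw [← integral_finsetSum _ fun i _ => (D.int (h := fun t => t ^ i) (by fun_prop) θ).const_mul _]
    congr 1; ext ξ
    rw [Polynomial.eval_eq_sum_range' (Nat.lt_of_succ_le hN), Finset.sum_mul]
    refine sum_congr rfl fun i _ => ?_
    rw [real_inner_smul_left, mul_pow]; ring
  rw [← hH, ← real_inner_self_eq_norm_sq, Hs_inner]
  refine le_trans ?_ hη2
  have e2 : ∀ᵐ θ ∂(nuS d), ‖(G - H : Hs d) θ * (G - H : Hs d) θ‖ ≤ (η * I) ^ 2 := by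
    filter_upwards [Lp.coeFn_sub G H, hG, e1, nuS_norm d] with θ h1 h2 h3 h4
    rw [h1, Pi.sub_apply, h2, h3, norm_mul, ← pow_two]
    refine pow_le_pow_left₀ (norm_nonneg _) ?_ 2
    unfold Tw
    rw [← integral_sub (D.int hh _) (D.int p.continuous _), hI, ← integral_const_mul]
    refine norm_integral_le_of_norm_le (D.int1.norm.const_mul η) (.of_forall fun ξ => ?_)
    rw [← sub_mul, norm_mul]
    by_cases h0 : w ξ = 0
    · simp [h0]
    refine mul_le_mul_of_nonneg_right ?_ (norm_nonneg _)
    have hξ : ‖ξ‖ ≤ b := by simpa using D.supp h0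
    have h5 := abs_real_inner_le_norm (s • θ) ξ
    rw [norm_smul, h4, mul_one, norm_of_nonneg hs.le] at h5
    rw [norm_sub_rev]
    exact (hp _ (abs_le.1 (h5.trans (by gcongr)))).le
  have := norm_integral_le_of_norm_le_const e2
  rw [← hA] at this
  exact (le_abs_self _).trans this

lemma pairY (hd : 1 ≤ d) (E : Eig d Y l) (hY : Measurable Y) (D : Dat d a b M w) (T : Trig h h') {s : ℝ} (hs : 0 < s) :
    ∫ θ, Y θ * Tw h w (s • θ) ∂(nuS d) = ∫ r in Ioi 0, r ^ (d - 1) * (l (fun t => h (r * s * t)) * ∫ ω, w (r • ω) * Y ω ∂(nuS d)) := by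
  have ch := hd_cont T.d1
  have wm := D.meas
  have i1 : Integrable (fun p : Euc d × Euc d => h ⟪s • p.1, p.2⟫ * (Y p.1 * w p.2)) ((nuS d).prod volume) :=
    (E.int.mul_prod D.int1).bdd_mul (c := 1) (Continuous.aestronglyMeasurable (by fun_prop)) (.of_forall fun _ => T.b1 _)
  have e1 : ∫ θ, Y θ * Tw h w (s • θ) ∂(nuS d) = ∫ ξ, ∫ θ, h ⟪s • θ, ξ⟫ * (Y θ * w ξ) ∂(nuS d) := by
    rw [← integral_integral_swap (f := fun θ ξ => h ⟪s • θ, ξ⟫ * (Y θ * w ξ)) i1]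
    unfold Tw
    congr 1; ext θ; rw [← integral_const_mul]; congr 1; ext ξ; ring
  rw [e1, polar_int hd i1.integral_prod_right]
  refine setIntegral_congr_fun measurableSet_Ioi fun r (hr : 0 < r) => ?_
  simp only [smul_eq_mul]
  congr 1
  rw [← integral_const_mul]
  refine integral_congr_ae ?_
  filter_upwards [E.all T] with ω hω
  have : ∫ θ, h ⟪s • θ, r • ω⟫ * (Y θ * w (r • ω)) ∂(nuS d) = w (r • ω) * Ak (fun t => h (r * s * t)) Y ω := by
    unfold Ak; rw [← integral_const_mul]; congr 1; ext θ
    rw [real_inner_smul_left, real_inner_smul_right, real_inner_comm, ← mul_assoc s r, mul_comm s r]; ring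
  rw [this, hω]; ring
end
end

section
def Wc {d : ℕ} (S : ℝ → ℝ) (g : Euc d → ℝ) (s : ℝ) (ξ : Euc d) : ℝ := if S ‖ξ‖ < s then g ξ else 0

def gY {d : ℕ} (g Y : Euc d → ℝ) (r : ℝ) : ℝ := if 0 < r then r ^ gam d * ∫ ω, g (r • ω) * Y ω ∂(nuS d) else 0

section
variable {d : ℕ} {Y g : Euc d → ℝ} {l : (ℝ → ℝ) → ℝ} {h h' k S : ℝ → ℝ} {a b M C₀ κ : ℝ}

lemma Dat.cut (D : Dat d a b M g) (hS : Measurable S) (s : ℝ) : Dat d a b M (Wc S g s) where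
  meas := Measurable.ite (measurableSet_lt (by fun_prop) measurable_const) D.meas measurable_const
  bd ξ := by
    have := D.bd ξ
    unfold Wc; split_ifs
    · exact this
    · simpa using (abs_nonneg _).trans this
  ha := D.ha
  z ξ hξ := by unfold Wc; rw [D.z ξ hξ, ite_self]

lemma gam_nn (hd : 1 ≤ d) : 0 ≤ gam d := by
  have : (1:ℝ) ≤ d := by exact_mod_cast hd
  unfold gam; linarith

lemma gY_adm (hd : 1 ≤ d) (D : Dat d a b M g) (hY : Measurable Y) (iY : Integrable Y (nuS d)) : Adm (gY g Y) := by
  have gm := D.meas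
  have hz : ∀ r, r ∉ Icc a b → gY g Y r = 0 := fun r hr => by
    unfold gY; split_ifs with h0
    · rw [integral_eq_zero_of_ae, mul_zero]
      filter_upwards [nuS_norm d] with ω hω
      rw [D.zr h0 hω hr, zero_mul]; rfl
    · rfl
  refine ⟨?_, a, b, |b| ^ gam d * ∫ ω, M * |Y ω| ∂(nuS d), D.ha, fun r => ?_, hz⟩
  · refine Measurable.ite measurableSet_Ioi (Measurable.mul (by fun_prop) ?_) measurable_const
    exact (integral_prod_right (f := fun (r : ℝ) (ω : Euc d) => g (r • ω) * Y ω) (Measurable.stronglyMeasurable (by fun_prop))).measurable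
  · have hM : 0 ≤ M := (abs_nonneg _).trans (D.bd 0)
    by_cases hr : r ∈ Icc a b
    · have h0 := D.ha.trans_le hr.1
      rw [gY, if_pos h0, abs_mul, abs_of_nonneg (by positivity)]
      refine mul_le_mul (rpow_le_rpow h0.le (hr.2.trans (le_abs_self b)) (gam_nn hd)) ?_ (abs_nonneg _) (by positivity)
      rw [← norm_eq_abs]
      refine norm_integral_le_of_norm_le (iY.abs.const_mul M) (.of_forall fun ω => ?_)
      rw [norm_mul]; exact mul_le_mul_of_nonneg_right (D.bd _) (norm_nonneg _)
    · rw [hz r hr, abs_zero]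
      exact mul_nonneg (by positivity) (integral_nonneg fun ω => by positivity)

lemma pairTL (hd : 1 ≤ d) (E : Eig d Y l) (hY : Measurable Y) (D : Dat d a b M g) (hS : Measurable S) (T : Trig h h') (hκ : 0 < κ) {s : ℝ} (hs : 0 < s) :
    ∫ θ, Y θ * Tw h (Wc S g s) (s • θ) ∂(nuS d) = (κ * s ^ gam d)⁻¹ * TL (kk d κ l h) (fun r => Ioi (S r)) (gY g Y) s := by
  rw [pairY hd E hY (D.cut hS s) T hs, TL, ← integral_const_mul, ← integral_indicator measurableSet_Ioi]
  congr 1; ext r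
  by_cases hr : 0 < r
  · rw [indicator_of_mem (show r ∈ Ioi 0 from hr)]
    have e1 : ∫ ω, Wc S g s (r • ω) * Y ω ∂(nuS d) = if S r < s then ∫ ω, g (r • ω) * Y ω ∂(nuS d) else 0 := by
      have : ∀ᵐ ω ∂(nuS d), Wc S g s (r • ω) = if S r < s then g (r • ω) else 0 := by
        filter_upwards [nuS_norm d] with ω hω
        rw [Wc, norm_smul, hω, mul_one, norm_of_nonneg hr.le]
      rw [integral_congr_ae (g := fun ω => (if S r < s then g (r • ω) else 0) * Y ω) (by filter_upwards [this] with ω hω; rw [hω])]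
      split_ifs <;> simp
    rw [e1]
    by_cases h0 : S r < s
    · rw [if_pos h0, indicator_of_mem (show r ∈ {r | s ∈ Ioi (S r)} from h0), gY, if_pos hr, rp hd hr, kk, mul_rpow hr.le hs.le]
      have : 0 < s ^ gam d := by positivity
      field_simp
    · rw [if_neg h0, indicator_of_notMem (show r ∉ {r | s ∈ Ioi (S r)} from h0)]; ring
  · rw [indicator_of_notMem (show r ∉ Ioi 0 from hr)]; simp [Set.indicator, gY, hr]

lemma kk_meas (E : Eig d Y l) (T : Trig h h') : Measurable (kk d κ l h) := by
  have := (E.cont T).measurable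
  exact (((measurable_id.pow_const _).mul this).const_mul _)

lemma TLm {k g : ℝ → ℝ} (hk : Measurable k) (hg : Measurable g) (hS : Measurable S) : Measurable (TL k (fun r => Ioi (S r)) g) := by
  have : Measurable fun p : ℝ × ℝ => ({p : ℝ × ℝ | S p.2 < p.1}.indicator (fun p => k (p.2 * p.1) * g p.2)) p :=
    Measurable.indicator (by fun_prop) (measurableSet_lt (by fun_prop) (by fun_prop))
  exact (integral_prod_right (f := fun s r : ℝ => {r | s ∈ Ioi (S r)}.indicator (fun r => k (r * s) * g r) r) this.stronglyMeasurable).measurable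

lemma trig_of (hh : h = cos ∨ h = sin) : ∃ h', Trig h h' := by
  rcases hh with rfl | rfl
  · exact ⟨_, trig_cos⟩
  · exact ⟨_, trig_sin⟩

lemma oneY (hd : 1 ≤ d) (hC₀ : 1 ≤ C₀) (hκ : 0 < κ) (hκ2 : κ ^ 2 * (2 * Real.pi) ^ d = 1) : ∃ C, 0 ≤ C ∧ ∀ (Y : Euc d → ℝ) (l : (ℝ → ℝ) → ℝ) (h S : ℝ → ℝ) (φ : ℝ → ℝ), Eig d Y l → Measurable Y →
    (h = cos ∨ h = sin) → Cfg C₀ S → (MonotoneOn S (Ioi 0) ∨ AntitoneOn S (Ioi 0)) → Adm φ →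
    NN (TL (kk d κ l h) (fun r => Ioi (S r)) φ) ≤ ofReal C * ∫⁻ r, ofReal (φ r ^ 2) := by
  obtain ⟨C, hC, H⟩ := thm1D (B := κ * (nuS d).real Set.univ) (γ := gam d) hC₀
  refine ⟨C, hC, fun Y l h S φ E hY hh cf hS hφ => ?_⟩
  rcases E.kerH hd hκ hκ2 hY hh with h0 | ⟨m, k', K⟩
  · simp [NN, TL, kk, h0]
  · exact H m _ k' S φ K cf hS hφ

lemma ofn (G : Hs d) {F : Euc d → ℝ} (hG : ∀ᵐ θ ∂(nuS d), G θ = F θ) : ofReal (‖G‖ ^ 2) = ∫⁻ θ, ofReal (F θ ^ 2) ∂(nuS d) := by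
  rw [← real_inner_self_eq_norm_sq, Hs_inner, ofReal_integral_eq_lintegral_ofReal (show Integrable (fun θ => G θ * G θ) (nuS d) from (Lp.memLp G).integrable_mul (Lp.memLp G)) (.of_forall fun θ => mul_self_nonneg _)]
  refine lintegral_congr_ae ?_
  filter_upwards [hG] with θ hθ; rw [hθ, pow_two]

lemma bessel (hd : 1 ≤ d) (D : Dat d a b M g) {n : ℕ} {y : Fin n → Hs d} (hy : Orthonormal ℝ y) :
    ∑ i, ∫⁻ r, ofReal (gY g (y i) r ^ 2) ≤ ∫⁻ ξ, ofReal (g ξ ^ 2) := by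
  have gm := D.meas
  have mY : ∀ i, Measurable (gY g (y i)) := fun i => (gY_adm hd D (Lp.stronglyMeasurable (y i)).measurable (Hs_int _)).1
  rw [← lintegral_finsetSum _ (fun i _ => by have := mY i; fun_prop), polar_l hd (by fun_prop), ← setLIntegral_eq_of_support_subset (s := Ioi (0:ℝ))]
  · refine setLIntegral_mono' measurableSet_Ioi fun r (hr : 0 < r) => ?_
    have mem : MemLp (fun ω => g (r • ω)) 2 (nuS d) := MemLp.of_bound (Measurable.aestronglyMeasurable (by fun_prop)) M (.of_forall fun ω => D.bd _)
    have e1 : ∀ i, gY g (y i) r = r ^ gam d * ⟪y i, mem.toLp⟫ := fun i => by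
      rw [gY, if_pos hr, Hs_inner]; congr 1
      refine integral_congr_ae ?_
      filter_upwards [mem.coeFn_toLp] with ω hω; rw [hω, mul_comm]
    rw [← ofn mem.toLp mem.coeFn_toLp, ← ofReal_mul (by positivity), ← ENNReal.ofReal_sum_of_nonneg fun i _ => sq_nonneg _]
    refine ofReal_le_ofReal ?_
    have := hy.sum_inner_products_le (x := mem.toLp) (s := Finset.univ)
    simp only [norm_eq_abs, sq_abs] at this
    simp only [e1, mul_pow, ← mul_sum]
    rw [rp hd hr, ← pow_two]
    gcongr
  · intro r hr
    by_contra h0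
    simp [gY, show ¬ 0 < r from h0] at hr
end
end

section
section
variable {d : ℕ} {Y g w : Euc d → ℝ} {l : (ℝ → ℝ) → ℝ} {h h' k S : ℝ → ℝ} {a b M C₀ κ : ℝ}

lemma Tw_mem (D : Dat d a b M w) (T : Trig h h') (s : ℝ) : MemLp (fun θ => Tw h w (s • θ)) 2 (nuS d) := by
  have ch := hd_cont T.d1
  have wm := D.meas
  refine MemLp.of_bound (C := ∫ ξ, ‖w ξ‖) ?_ (.of_forall fun θ => ?_)
  · exact (integral_prod_right (f := fun (θ ξ : Euc d) => h ⟪s • θ, ξ⟫ * w ξ) (Measurable.stronglyMeasurable (by fun_prop))).aestronglyMeasurable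
  · refine norm_integral_le_of_norm_le D.int1.norm (.of_forall fun ξ => ?_)
    rw [norm_mul]; exact mul_le_of_le_one_left (norm_nonneg _) (T.b1 _)

lemma Wc_meas (gm : Measurable g) (hS : Measurable S) : Measurable fun p : Euc d × Euc d => Wc S g ‖p.1‖ p.2 := by
  unfold Wc
  exact Measurable.ite (measurableSet_lt (by fun_prop) (by fun_prop)) (by fun_prop) measurable_const

lemma TW_meas (gm : Measurable g) (hS : Measurable S) (ch : Continuous h) : Measurable fun x : Euc d => Tw h (Wc S g ‖x‖) x := by
  have := Wc_meas gm hS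
  exact (integral_prod_right (f := fun (x ξ : Euc d) => h ⟪x, ξ⟫ * Wc S g ‖x‖ ξ) (Measurable.stronglyMeasurable (by fun_prop))).measurable

theorem sector (hd : 1 ≤ d) (hC₀ : 1 ≤ C₀) : ∃ C, 0 ≤ C ∧ ∀ (a b M : ℝ) (g : Euc d → ℝ) (h S : ℝ → ℝ), Dat d a b M g →
    (h = cos ∨ h = sin) → Cfg C₀ S → (MonotoneOn S (Ioi 0) ∨ AntitoneOn S (Ioi 0)) →
    ∫⁻ x : Euc d, ofReal (Tw h (Wc S g ‖x‖) x ^ 2) ≤ ofReal C * ∫⁻ ξ, ofReal (g ξ ^ 2) := by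
  obtain ⟨κ, hκ, hκ2⟩ : ∃ κ : ℝ, 0 < κ ∧ κ ^ 2 * (2 * Real.pi) ^ d = 1 := by
    refine ⟨√(((2 * Real.pi) ^ d)⁻¹), by positivity, ?_⟩
    rw [sq_sqrt (by positivity), inv_mul_cancel₀ (by positivity)]
  obtain ⟨C, hC, H⟩ := oneY hd hC₀ hκ hκ2
  refine ⟨(κ ^ 2)⁻¹ * C, by positivity, fun a b M g h S D hh cf mS => ?_⟩
  obtain ⟨h', T⟩ := trig_of hh
  have ch := hd_cont T.d1
  choose n y hy hl hB using sph_basis hd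
  choose l hl using hl
  have Ym : ∀ N i, Measurable (y N i) := fun N i => (Lp.stronglyMeasurable _).measurable
  have E : ∀ N i, Eig d (y N i) (l N i) := fun N i => ⟨Lp.memLp _, by
    rw [← Hs_inner, real_inner_self_eq_norm_sq, (hy N).1 i, one_pow], hl N i⟩
  have gA : ∀ N i, Adm (gY g (y N i)) := fun N i => gY_adm hd D (Ym N i) (Hs_int _)
  obtain ⟨U, hU⟩ : ∃ U : ∀ N, Fin (n N) → ℝ → ℝ, U = fun N i => TL (kk d κ (l N i) h) (fun r => Ioi (S r)) (gY g (y N i)) := ⟨_, rfl⟩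
  have Um : ∀ N i, Measurable (U N i) := fun N i => by
    rw [hU]; exact TLm (kk_meas (E N i) T) (gA N i).1 cf.meas
  have UN : ∀ N i, NN (U N i) ≤ ofReal C * ∫⁻ r, ofReal (gY g (y N i) r ^ 2) := fun N i => by
    rw [hU]; exact H _ _ _ _ _ (E N i) (Ym N i) hh cf mS (gA N i)
  obtain ⟨Q, hQ⟩ : ∃ Q : ℕ → ℝ → ℝ≥0∞, Q = fun N s => ofReal ((κ ^ 2)⁻¹) * ∑ i, ofReal (U N i s ^ 2) := ⟨_, rfl⟩
  have Qm : ∀ N, Measurable (Q N) := fun N => by rw [hQ]; have := Um N; fun_prop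
  have QN : ∀ N, ∫⁻ s in Ioi 0, Q N s ≤ ofReal ((κ ^ 2)⁻¹ * C) * ∫⁻ ξ, ofReal (g ξ ^ 2) := fun N => by
    rw [hQ]
    simp only
    rw [lintegral_const_mul' _ _ (by finiteness), lintegral_finsetSum _ (fun i _ => by have := Um N i; fun_prop), ofReal_mul (by positivity), mul_assoc]
    gcongr
    refine (Finset.sum_le_sum fun i _ => UN N i).trans ?_
    rw [← mul_sum]
    gcongr
    exact bessel hd D (hy N)
  have key : ∀ s, 0 < s → ofReal (s ^ (d - 1)) * ∫⁻ ω, ofReal (Tw h (Wc S g ‖s • ω‖) (s • ω) ^ 2) ∂(nuS d) ≤ liminf (fun N => Q N s) atTop := by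
    intro s hs
    have mem := Tw_mem (D.cut cf.meas s) T s
    obtain ⟨G, hG⟩ : ∃ G : Hs d, G = mem.toLp := ⟨_, rfl⟩
    have hG1 : ∀ᵐ θ ∂(nuS d), G θ = Tw h (Wc S g s) (s • θ) := hG ▸ mem.coeFn_toLp
    have hG2 : ∀ᵐ θ ∂(nuS d), G θ = Tw h (Wc S g ‖s • θ‖) (s • θ) := by
      filter_upwards [hG1, nuS_norm d] with θ h1 h2
      rw [h1, norm_smul, h2, mul_one, norm_of_nonneg hs.le]
    rw [← ofn G hG2, ← ofReal_mul (by positivity)]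
    have e1 : ∀ N i, s ^ (d - 1) * ⟪y N i, G⟫ ^ 2 = (κ ^ 2)⁻¹ * U N i s ^ 2 := fun N i => by
      have : ⟪y N i, G⟫ = (κ * s ^ gam d)⁻¹ * U N i s := by
        rw [hU, Hs_inner]
        simp only
        rw [← pairTL hd (E N i) (Ym N i) D cf.meas T hκ hs]
        refine integral_congr_ae ?_
        filter_upwards [hG1] with θ h1; rw [h1]
      have h2 : 0 < s ^ gam d := by positivity
      rw [this, rp hd hs]; field_simp
    refine ENNReal.le_of_forall_pos_le_add fun ε hε _ => ?_
    rw [← tsub_le_iff_right]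
    obtain ⟨N₀, hN₀⟩ := approx hd (D.cut cf.meas s) ch hs hG1 (ε := (s ^ (d - 1))⁻¹ * ε) (by positivity)
    refine le_liminf_of_le (by isBoundedDefault) ?_
    filter_upwards [eventually_ge_atTop N₀] with N hN
    obtain ⟨F, hF⟩ := hN₀ N hN
    rw [tsub_le_iff_right, hQ]
    simp only
    rw [← ENNReal.ofReal_sum_of_nonneg fun i _ => sq_nonneg _, ← ofReal_mul (by positivity), ← ENNReal.ofReal_coe_nnreal, ← ofReal_add (mul_nonneg (by positivity) (Finset.sum_nonneg fun i _ => sq_nonneg _)) ε.coe_nonneg, mul_sum]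
    refine ofReal_le_ofReal ?_
    simp only [← e1, ← mul_sum]
    have h3 := mul_le_mul_of_nonneg_left ((hB N F G).trans (add_le_add_right hF _)) (show 0 ≤ s ^ (d - 1) by positivity)
    rwa [mul_add, mul_inv_cancel_left₀ (by positivity)] at h3
  rw [polar_l hd (by have := TW_meas D.meas cf.meas ch; fun_prop)]
  refine (setLIntegral_mono' measurableSet_Ioi key).trans ((lintegral_liminf_le Qm).trans ((liminf_le_liminf (.of_forall QN)).trans ?_))
  rw [liminf_const]
end
end

section
lemma FT_bd {d : ℕ} (f : Euc d → ℂ) (ξ : Euc d) : ‖FT f ξ‖ ≤ ∫ x, ‖f x‖ := by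
  refine (norm_integral_le_integral_norm _).trans_eq (integral_congr_ae (.of_forall fun x => ?_))
  simp only [norm_mul]
  rw [show -(Complex.I * ((⟪x, ξ⟫ : ℝ) : ℂ)) = ((-⟪x, ξ⟫ : ℝ) : ℂ) * Complex.I by push_cast; ring, Complex.norm_exp_ofReal_mul_I, one_mul]

lemma FT_meas {d : ℕ} {f : Euc d → ℂ} (hf : Measurable f) : Measurable (FT f) :=
  (integral_prod_right (f := fun ξ x : Euc d => Complex.exp (-(Complex.I * ((⟪x, ξ⟫ : ℝ) : ℂ))) * f x)
    (Measurable.stronglyMeasurable (by fun_prop))).measurable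

lemma Dat.mulF {d : ℕ} {a b M N : ℝ} {m F : Euc d → ℝ} (D : Dat d a b M m) (hF : Measurable F) (hN : ∀ ξ, |F ξ| ≤ N) : Dat d a b (M * N) (fun ξ => m ξ * F ξ) where
  meas := D.meas.mul hF
  bd ξ := by rw [abs_mul]; exact mul_le_mul (D.bd ξ) (hN ξ) (abs_nonneg _) ((abs_nonneg _).trans (D.bd ξ))
  ha := D.ha
  z ξ hξ := by simp only [D.z ξ hξ, zero_mul]

lemma opbound {d : ℕ} {C₀ : ℝ} (hd : 1 ≤ d) (hC₀ : 1 ≤ C₀) : ∃ K, 0 ≤ K ∧ ∀ (a b M : ℝ) (m : Euc d → ℝ) (S : ℝ → ℝ) (f : Euc d → ℂ) (σ : Euc d → Euc d → ℂ), Dat d a b M m → Cfg C₀ S →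
    (MonotoneOn S (Ioi 0) ∨ AntitoneOn S (Ioi 0)) → Measurable f → Integrable f → MemLp f 2 → (∀ x ξ, σ x ξ = ((Wc S m ‖x‖ ξ : ℝ) : ℂ)) →
    eLpNorm (OpS σ f) 2 ≤ ofReal (K * M) * eLpNorm f 2 := by
  obtain ⟨C, hC, H⟩ := sector hd hC₀
  obtain ⟨q, hq⟩ : ∃ q : ℝ, q = ((2 * Real.pi) ^ d)⁻¹ := ⟨_, rfl⟩
  have hq0 : 0 < q := hq ▸ by positivity
  refine ⟨√(4 * q * C), by positivity, fun a b M m S f σ D cf mS fm fi f2 hσ => ?_⟩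
  have hM : 0 ≤ M := (abs_nonneg _).trans (D.bd 0)
  have Fm := FT_meas fm
  have hq3 : q * (2 * Real.pi) ^ d = 1 := by rw [hq, inv_mul_cancel₀ (by positivity)]
  obtain ⟨F, hF⟩ : ∃ F, F = FT f := ⟨_, rfl⟩
  have hFb : ∀ ξ, ‖F ξ‖ ≤ ∫ x, ‖f x‖ := fun ξ => hF ▸ FT_bd f ξ
  rw [← hF] at Fm
  have D1 := D.mulF (F := fun ξ => (F ξ).re) (by fun_prop) (fun ξ => (Complex.abs_re_le_norm _).trans (hFb ξ))
  have D2 := D.mulF (F := fun ξ => (F ξ).im) (by fun_prop) (fun ξ => (Complex.abs_im_le_norm _).trans (hFb ξ))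
  obtain ⟨g1, hg1⟩ : ∃ g1, g1 = fun ξ => m ξ * (F ξ).re := ⟨_, rfl⟩
  obtain ⟨g2, hg2⟩ : ∃ g2, g2 = fun ξ => m ξ * (F ξ).im := ⟨_, rfl⟩
  rw [← hg1] at D1
  rw [← hg2] at D2
  have key : ∀ x, OpS σ f x = (q : ℂ) * (((Tw cos (Wc S g1 ‖x‖) x - Tw sin (Wc S g2 ‖x‖) x : ℝ) : ℂ) + ((Tw cos (Wc S g2 ‖x‖) x + Tw sin (Wc S g1 ‖x‖) x : ℝ) : ℂ) * Complex.I) := by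
    intro x
    rw [OpS, hq, Complex.ofReal_inv]
    congr 1
    have E1 := D1.cut cf.meas ‖x‖
    have E2 := D2.cut cf.meas ‖x‖
    have a1 := E1.int continuous_cos x
    have a2 := E1.int continuous_sin x
    have a3 := E2.int continuous_cos x
    have a4 := E2.int continuous_sin x
    unfold Tw
    rw [← integral_sub a1 a4, ← integral_add a3 a2, ← integral_complex_ofReal, ← integral_complex_ofReal, ← integral_mul_const,
      ← integral_add (a1.sub a4).ofReal ((a3.add a2).ofReal.mul_const _)]
    congr 1; ext ξ
    rw [hσ, mul_comm Complex.I, Complex.exp_mul_I, ← Complex.ofReal_cos, ← Complex.ofReal_sin, ← hF]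
    have e1 : Wc S g1 ‖x‖ ξ = Wc S m ‖x‖ ξ * (F ξ).re := by rw [hg1]; unfold Wc; split_ifs <;> simp
    have e2 : Wc S g2 ‖x‖ ξ = Wc S m ‖x‖ ξ * (F ξ).im := by rw [hg2]; unfold Wc; split_ifs <;> simp
    rw [e1, e2]
    apply Complex.ext <;> simp <;> ring
  have hsq : ∀ x, ‖OpS σ f x‖ ^ 2 ≤ 2 * q ^ 2 * ((Tw cos (Wc S g1 ‖x‖) x ^ 2 + Tw sin (Wc S g2 ‖x‖) x ^ 2) + (Tw cos (Wc S g2 ‖x‖) x ^ 2 + Tw sin (Wc S g1 ‖x‖) x ^ 2)) := by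
    intro x
    rw [key, norm_mul, mul_pow, Complex.norm_real, norm_of_nonneg hq0.le, ← normSq_eq_norm_sq, Complex.normSq_add_mul_I, mul_comm 2, mul_assoc]
    refine mul_le_mul_of_nonneg_left ?_ (by positivity)
    generalize Tw cos (Wc S g1 ‖x‖) x = A
    generalize Tw sin (Wc S g2 ‖x‖) x = B
    generalize Tw cos (Wc S g2 ‖x‖) x = A'
    generalize Tw sin (Wc S g1 ‖x‖) x = B'
    nlinarith [sq_nonneg (A + B), sq_nonneg (A' - B')]
  have m1 := TW_meas D1.meas cf.meas continuous_cos
  have m2 := TW_meas D1.meas cf.meas continuous_sin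
  have m3 := TW_meas D2.meas cf.meas continuous_cos
  have m4 := TW_meas D2.meas cf.meas continuous_sin
  have h1 := H _ _ _ g1 _ S D1 (.inl rfl) cf mS
  have h2 := H _ _ _ g1 _ S D1 (.inr rfl) cf mS
  have h3 := H _ _ _ g2 _ S D2 (.inl rfl) cf mS
  have h4 := H _ _ _ g2 _ S D2 (.inr rfl) cf mS
  have gm1 := D1.meas
  have gm2 := D2.meas
  have hgs : (∫⁻ ξ, ofReal (g1 ξ ^ 2)) + ∫⁻ ξ, ofReal (g2 ξ ^ 2) ≤ ofReal (M ^ 2 * (2 * Real.pi) ^ d) * ∫⁻ x, ofReal (‖f x‖ ^ 2) := by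
    rw [ofReal_mul (by positivity), mul_assoc, ← planchFT fi f2, ← lintegral_const_mul' _ _ (by finiteness), ← lintegral_add_left (by fun_prop)]
    refine lintegral_mono fun ξ => ?_
    rw [← ofReal_mul (by positivity), ← ofReal_add (by positivity) (by positivity), ← hF]
    refine ofReal_le_ofReal ?_
    have h0 : m ξ ^ 2 ≤ M ^ 2 := sq_le_sq.2 ((D.bd ξ).trans (le_abs_self _))
    rw [← normSq_eq_norm_sq, Complex.normSq_apply, hg1, hg2]
    nlinarith [mul_self_nonneg (F ξ).re, mul_self_nonneg (F ξ).im]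
  have fin : eLpNorm (OpS σ f) 2 ^ 2 ≤ (ofReal (√(4 * q * C) * M) * eLpNorm f 2) ^ 2 := by
    rw [mul_pow, enorm2, enorm2, ← ofReal_pow (by positivity), mul_pow, sq_sqrt (by positivity)]
    refine (lintegral_mono fun x => ofReal_le_ofReal (hsq x)).trans ?_
    simp only [ofReal_mul (show 0 ≤ 2 * q ^ 2 by positivity), ofReal_add (add_nonneg (sq_nonneg _) (sq_nonneg _)) (add_nonneg (sq_nonneg _) (sq_nonneg _)), ofReal_add (sq_nonneg _) (sq_nonneg _)]
    rw [lintegral_const_mul' _ _ (by finiteness), lintegral_add_left (by fun_prop), lintegral_add_left (by fun_prop), lintegral_add_left (by fun_prop)]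
    refine (mul_le_mul_right (add_le_add (add_le_add h1 h4) (add_le_add h3 h2)) _).trans ?_
    generalize (∫⁻ ξ, ofReal (g1 ξ ^ 2)) = G1 at *
    generalize (∫⁻ ξ, ofReal (g2 ξ ^ 2)) = G2 at *
    have : ofReal (4 * q * C * M ^ 2) = ofReal (2 * q ^ 2) * (2 * ofReal C * ofReal (M ^ 2 * (2 * Real.pi) ^ d)) := by
      rw [show (2:ℝ≥0∞) = ofReal 2 by simp, ← ofReal_mul (by positivity), ← ofReal_mul (by positivity), ← ofReal_mul (by positivity)]
      congr 1
      linear_combination (-(4 * q * C * M ^ 2)) * hq3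
    rw [this, mul_assoc, mul_assoc]
    refine mul_le_mul_right ?_ _
    refine le_trans (le_of_eq ?_) (mul_le_mul_right hgs (2 * ofReal C))
    ring
  exact (ENNReal.pow_le_pow_left_iff two_ne_zero).1 fin
end

section
lemma HypH.cfg {p₀ p₁ P₀ P₁ : ℝ} {P : ℝ → ℝ} (h : HypH p₀ p₁ P₀ P₁ P) (hp₁ : p₁ < 0) (hp₀ : 0 < p₀) (hP₀ : 0 < P₀) (hP₁ : 0 < P₁) :
    ∃ C₀, 1 ≤ C₀ ∧ ∀ t : ℝ, 0 < t → Cfg C₀ (fun r => t * deriv P r) := by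
  obtain ⟨sm, pos, mon, ⟨c, C, ρ₀, hc, hcC, hρ₀, h0⟩, ⟨c', C', R, hc', hcC', h1⟩, -⟩ := h
  have cd1 : ContDiffOn ℝ 2 (deriv P) (Ioi 0) := sm.deriv_of_isOpen isOpen_Ioi (by norm_cast)
  have cd2 : ContDiffOn ℝ 1 (deriv (deriv P)) (Ioi 0) := cd1.deriv_of_isOpen isOpen_Ioi (by norm_num)
  have l0 : ∀ᶠ ρ in 𝓝[>] (0:ℝ), P₀ / 2 ≤ deriv P ρ := by
    have : Tendsto (fun ρ : ℝ => C * ρ ^ p₀) (𝓝[>] 0) (𝓝 0) := by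
      have := ((Real.continuousAt_rpow_const (0:ℝ) p₀ (.inr hp₀.le)).tendsto.const_mul C).mono_left (nhdsWithin_le_nhds (s := Ioi 0))
      simpa [zero_rpow hp₀.ne'] using this
    filter_upwards [this.eventually_lt_const (show 0 < P₀ / 2 by positivity), self_mem_nhdsWithin, Ioo_mem_nhdsGT hρ₀] with ρ h2 h3 h4
    have := (abs_le.1 (h0 ρ h3 h4.2).1.2).1
    linarith
  have l1 : ∀ᶠ ρ in atTop, P₁ / 2 ≤ deriv P ρ := by
    have : Tendsto (fun ρ : ℝ => C' * ρ ^ p₁) atTop (𝓝 0) := by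
      simpa using (tendsto_rpow_neg_atTop (neg_pos.2 hp₁)).const_mul C'
    filter_upwards [this.eventually_lt_const (show 0 < P₁ / 2 by positivity), eventually_gt_atTop R] with ρ h2 h3
    have := (abs_le.1 (h1 ρ h3).1.2).1
    linarith
  obtain ⟨μ, hμ, hv⟩ : ∃ μ : ℝ, 0 < μ ∧ ∀ ρ, 0 < ρ → μ ≤ deriv P ρ := by
    rcases mon with mon | mon
    · refine ⟨P₀ / 2, by positivity, fun ρ hρ => ?_⟩
      obtain ⟨x, h2, h3⟩ := (l0.and (Ioo_mem_nhdsGT hρ)).exists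
      exact h2.trans (mon h3.1 hρ h3.2.le)
    · refine ⟨P₁ / 2, by positivity, fun ρ hρ => ?_⟩
      obtain ⟨x, h2, h3⟩ := (l1.and (eventually_ge_atTop ρ)).exists
      exact h2.trans (mon hρ (hρ.trans_le h3) h3)
  obtain ⟨K, hK, hd⟩ : ∃ K : ℝ, 0 ≤ K ∧ ∀ ρ, 0 < ρ → |deriv (deriv P) ρ| * ρ ≤ K := by
    obtain ⟨A, hA⟩ := (isCompact_Icc (a := ρ₀ / 2) (b := max R 0 + 1)).exists_bound_of_continuousOn (f := fun ρ => deriv (deriv P) ρ * ρ)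
      ((cd2.continuousOn.mono fun x hx => lt_of_lt_of_le (by positivity) hx.1).mul continuousOn_id)
    have hC : 0 < C := hc.trans hcC
    have hC' : 0 < C' := hc'.trans hcC'
    refine ⟨C * ρ₀ ^ p₀ + C' + |A|, by positivity, fun ρ hρ => ?_⟩
    have n1 : 0 ≤ C * ρ₀ ^ p₀ := by positivity
    by_cases b1 : ρ < ρ₀ / 2
    · refine (mul_le_mul_of_nonneg_right (h0 ρ hρ (by linarith)).2.2 hρ.le).trans ?_
      rw [mul_assoc, ← rpow_add_one hρ.ne', sub_add_cancel]
      have := mul_le_mul_of_nonneg_left (rpow_le_rpow hρ.le (show ρ ≤ ρ₀ by linarith) hp₀.le) hC.le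
      linarith [abs_nonneg A]
    by_cases b2 : max R 0 + 1 < ρ
    · have b3 : R < ρ := by linarith [le_max_left R 0]
      have b4 : 1 ≤ ρ := by linarith [le_max_right R 0]
      refine (mul_le_mul_of_nonneg_right (h1 ρ b3).2.2 hρ.le).trans ?_
      rw [mul_assoc, ← rpow_add_one hρ.ne', sub_add_cancel]
      have := mul_le_mul_of_nonneg_left (Real.rpow_le_one_of_one_le_of_nonpos b4 hp₁.le) hC'.le
      linarith [abs_nonneg A]
    · have := hA ρ ⟨not_lt.1 b1, not_lt.1 b2⟩
      rw [norm_mul, norm_of_nonneg hρ.le, norm_eq_abs] at this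
      linarith [le_abs_self A]
  refine ⟨max 1 (K / μ), le_max_left _ _, fun t ht => ⟨le_max_left _ _, (measurable_deriv P).const_mul t, cd1.continuousOn.const_smul t, fun r hr => mul_pos ht (pos r hr), fun r r' hr hrr => ?_⟩⟩
  have mv := (convex_Icc r r').norm_image_sub_le_of_norm_hasDerivWithin_le (f := deriv P) (f' := deriv (deriv P)) (C := K / r)
    (fun x hx => ((cd1.differentiableOn (by norm_num)).differentiableAt (Ioi_mem_nhds (hr.trans_le hx.1))).hasDerivAt.hasDerivWithinAt)
    (fun x hx => by
      rw [le_div_iff₀ hr, norm_eq_abs]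
      exact (mul_le_mul_of_nonneg_left hx.1 (abs_nonneg _)).trans (hd x (hr.trans_le hx.1))) (Set.left_mem_Icc.2 hrr) (Set.right_mem_Icc.2 hrr)
  rw [norm_eq_abs, norm_of_nonneg (sub_nonneg.2 hrr)] at mv
  have h5 : K ≤ max 1 (K / μ) * deriv P r := by
    calc K = K / μ * μ := by field_simp
      _ ≤ _ := mul_le_mul (le_max_right _ _) (hv r hr) hμ.le (by positivity)
  rw [← mul_sub, abs_mul, abs_of_pos ht]
  calc t * |deriv P r' - deriv P r| ≤ t * (K / r * (r' - r)) := mul_le_mul_of_nonneg_left mv ht.le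
    _ = t * K * ((r' - r) / r) := by ring
    _ ≤ t * (max 1 (K / μ) * deriv P r) * ((r' - r) / r) := mul_le_mul_of_nonneg_right (mul_le_mul_of_nonneg_left h5 ht.le) (div_nonneg (sub_nonneg.2 hrr) hr.le)
    _ = _ := by ring
end

/-- Theorem 1.4 (ii): with `P₀, P₁ > 0` and `p₁ < 0 < p₀`, the operator
with symbol `1_{|x| > |t||P'(ξ)|} (1−χ_l)(|t|^{ε₀}ξ) χ_h(|t|^{−ε₁}ξ)` is bounded on `L²`
uniformly for `|t| > t₀ ≫ 1`. -/
theorem statement6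
    (d : ℕ) (hd : 1 ≤ d) (p₀ p₁ : ℝ) (hp₁0 : p₁ < 0) (hp₀0 : 0 < p₀)
    (P₀ P₁ : ℝ) (hP₀ : 0 < P₀) (hP₁ : 0 < P₁)
    (P : ℝ → ℝ) (hP : HypH p₀ p₁ P₀ P₁ P)
    (χl χh : Euc d → ℝ)
    (hχlsm : ContDiff ℝ (⊤ : ℕ∞) χl) (hχlc : HasCompactSupport χl) (hχl1 : EqOneNearZero χl)
    (hχhsm : ContDiff ℝ (⊤ : ℕ∞) χh) (hχhc : HasCompactSupport χh) (hχh1 : EqOneNearZero χh)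
    (ε₀ ε₁ : ℝ) (hε : Admissible p₀ p₁ ε₀ ε₁) :
    ∃ C t₀ : ℝ, 0 < C ∧ 1 ≤ t₀ ∧ ∀ t : ℝ, t₀ < |t| → ∀ f : SchwartzMap (Euc d) ℂ,
      eLpNorm
        (OpS (fun x ξ =>
          (if |t| * ‖Pgrad P ξ‖ < ‖x‖ then (1:ℂ) else 0) *
            (((1 - χl ((|t| ^ ε₀) • ξ)) : ℝ) : ℂ) *
            ((χh ((|t| ^ (-ε₁)) • ξ) : ℝ) : ℂ)) ⇑f) 2
        (volume : Measure (Euc d))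
      ≤ ENNReal.ofReal C * eLpNorm (⇑f) 2 (volume : Measure (Euc d)) := by
  obtain ⟨C₀, hC₀, cfg⟩ := hP.cfg hp₁0 hp₀0 hP₀ hP₁
  obtain ⟨K, hK, H⟩ := opbound hd hC₀
  obtain ⟨A, hA⟩ := hχlc.exists_bound_of_continuous hχlsm.continuous
  obtain ⟨B, hB⟩ := hχhc.exists_bound_of_continuous hχhsm.continuous
  have hA0 : 0 ≤ A := (norm_nonneg _).trans (hA 0)
  have hB0 : 0 ≤ B := (norm_nonneg _).trans (hB 0)
  obtain ⟨r, hr, hχ⟩ := hχl1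
  obtain ⟨R, hR⟩ := hχhc.isCompact.isBounded.subset_closedBall 0
  refine ⟨K * ((1 + A) * B) + 1, 1, by positivity, le_rfl, fun t ht f => ?_⟩
  have ht0 : 0 < |t| := zero_lt_one.trans ht
  have s0 : 0 < |t| ^ ε₀ := by positivity
  have s1 : 0 < |t| ^ (-ε₁) := by positivity
  have c1 := hχlsm.continuous
  have c2 := hχhsm.continuous
  have D : Dat d (r / |t| ^ ε₀) (R / |t| ^ (-ε₁)) ((1 + A) * B) (fun ξ => (1 - χl ((|t| ^ ε₀) • ξ)) * χh ((|t| ^ (-ε₁)) • ξ)) := by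
    refine ⟨Continuous.measurable (by fun_prop), fun ξ => ?_, by positivity, fun ξ hξ => ?_⟩
    · rw [abs_mul]
      refine mul_le_mul ?_ (hB _) (abs_nonneg _) (by positivity)
      exact (abs_sub _ _).trans (by rw [abs_one]; exact add_le_add_right (hA _) _)
    · rcases lt_or_ge ‖ξ‖ (r / |t| ^ ε₀) with h1 | h1
      · rw [hχ, sub_self, zero_mul]
        rw [norm_smul, norm_of_nonneg s0.le, mul_comm]; exact (lt_div_iff₀ s0).1 h1
      · have h2 : R / |t| ^ (-ε₁) < ‖ξ‖ := not_le.1 fun h2 => hξ ⟨h1, h2⟩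
        rw [div_lt_iff₀ s1] at h2
        refine mul_eq_zero_of_right _ (image_eq_zero_of_notMem_tsupport fun h3 => ?_)
        have := hR h3
        rw [mem_closedBall_zero_iff, norm_smul, norm_of_nonneg s1.le] at this
        linarith
  have mS : MonotoneOn (fun r => |t| * deriv P r) (Ioi 0) ∨ AntitoneOn (fun r => |t| * deriv P r) (Ioi 0) :=
    hP.2.2.1.imp (fun h x hx y hy hxy => mul_le_mul_of_nonneg_left (h hx hy hxy) ht0.le) fun h x hx y hy hxy => mul_le_mul_of_nonneg_left (h hx hy hxy) ht0.le
  refine (H _ _ _ _ _ f _ D (cfg |t| ht0) mS f.continuous.measurable f.integrable (f.memLp 2) fun x ξ => ?_).trans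
    (mul_le_mul_left (ofReal_le_ofReal (by linarith)) _)
  by_cases h0 : ξ = 0
  · simp [h0, Wc, hχ 0 (by simpa using hr)]
  · have h1 : 0 < ‖ξ‖ := norm_pos_iff.2 h0
    have : ‖Pgrad P ξ‖ = deriv P ‖ξ‖ := by
      rw [Pgrad, norm_smul, norm_of_nonneg (div_nonneg (hP.2.1 _ h1).le h1.le), div_mul_cancel₀ _ h1.ne']
    rw [this, Wc]
    split_ifs <;> push_cast <;> ring
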